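/- For c = 6, every sufficiently large odd integer n can be written as n = p1^2 + p2^2 + p3^3 + p4^3 + p5^5 + p6^6 + p7^6 with p1, ..., p7 all prime. That is, there exists N such that for every odd integer n ≥ N there exist primes p1, ..., p7 with n = p1^2 + p2^2 + p3^3 + p4^3 + p5^5 + p6^6 + p7^6. -/

import Mathlib

section
namespace WG
open Complex Filter Topology Asymptotics MeasureTheory
/-- tail function given by a bounded summatory function -/
noncomputable def tailG (A : ℝ → ℂ) (s : ℂ) : ℂ := s * ∫ t in Set.Ioi (1 : ℝ), A t*(t : ℂ)^(-(s + 1))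
lemma tailG_norm_le {A : ℝ → ℂ} {D M : ℝ} (hM : 1 ≤ M)
    (hA : ∀ t, ‖A t‖ ≤ D) (hA0 : ∀ t, t ≤ M → A t = 0) {s : ℂ} (hs : 0 < s.re) :
    ‖tailG A s‖ ≤ ‖s‖ * (D*M^(-s.re) / s.re) := by
  unfold tailG; rw [norm_mul]; gcongr
  have h1 : ∫ t in Set.Ioi (1 : ℝ), A t*(t : ℂ)^(-(s + 1))
      = ∫ t in Set.Ioi M, A t*(t : ℂ)^(-(s + 1)) := by
    refine (setIntegral_eq_of_subset_of_forall_sdiff_eq_zero measurableSet_Ioi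
      (Set.Ioi_subset_Ioi hM) ?_)
    intro x hx; rw [hA0 x (by simpa using hx.2), zero_mul]
  rw [h1]
  have hM0 : 0 < M := by linarith
  have hlt : -(s.re + 1) < -1 := by linarith
  have h2 : ∫ t in Set.Ioi M, D*t^(-(s.re + 1)) = D*M^(-s.re) / s.re := by
    rw [integral_const_mul, integral_Ioi_rpow_of_lt hlt hM0]
    have : -(s.re + 1) + 1 = -s.re := by ring
    rw [this]; field_simp
  rw [← h2]
  refine norm_integral_le_of_norm_le ((integrableOn_Ioi_rpow_of_lt hlt hM0).const_mul D) ?_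
  filter_upwards [ae_restrict_mem measurableSet_Ioi] with t ht
  have ht0 : 0 < t := hM0.trans ht
  rw [norm_mul, Complex.norm_cpow_eq_rpow_re_of_pos ht0]; simp only [neg_re, add_re, one_re]
  gcongr; exact hA t
lemma tailG_differentiableAt {A : ℝ → ℂ} {D M : ℝ} (hM : 1 ≤ M)
    (hAm : LocallyIntegrableOn A (Set.Ioi 0))
    (hA : ∀ t, ‖A t‖ ≤ D) (hA0 : ∀ t, t ≤ M → A t = 0) {s : ℂ} (hs : 0 < s.re) :
    DifferentiableAt ℂ (tailG A) s := by
  have h1 : tailG A = fun s => s*mellin A (-s) := by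
    funext s
    unfold tailG mellin; congr 1; rw [eq_comm]
    calc ∫ t in Set.Ioi (0:ℝ), (t : ℂ)^(-s - 1) • A t
        = ∫ t in Set.Ioi (1:ℝ), (t : ℂ)^(-s - 1) • A t := by
          refine (setIntegral_eq_of_subset_of_forall_sdiff_eq_zero measurableSet_Ioi
            (Set.Ioi_subset_Ioi zero_le_one) ?_)
          intro x hx; rw [hA0 x (le_trans (by simpa using hx.2) hM), smul_zero]
      _ = _ := by
          congr 1; funext t
          rw [smul_eq_mul, mul_comm]; congr 2; ring
  rw [h1]
  refine differentiableAt_id.mul ?_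
  have : DifferentiableAt ℂ (mellin A) (-s) := by
    refine mellin_differentiableAt_of_isBigO_rpow (a := 0) (b := -s.re - 1) hAm ?_ ?_ ?_ ?_
    · simp only [neg_zero, Real.rpow_zero]
      exact isBigO_of_le' (c := D) _ (fun t => by simpa using hA t)
    · simpa using hs
    · refine IsBigO.of_bound 1 ?_
      have : Set.Iic M ∈ 𝓝 (0:ℝ) := Iic_mem_nhds (by linarith)
      filter_upwards [mem_nhdsWithin_of_mem_nhds this] with t ht
      rw [hA0 t ht]; simp
    · simp
  exact this.comp s differentiableAt_id.neg
/-- analytic identity principle: agree on `re > 1` → agree on `re > 0` -/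
lemma eqOn_of_eqOn_right {F G : ℂ → ℂ}
    (hF : ∀ s : ℂ, 0 < s.re → DifferentiableAt ℂ F s)
    (hG : ∀ s : ℂ, 0 < s.re → DifferentiableAt ℂ G s)
    (h : ∀ s : ℂ, 1 < s.re → F s = G s) {s : ℂ} (hs : 0 < s.re) : F s = G s := by
  let U : Set ℂ := {s | 0 < s.re}
  have hUo : IsOpen U := isOpen_lt continuous_const Complex.continuous_re
  have hUc : IsPreconnected U := (convex_halfSpace_re_gt 0).isPreconnected
  have hF' : AnalyticOnNhd ℂ F U := DifferentiableOn.analyticOnNhd (fun z hz => (hF z hz).differentiableWithinAt) hUo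
  have hG' : AnalyticOnNhd ℂ G U := DifferentiableOn.analyticOnNhd (fun z hz => (hG z hz).differentiableWithinAt) hUo
  have h2 : (2 : ℂ) ∈ U := by simp [U]
  refine hF'.eqOn_of_preconnected_of_eventuallyEq hG' hUc h2 ?_ hs
  have : {s : ℂ | 1 < s.re} ∈ 𝓝 (2:ℂ) := (isOpen_lt continuous_const Complex.continuous_re).mem_nhds (by simp)
  filter_upwards [this] with z hz using h z hz
lemma sum_range_zmod {q : ℕ} [NeZero q] {E : Type*} [AddCommMonoid E] (f : ZMod q → E) : ∑ k ∈ Finset.range q, f (k : ZMod q) = ∑ a, f a := by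
  refine Finset.sum_nbij' (fun k => (k : ZMod q)) (fun a => a.val) ?_ ?_ ?_ ?_ ?_
  · simp
  · intro a _; simpa using ZMod.val_lt a
  · intro k hk; exact ZMod.val_cast_of_lt (by simpa using hk)
  · intro a _; simp
  · simp
/-- partial sums of a nonprincipal character are bounded by the modulus -/
lemma char_sum_bound {q : ℕ} [NeZero q] {χ : DirichletCharacter ℂ q} (hχ : χ ≠ 1) (n : ℕ) : ‖∑ k ∈ Finset.range n, χ (k : ZMod q)‖ ≤ q := by
  have hper : ∀ m, ∑ k ∈ Finset.range q, χ ((m + k : ℕ) : ZMod q) = 0 := by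
    intro m
    have h0 := MulChar.sum_eq_zero_of_ne_one hχ
    rw [← h0, ← Equiv.sum_comp (Equiv.addLeft (m : ZMod q)), ← sum_range_zmod]; simp
  induction n using Nat.strong_induction_on with
  | _ n ih =>
    by_cases h : n < q
    · refine (norm_sum_le _ _).trans ?_
      calc ∑ k ∈ Finset.range n, ‖χ (k : ZMod q)‖ ≤ ∑ k ∈ Finset.range n, (1:ℝ) := Finset.sum_le_sum fun k _ => DirichletCharacter.norm_le_one χ _
        _ ≤ q := by simp; exact_mod_cast h.le
    · push Not at h
      obtain ⟨m, rfl⟩ := Nat.exists_eq_add_of_le' h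
      rw [Finset.sum_range_add, hper, add_zero]
      exact ih m (by have := NeZero.pos q; omega)
lemma char_sum_bound_Ioc {q : ℕ} [NeZero q] {χ : DirichletCharacter ℂ q} (hχ : χ ≠ 1) (M n : ℕ) : ‖∑ k ∈ Finset.Ioc M n, χ (k : ZMod q)‖ ≤ 2*q := by
  rcases le_total n M with h | h
  · rw [Finset.Ioc_eq_empty_of_le h]; simp
  · have : ∑ k ∈ Finset.Ioc M n, χ (k : ZMod q) = ∑ k ∈ Finset.range (n+1), χ (k : ZMod q)
        - ∑ k ∈ Finset.range (M+1), χ (k : ZMod q) := by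
      rw [← Finset.sum_Ico_eq_sub _ (by omega)]
      refine Finset.sum_congr ?_ fun _ _ => rfl
      ext x; simp
    rw [this]
    refine (norm_sub_le _ _).trans ?_
    linarith [char_sum_bound hχ (n+1), char_sum_bound hχ (M+1)]
lemma LSeries_split {f : ℕ → ℂ} {s : ℂ} (hf : LSeriesSummable f s) (M : ℕ) : LSeries f s = ∑ n ∈ Finset.Icc 1 M, f n*(n : ℂ)^(-s)
      + LSeries (fun n => if n ≤ M then 0 else f n) s := by
  have hg : LSeriesSummable (fun n => if n ≤ M then f n else 0) s := by
    refine summable_of_ne_finset_zero (s := Finset.Icc 1 M) ?_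
    intro n hn
    rcases Nat.eq_zero_or_pos n with rfl | h
    · simp
    · rw [LSeries.term_of_ne_zero h.ne', if_neg (by simp at hn; omega), zero_div]
  have hg' : LSeriesSummable (fun n => if n ≤ M then 0 else f n) s := by
    have := hf.sub hg
    refine this.congr ?_
    intro n; simp [LSeries.term]; split_ifs <;> simp
  have : f = (fun n => if n ≤ M then f n else 0) + (fun n => if n ≤ M then 0 else f n) := by
    funext n; simp only [Pi.add_apply]; split_ifs <;> simp
  conv_lhs => rw [this]
  rw [LSeries_add hg hg']; congr 1; unfold LSeries; rw [tsum_eq_sum (s := Finset.Icc 1 M)]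
  · refine Finset.sum_congr rfl fun n hn => ?_
    simp at hn
    rw [LSeries.term_of_ne_zero (by omega), if_pos hn.2, cpow_neg, div_eq_mul_inv]
  · intro n hn
    rcases Nat.eq_zero_or_pos n with rfl | h
    · simp
    · rw [LSeries.term_of_ne_zero h.ne', if_neg (by simp at hn; omega), zero_div]
lemma LSeriesSummable_tail {f : ℕ → ℂ} {s : ℂ} (hf : LSeriesSummable f s) (M : ℕ) : LSeriesSummable (fun n => if n ≤ M then 0 else f n) s := by
  refine Summable.of_norm_bounded hf.norm ?_
  intro n; simp only [LSeries.term]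
  split_ifs <;> simp
  positivity
lemma sum_Icc_tail (f : ℕ → ℂ) (M n : ℕ) : ∑ k ∈ Finset.Icc 1 n, (if k ≤ M then 0 else f k) = ∑ k ∈ Finset.Ioc M n, f k := by
  rw [← Finset.sum_filter_add_sum_filter_not (Finset.Icc 1 n) (fun k => k ≤ M)]
  rw [Finset.sum_eq_zero (s := Finset.filter _ _) (by intro k hk; simp at hk; simp [hk.2])]
  rw [zero_add]
  have : (Finset.Icc 1 n).filter (fun k => ¬ k ≤ M) = Finset.Ioc M n := by
    ext x; simp; omega
  rw [this]
  refine Finset.sum_congr rfl fun k hk => ?_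
  simp at hk
  rw [if_neg (by omega)]
lemma locInt_of_bdd {A : ℝ → ℂ} {D : ℝ} (hm : Measurable A) (hA : ∀ t, ‖A t‖ ≤ D) : LocallyIntegrableOn A (Set.Ioi 0) := by
  have : LocallyIntegrable A := by
    refine (locallyIntegrable_const D).mono hm.aestronglyMeasurable ?_
    filter_upwards with t
    exact (hA t).trans (le_abs_self D)
  exact this.locallyIntegrableOn _
/-- approximate formula for `L(s,χ)` in the half plane `re s > 0` -/
lemma LFunction_approx {q : ℕ} [NeZero q] {χ : DirichletCharacter ℂ q} (hχ : χ ≠ 1) {s : ℂ}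
    (hs : 0 < s.re) (M : ℕ) (hM : 1 ≤ M) :
    ‖DirichletCharacter.LFunction χ s‖ ≤ ∑ n ∈ Finset.Icc 1 M, (n : ℝ)^(-s.re)
      + ‖s‖ * (2*q*(M:ℝ)^(-s.re) / s.re) := by
  set A : ℝ → ℂ := fun t => ∑ k ∈ Finset.Ioc M ⌊t⌋₊, χ (k : ZMod q) with hAdef
  have hAm : Measurable A := (measurable_from_nat (f := fun n => ∑ k ∈ Finset.Ioc M n, χ (k : ZMod q))).comp
      Nat.measurable_floor
  have hA : ∀ t, ‖A t‖ ≤ 2*q := fun t => char_sum_bound_Ioc hχ _ _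
  have hA0 : ∀ t : ℝ, t ≤ M → A t = 0 := by
    intro t ht; simp only [hAdef]
    rw [Finset.Ioc_eq_empty_of_le (Nat.floor_le_of_le ht)]; simp
  have hM1 : (1:ℝ) ≤ M := by exact_mod_cast hM
  have key : DirichletCharacter.LFunction χ s = ∑ n ∈ Finset.Icc 1 M, χ (n : ZMod q)*(n : ℂ)^(-s) + tailG A s := by
    refine eqOn_of_eqOn_right (F := DirichletCharacter.LFunction χ)
      (G := fun s => ∑ n ∈ Finset.Icc 1 M, χ (n : ZMod q)*(n : ℂ)^(-s) + tailG A s)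
      (fun s _ => (DirichletCharacter.differentiable_LFunction hχ) s) ?_ ?_ hs
    · intro s hs
      refine DifferentiableAt.add ?_ (tailG_differentiableAt hM1 (locInt_of_bdd hAm hA) hA hA0 hs)
      refine DifferentiableAt.fun_sum fun n hn => ?_
      simp at hn
      refine DifferentiableAt.const_mul ?_ _
      exact differentiableAt_id.neg.const_cpow (Or.inl (by exact_mod_cast (by omega : n ≠ 0)))
    · intro s hs
      have hsum := DirichletCharacter.LSeriesSummable_of_one_lt_re χ hs
      rw [DirichletCharacter.LFunction_eq_LSeries χ hs, LSeries_split hsum M]; congr 1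
      rw [LSeries_eq_mul_integral _ le_rfl (by linarith) (LSeriesSummable_tail hsum M)]
      · simp only [sum_Icc_tail]; rfl
      · simp only [sum_Icc_tail]
        refine IsBigO.of_bound (2*q) ?_
        filter_upwards with n
        simpa using char_sum_bound_Ioc hχ M n
  rw [key]
  refine (norm_add_le _ _).trans (add_le_add ?_ (tailG_norm_le hM1 hA hA0 hs))
  refine (norm_sum_le _ _).trans (Finset.sum_le_sum fun n hn => ?_)
  simp at hn
  rw [norm_mul, Complex.norm_natCast_cpow_of_pos (by omega)]
  simpa using mul_le_mul_of_nonneg_right (DirichletCharacter.norm_le_one χ n)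
    (by positivity : (0:ℝ) ≤ (n:ℝ)^(-s.re))
/-- approximate formula for `ζ(s)` in the half plane `re s > 0` -/
lemma zeta_approx {s : ℂ} (hs : 0 < s.re) (hs1 : s ≠ 1) (M : ℕ) (hM : 1 ≤ M) : ‖riemannZeta s‖ ≤ ∑ n ∈ Finset.Icc 1 M, (n : ℝ)^(-s.re) + (M:ℝ)^(1 - s.re) / ‖s - 1‖
      + ‖s‖ * ((M:ℝ)^(-s.re) / s.re) := by
  set A : ℝ → ℂ := fun t => if t ≤ M then 0 else (-(Int.fract t : ℝ) : ℂ) with hAdef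
  have hAm : Measurable A := by
    refine Measurable.ite measurableSet_Iic measurable_const ?_
    exact (Complex.measurable_ofReal.comp measurable_fract).neg
  have hA : ∀ t, ‖A t‖ ≤ 1 := by
    intro t; simp only [hAdef]
    split_ifs
    · simp
    · rw [norm_neg, Complex.norm_real, Real.norm_of_nonneg (Int.fract_nonneg t)]; exact (Int.fract_lt_one t).le
  have hA0 : ∀ t : ℝ, t ≤ M → A t = 0 := by intro t ht; simp [hAdef, ht]
  have hM1 : (1:ℝ) ≤ M := by exact_mod_cast hM
  have hM0 : (0:ℝ) < M := by linarith
  have key : (s - 1)*riemannZeta s = (s - 1)*(∑ n ∈ Finset.Icc 1 M, (n : ℂ)^(-s) + tailG A s) + (M:ℂ)^(1 - s) := by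
    have h0 : ∀ z : ℂ, z ≠ 1 → DirichletCharacter.LFunctionTrivChar₁ 1 z = (z - 1)*riemannZeta z := by
      intro z hz
      rw [DirichletCharacter.LFunctionTrivChar₁, Function.update_of_ne hz, DirichletCharacter.LFunctionTrivChar_eq_mul_riemannZeta hz]
      simp
    rw [← h0 s hs1]
    refine eqOn_of_eqOn_right (F := DirichletCharacter.LFunctionTrivChar₁ 1)
      (G := fun s => (s - 1)*(∑ n ∈ Finset.Icc 1 M, (n : ℂ)^(-s) + tailG A s)
        + (M:ℂ)^(1 - s))
      (fun s _ => (DirichletCharacter.differentiable_LFunctionTrivChar₁ 1) s) ?_ ?_ hs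
    · intro s hs
      refine DifferentiableAt.add (DifferentiableAt.mul (by fun_prop)
        (DifferentiableAt.add ?_ (tailG_differentiableAt hM1 (locInt_of_bdd hAm hA) hA hA0 hs))) ?_
      · refine DifferentiableAt.fun_sum fun n hn => ?_
        simp at hn
        exact differentiableAt_id.neg.const_cpow (Or.inl (by exact_mod_cast (by omega : n ≠ 0)))
      · exact DifferentiableAt.const_cpow (by fun_prop)
          (Or.inl (by exact_mod_cast (by omega : M ≠ 0)))
    · intro s hs
      have hs1 : s ≠ 1 := by rintro rfl; simp at hs
      have hs0 : s ≠ 0 := by rintro rfl; simp at hs; linarith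
      have hs1' : s - 1 ≠ 0 := sub_ne_zero.mpr hs1
      have hsum : LSeriesSummable 1 s := LSeriesSummable_one_iff.mpr hs
      rw [h0 s hs1, ← LSeries_one_eq_riemannZeta hs, LSeries_split hsum M, LSeries_eq_mul_integral _ zero_le_one hs (LSeriesSummable_tail hsum M)]
      · simp only [sum_Icc_tail]
        have e1 : ∫ t in Set.Ioi (1:ℝ), (∑ k ∈ Finset.Ioc M ⌊t⌋₊, (1 : ℕ → ℂ) k)*(t:ℂ)^(-(s+1))
            = (∫ t in Set.Ioi (1:ℝ), A t*(t:ℂ)^(-(s+1)))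
              + ∫ t in Set.Ioi (M:ℝ), ((t:ℂ)^(-s) - M*(t:ℂ)^(-(s+1))) := by
          have r1 : ∫ t in Set.Ioi (1:ℝ), (∑ k ∈ Finset.Ioc M ⌊t⌋₊, (1 : ℕ → ℂ) k)*(t:ℂ)^(-(s+1))
             = ∫ t in Set.Ioi (M:ℝ), (∑ k ∈ Finset.Ioc M ⌊t⌋₊, (1 : ℕ → ℂ) k)*(t:ℂ)^(-(s+1)) := by
            refine (setIntegral_eq_of_subset_of_forall_sdiff_eq_zero measurableSet_Ioi
              (Set.Ioi_subset_Ioi hM1) ?_)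
            intro x hx
            rw [Finset.Ioc_eq_empty_of_le (Nat.floor_le_of_le (by simpa using hx.2))]; simp
          have r2 : ∫ t in Set.Ioi (1:ℝ), A t*(t:ℂ)^(-(s+1))
             = ∫ t in Set.Ioi (M:ℝ), A t*(t:ℂ)^(-(s+1)) := by
            refine (setIntegral_eq_of_subset_of_forall_sdiff_eq_zero measurableSet_Ioi
              (Set.Ioi_subset_Ioi hM1) ?_)
            intro x hx; rw [hA0 x (by simpa using hx.2), zero_mul]
          have i2 : IntegrableOn (fun t : ℝ => (t:ℂ)^(-(s+1))) (Set.Ioi (M:ℝ)) := integrableOn_Ioi_cpow_of_lt (by simp; linarith) hM0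
          have i1 : IntegrableOn (fun t : ℝ => (t:ℂ)^(-s)) (Set.Ioi (M:ℝ)) := integrableOn_Ioi_cpow_of_lt (by simp; linarith) hM0
          rw [r1, r2, ← integral_add]
          · refine setIntegral_congr_fun measurableSet_Ioi fun t ht => ?_
            have ht : (M:ℝ) < t := ht
            have ht0 : (t:ℂ) ≠ 0 := by exact_mod_cast (hM0.trans ht).ne'
            have hfl : M ≤ ⌊t⌋₊ := Nat.le_floor ht.le
            have e2 : ((⌊t⌋₊ : ℝ) : ℂ) = ((t - Int.fract t : ℝ) : ℂ) := by congr 1; rw [natCast_floor_eq_intCast_floor (hM0.trans ht).le, Int.self_sub_fract]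
            simp only [Pi.one_apply, Finset.sum_const, Nat.card_Ioc, hAdef, if_neg (not_le.mpr ht)]
            have e3 : (t:ℂ)^(-s) = t*(t:ℂ)^(-(s+1)) := by
              have e30 : (-s) = 1 + -(s+1) := by ring
              conv_lhs => rw [e30, cpow_add _ _ ht0, cpow_one]
            rw [e3, nsmul_eq_mul, mul_one, Nat.cast_sub hfl]; push_cast at e2
            rw [e2]; ring
          · refine Integrable.mono (i2) ?_ ?_
            · refine (hAm.mul ?_).aestronglyMeasurable
              exact (Complex.measurable_ofReal.pow_const _)
            · filter_upwards with t
              rw [norm_mul]; exact mul_le_of_le_one_left (norm_nonneg _) (hA t)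
          · exact i1.sub (i2.const_mul _)
        rw [e1, integral_sub, integral_const_mul, integral_Ioi_cpow_of_lt (by simp; linarith) hM0, integral_Ioi_cpow_of_lt (by simp; linarith) hM0]
        · unfold tailG
          have hMc : (M:ℂ) ≠ 0 := by exact_mod_cast hM0.ne'
          have e4 : ((M:ℝ):ℂ)^(-s + 1) = M^(1 - s) := by push_cast; congr 1; ring
          have e5 : ((M:ℝ):ℂ)^(-(s+1) + 1) = M^(1 - s) / M := by
            rw [eq_div_iff hMc]; push_cast
            nth_rewrite 2 [← cpow_one (M:ℂ)]
            rw [← cpow_add _ _ hMc]; congr 1; ring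
          rw [e4, e5]
          have h1s : -s + 1 ≠ 0 := by intro h; apply hs1; linear_combination -h
          have h2s : -(s+1) + 1 ≠ 0 := by intro h; apply hs0; linear_combination -h
          simp only [Pi.one_apply, one_mul]
          field_simp; ring
        · exact integrableOn_Ioi_cpow_of_lt (by simp; linarith) hM0
        · exact (integrableOn_Ioi_cpow_of_lt (by simp; linarith) hM0).const_mul _
      · simp only [sum_Icc_tail]
        refine IsBigO.of_bound 1 ?_
        filter_upwards with n
        simp
  have hs1' : s - 1 ≠ 0 := sub_ne_zero.mpr hs1
  have key2 : riemannZeta s = ∑ n ∈ Finset.Icc 1 M, (n : ℂ)^(-s) + (M:ℂ)^(1 - s) / (s - 1)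
      + tailG A s := by field_simp; linear_combination key
  rw [key2]
  refine (norm_add_le _ _).trans (add_le_add ((norm_add_le _ _).trans (add_le_add ?_ ?_)) ?_)
  · refine (norm_sum_le _ _).trans (Finset.sum_le_sum fun n hn => ?_)
    simp at hn
    rw [Complex.norm_natCast_cpow_of_pos (by omega)]; simp
  · rw [norm_div, Complex.norm_natCast_cpow_of_pos (by omega)]; simp
  · simpa using tailG_norm_le hM1 hA hA0 hs
end WG
end
section
open Complex MeasureTheory Filter Asymptotics
namespace WG
lemma sum_rpow_bound {M : ℕ} (hM : 1 ≤ M) {ε σ : ℝ} (hε : 0 < ε) (hσ : 1 - ε ≤ σ) : ∑ n ∈ Finset.Icc 1 M, (n:ℝ)^(-σ) ≤ (M:ℝ)^ε*(1 + Real.log M) := by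
  have h1 : ∑ n ∈ Finset.Icc 1 M, (n:ℝ)^(-σ) ≤ ∑ n ∈ Finset.Icc 1 M, (M:ℝ)^ε*(n:ℝ)⁻¹ := by
    refine Finset.sum_le_sum fun n hn => ?_
    simp only [Finset.mem_Icc] at hn
    have hn0 : (1:ℝ) ≤ n := by exact_mod_cast hn.1
    calc (n:ℝ)^(-σ) ≤ (n:ℝ)^(ε + -1) := Real.rpow_le_rpow_of_exponent_le hn0 (by linarith)
      _ = (n:ℝ)^ε*(n:ℝ)⁻¹ := by rw [Real.rpow_add (by linarith), Real.rpow_neg_one]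
      _ ≤ _ := by gcongr; exact_mod_cast hn.2
  refine h1.trans ?_
  rw [← Finset.mul_sum]; gcongr
  have := harmonic_le_one_add_log M
  rw [harmonic_eq_sum_Icc] at this; push_cast at this
  exact this
/-- the analytic conductor -/
noncomputable def Qc (q : ℕ) (t : ℝ) : ℝ := q*(|t| + 2)
lemma Qc_ge_two {q : ℕ} (hq : 1 ≤ q) (t : ℝ) : 2 ≤ Qc q t := by
  unfold Qc
  have : (1:ℝ) ≤ q := by exact_mod_cast hq
  nlinarith [abs_nonneg t]
lemma ceil_bound {Q ε : ℝ} (hQ : 2 ≤ Q) (hε : 0 < ε) (hε2 : ε ≤ 1/2) {c : ℝ} (hc : 0 ≤ c) : ((⌈Q⌉₊ : ℕ) : ℝ)^ε*(c + Real.log (⌈Q⌉₊ : ℕ)) ≤ 2*(c + 1/ε)*Q^(2*ε) := by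
  set M := ⌈Q⌉₊
  have hM1 : Q ≤ M := Nat.le_ceil Q
  have hM2 : (M:ℝ) ≤ 2*Q := by
    have := Nat.ceil_lt_add_one (by linarith : 0 ≤ Q)
    linarith
  have hlog : Real.log M ≤ (M:ℝ)^ε / ε := Real.log_le_rpow_div (by positivity) hε
  have h1 : (1:ℝ) ≤ (M:ℝ)^ε := Real.one_le_rpow (by linarith) hε.le
  calc (M:ℝ)^ε*(c + Real.log M) ≤ (M:ℝ)^ε*((c + 1/ε)*(M:ℝ)^ε) := by
        gcongr
        have := mul_le_mul_of_nonneg_left h1 hc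
        rw [add_mul, one_div, inv_mul_eq_div]; linarith
    _ = (c + 1/ε)*(M:ℝ)^(2*ε) := by rw [two_mul, Real.rpow_add (by linarith)]; ring
    _ ≤ (c + 1/ε)*(2*Q)^(2*ε) := by gcongr
    _ = (c + 1/ε)*(2^(2*ε)*Q^(2*ε)) := by rw [Real.mul_rpow (by norm_num) (by linarith)]
    _ ≤ (c + 1/ε)*(2*Q^(2*ε)) := by
        gcongr
        calc (2:ℝ)^(2*ε) ≤ 2^(1:ℝ) := Real.rpow_le_rpow_of_exponent_le (by norm_num) (by linarith)
          _ = 2 := by norm_num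
    _ = _ := by ring
lemma tail_term_bound {s : ℂ} {ε Q : ℝ} (hε2 : ε ≤ 1/2) (hs : 1 - ε ≤ s.re)
    {q : ℕ} (hQ : Q = Qc q s.im) (hq : 1 ≤ q) :
    ‖s‖ * (q*(⌈Q⌉₊ : ℝ)^(-s.re) / s.re) ≤ 2*(⌈Q⌉₊ : ℝ)^ε := by
  set M := ⌈Q⌉₊
  have hQ2 := Qc_ge_two hq s.im
  rw [← hQ] at hQ2
  have hM1 : Q ≤ M := Nat.le_ceil Q
  have hσ : 0 < s.re := by linarith
  have hns : ‖s‖ / s.re ≤ 2*(|s.im| + 2) := by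
    rw [div_le_iff₀ hσ]
    have h1 := Complex.norm_le_abs_re_add_abs_im s
    rw [abs_of_pos hσ] at h1; nlinarith [abs_nonneg s.im]
  have hMr : (M:ℝ)^(-s.re) ≤ (M:ℝ)^ε*(M:ℝ)⁻¹ := by
    calc (M:ℝ)^(-s.re) ≤ (M:ℝ)^(ε + -1) := Real.rpow_le_rpow_of_exponent_le (by linarith) (by linarith)
      _ = _ := by rw [Real.rpow_add (by linarith), Real.rpow_neg_one]
  have hM0 : (0:ℝ) < M := by linarith
  calc ‖s‖ * (q*(M : ℝ)^(-s.re) / s.re) = ‖s‖ / s.re*q*(M : ℝ)^(-s.re) := by ring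
    _ ≤ (2*(|s.im| + 2))*q*((M:ℝ)^ε*(M:ℝ)⁻¹) := by gcongr
    _ = 2*Q*(M:ℝ)⁻¹*(M:ℝ)^ε := by rw [hQ, Qc]; ring
    _ ≤ 2*M*(M:ℝ)⁻¹*(M:ℝ)^ε := by gcongr
    _ = _ := by field_simp
lemma LFunction_bound {q : ℕ} [NeZero q] {χ : DirichletCharacter ℂ q} (hχ : χ ≠ 1) {ε : ℝ}
    (hε : 0 < ε) (hε2 : ε ≤ 1/2) {s : ℂ} (hs : 1 - ε ≤ s.re) :
    ‖DirichletCharacter.LFunction χ s‖ ≤ 2*(5 + 1/ε)*Qc q s.im^(2*ε) := by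
  have hq : 1 ≤ q := NeZero.one_le
  have hQ2 := Qc_ge_two hq s.im
  set Q := Qc q s.im with hQ
  have hM : 1 ≤ ⌈Q⌉₊ := Nat.one_le_ceil_iff.mpr (by linarith)
  refine (LFunction_approx hχ (by linarith) _ hM).trans ?_
  refine le_trans ?_ (ceil_bound hQ2 hε hε2 (by norm_num : (0:ℝ) ≤ 5))
  have h1 := sum_rpow_bound hM hε hs
  have h2 := tail_term_bound hε2 hs hQ hq
  have e : ‖s‖ * (2*q*(⌈Q⌉₊ : ℝ)^(-s.re) / s.re) = 2*(‖s‖ * (q*(⌈Q⌉₊ : ℝ)^(-s.re) / s.re)) := by ring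
  rw [e]; nlinarith
lemma zeta_bound {ε : ℝ}
    (hε : 0 < ε) (hε2 : ε ≤ 1/2) {s : ℂ} (hs : 1 - ε ≤ s.re) (hs1 : s ≠ 1) :
    ‖riemannZeta s‖ ≤ 2*(5 + 1/ε)*Qc 1 s.im^(2*ε)*(1 + 1 / ‖s - 1‖) := by
  have hQ2 := Qc_ge_two le_rfl s.im
  set Q := Qc 1 s.im with hQ
  have hM : 1 ≤ ⌈Q⌉₊ := Nat.one_le_ceil_iff.mpr (by linarith)
  have hs1' : 0 < ‖s - 1‖ := norm_pos_iff.mpr (sub_ne_zero.mpr hs1)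
  refine (zeta_approx (by linarith) hs1 _ hM).trans ?_
  have hcb := ceil_bound hQ2 hε hε2 (by norm_num : (0:ℝ) ≤ 5)
  have h1 := sum_rpow_bound hM hε hs
  have h2 := tail_term_bound hε2 hs hQ le_rfl
  have hM' : (1:ℝ) ≤ ⌈Q⌉₊ := by exact_mod_cast hM
  have h3 : (⌈Q⌉₊ : ℝ)^(1 - s.re) / ‖s - 1‖ ≤ (⌈Q⌉₊ : ℝ)^ε*(1 / ‖s - 1‖) := by rw [div_eq_mul_one_div]; gcongr; linarith
  have h4 : 0 ≤ (⌈Q⌉₊ : ℝ)^ε := by positivity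
  have h5 : 0 ≤ Real.log (⌈Q⌉₊ : ℝ) := Real.log_nonneg hM'
  simp only [Nat.cast_one, one_mul] at h2
  have h6 : (⌈Q⌉₊ : ℝ)^ε*(1 / ‖s - 1‖) ≤ 2*(5 + 1/ε)*Q^(2*ε)*(1 / ‖s - 1‖) := by
    gcongr
    refine le_trans ?_ hcb
    nlinarith
  rw [mul_add, mul_one]; nlinarith
end WG
end
section
open Complex MeasureTheory Filter Asymptotics
open scoped ComplexOrder
namespace WG
/-- the entire function `(s-1) ζ(s)` -/
noncomputable def Z1 : ℂ → ℂ := DirichletCharacter.LFunctionTrivChar₁ 1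
lemma Z1_diff : Differentiable ℂ Z1 := DirichletCharacter.differentiable_LFunctionTrivChar₁ 1
lemma Z1_one : Z1 1 = 1 := by unfold Z1; simp [DirichletCharacter.LFunctionTrivChar₁]
lemma Z1_eq {s : ℂ} (hs : s ≠ 1) : Z1 s = (s - 1)*riemannZeta s := by
  unfold Z1
  rw [DirichletCharacter.LFunctionTrivChar₁, Function.update_of_ne hs, DirichletCharacter.LFunctionTrivChar_eq_mul_riemannZeta hs]
  simp
/-- Hypotheses bundle: `ζ G` has a nonnegative Dirichlet series -/
lemma siegel_core : ∃ C : ℝ, 1 ≤ C ∧ ∀ (G : ℂ → ℂ) (f : ℕ → ℂ) (B ε β : ℝ), Differentiable ℂ G →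
    0 ≤ f → f 1 = 1 → (∀ s : ℂ, 1 < s.re → LSeriesSummable f s ∧ LSeries f s = riemannZeta s*G s) →
    1 ≤ B → (∀ s ∈ Metric.closedBall (2:ℂ) (4/3), ‖G s‖ ≤ B) → 0 < ε → ε ≤ 1/6 → 1 - ε ≤ β → β < 1 →
    (riemannZeta β*G β).re ≤ 0 → (1 - β) / 12*(C*B)^(-(8*ε)) ≤ ‖G 1‖ := by
  obtain ⟨C0, hC0⟩ := (isCompact_closedBall (2:ℂ) (4/3)).exists_bound_of_continuousOn
    Z1_diff.continuous.continuousOn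
  refine ⟨16*(3*(|C0| + 1)), by nlinarith [abs_nonneg C0], ?_⟩
  intro G f B ε β hG hf0 hf1 hfL hB hGB hε hε6 hβ hβ1 hneg
  set C1 := 3*(|C0| + 1) with hC1
  have hC1' : 3 ≤ C1 := by nlinarith [abs_nonneg C0]
  set H : ℂ → ℂ := dslope (fun s => Z1 s*G s) 1 with hH
  have hZG : Differentiable ℂ (fun s => Z1 s*G s) := Z1_diff.mul hG
  have hHd : Differentiable ℂ H := by rw [← differentiableOn_univ, hH, Complex.differentiableOn_dslope (by simp)]; exact hZG.differentiableOn
  have hHne : ∀ s : ℂ, s ≠ 1 → H s = riemannZeta s*G s - G 1*(s - 1)⁻¹ := by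
    intro s hs
    have : s - 1 ≠ 0 := sub_ne_zero.mpr hs
    rw [hH, dslope_of_ne _ hs, slope_def_field, Z1_one, Z1_eq hs]; field_simp
  have h1mem : (1:ℂ) ∈ Metric.closedBall (2:ℂ) (4/3) := by simp [dist_eq]; norm_num
  have hHb : ∀ s ∈ Metric.sphere (2:ℂ) (4/3), ‖H s‖ ≤ C1*B := by
    intro s hs
    have hs' : ‖s - 2‖ = 4/3 := by simpa [dist_eq] using hs
    have hsc := Metric.sphere_subset_closedBall hs
    have h13 : 1/3 ≤ ‖s - 1‖ := by
      have := norm_sub_norm_le (s - 2) (-1)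
      have e : s - 2 - -1 = s - 1 := by ring
      rw [e, hs'] at this
      norm_num at this ⊢; linarith
    have hs1 : s ≠ 1 := by rintro rfl; norm_num at h13
    rw [hH, dslope_of_ne _ hs1, slope_def_field, norm_div, div_le_iff₀ (by linarith), Z1_one, one_mul]
    have a1 : ‖Z1 s*G s - G 1‖ ≤ |C0| * B + B := by
      refine (norm_sub_le _ _).trans (add_le_add ?_ (hGB _ h1mem))
      rw [norm_mul]; exact mul_le_mul ((hC0 s hsc).trans (le_abs_self _)) (hGB s hsc) (norm_nonneg _) (abs_nonneg _)
    have : |C0| * B + B ≤ C1*B*(1/3) := by rw [hC1]; ring_nf; linarith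
    have : C1*B*(1/3) ≤ C1*B * ‖s - 1‖ := by gcongr
    linarith
  -- Taylor coefficients
  set b : ℕ → ℂ := fun k => (-1)^k*((k.factorial : ℂ)⁻¹*iteratedDeriv k H 2) with hb
  have hbn : ∀ k, ‖b k‖ ≤ C1*B*(3/4)^k := by
    intro k
    have := norm_iteratedDeriv_le_of_forall_mem_sphere_norm_le k (by norm_num : (0:ℝ) < 4/3)
      hHd.diffContOnCl hHb
    simp only [hb, norm_mul, norm_pow, norm_neg, norm_one, one_pow, one_mul, norm_inv, norm_natCast]
    calc ((k.factorial : ℝ))⁻¹ * ‖iteratedDeriv k H 2‖ ≤ ((k.factorial : ℝ))⁻¹*(k.factorial*(C1*B) / (4/3)^k) := by gcongr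
      _ = C1*B*(3/4)^k := by
        have : (k.factorial : ℝ) ≠ 0 := by positivity
        have e : (3/4:ℝ)^k = ((4/3:ℝ)^k)⁻¹ := by rw [← inv_pow]; norm_num
        rw [e]; field_simp
  have habs : LSeries.abscissaOfAbsConv f < ((2:ℝ) : EReal) := by
    have : LSeries.abscissaOfAbsConv f ≤ ((3/2 : ℝ) : EReal) := by
      have := (hfL (3/2 : ℂ) (by norm_num)).1.abscissaOfAbsConv_le
      norm_num at this ⊢; exact this
    refine this.trans_lt ?_
    exact_mod_cast (by norm_num : (3/2:ℝ) < 2)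
  have hbr : ∀ k, 0 ≤ (b k + G 1).re := by
    intro k
    have hev : H =ᶠ[nhds (2:ℂ)] fun s => LSeries f s - G 1*(s - 1)⁻¹ := by
      have : {s : ℂ | 1 < s.re} ∈ nhds (2:ℂ) := (isOpen_lt continuous_const continuous_re).mem_nhds (by simp)
      filter_upwards [this] with s hs
      have hs1 : s ≠ 1 := by rintro rfl; simp at hs
      rw [hHne s hs1, (hfL s hs).2]
    have hcd1 : ContDiffAt ℂ k (LSeries f) 2 := by
      refine AnalyticAt.contDiffAt ?_
      exact LSeries_analyticOnNhd f 2 (by simpa using habs)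
    have hcd2 : ContDiffAt ℂ k (fun s : ℂ => G 1*(s - 1)⁻¹) 2 := by
      refine contDiffAt_const.mul (ContDiffAt.inv (by fun_prop) (by norm_num))
    have hd2 : iteratedDeriv k (fun s : ℂ => G 1*(s - 1)⁻¹) 2 = G 1*((-1)^k*k.factorial) := by
      rw [iteratedDeriv_const_mul_field]
      have := iteratedDeriv_comp_sub_const k (fun s : ℂ => s⁻¹) 1
      have := congrFun this 2
      rw [this, iteratedDeriv_eq_iterate, iter_deriv_inv]; norm_num
    have e := hev.iteratedDeriv_eq k
    rw [iteratedDeriv_fun_sub hcd1 hcd2, hd2] at e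
    have hk : (k.factorial : ℂ) ≠ 0 := by exact_mod_cast k.factorial_ne_zero
    have e2 : b k + G 1 = (k.factorial : ℂ)⁻¹*((-1)^k*iteratedDeriv k (LSeries f) 2) := by
      simp only [hb, e]
      have : ((-1:ℂ)^k)*(-1)^k = 1 := by rw [← mul_pow]; simp
      field_simp; linear_combination (- G 1*k.factorial)*this
    rw [e2]
    have := LSeries.iteratedDeriv_alternating (x := 2) hf0 habs k
    have h2 : (0:ℂ) ≤ (k.factorial : ℂ)⁻¹*((-1)^k*iteratedDeriv k (LSeries f) 2) := by
      refine mul_nonneg ?_ (by exact_mod_cast this)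
      rw [← Complex.ofReal_natCast, ← Complex.ofReal_inv, Complex.zero_le_real]; positivity
    exact (Complex.le_def.mp h2).1
  have hb0 : 1 ≤ (b 0 + G 1).re := by
    have : b 0 + G 1 = LSeries f 2 := by
      simp only [hb, pow_zero, one_mul, Nat.factorial_zero, Nat.cast_one, inv_one, iteratedDeriv_zero]
      rw [hHne 2 (by norm_num), (hfL 2 (by norm_num)).2]; norm_num
    rw [this, LSeries, Complex.re_tsum (hfL 2 (by norm_num)).1]
    have hs := Complex.hasSum_re ((hfL 2 (by norm_num)).1).hasSum
    have h2 := hs.summable.le_tsum 1 (fun n _ => (Complex.le_def.mp (LSeries.term_nonneg (hf0 n) 2)).1)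
    refine le_trans ?_ h2
    simp [LSeries.term, hf1]
  -- the expansion at β
  set x := 2 - β with hx
  have hx1 : 1 < x := by linarith
  have hx2 : x ≤ 1 + ε := by linarith
  have hsum : HasSum (fun k => (b k).re*x^k) (H β).re := by
    have h1 := Complex.hasSum_taylorSeries_of_entire hHd 2 (β:ℂ)
    have h2 := Complex.hasSum_re h1
    convert h2 using 2 with k
    have : ((β:ℂ) - 2)^k = (-1)^k*((x^k : ℝ) : ℂ) := by rw [← neg_sub, neg_pow]; push_cast [hx]; rfl
    rw [this, smul_eq_mul, smul_eq_mul]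
    have e3 : ((k.factorial:ℂ))⁻¹*((-1)^k*((x^k : ℝ) : ℂ)*iteratedDeriv k H 2)
       = b k*((x^k : ℝ) : ℂ) := by simp only [hb]; ring
    rw [e3, Complex.re_mul_ofReal]
  set K := ⌈8*Real.log (16*C1*B)⌉₊ with hK
  have hxr : 3/4*x ≤ 7/8 := by linarith
  have hCB : 16 ≤ 16*C1*B := by nlinarith
  have htail : C1*B*(7/8)^K*8 ≤ 1/2 := by
    have h78 : (7/8:ℝ) ≤ Real.exp (-(1/8)) := by
      have := Real.add_one_le_exp (-(1/8) : ℝ); linarith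
    have : (7/8:ℝ)^K ≤ (16*C1*B)⁻¹ := by
      calc (7/8:ℝ)^K ≤ (Real.exp (-(1/8)))^K := by gcongr
        _ = Real.exp (-(1/8)*K) := by rw [← Real.exp_nat_mul]; ring_nf
        _ ≤ Real.exp (- Real.log (16*C1*B)) := by
          apply Real.exp_le_exp.mpr
          have := Nat.le_ceil (8*Real.log (16*C1*B))
          rw [← hK] at this; linarith
        _ = _ := by rw [Real.exp_neg, Real.exp_log (by linarith)]
    calc C1*B*(7/8)^K*8 ≤ C1*B*(16*C1*B)⁻¹*8 := by gcongr
      _ = 1/2 := by field_simp; norm_num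
  set g := ‖G 1‖ with hg
  have hG1 : (G 1).re ≤ g := (le_abs_self _).trans (Complex.abs_re_le_norm _)
  have hlow : 1 - g*(x^K / (x - 1)) - 1/2 ≤ (H β).re := by
    rw [← hsum.tsum_eq, ← hsum.summable.sum_add_tsum_nat_add K]
    have t1 : 1 - g*(x^K / (x - 1)) ≤ ∑ i ∈ Finset.range K, (b i).re*x^i := by
      have hKpos : 0 < K := by rw [hK, Nat.ceil_pos]; exact mul_pos (by norm_num) (Real.log_pos (by linarith))
      have s1 : ∑ i ∈ Finset.range K, (if i = 0 then (1:ℝ) else 0) = 1 := by simp [hKpos.ne']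
      have s2 : ∑ i ∈ Finset.range K, g*x^i ≤ g*(x^K / (x - 1)) := by rw [← Finset.mul_sum, geom_sum_eq hx1.ne']; gcongr; linarith
      refine le_trans (sub_le_sub_left s2 _) ?_
      rw [← s1, ← Finset.sum_sub_distrib]
      refine Finset.sum_le_sum fun i _ => ?_
      have hxi : 0 < x^i := by positivity
      split_ifs with h
      · subst h
        simp at hb0 ⊢; linarith
      · have := hbr i
        simp at this
        nlinarith
    have t2 : -(1/2) ≤ ∑' i, (b (i + K)).re*x^(i + K) := by
      have hbd : ∀ i, ‖(b (i + K)).re*x^(i + K)‖ ≤ C1*B*(7/8)^K*(7/8)^i := by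
        intro i; rw [norm_mul, Real.norm_eq_abs, Real.norm_eq_abs, abs_of_pos (by positivity : 0 < x^(i + K))]
        calc |(b (i+K)).re| * x^(i+K) ≤ (C1*B*(3/4)^(i+K))*x^(i+K) := by gcongr; exact (Complex.abs_re_le_norm _).trans (hbn _)
          _ = C1*B*(3/4*x)^(i+K) := by rw [mul_pow]; ring
          _ ≤ C1*B*(7/8)^(i+K) := by gcongr
          _ = _ := by rw [pow_add]; ring
      have hgs : HasSum (fun i : ℕ => C1*B*(7/8:ℝ)^K*(7/8)^i) (C1*B*(7/8)^K*8) := by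
        have := (hasSum_geometric_of_lt_one (by norm_num : (0:ℝ) ≤ 7/8) (by norm_num)).mul_left (C1*B*(7/8:ℝ)^K)
        norm_num at this ⊢; exact this
      have := tsum_of_norm_bounded hgs hbd
      rw [Real.norm_eq_abs] at this
      have := (abs_le.mp this).1
      linarith
    linarith
  have hβ1c : (β:ℂ) ≠ 1 := by exact_mod_cast hβ1.ne
  have hup : (H β).re ≤ g / (x - 1) := by
    rw [hHne _ hβ1c, Complex.sub_re]
    have : G 1*((β:ℂ) - 1)⁻¹ = G 1*(((β - 1)⁻¹ : ℝ) : ℂ) := by push_cast; rfl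
    rw [this, Complex.re_mul_ofReal]
    have e : (β - 1)⁻¹ = - (x - 1)⁻¹ := by rw [← inv_neg, hx]; ring_nf
    rw [e, div_eq_mul_inv]
    have : (G 1).re*(x-1)⁻¹ ≤ g*(x-1)⁻¹ := by
      have : 0 < x - 1 := by linarith
      gcongr
    linarith
  have hxK : x^K ≤ 3*(16*C1*B)^(8*ε) := by
    calc x^K ≤ (Real.exp ε)^K := by gcongr; linarith [Real.add_one_le_exp ε]
      _ = Real.exp (ε*K) := by rw [← Real.exp_nat_mul]; ring_nf
      _ ≤ Real.exp (1 + Real.log (16*C1*B)*(8*ε)) := by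
        apply Real.exp_le_exp.mpr
        have hl : 0 ≤ Real.log (16*C1*B) := Real.log_nonneg (by linarith)
        have := Nat.ceil_lt_add_one (by positivity : 0 ≤ 8*Real.log (16*C1*B))
        rw [← hK] at this; nlinarith
      _ = Real.exp 1*(16*C1*B)^(8*ε) := by rw [Real.exp_add, Real.rpow_def_of_pos (by linarith)]
      _ ≤ _ := by gcongr; linarith [Real.exp_one_lt_d9]
  have hP : 1 ≤ (16*C1*B)^(8*ε) := Real.one_le_rpow (by linarith) (by positivity)
  set P := (16*C1*B)^(8*ε) with hPd
  rw [Real.rpow_neg (by nlinarith), ← hPd]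
  have hx10 : 0 < x - 1 := by linarith
  have hfin : (x - 1) / 2 ≤ g*(1 + x^K) := by
    have := hlow.trans hup
    field_simp at this ⊢
    nlinarith
  have hg0 : 0 ≤ g := norm_nonneg _
  have : (x - 1) / 2 ≤ g*(6*P) := by
    refine hfin.trans ?_
    have : 1 + x^K ≤ 6*P := by linarith
    gcongr
  have e9 : 1 - β = x - 1 := by rw [hx]; ring
  rw [e9, ← div_eq_mul_inv, div_le_iff₀ (by linarith)]; linarith
noncomputable def ca {q : ℕ} (χ : DirichletCharacter ℂ q) : ArithmeticFunction ℂ := toArithmeticFunction (fun n => χ (n : ZMod q))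
noncomputable def caL {q : ℕ} (χ : DirichletCharacter ℂ q) : ArithmeticFunction ℂ := ⟨fun n => χ (n : ZMod q)*(ArithmeticFunction.vonMangoldt n : ℂ), by simp⟩
lemma ca_apply {q : ℕ} (χ : DirichletCharacter ℂ q) {n : ℕ} (hn : n ≠ 0) : ca χ n = χ (n : ZMod q) := by simp [ca, toArithmeticFunction, hn]
lemma caL_apply {q : ℕ} (χ : DirichletCharacter ℂ q) (n : ℕ) : caL χ n = χ (n : ZMod q)*(ArithmeticFunction.vonMangoldt n : ℂ) := rfl
/-- `g` is the logarithmic derivative of `f`. -/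
def IsLogD (f g : ArithmeticFunction ℂ) : Prop := ∀ n, f n*(Real.log n : ℂ) = (f*g) n
lemma isLogD_ca {q : ℕ} (χ : DirichletCharacter ℂ q) : IsLogD (ca χ) (caL χ) := by
  intro n
  rcases eq_or_ne n 0 with rfl | hn
  · simp
  rw [ca_apply χ hn, ArithmeticFunction.mul_apply]
  have : ∀ x ∈ n.divisorsAntidiagonal, ca χ x.1*caL χ x.2 = χ (n : ZMod q)*(ArithmeticFunction.vonMangoldt x.2 : ℂ) := by
    intro x hx
    obtain ⟨h1, h2⟩ := Nat.mem_divisorsAntidiagonal.mp hx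
    have hx1 : x.1 ≠ 0 := by rintro h; simp [h] at h1; exact hn h1.symm
    rw [ca_apply χ hx1, caL_apply, ← h1]; push_cast; rw [map_mul]; ring
  rw [Finset.sum_congr rfl this, ← Finset.mul_sum]; congr 1; rw [← ArithmeticFunction.vonMangoldt_sum]; push_cast
  rw [← Nat.map_div_left_divisors]; simp only [Finset.sum_map]; rfl
lemma IsLogD.mul {f g f' g' : ArithmeticFunction ℂ} (h : IsLogD f g) (h' : IsLogD f' g') : IsLogD (f*f') (g + g') := by
  intro n
  have e : f*f' * (g + g') = (f*g)*f' + f*(f' * g') := by ring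
  rw [e, ArithmeticFunction.add_apply, ArithmeticFunction.mul_apply, ArithmeticFunction.mul_apply (f := f*g),
    ArithmeticFunction.mul_apply (g := f' * g'), Finset.sum_mul, ← Finset.sum_add_distrib]
  refine Finset.sum_congr rfl fun x hx => ?_
  obtain ⟨h1, h2⟩ := Nat.mem_divisorsAntidiagonal.mp hx
  have hx1 : (x.1:ℝ) ≠ 0 := by
    rintro h; have : x.1 = 0 := by exact_mod_cast h
    simp [this] at h1; exact h2 h1.symm
  have hx2 : (x.2:ℝ) ≠ 0 := by
    rintro h; have : x.2 = 0 := by exact_mod_cast h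
    simp [this] at h1; exact h2 h1.symm
  rw [← h x.1, ← h' x.2, ← h1, Nat.cast_mul, Real.log_mul hx1 hx2]; push_cast; ring
lemma IsLogD.nonneg {f g : ArithmeticFunction ℂ} (h : IsLogD f g) (h1 : f 1 = 1) (hg1 : g 1 = 0)
    (hg : ∀ n, 0 ≤ g n) : ∀ n, 0 ≤ f n := by
  intro n
  induction n using Nat.strong_induction_on with
  | _ n ih =>
    rcases Nat.lt_or_ge n 2 with hn | hn
    · interval_cases n
      · simp
      · simp [h1]
    have hl : 0 < Real.log n := Real.log_pos (by exact_mod_cast hn)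
    have h2 : 0 ≤ f n*(Real.log n : ℂ) := by
      rw [h n, ArithmeticFunction.mul_apply]
      refine Finset.sum_nonneg fun x hx => ?_
      obtain ⟨h1, h2⟩ := Nat.mem_divisorsAntidiagonal.mp hx
      rcases eq_or_ne x.2 1 with h3 | h3
      · rw [h3, hg1, mul_zero]
      · refine mul_nonneg (ih _ ?_) (hg _)
        have : x.2 ≠ 0 := by rintro h; simp [h] at h1; omega
        have : x.1 ≠ 0 := by rintro h; simp [h] at h1; omega
        have : 2 ≤ x.2 := by omega
        nlinarith [Nat.pos_of_ne_zero ‹x.1 ≠ 0›]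
    have e : f n = f n*(Real.log n : ℂ)*(((Real.log n)⁻¹ : ℝ) : ℂ) := by
      have : (Real.log n : ℂ) ≠ 0 := by exact_mod_cast hl.ne'
      rw [Complex.ofReal_inv, mul_inv_cancel_right₀ this]
    rw [e]
    exact mul_nonneg h2 (by rw [Complex.zero_le_real]; positivity)
lemma ca_one {q : ℕ} (χ : DirichletCharacter ℂ q) : ca χ 1 = 1 := by rw [ca_apply χ one_ne_zero]; simp
lemma caL_one {q : ℕ} (χ : DirichletCharacter ℂ q) : caL χ 1 = 0 := by simp [caL_apply]
lemma am_mul_one {f g : ArithmeticFunction ℂ} (hf : f 1 = 1) (hg : g 1 = 1) : (f*g) 1 = 1 := by rw [ArithmeticFunction.mul_apply_one, hf, hg, one_mul]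
lemma ca_LSeries {q : ℕ} [NeZero q] (χ : DirichletCharacter ℂ q) {s : ℂ} (hs : 1 < s.re) : LSeriesSummable (ca χ) s ∧ LSeries (ca χ) s = DirichletCharacter.LFunction χ s := by
  constructor
  · refine (LSeriesSummable_congr s ?_).mpr (DirichletCharacter.LSeriesSummable_of_one_lt_re χ hs)
    intro n hn; exact ca_apply χ hn
  · rw [DirichletCharacter.LFunction_eq_LSeries χ hs]; exact LSeries_congr (fun hn => ca_apply χ hn) s
lemma mul_LSeries {f g : ArithmeticFunction ℂ} {s a b : ℂ} (hf : LSeriesSummable f s ∧ LSeries f s = a)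
    (hg : LSeriesSummable g s ∧ LSeries g s = b) :
    LSeriesSummable (f*g : ArithmeticFunction ℂ) s ∧ LSeries (f*g : ArithmeticFunction ℂ) s = a*b :=
  ⟨ArithmeticFunction.LSeriesSummable_mul hf.1 hg.1, by
    rw [ArithmeticFunction.LSeries_mul' hf.1 hg.1, hf.2, hg.2]⟩
lemma quad_val {q : ℕ} {χ : DirichletCharacter ℂ q} (h : χ^2 = 1) (a : ZMod q) : χ a = 0 ∨ χ a = 1 ∨ χ a = -1 := by
  by_cases ha : IsUnit a
  · right
    have : (χ^2) a = 1 := by rw [h, MulChar.one_apply ha]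
    rw [MulChar.pow_apply' _ two_ne_zero] at this
    have h3 : (χ a - 1)*(χ a + 1) = 0 := by linear_combination this
    rcases mul_eq_zero.mp h3 with h4 | h4
    · left; linear_combination h4
    · right; linear_combination h4
  · left; exact MulChar.map_nonunit χ ha
/-- trivial character mod 1 -/
noncomputable abbrev tr1 : DirichletCharacter ℂ 1 := 1
lemma tr1_apply (a : ZMod 1) : tr1 a = 1 := by rw [Subsingleton.elim a 1]; simp
lemma LF_tr1 (s : ℂ) : DirichletCharacter.LFunction tr1 s = riemannZeta s := by rw [DirichletCharacter.LFunction_modOne_eq]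
lemma vM_nonneg (n : ℕ) : (0:ℂ) ≤ (ArithmeticFunction.vonMangoldt n : ℂ) := by rw [Complex.zero_le_real]; exact ArithmeticFunction.vonMangoldt_nonneg
lemma nonneg_two {q : ℕ} {χ : DirichletCharacter ℂ q} (h : χ^2 = 1) : ∀ n, 0 ≤ (ca tr1*ca χ) n := by
  refine ((isLogD_ca tr1).mul (isLogD_ca χ)).nonneg (am_mul_one (ca_one _) (ca_one _))
    (by simp [caL_one]) fun n => ?_
  rw [ArithmeticFunction.add_apply, caL_apply, caL_apply, tr1_apply, ← add_mul]
  refine mul_nonneg ?_ (vM_nonneg n)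
  rcases quad_val h (n : ZMod q) with h | h | h <;> rw [h] <;> norm_num
lemma nonneg_four {q : ℕ} {χ ψ : DirichletCharacter ℂ q} (h : χ^2 = 1) (h' : ψ^2 = 1) : ∀ n, 0 ≤ (ca tr1*(ca χ*ca ψ*ca (χ*ψ))) n := by
  refine ((isLogD_ca tr1).mul (((isLogD_ca χ).mul (isLogD_ca ψ)).mul (isLogD_ca (χ*ψ)))).nonneg
    (am_mul_one (ca_one _) (am_mul_one (am_mul_one (ca_one _) (ca_one _)) (ca_one _)))
    (by simp [caL_one]) fun n => ?_
  simp only [ArithmeticFunction.add_apply, caL_apply, tr1_apply, MulChar.mul_apply, ← add_mul]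
  refine mul_nonneg ?_ (vM_nonneg n)
  rcases quad_val h (n : ZMod q) with h | h | h <;> rcases quad_val h' (n : ZMod q) with h' | h' | h' <;>
    rw [h, h'] <;> norm_num
lemma prod_one_sub_inv (S : Finset ℕ) (hS : ∀ p ∈ S, 2 ≤ p) : 1 / ((S.card : ℝ) + 1) ≤ ∏ p ∈ S, (1 - 1 / (p:ℝ)) := by
  induction S using Finset.induction_on_max with
  | empty => simp
  | insert a s hmax ih =>
    have ha : a ∉ s := fun h => lt_irrefl _ (hmax a h)
    rw [Finset.prod_insert ha, Finset.card_insert_of_notMem ha]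
    have hcard : s.card + 2 ≤ a := by
      have h1 : s ⊆ Finset.Ico 2 a := fun p hp => Finset.mem_Ico.mpr ⟨hS p (Finset.mem_insert_of_mem hp), hmax p hp⟩
      have h2 := Finset.card_le_card h1
      have h3 := hS a (Finset.mem_insert_self a s)
      simp at h2; omega
    have hc : (s.card:ℝ) + 2 ≤ a := by exact_mod_cast hcard
    have ih' := ih fun p hp => hS p (Finset.mem_insert_of_mem hp)
    have h4 : 1 / ((s.card:ℝ) + 2) ≥ 1 / (a:ℝ) := by gcongr
    calc 1 / (((s.card + 1 : ℕ) : ℝ) + 1) = (1 - 1 / ((s.card:ℝ) + 2))*(1 / ((s.card : ℝ) + 1)) := by push_cast; field_simp; ring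
      _ ≤ (1 - 1 / (a:ℝ))*(1 / ((s.card : ℝ) + 1)) := by gcongr
      _ ≤ _ := by
        gcongr
        have : 1 / (a:ℝ) ≤ 1 := by rw [div_le_one (by linarith)]; linarith
        linarith
lemma card_primeFactors_le {N : ℕ} (hN : 1 ≤ N) {ε : ℝ} (hε : 0 < ε) : (N.primeFactors.card : ℝ) + 1 ≤ (1 + 2 / ε)*(N:ℝ)^ε := by
  have h1 : 2^N.primeFactors.card ≤ N := by
    calc 2^N.primeFactors.card ≤ ∏ p ∈ N.primeFactors, p := Finset.pow_card_le_prod _ _ _ fun p hp => (Nat.prime_of_mem_primeFactors hp).two_le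
      _ ≤ N := Nat.le_of_dvd hN (Nat.prod_primeFactors_dvd N)
  have h2 : (N.primeFactors.card : ℝ)*Real.log 2 ≤ Real.log N := by rw [← Real.log_pow]; exact Real.log_le_log (by positivity) (by exact_mod_cast h1)
  have h3 : Real.log N ≤ (N:ℝ)^ε / ε := Real.log_le_rpow_div (by positivity) hε
  have h4 : 1 ≤ (N:ℝ)^ε := Real.one_le_rpow (by exact_mod_cast hN) hε.le
  have h5 := Real.log_two_gt_d9
  have h6 : (1 + 2 / ε)*(N:ℝ)^ε = (N:ℝ)^ε + 2*((N:ℝ)^ε / ε) := by ring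
  rw [h6]; nlinarith [Nat.cast_nonneg (α := ℝ) N.primeFactors.card]
lemma euler_factor_bounds {N : ℕ} (hN : 1 ≤ N) {ε : ℝ} (hε : 0 < ε) {q : ℕ} (χ : DirichletCharacter ℂ q) :
    ((1 + 2 / ε)*(N:ℝ)^ε)⁻¹ ≤ ‖∏ p ∈ N.primeFactors, (1 - χ (p : ZMod q)*(p:ℂ)^(-1 : ℂ))‖ ∧
    ‖∏ p ∈ N.primeFactors, (1 - χ (p : ZMod q)*(p:ℂ)^(-1 : ℂ))‖ ≤ (1 + 2 / ε)*(N:ℝ)^ε := by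
  have h1 := card_primeFactors_le hN hε
  have h2 := prod_one_sub_inv N.primeFactors fun p hp => (Nat.prime_of_mem_primeFactors hp).two_le
  have hle : ∀ p ∈ N.primeFactors, ‖χ (p : ZMod q)*(p:ℂ)^(-1 : ℂ)‖ ≤ 1 / (p:ℝ) := by
    intro p hp; rw [norm_mul, cpow_neg_one, norm_inv, norm_natCast, one_div]
    exact mul_le_of_le_one_left (by positivity) (DirichletCharacter.norm_le_one χ _)
  have hp2 : ∀ p ∈ N.primeFactors, (1:ℝ) / p ≤ 1/2 := by
    intro p hp
    have : (2:ℝ) ≤ p := by exact_mod_cast (Nat.prime_of_mem_primeFactors hp).two_le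
    gcongr
  have hpos : (0:ℝ) < (N.primeFactors.card : ℝ) + 1 := by positivity
  rw [norm_prod]
  constructor
  · calc ((1 + 2 / ε)*(N:ℝ)^ε)⁻¹ ≤ 1 / ((N.primeFactors.card : ℝ) + 1) := by rw [one_div]; gcongr
      _ ≤ ∏ p ∈ N.primeFactors, (1 - 1 / (p:ℝ)) := h2
      _ ≤ _ := by
        refine Finset.prod_le_prod (fun p hp => ?_) (fun p hp => ?_)
        · linarith [hp2 p hp]
        · have := norm_sub_norm_le (1:ℂ) (χ (p : ZMod q)*(p:ℂ)^(-1 : ℂ))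
          rw [norm_one] at this; linarith [hle p hp]
  · calc _ ≤ ∏ p ∈ N.primeFactors, (1 - 1 / (p:ℝ))⁻¹ := by
          refine Finset.prod_le_prod (fun p hp => norm_nonneg _) (fun p hp => ?_)
          have h3 := norm_sub_le (1:ℂ) (χ (p : ZMod q)*(p:ℂ)^(-1 : ℂ))
          rw [norm_one] at h3
          have h4 := hle p hp
          have h5 := hp2 p hp
          refine (h3.trans (add_le_add_right h4 _)).trans ?_
          rw [← one_div, le_div_iff₀ (by linarith)]; nlinarith [sq_nonneg (1 / (p:ℝ))]
      _ = (∏ p ∈ N.primeFactors, (1 - 1 / (p:ℝ)))⁻¹ := by rw [Finset.prod_inv_distrib]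
      _ ≤ (1 / ((N.primeFactors.card : ℝ) + 1))⁻¹ := by gcongr
      _ = (N.primeFactors.card : ℝ) + 1 := by simp
      _ ≤ _ := h1
lemma LF_diff {q : ℕ} [NeZero q] {χ : DirichletCharacter ℂ q} (hχ : χ ≠ 1) : Differentiable ℂ (DirichletCharacter.LFunction χ) :=
  DirichletCharacter.differentiable_LFunction hχ
lemma LF_ball_bound {q : ℕ} [NeZero q] {χ : DirichletCharacter ℂ q} (hχ : χ ≠ 1) {s : ℂ}
    (hs : s ∈ Metric.closedBall (2:ℂ) (4/3)) : ‖DirichletCharacter.LFunction χ s‖ ≤ 64*q := by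
  have hs' : ‖s - 2‖ ≤ 4/3 := by simpa [dist_eq] using hs
  have h1 := (Complex.abs_re_le_norm (s - 2)).trans hs'
  have h2 := (Complex.abs_im_le_norm (s - 2)).trans hs'
  simp at h1 h2
  have h3 := (abs_le.mp h1).1
  refine (LFunction_bound hχ (ε := 1/3) (by norm_num) (by norm_num) (by linarith)).trans ?_
  have hq : (1:ℝ) ≤ q := by exact_mod_cast NeZero.one_le
  have hQ : Qc q s.im ≤ 4*q := by unfold Qc; nlinarith
  have hQ0 := Qc_ge_two (NeZero.one_le : 1 ≤ q) s.im
  calc 2*(5 + 1 / (1/3:ℝ))*Qc q s.im^(2*(1/3:ℝ)) ≤ 2*(5 + 1 / (1/3:ℝ))*Qc q s.im^(1:ℝ) := by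
        gcongr
        · linarith
        · norm_num
    _ ≤ 2*(5 + 1 / (1/3:ℝ))*(4*q) := by rw [Real.rpow_one]; gcongr
    _ = 64*q := by norm_num; ring
/-- `L(x,χ)` is real for quadratic χ and real x. -/
lemma LF_real {q : ℕ} [NeZero q] {χ : DirichletCharacter ℂ q} (hχ : χ ≠ 1) (h2 : χ^2 = 1) (x : ℝ)
    (hx : 0 < x) : (DirichletCharacter.LFunction χ x).im = 0 := by
  have key : ∀ s : ℂ, 0 < s.re → DirichletCharacter.LFunction χ s = (starRingEnd ℂ) (DirichletCharacter.LFunction χ ((starRingEnd ℂ) s)) := by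
    intro s hs
    refine eqOn_of_eqOn_right (F := DirichletCharacter.LFunction χ)
      (G := (starRingEnd ℂ) ∘ (DirichletCharacter.LFunction χ) ∘ (starRingEnd ℂ))
      (fun s _ => LF_diff hχ s) (fun s _ => ?_) ?_ hs
    · have := (LF_diff hχ ((starRingEnd ℂ) s)).star_star
      simpa using this
    · intro s hs
      have hs' : 1 < ((starRingEnd ℂ) s).re := by simpa using hs
      simp only [Function.comp]
      rw [DirichletCharacter.LFunction_eq_LSeries χ hs, DirichletCharacter.LFunction_eq_LSeries χ hs', LSeries, LSeries, Complex.conj_tsum]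
      refine tsum_congr fun n => ?_
      rcases eq_or_ne n 0 with rfl | hn
      · simp
      rw [LSeries.term_of_ne_zero hn, LSeries.term_of_ne_zero hn, map_div₀]; congr 1
      · rcases quad_val h2 (n : ZMod q) with h | h | h <;> simp [h]
      · rw [Complex.cpow_conj _ _ (by rw [Complex.natCast_arg (n := n)]; exact Real.pi_pos.ne)]
        simp
  have := key x (by simpa using hx)
  rw [Complex.conj_ofReal] at this; exact Complex.conj_eq_iff_im.mp this.symm
end WG
end
section
open Complex MeasureTheory Filter Asymptotics
open scoped ComplexOrder
open DirichletCharacter (LFunction changeLevel)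
namespace WG
lemma Z1_pos_near : ∃ ε0 : ℝ, 0 < ε0 ∧ ∀ x : ℝ, 1 - ε0 ≤ x → x ≤ 1 → 0 < (Z1 x).re := by
  have hc : Continuous (fun x : ℝ => (Z1 x).re) := continuous_re.comp (Z1_diff.continuous.comp continuous_ofReal)
  have h1 : {x : ℝ | 0 < (Z1 x).re} ∈ nhds (1:ℝ) := (isOpen_lt continuous_const hc).mem_nhds (by simp [Z1_one])
  obtain ⟨ε, hε, hb⟩ := Metric.mem_nhds_iff.mp h1
  refine ⟨ε/2, by positivity, fun x h2 h3 => hb ?_⟩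
  rw [Metric.mem_ball, Real.dist_eq, abs_lt]; constructor <;> linarith
lemma zeta_neg_of_Z1 {x : ℝ} (hx : x < 1) (h : 0 < (Z1 x).re) : (riemannZeta x).re ≤ 0 := by
  have hx1 : (x:ℂ) ≠ 1 := by exact_mod_cast hx.ne
  rw [Z1_eq hx1] at h
  have e : ((x:ℂ) - 1)*riemannZeta x = ((x - 1 : ℝ) : ℂ)*riemannZeta x := by push_cast; ring
  rw [e, Complex.re_ofReal_mul] at h; nlinarith
lemma LF_pos {q : ℕ} [NeZero q] {χ : DirichletCharacter ℂ q} (hχ : χ ≠ 1) (h2 : χ^2 = 1) {β : ℝ}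
    (hβ0 : 0 < β) (hβ1 : β < 1) (hz : ∀ x : ℝ, β ≤ x → x < 1 → LFunction χ x ≠ 0) :
    0 < (LFunction χ β).re := by
  by_contra hcon
  push Not at hcon
  have hc : Continuous (fun x : ℝ => (LFunction χ x).re) := continuous_re.comp ((LF_diff hχ).continuous.comp continuous_ofReal)
  have hL2 : 0 < (LFunction χ (2:ℝ)).re := by
    have h2s : 1 < ((2:ℝ):ℂ).re := by simp
    have hL := mul_LSeries (ca_LSeries tr1 h2s) (ca_LSeries χ h2s)
    rw [LF_tr1] at hL
    have hz := riemannZeta_pos_of_one_lt (by norm_num : (1:ℝ) < 2)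
    have habs : LSeries.abscissaOfAbsConv (ca tr1*ca χ : ArithmeticFunction ℂ) < ((2:ℝ) : EReal) := by
      have h3s : 1 < ((3/2:ℝ):ℂ).re := by simp; norm_num
      refine (mul_LSeries (ca_LSeries tr1 h3s) (ca_LSeries χ h3s)).1.abscissaOfAbsConv_le.trans_lt ?_
      exact_mod_cast (by norm_num : (3/2:ℝ) < 2)
    have hp := LSeries.positive (a := (ca tr1*ca χ : ArithmeticFunction ℂ)) (nonneg_two h2)
      (by rw [am_mul_one (ca_one _) (ca_one _)]; exact zero_lt_one) habs
    rw [hL.2] at hp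
    have hp' := (Complex.lt_def.mp hp).1
    have hz1 := (Complex.lt_def.mp hz).1
    have hz2 := (Complex.lt_def.mp hz).2
    rw [Complex.mul_re] at hp'
    simp only [Complex.zero_re, Complex.zero_im] at hp' hz1 hz2
    rw [← hz2] at hp'
    nlinarith
  obtain ⟨x, hx, hx0⟩ := intermediate_value_Icc (by linarith : β ≤ 2) hc.continuousOn ⟨hcon, hL2.le⟩
  have hx0' : LFunction χ x = 0 := Complex.ext hx0 (LF_real hχ h2 x (by linarith [hx.1]))
  rcases lt_or_ge x 1 with h | h
  · exact hz x hx.1 h hx0'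
  · exact DirichletCharacter.LFunction_ne_zero_of_one_le_re χ (Or.inl hχ) (by simpa using h) hx0'
lemma rpow_split {C N η : ℝ} (hC : 0 < C) (hN : 0 < N) (k : ℕ) : (C*N^k)^(-(8*η)) = C^(-(8*η))*((N^η)^(8*k))⁻¹ := by
  rw [Real.mul_rpow hC.le (by positivity)]; congr 1
  rw [← Real.rpow_natCast N k, ← Real.rpow_mul hN.le, ← Real.rpow_natCast, ← Real.rpow_mul hN.le, ← Real.rpow_neg hN.le]
  congr 1; push_cast; ring
lemma LF_one_bound {q : ℕ} [NeZero q] {χ : DirichletCharacter ℂ q} (hχ : χ ≠ 1) {η : ℝ}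
    (hη : 0 < η) (hη2 : η ≤ 1/2) : ‖LFunction χ 1‖ ≤ 4*(5 + 1/η)*((q:ℝ)^η)^2 := by
  have h := LFunction_bound hχ hη hη2 (s := 1) (by simp; linarith)
  refine h.trans ?_
  have : Qc q (1:ℂ).im = 2*q := by simp [Qc]; ring
  rw [this, Real.mul_rpow (by norm_num) (by positivity), ← Real.rpow_natCast, ← Real.rpow_mul (by positivity)]
  have h2 : (2:ℝ)^(2*η) ≤ 2 := by
    calc (2:ℝ)^(2*η) ≤ 2^(1:ℝ) := Real.rpow_le_rpow_of_exponent_le (by norm_num) (by linarith)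
      _ = 2 := by norm_num
  have e : (q:ℝ)^(η*((2:ℕ):ℝ)) = (q:ℝ)^(2*η) := by congr 1; push_cast; ring
  rw [e]
  calc 2*(5 + 1 / η)*(2^(2*η)*(q:ℝ)^(2*η)) ≤ 2*(5 + 1 / η)*(2*(q:ℝ)^(2*η)) := by gcongr
    _ = _ := by ring
theorem siegel {ε : ℝ} (hε : 0 < ε) : ∃ c : ℝ, 0 < c ∧ ∀ (q : ℕ) [NeZero q] (χ : DirichletCharacter ℂ q),
    χ ≠ 1 → χ^2 = 1 → c*(q:ℝ)^(-ε) ≤ ‖LFunction χ 1‖ := by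
  obtain ⟨ε0, hε0, hZ⟩ := Z1_pos_near
  obtain ⟨C, hC1, hcore⟩ := siegel_core
  set η := min (ε / 30) (min ε0 (1/6)) with hη
  have hη0 : 0 < η := by positivity
  have hη1 : η ≤ ε / 30 := min_le_left _ _
  have hη2 : η ≤ ε0 := (min_le_right _ _).trans (min_le_left _ _)
  have hη3 : η ≤ 1/6 := (min_le_right _ _).trans (min_le_right _ _)
  have hqpow : ∀ (q : ℕ), 1 ≤ q → ∀ k : ℕ, k ≤ 29 → (q:ℝ)^(-ε) ≤ (((q:ℝ)^η)^k)⁻¹ := by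
    intro q hq k hk
    have hq1 : (1:ℝ) ≤ q := by exact_mod_cast hq
    rw [← Real.rpow_natCast, ← Real.rpow_mul (by linarith), ← Real.rpow_neg (by linarith)]; apply Real.rpow_le_rpow_of_exponent_le hq1
    have : (k:ℝ) ≤ 29 := by exact_mod_cast hk
    nlinarith
  by_cases hex : ∃ (r : ℕ) (_ : NeZero r) (ψ : DirichletCharacter ℂ r) (β : ℝ), ψ ≠ 1 ∧ ψ^2 = 1 ∧ 1 - η ≤ β ∧ β < 1 ∧ LFunction ψ β = 0
  · obtain ⟨r, hr, ψ, β, hψ1, hψ2, hβ, hβ1, hβ0⟩ := hex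
    set K := 1 + 2 / η with hK
    have hKp : 0 < K := by positivity
    set K2 := 4*(5 + 1/η) with hK2
    have hK2p : 0 < K2 := by positivity
    have hr1 : (1:ℝ) ≤ r := by exact_mod_cast hr.one_le
    set R := (r:ℝ)^η with hR
    have hRp : 0 < R := by positivity
    have hℓ : 0 < ‖LFunction ψ 1‖ := norm_pos_iff.mpr (DirichletCharacter.LFunction_ne_zero_of_one_le_re ψ (Or.inl hψ1) (by simp))
    set D := (C*64^3)^(-(8*η)) with hD
    have hDp : 0 < D := by positivity
    set c1 := ‖LFunction ψ 1‖ / (K^2*R^2) with hc1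
    set c2 := (1 - β) / 12*D / (K2^2*K*R^29) with hc2
    have hc1p : 0 < c1 := by positivity
    have hc2p : 0 < c2 := by
      have : 0 < 1 - β := by linarith
      positivity
    refine ⟨min c1 c2, lt_min hc1p hc2p, ?_⟩
    intro q hq χ hχ1 hχ2
    have hq1 : (1:ℝ) ≤ q := by exact_mod_cast hq.one_le
    set N := q*r with hN
    have : NeZero N := ⟨mul_ne_zero hq.ne hr.ne⟩
    have hN1 : 1 ≤ N := NeZero.one_le
    set T := (q:ℝ)^η with hT
    have hTp : 0 < T := by positivity
    have hNT : (N:ℝ)^η = T*R := by rw [hN]; push_cast; rw [Real.mul_rpow (by positivity) (by positivity)]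
    have hqN : q ∣ N := Dvd.intro _ rfl
    have hrN : r ∣ N := Dvd.intro_left _ rfl
    set χ' := changeLevel hqN χ with hχ'
    set ψ' := changeLevel hrN ψ with hψ'
    have hχ'1 : χ' ≠ 1 := fun h => hχ1 ((DirichletCharacter.changeLevel_eq_one_iff hqN).mp h)
    have hψ'1 : ψ' ≠ 1 := fun h => hψ1 ((DirichletCharacter.changeLevel_eq_one_iff hrN).mp h)
    have hχ'2 : χ'^2 = 1 := by rw [hχ', ← map_pow, hχ2, map_one]
    have hψ'2 : ψ'^2 = 1 := by rw [hψ', ← map_pow, hψ2, map_one]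
    have e1 := DirichletCharacter.LFunction_changeLevel hqN χ (s := 1) (Or.inl hχ1)
    have e2 := DirichletCharacter.LFunction_changeLevel hrN ψ (s := 1) (Or.inl hψ1)
    obtain ⟨b1, b2⟩ := euler_factor_bounds hN1 hη0 χ
    obtain ⟨b3, b4⟩ := euler_factor_bounds hN1 hη0 ψ
    rw [← hK, hNT] at b1 b2 b3 b4
    set P1 := ‖∏ p ∈ N.primeFactors, (1 - χ (p : ZMod q)*(p:ℂ)^(-1 : ℂ))‖
    set P2 := ‖∏ p ∈ N.primeFactors, (1 - ψ (p : ZMod r)*(p:ℂ)^(-1 : ℂ))‖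
    have n1 : ‖LFunction χ' 1‖ ≤ ‖LFunction χ 1‖ * (K*(T*R)) := by rw [hχ', e1, norm_mul]; gcongr
    by_cases hsame : χ' = ψ'
    · have n2 : ‖LFunction ψ 1‖ * (K*(T*R))⁻¹ ≤ ‖LFunction χ' 1‖ := by rw [hsame, hψ', e2, norm_mul]; gcongr
      have n3 := n2.trans n1
      have : c1*(T^2)⁻¹ ≤ ‖LFunction χ 1‖ := by
        rw [hc1]
        have n4 : ‖LFunction ψ 1‖ ≤ ‖LFunction χ 1‖ * (K*(T*R))*(K*(T*R)) := by
          have := mul_le_mul_of_nonneg_right n3 (by positivity : 0 ≤ K*(T*R))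
          rwa [inv_mul_cancel_right₀ (by positivity)] at this
        rw [div_mul_eq_mul_div, ← div_eq_mul_inv, div_div, div_le_iff₀ (by positivity)]; nlinarith
      refine le_trans ?_ this
      have := hqpow q hq.one_le 2 (by norm_num)
      have h0 := min_le_left c1 c2
      gcongr
    · have hprod : χ' * ψ' ≠ 1 := by
        intro h; apply hsame
        have : χ' * ψ' * ψ' = ψ' := by rw [h, one_mul]
        rw [mul_assoc, ← sq, hψ'2, mul_one] at this; exact this
      have hβz : LFunction ψ' β = 0 := by rw [hψ', DirichletCharacter.LFunction_changeLevel hrN ψ (Or.inl hψ1), hβ0, zero_mul]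
      have hNpos : (0:ℝ) < N := by exact_mod_cast hN1
      have hN1' : (1:ℝ) ≤ N := by exact_mod_cast hN1
      have hc := hcore (fun s => LFunction χ' s*LFunction ψ' s*LFunction (χ' * ψ') s)
        (ca tr1*(ca χ' * ca ψ' * ca (χ' * ψ')) : ArithmeticFunction ℂ) ((64*N)^3) η β
        (((LF_diff hχ'1).mul (LF_diff hψ'1)).mul (LF_diff hprod))
        (nonneg_four hχ'2 hψ'2)
        (am_mul_one (ca_one _) (am_mul_one (am_mul_one (ca_one _) (ca_one _)) (ca_one _)))
        (fun s hs => by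
          have := mul_LSeries (ca_LSeries tr1 hs) (mul_LSeries (mul_LSeries (ca_LSeries χ' hs)
            (ca_LSeries ψ' hs)) (ca_LSeries (χ' * ψ') hs))
          rwa [LF_tr1] at this)
        (one_le_pow₀ (by linarith))
        (fun s hs => by
          rw [norm_mul, norm_mul]
          have a1 := LF_ball_bound hχ'1 hs
          have a2 := LF_ball_bound hψ'1 hs
          have a3 := LF_ball_bound hprod hs
          calc _ ≤ (64*N : ℝ)*(64*N)*(64*N) := by gcongr
            _ = _ := by ring)
        hη0 hη3 hβ hβ1 (by simp [hβz])
      have eD : C*(64*(N:ℝ))^3 = (C*64^3)*(N:ℝ)^3 := by ring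
      rw [eD, rpow_split (by positivity) hNpos 3, hNT, ← hD, norm_mul, norm_mul] at hc
      have a2 := LF_one_bound hψ'1 hη0 (by linarith)
      have a3 := LF_one_bound hprod hη0 (by linarith)
      rw [← hK2, hNT] at a2 a3
      have hc' : (1 - β) / 12*(D*((T*R)^(8*3))⁻¹) ≤ ‖LFunction χ 1‖ * (K*(T*R))*(K2*(T*R)^2)*(K2*(T*R)^2) := by
        refine hc.trans ?_
        gcongr
      have : c2*(T^29)⁻¹ ≤ ‖LFunction χ 1‖ := by
        rw [← mul_assoc, ← div_eq_mul_inv, div_le_iff₀ (by positivity)] at hc'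
        rw [hc2, div_mul_eq_mul_div, ← div_eq_mul_inv, div_div, div_le_iff₀ (by positivity)]
        refine hc'.trans (le_of_eq ?_)
        ring
      refine le_trans ?_ this
      have := hqpow q hq.one_le 29 (by norm_num)
      have h0 := min_le_right c1 c2
      gcongr
  · push Not at hex
    refine ⟨η / 12*(C*64)^(-(8*η)), by positivity, ?_⟩
    intro q hq χ hχ1 hχ2
    have hq1 : (1:ℝ) ≤ q := by exact_mod_cast hq.one_le
    have hpos := LF_pos hχ1 hχ2 (β := 1 - η) (by linarith) (by linarith)
      (fun x h1 h2 => hex q hq χ x hχ1 hχ2 h1 h2)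
    have hreal := LF_real hχ1 hχ2 (1 - η) (by linarith)
    have hc := hcore (LFunction χ) (ca tr1*ca χ : ArithmeticFunction ℂ) (64*q) η (1 - η)
        (LF_diff hχ1) (nonneg_two hχ2) (am_mul_one (ca_one _) (ca_one _))
        (fun s hs => by
          have := mul_LSeries (ca_LSeries tr1 hs) (ca_LSeries χ hs)
          rwa [LF_tr1] at this)
        (by linarith) (fun s hs => LF_ball_bound hχ1 hs) hη0 hη3 le_rfl (by linarith) (by
          rw [Complex.mul_re, hreal, mul_zero, sub_zero]
          have := zeta_neg_of_Z1 (by linarith : 1 - η < 1) (hZ (1 - η) (by linarith) (by linarith))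
          exact mul_nonpos_of_nonpos_of_nonneg this hpos.le)
    have eD : C*(64*(q:ℝ)) = (C*64)*(q:ℝ)^1 := by ring
    rw [eD, rpow_split (by positivity) (by linarith) 1, sub_sub_cancel] at hc
    refine le_trans ?_ hc
    rw [mul_assoc]
    have := hqpow q hq.one_le 8 (by norm_num)
    gcongr
end WG
end
section
open Complex MeasureTheory Filter Asymptotics
open DirichletCharacter (LFunction changeLevel)
namespace WG
lemma lip_of_bound {f : ℂ → ℂ} {D : Set ℂ} (hD : Convex ℝ D) {r U : ℝ} (hr : 0 < r)
    (hf : ∀ z ∈ D, ∀ w ∈ Metric.closedBall z r, DifferentiableAt ℂ f w ∧ ‖f w‖ ≤ U)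
    {x y : ℂ} (hx : x ∈ D) (hy : y ∈ D) : ‖f y - f x‖ ≤ U / r * ‖y - x‖ := by
  refine hD.norm_image_sub_le_of_norm_deriv_le (𝕜 := ℂ)
    (fun z hz => (hf z hz z (Metric.mem_closedBall_self hr.le)).1) (fun z hz => ?_) hx hy
  refine norm_deriv_le_of_forall_mem_sphere_norm_le hr ?_
    (fun w hw => (hf z hz w (Metric.sphere_subset_closedBall hw)).2)
  refine DifferentiableOn.diffContOnCl fun w hw => ?_
  rw [closure_ball _ hr.ne'] at hw; exact (hf z hz w hw).1.differentiableWithinAt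
lemma logDeriv_iter_bound {f : ℂ → ℂ} {s0 : ℂ} {r U l : ℝ} (hr : 0 < r) (hl : 0 < l) (hlU : l ≤ U)
    (hf : ∀ w ∈ Metric.closedBall s0 r, DifferentiableAt ℂ f w ∧ ‖f w‖ ≤ U) (h0 : l ≤ ‖f s0‖) (k : ℕ) :
    ‖iteratedDeriv k (logDeriv f) s0‖ ≤ k.factorial*(4*U / (r*l))^(k + 1) := by
  have hU : 0 < U := hl.trans_le hlU
  set ρ := l*r / (4*U) with hρ
  have hρ0 : 0 < ρ := by positivity
  have hρr : ρ ≤ r / 4 := by rw [hρ, div_le_iff₀ (by positivity)]; nlinarith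
  have hsub : ∀ z ∈ Metric.closedBall s0 (r/2), ∀ w ∈ Metric.closedBall z (r/2), DifferentiableAt ℂ f w ∧ ‖f w‖ ≤ U := by
    intro z hz w hw
    refine hf w ?_
    rw [Metric.mem_closedBall] at *
    linarith [dist_triangle w z s0]
  have hlow : ∀ z ∈ Metric.closedBall s0 ρ, l / 2 ≤ ‖f z‖ := by
    intro z hz
    have hz' : z ∈ Metric.closedBall s0 (r/2) := Metric.closedBall_subset_closedBall (by linarith) hz
    have h1 := lip_of_bound (convex_closedBall s0 (r/2)) (by linarith : 0 < r/2) hsub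
      hz' (Metric.mem_closedBall_self (by linarith))
    have h2 : ‖s0 - z‖ ≤ ρ := by rw [← dist_eq, dist_comm]; exact hz
    have h3 : U / (r/2) * ‖s0 - z‖ ≤ l / 2 := by
      calc U / (r/2) * ‖s0 - z‖ ≤ U / (r/2)*ρ := by gcongr
        _ = l / 2 := by rw [hρ]; field_simp; norm_num
    have h4 := norm_sub_norm_le (f s0) (f z)
    linarith
  have hder : ∀ z ∈ Metric.closedBall s0 ρ, ‖deriv f z‖ ≤ U / (r/2) := by
    intro z hz
    have hz' : z ∈ Metric.closedBall s0 (r/2) := Metric.closedBall_subset_closedBall (by linarith) hz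
    refine norm_deriv_le_of_forall_mem_sphere_norm_le (by linarith) ?_
      (fun w hw => (hsub z hz' w (Metric.sphere_subset_closedBall hw)).2)
    refine DifferentiableOn.diffContOnCl fun w hw => ?_
    rw [closure_ball _ (by linarith)] at hw; exact (hsub z hz' w hw).1.differentiableWithinAt
  have hC : ∀ z ∈ Metric.sphere s0 ρ, ‖logDeriv f z‖ ≤ 1 / ρ := by
    intro z hz
    have hz := Metric.sphere_subset_closedBall hz
    have h1 := hlow z hz
    rw [logDeriv_apply, norm_div, div_le_iff₀ (by linarith)]
    refine (hder z hz).trans ?_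
    calc U / (r/2) = 1 / ρ*(l / 2) := by rw [hρ]; field_simp; norm_num
      _ ≤ _ := by gcongr
  have hd : DiffContOnCl ℂ (logDeriv f) (Metric.ball s0 ρ) := by
    refine DifferentiableOn.diffContOnCl fun w hw => ?_
    rw [closure_ball _ hρ0.ne'] at hw
    have hdf : DifferentiableOn ℂ f (Metric.ball s0 r) := fun u hu => (hf u (Metric.ball_subset_closedBall hu)).1.differentiableWithinAt
    have hwr : w ∈ Metric.ball s0 r := Metric.closedBall_subset_ball (by linarith) hw
    have hnhds := Metric.isOpen_ball.mem_nhds hwr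
    have h1 : DifferentiableAt ℂ (deriv f) w := ((hdf.deriv Metric.isOpen_ball) w hwr).differentiableAt hnhds
    have h2 : f w ≠ 0 := by
      have := hlow w hw
      intro h; rw [h, norm_zero] at this; linarith
    exact (h1.div ((hdf w hwr).differentiableAt hnhds) h2).differentiableWithinAt
  have := norm_iteratedDeriv_le_of_forall_mem_sphere_norm_le k hρ0 hd hC
  refine this.trans (le_of_eq ?_)
  have : 4*U / (r*l) = 1 / ρ := by rw [hρ]; field_simp
  rw [this, pow_succ, one_div_pow]; field_simp
lemma low341 {f : ℂ → ℂ} {t U W : ℝ} (hU : 1 ≤ U) (hW : 1 ≤ W)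
    (hlip : ∀ x y : ℝ, 0 ≤ x → 0 ≤ y → ‖f (1 + x + I*t) - f (1 + y + I*t)‖ ≤ U * |x - y|)
    (h : ∀ x : ℝ, 0 < x → x ≤ 1 → x^3 / W ≤ ‖f (1 + x + I*t)‖ ^ 4) {x : ℝ} (hx : 0 ≤ x) (hx1 : x ≤ 1) :
    1 / (16*U^3*W) ≤ ‖f (1 + x + I*t)‖ := by
  set x0 := 1 / (16*U^4*W) with hx0
  have hx0p : 0 < x0 := by positivity
  have hU4 : 1 ≤ U^4 := one_le_pow₀ hU
  have hx01 : x0 ≤ 1 := by rw [hx0, div_le_one (by positivity)]; nlinarith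
  have key : ∀ x : ℝ, x0 ≤ x → x ≤ 1 → 2*(x0*U) ≤ ‖f (1 + x + I*t)‖ := by
    intro x h1 h2
    have h3 := h x (by linarith) h2
    have h4 : (2*(x0*U))^4 ≤ ‖f (1 + x + I*t)‖ ^ 4 := by
      refine le_trans ?_ h3
      calc (2*(x0*U))^4 = x0^3*(x0*(16*U^4)) := by ring
        _ = x0^3 / W := by rw [show x0*(16*U^4) = 1 / W by rw [hx0]; field_simp]; ring
        _ ≤ x^3 / W := by gcongr
    exact le_of_pow_le_pow_left₀ (by norm_num) (norm_nonneg _) h4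
  have e : 1 / (16*U^3*W) = x0*U := by rw [hx0]; field_simp
  rw [e]
  have hp : 0 < x0*U := by positivity
  rcases le_or_gt x0 x with h1 | h1
  · linarith [key x h1 hx1]
  · have h2 := key x0 le_rfl hx01
    have h3 := hlip x0 x hx0p.le hx
    have h4 : U * |x0 - x| ≤ x0*U := by rw [abs_of_pos (by linarith), mul_comm]; gcongr; linarith
    have h5 := norm_sub_norm_le (f (1 + x0 + I*t)) (f (1 + x + I*t))
    linarith
lemma Qc_le {q : ℕ} {t u : ℝ} (h : |u| ≤ 2 * |t| + 2) : Qc q u ≤ 2*Qc q t := by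
  unfold Qc
  have : (q:ℝ)*(|u| + 2) ≤ q*(2*(|t| + 2)) := by gcongr; linarith
  linarith
lemma two_rpow_le {η : ℝ} (hη2 : η ≤ 1/2) : (2:ℝ)^(2*η) ≤ 2 := by
  calc (2:ℝ)^(2*η) ≤ 2^(1:ℝ) := Real.rpow_le_rpow_of_exponent_le (by norm_num) (by linarith)
    _ = 2 := by norm_num
lemma Qc_rpow_le {q : ℕ} (hq : 1 ≤ q) {t u η : ℝ} (h : |u| ≤ 2 * |t| + 2) (hη : 0 < η) (hη2 : η ≤ 1/2) : Qc q u^(2*η) ≤ 2*Qc q t^(2*η) := by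
  have h0 := Qc_ge_two hq t
  have h1 := Qc_ge_two hq u
  calc Qc q u^(2*η) ≤ (2*Qc q t)^(2*η) := by
        have := Qc_le (q := q) h
        gcongr
    _ = 2^(2*η)*Qc q t^(2*η) := Real.mul_rpow (by norm_num) (by linarith)
    _ ≤ _ := by
      have := two_rpow_le hη2
      gcongr
end WG
end
section
open Complex MeasureTheory Filter Asymptotics
open DirichletCharacter (LFunction LFunctionTrivChar changeLevel)
namespace WG
lemma triv_le_zeta {q : ℕ} [NeZero q] {ε : ℝ} (hε : 0 < ε) {s : ℂ} (hs : 1 ≤ s.re) (hs1 : s ≠ 1) : ‖LFunctionTrivChar q s‖ ≤ (1 + 2 / ε)*(q:ℝ)^ε * ‖riemannZeta s‖ := by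
  rw [DirichletCharacter.LFunctionTrivChar_eq_mul_riemannZeta hs1, norm_mul]; gcongr
  have hq : 1 ≤ q := NeZero.one_le
  refine le_trans ?_ (card_primeFactors_le hq hε)
  have h1 := prod_one_sub_inv q.primeFactors (fun p hp => (Nat.prime_of_mem_primeFactors hp).two_le)
  have h2 : ‖∏ p ∈ q.primeFactors, (1 - (p:ℂ)^(-s))‖ ≤ ∏ p ∈ q.primeFactors, (1 - 1/(p:ℝ))⁻¹ := by
    rw [norm_prod]
    refine Finset.prod_le_prod (fun _ _ => norm_nonneg _) fun p hp => ?_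
    have hp2 : (2:ℝ) ≤ p := by exact_mod_cast (Nat.prime_of_mem_primeFactors hp).two_le
    have h3 : ‖(p:ℂ)^(-s)‖ ≤ 1 / (p:ℝ) := by
      rw [Complex.norm_natCast_cpow_of_pos (by exact_mod_cast (by linarith : (0:ℝ) < p)), neg_re, Real.rpow_neg (by linarith), one_div]
      gcongr
      calc (p:ℝ) = p^(1:ℝ) := by simp
        _ ≤ _ := Real.rpow_le_rpow_of_exponent_le (by linarith) hs
    have h4 : 1 / (p:ℝ) ≤ 1/2 := by gcongr
    calc ‖1 - (p:ℂ)^(-s)‖ ≤ 1 + 1 / (p:ℝ) := by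
          refine (norm_sub_le _ _).trans ?_; rw [norm_one]; linarith
      _ ≤ _ := by rw [← one_div, le_div_iff₀ (by linarith)]; nlinarith [sq_nonneg (1/(p:ℝ))]
  refine h2.trans ?_
  rw [Finset.prod_inv_distrib, inv_le_comm₀ _ (by positivity), ← one_div]
  · exact h1
  · exact lt_of_lt_of_le (by positivity) h1
lemma triv_bound {η : ℝ} (hη : 0 < η) (hη2 : η ≤ 1/2) : ∃ A : ℝ, 1 ≤ A ∧ ∀ (q : ℕ) [NeZero q] (s : ℂ) (t τ : ℝ),
    1 ≤ s.re → |s.im| ≤ 2 * |t| + 2 → 0 < τ → τ ≤ 1 → τ ≤ ‖s - 1‖ →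
    ‖LFunctionTrivChar q s‖ ≤ A*Qc q t^(3*η) / τ := by
  refine ⟨(1 + 2/η)*(8*(5 + 1/η)), ?_, ?_⟩
  · have : 0 < 1/η := by positivity
    have : 0 < 2/η := by positivity
    nlinarith
  intro q _ s t τ hs him hτ hτ1 hτs
  have hq : 1 ≤ q := NeZero.one_le
  have hs1 : s ≠ 1 := by rintro rfl; simp at hτs; linarith
  have h1 := zeta_bound hη hη2 (by linarith : 1 - η ≤ s.re) hs1
  have h2 := Qc_rpow_le (q := 1) le_rfl him hη hη2
  have hq' : (1:ℝ) ≤ q := by exact_mod_cast hq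
  have hQ1 : 0 < Qc 1 t := by linarith [Qc_ge_two (q := 1) le_rfl t]
  have h3 : Qc 1 t ≤ Qc q t := by unfold Qc; push_cast; gcongr
  have h4 : (q:ℝ) ≤ Qc q t := by unfold Qc; nlinarith [abs_nonneg t]
  have hQ : 0 < Qc q t := by linarith
  have h5 : 1 + 1/‖s-1‖ ≤ 2 / τ := by
    have : 1/‖s-1‖ ≤ 1/τ := by gcongr
    have h6 : 1 ≤ 1/τ := by rw [le_div_iff₀ hτ]; linarith
    calc _ ≤ 1/τ + 1/τ := by linarith
      _ = _ := by ring
  have e : Qc q t^(3*η) = Qc q t^η*Qc q t^(2*η) := by rw [← Real.rpow_add hQ]; ring_nf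
  calc ‖LFunctionTrivChar q s‖ ≤ (1 + 2 / η)*(q:ℝ)^η * ‖riemannZeta s‖ := triv_le_zeta hη hs hs1
    _ ≤ (1 + 2 / η)*(Qc q t)^η*(2*(5 + 1/η)*(2*Qc q t^(2*η))*(2 / τ)) := by
      gcongr
      refine h1.trans ?_
      gcongr; exact h2.trans (by gcongr)
    _ = _ := by rw [e]; ring
lemma gen_bound {η : ℝ} (hη : 0 < η) (hη2 : η ≤ 1/2) : ∃ A : ℝ, 1 ≤ A ∧ ∀ (q : ℕ) [NeZero q] (χ : DirichletCharacter ℂ q) (t : ℝ) (w : ℂ),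
    1 - η ≤ w.re → |w.im| ≤ 2 * |t| + 2 → (χ ≠ 1 ∨ (q = 1 ∧ 1 ≤ |w.im|)) →
    DifferentiableAt ℂ (LFunction χ) w ∧ ‖LFunction χ w‖ ≤ A*Qc q t^(2*η) := by
  refine ⟨8*(5 + 1/η), ?_, ?_⟩
  · have : 0 < 1/η := by positivity
    nlinarith
  intro q _ χ t w hw him h
  have hq : 1 ≤ q := NeZero.one_le
  have h2 := Qc_rpow_le (q := q) hq him hη hη2
  have hQ : 0 < Qc q t := by linarith [Qc_ge_two (q := q) hq t]
  rcases h with h | ⟨h, h'⟩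
  · refine ⟨(LF_diff h) w, (LFunction_bound h hη hη2 hw).trans ?_⟩
    calc 2*(5 + 1/η)*Qc q w.im^(2*η) ≤ 2*(5 + 1/η)*(2*Qc q t^(2*η)) := by gcongr
      _ ≤ _ := by
        have : 0 ≤ (5 + 1/η)*Qc q t^(2*η) := by positivity
        linarith
  · subst h
    have hw1 : w ≠ 1 := by rintro rfl; simp at h'; linarith
    refine ⟨DirichletCharacter.differentiableAt_LFunction χ w (Or.inl hw1), ?_⟩
    rw [DirichletCharacter.LFunction_modOne_eq]
    refine (zeta_bound hη hη2 hw hw1).trans ?_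
    have h5 : 1 + 1/‖w-1‖ ≤ 2 := by
      have h6 : 1 ≤ ‖w - 1‖ := by
        refine h'.trans ?_
        have := Complex.abs_im_le_norm (w - 1)
        simpa using this
      have : 1/‖w-1‖ ≤ 1 := by rw [div_le_one (by linarith)]; exact h6
      linarith
    calc _ ≤ 2*(5 + 1/η)*(2*Qc 1 t^(2*η))*2 := by gcongr
      _ = _ := by ring
lemma core341 {η : ℝ} (hη : 0 < η) (hη2 : η ≤ 1/2) : ∃ A : ℝ, 1 ≤ A ∧ ∀ (q : ℕ) [NeZero q] (χ : DirichletCharacter ℂ q) (t x τ : ℝ), 0 < x → x ≤ 1 → 0 < τ → τ ≤ 1 →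
    (χ^2 ≠ 1 ∨ τ ≤ |t| ∨ τ ≤ x) →
    x^3 / ((A*Qc q t^(3*η))^4 / τ) ≤ ‖LFunction χ (1 + x + I*t)‖ ^ 4 := by
  obtain ⟨A1, hA1, h1⟩ := triv_bound hη hη2
  obtain ⟨A2, hA2, h2⟩ := gen_bound hη hη2
  refine ⟨max A1 A2, hA1.trans (le_max_left _ _), ?_⟩
  intro q _ χ t x τ hx hx1 hτ hτ1 h
  have hq : 1 ≤ q := NeZero.one_le
  have hQ : 2 ≤ Qc q t := Qc_ge_two (q := q) hq t
  have hQ3 : 0 < Qc q t^(3*η) := by positivity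
  have hQ23 : Qc q t^(2*η) ≤ Qc q t^(3*η) := Real.rpow_le_rpow_of_exponent_le (by linarith) (by linarith)
  set V := max A1 A2*Qc q t^(3*η) with hV
  have hVp : 0 < V := by have := hA1.trans (le_max_left A1 A2); positivity
  have k1 : ‖LFunctionTrivChar q (1 + x)‖ ≤ V / x := by
    refine (h1 q (1 + x) t x ?_ ?_ hx hx1 ?_).trans ?_
    · simp [hx.le]
    · simp; positivity
    · simp [abs_of_pos hx]
    · rw [hV]; gcongr; exact le_max_left _ _
  have k2 : ‖LFunction (χ^2) (1 + x + 2*I*t)‖ ≤ V / τ := by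
    by_cases hc : χ^2 = 1
    · rw [hc]
      refine (h1 q (1 + x + 2*I*t) t τ ?_ ?_ hτ hτ1 ?_).trans ?_
      · simp [hx.le]
      · simp [abs_mul]
      · rcases h with h | h | h
        · exact absurd hc h
        · have := Complex.abs_im_le_norm (1 + x + 2*I*t - 1)
          simp [abs_mul] at this
          simp; linarith [abs_nonneg t]
        · have := Complex.abs_re_le_norm (1 + x + 2*I*t - 1)
          simp [abs_of_pos hx] at this
          simp; linarith [abs_nonneg t]
      · rw [hV]; gcongr; exact le_max_left _ _
    · refine (h2 q (χ^2) t (1 + x + 2*I*t) ?_ ?_ (Or.inl hc)).2.trans ?_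
      · simp; linarith
      · simp [abs_mul]
      · rw [le_div_iff₀ hτ]
        calc A2*Qc q t^(2*η)*τ ≤ max A1 A2*Qc q t^(3*η)*1 := by gcongr; exact le_max_right _ _
          _ = V := by rw [mul_one]
  have k3 := DirichletCharacter.norm_LFunction_product_ge_one χ hx t
  rw [norm_mul, norm_mul, norm_pow, norm_pow] at k3
  have k4 : 1 ≤ (V/x)^3 * ‖LFunction χ (1 + x + I*t)‖ ^ 4*(V/τ) := by
    refine k3.trans ?_
    gcongr
  rw [div_le_iff₀ (by positivity)]
  have e : (V/x)^3 * ‖LFunction χ (1 + x + I*t)‖ ^ 4*(V/τ) = ‖LFunction χ (1 + x + I*t)‖ ^ 4*(V^4/τ) / x^3 := by field_simp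
  rw [e, le_div_iff₀ (by positivity)] at k4; linarith
lemma gen_lip {η : ℝ} (hη : 0 < η) (hη2 : η ≤ 1/2) : ∃ A : ℝ, 1 ≤ A ∧ ∀ (q : ℕ) [NeZero q] (χ : DirichletCharacter ℂ q) (t a b : ℝ) (z w : ℂ), a ≤ b →
    |a| ≤ |t| + 1 → |b| ≤ |t| + 1 →
    (χ ≠ 1 ∨ (q = 1 ∧ (2 ≤ a ∨ b ≤ -2))) → 1 ≤ z.re → 1 ≤ w.re → z.im ∈ Set.Icc a b → w.im ∈ Set.Icc a b →
    ‖LFunction χ z - LFunction χ w‖ ≤ A*Qc q t^(2*η) * ‖z - w‖ := by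
  obtain ⟨A2, hA2, h2⟩ := gen_bound hη hη2
  refine ⟨A2 / η, ?_, ?_⟩
  · rw [le_div_iff₀ hη]; linarith
  intro q _ χ t a b z w hab ha hb h hz hw hzi hwi
  have := lip_of_bound (f := LFunction χ) (D := {z | 1 ≤ z.re} ∩ ({z | a ≤ z.im} ∩ {z | z.im ≤ b})) (r := η)
    (U := A2*Qc q t^(2*η)) ?_ hη ?_ (x := w) (y := z) ⟨hw, hwi.1, hwi.2⟩ ⟨hz, hzi.1, hzi.2⟩
  · refine this.trans (le_of_eq ?_); ring
  · exact (convex_halfSpace_re_ge 1).inter ((convex_halfSpace_im_ge a).inter (convex_halfSpace_im_le b))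
  · rintro u ⟨hu1, hu2, hu3⟩ v hv
    simp only [Set.mem_ofPred_eq] at hu1 hu2 hu3
    rw [Metric.mem_closedBall, Complex.dist_eq] at hv
    have r1 := abs_le.mp ((Complex.abs_re_le_norm (v - u)).trans hv)
    have r2 := abs_le.mp ((Complex.abs_im_le_norm (v - u)).trans hv)
    simp only [sub_re, sub_im] at r1 r2
    have ha' := abs_le.mp ha
    have hb' := abs_le.mp hb
    refine h2 q χ t v (by linarith) ?_ ?_
    · rw [abs_le]; constructor <;> linarith [abs_nonneg t]
    · rcases h with h | ⟨h0, h | h⟩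
      · exact Or.inl h
      · exact Or.inr ⟨h0, by rw [abs_of_nonneg] <;> linarith⟩
      · exact Or.inr ⟨h0, by rw [abs_of_nonpos] <;> linarith⟩
theorem L_lower {ε : ℝ} (hε : 0 < ε) : ∃ c : ℝ, 0 < c ∧
    ∀ (q : ℕ) [NeZero q] (χ : DirichletCharacter ℂ q) (s : ℂ), (χ ≠ 1 ∨ (q = 1 ∧ 2 ≤ |s.im|)) →
    1 ≤ s.re → s.re ≤ 2 → c*Qc q s.im^(-ε) ≤ ‖LFunction χ s‖ := by
  set η := min (ε/21) (1/2) with hη'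
  have hη : 0 < η := lt_min (by linarith) (by norm_num)
  have hη2 : η ≤ 1/2 := min_le_right _ _
  have hηε : 21*η ≤ ε := by have := min_le_left (ε/21) (1/2); linarith
  obtain ⟨A, hA, hcore⟩ := core341 hη hη2
  obtain ⟨A1, hA1, hlip⟩ := gen_lip hη hη2
  obtain ⟨c1, hc1, hsie⟩ := siegel hη
  set c2 := min 1 (c1 / (4*A1)) with hc2
  have hc2p : 0 < c2 := lt_min one_pos (by positivity)
  have hc21 : c2 ≤ 1 := min_le_left _ _
  have hc22 : c2*(4*A1) ≤ c1 := by
    have := min_le_right 1 (c1 / (4*A1)); rwa [← hc2, le_div_iff₀ (by positivity)] at this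
  refine ⟨min (c2 / (16*A1^3*A^4)) (c1/2), lt_min (by positivity) (by positivity), ?_⟩
  intro q _ χ s hχ hs hs2
  have hq : 1 ≤ q := NeZero.one_le
  set t := s.im with ht
  set x := s.re - 1 with hx
  have hse : s = 1 + x + I*t := by
    apply Complex.ext <;> simp [hx, ht]
  have hQ : 2 ≤ Qc q t := Qc_ge_two (q := q) hq t
  set Q := Qc q t with hQdef
  have hmono : ∀ {a b : ℝ}, a ≤ b → Q^a ≤ Q^b := fun h => Real.rpow_le_rpow_of_exponent_le (by linarith) h
  have hQ0 : 0 < Q := by linarith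
  have hP : ∀ a : ℝ, 0 < Q^a := fun a => by positivity
  have hge1 : ∀ a : ℝ, 0 ≤ a → 1 ≤ Q^a := fun a ha => Real.one_le_rpow (by linarith) ha
  set U := A1*Q^(2*η) with hU
  set V := A*Q^(3*η) with hV
  have hU1 : 1 ≤ U := one_le_mul_of_one_le_of_one_le hA1 (hge1 _ (by linarith))
  have hV1 : 1 ≤ V := one_le_mul_of_one_le_of_one_le hA (hge1 _ (by linarith))
  set τ := c2*Q^(-(3*η)) with hτ
  have hτ0 : 0 < τ := mul_pos hc2p (hP _)
  have hτ1 : τ ≤ 1 := by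
    have : Q^(-(3*η)) ≤ 1 := Real.rpow_le_one_of_one_le_of_nonpos (by linarith) (by linarith)
    exact mul_le_one₀ hc21 (hP _).le this
  have hexp : c2 / (16*A1^3*A^4)*Q^(-(21*η)) = τ / (16*U^3*V^4) := by
    have e1 : Q^(-(21*η)) = Q^(-(3*η))*(Q^(-(2*η)))^3*(Q^(-(3*η)))^4 := by
      simp only [← Real.rpow_natCast, ← Real.rpow_mul hQ0.le, ← Real.rpow_add hQ0]
      congr 1; push_cast; ring
    rw [e1, hτ, hU, hV, Real.rpow_neg hQ0.le (2*η), Real.rpow_neg hQ0.le (3*η)]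
    have := hP (2*η); have := hP (3*η)
    field_simp
  have hmain : min (c2 / (16*A1^3*A^4)) (c1/2)*Q^(-ε) ≤ τ / (16*U^3*V^4) := by
    rw [← hexp]; gcongr ?_ * ?_
    · exact min_le_left _ _
    · exact hmono (by linarith)
  have hx0 : 0 ≤ x := by linarith
  have hx1 : x ≤ 1 := by linarith
  by_cases hc : χ^2 ≠ 1 ∨ τ ≤ |t|
  · refine hmain.trans ?_
    rw [hse]
    have := low341 (f := LFunction χ) (t := t) (U := U) (W := V^4/τ) hU1 ?_ ?_ ?_ hx0 hx1
    · refine le_trans (le_of_eq ?_) this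
      field_simp
    · rw [le_div_iff₀ hτ0, one_mul]; exact hτ1.trans (one_le_pow₀ hV1)
    · intro x y hx hy
      have := hlip q χ t t t (1 + x + I*t) (1 + y + I*t) le_rfl (by linarith) (by linarith) ?_
        (by simp [hx]) (by simp [hy]) (by simp) (by simp)
      · refine this.trans (le_of_eq ?_)
        rw [show (1 + x + I*t - (1 + y + I*t) : ℂ) = ((x - y : ℝ) : ℂ) by push_cast; ring, Complex.norm_real, Real.norm_eq_abs]
      · rcases hχ with h | ⟨h, h'⟩
        · exact Or.inl h
        · refine Or.inr ⟨h, ?_⟩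
          rcases le_abs.mp h' with h | h
          · exact Or.inl h
          · right; linarith
    · intro x hx hx1; exact hcore q χ t x τ hx hx1 hτ0 hτ1 (by tauto)
  · push Not at hc
    obtain ⟨hc2, htτ⟩ := hc
    rcases le_or_gt τ x with hτx | hτx
    · refine hmain.trans ?_
      have h4 := hcore q χ t x τ (by linarith) hx1 hτ0 hτ1 (by tauto)
      rw [← hse] at h4
      have h5 : (τ/V)^4 ≤ ‖LFunction χ s‖^4 := by
        refine le_trans ?_ h4
        have : (τ/V)^4 = τ^3 / (V^4/τ) := by field_simp
        rw [this]; gcongr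
      have h6 := le_of_pow_le_pow_left₀ (by norm_num) (norm_nonneg _) h5
      refine le_trans ?_ h6
      gcongr
      have h7 : V ≤ V^4 := le_self_pow₀ hV1 (by norm_num)
      have h8 : 1 ≤ U^3 := one_le_pow₀ hU1
      nlinarith
    · have hχ1 : χ ≠ 1 := by
        rcases hχ with h | ⟨h, h'⟩
        · exact h
        · linarith
      have hs1 := hsie q χ hχ1 hc2
      have hl := hlip q χ t (-1) 1 1 s (by norm_num) (by norm_num) (by norm_num) (Or.inl hχ1) (by simp) hs (by simp)
        (by rw [Set.mem_Icc, ← abs_le]; linarith)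
      have h1s : ‖1 - s‖ ≤ 2*τ := by
        rw [hse]
        calc ‖1 - (1 + x + I*t)‖ = ‖-(x:ℂ) + -(I*t)‖ := by congr 1; ring
          _ ≤ ‖-(x:ℂ)‖ + ‖-(I*t)‖ := norm_add_le _ _
          _ = x + |t| := by simp [abs_of_nonneg hx0]
          _ ≤ _ := by linarith
      have h2 : U * ‖1 - s‖ ≤ c1 / 2*Q^(-η) := by
        calc U * ‖1 - s‖ ≤ U*(2*τ) := by gcongr
          _ = 2*A1*c2*(Q^(2*η)*Q^(-(3*η))) := by rw [hU, hτ]; ring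
          _ = (c2*(4*A1)) / 2*Q^(-η) := by rw [← Real.rpow_add hQ0]; ring_nf
          _ ≤ _ := by gcongr
      have h3 : c1*Q^(-η) ≤ ‖LFunction χ 1‖ := by
        refine le_trans ?_ hs1
        have : (1:ℝ) ≤ q := by exact_mod_cast hq
        rw [Real.rpow_neg hQ0.le, Real.rpow_neg (by linarith)]; gcongr
        rw [hQdef]; unfold Qc; nlinarith [abs_nonneg t]
      have h4 := norm_sub_norm_le (LFunction χ 1) (LFunction χ s)
      calc _ ≤ c1 / 2*Q^(-η) := by
            gcongr ?_ * ?_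
            · exact min_le_right _ _
            · exact hmono (by linarith)
        _ ≤ _ := by
          have : U * ‖1 - s‖ = A1*Q^(2*η) * ‖1 - s‖ := rfl
          linarith
lemma ball_re_im {u v : ℂ} {r : ℝ} (hv : v ∈ Metric.closedBall u r) :
    |v.re - u.re| ≤ r ∧ |v.im - u.im| ≤ r := by
  rw [Metric.mem_closedBall, Complex.dist_eq] at hv; exact ⟨(Complex.abs_re_le_norm (v - u)).trans hv, (Complex.abs_im_le_norm (v - u)).trans hv⟩
lemma gen_ball {η : ℝ} (hη2 : η ≤ 1/2) {q : ℕ} {χ : DirichletCharacter ℂ q} {s w : ℂ}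
    (h : χ ≠ 1 ∨ (q = 1 ∧ 2 ≤ |s.im|)) (hs : 1 ≤ s.re) (hw : w ∈ Metric.closedBall s η) :
    1 - η ≤ w.re ∧ |w.im| ≤ 2 * |s.im| + 2 ∧ (χ ≠ 1 ∨ (q = 1 ∧ 1 ≤ |w.im|)) := by
  obtain ⟨h1, h2⟩ := ball_re_im hw
  rw [abs_le] at h1
  have h3 := abs_sub_abs_le_abs_sub w.im s.im
  have h4 := abs_sub_abs_le_abs_sub s.im w.im
  rw [abs_sub_comm] at h4
  refine ⟨by linarith, by linarith [abs_nonneg s.im], ?_⟩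
  rcases h with h | ⟨h, h'⟩
  · exact Or.inl h
  · exact Or.inr ⟨h, by linarith⟩
theorem L_deriv (k : ℕ) {ε : ℝ} (hε : 0 < ε) : ∃ C : ℝ, 0 < C ∧
    ∀ (q : ℕ) [NeZero q] (χ : DirichletCharacter ℂ q) (s : ℂ), (χ ≠ 1 ∨ (q = 1 ∧ 2 ≤ |s.im|)) →
    1 ≤ s.re → s.re ≤ 2 → ‖iteratedDeriv k (logDeriv (LFunction χ)) s‖ ≤ C*Qc q s.im^ε := by
  set η := min (ε/(3*(k+1))) (1/2) with hη'
  have hη : 0 < η := lt_min (by positivity) (by norm_num)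
  have hη2 : η ≤ 1/2 := min_le_right _ _
  have hηε : 3*η*(k + 1) ≤ ε := by
    have := min_le_left (ε/(3*(k+1))) (1/2)
    rw [← hη', le_div_iff₀ (by positivity)] at this; linarith
  obtain ⟨A, hA, hb⟩ := gen_bound hη hη2
  obtain ⟨c0, hc0, hlow⟩ := L_lower hη
  set c := min c0 1 with hc
  have hcp : 0 < c := lt_min hc0 one_pos
  refine ⟨k.factorial*(4*A / (η*c))^(k+1), by positivity, ?_⟩
  intro q _ χ s h hs hs2
  have hq : 1 ≤ q := NeZero.one_le
  have hQ : 2 ≤ Qc q s.im := Qc_ge_two (q := q) hq _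
  set Q := Qc q s.im
  have hQ0 : 0 < Q := by linarith
  have h1 := logDeriv_iter_bound (f := LFunction χ) (s0 := s) (r := η) (U := A*Q^(2*η)) (l := c*Q^(-η))
    hη (by positivity) ?_ ?_ ?_ k
  · refine h1.trans ?_
    have e : 4*(A*Q^(2*η)) / (η*(c*Q^(-η))) = 4*A / (η*c)*Q^(3*η) := by
      rw [Real.rpow_neg hQ0.le, show 3*η = 2*η + η by ring, Real.rpow_add hQ0]
      have : 0 < Q^η := by positivity
      field_simp
    rw [e, mul_pow, ← mul_assoc, ← Real.rpow_natCast (Q^(3*η)), ← Real.rpow_mul hQ0.le]; gcongr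
    · linarith
    · push_cast; exact hηε
  · have h2 : Q^(-η) ≤ Q^(2*η) := Real.rpow_le_rpow_of_exponent_le (by linarith) (by linarith)
    have h3 : c ≤ 1 := min_le_right _ _
    gcongr; linarith
  · intro w hw
    obtain ⟨h1, h2, h3⟩ := gen_ball hη2 h hs hw
    exact hb q χ s.im w h1 h2 h3
  · refine le_trans ?_ (hlow q χ s h hs hs2)
    gcongr; exact min_le_left _ _
noncomputable def zG (s : ℂ) : ℂ := logDeriv riemannZeta s + riemannZeta s
noncomputable def zH (s : ℂ) : ℂ := logDeriv Z1 s + dslope Z1 1 s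
lemma zG_eq {s : ℂ} (hs : s ≠ 1) (hz : riemannZeta s ≠ 0) : zG s = zH s := by
  unfold zG zH
  have hs' := sub_ne_zero.mpr hs
  have e : Z1 =ᶠ[nhds s] fun z => (z - 1)*riemannZeta z := by
    filter_upwards [isOpen_ne.mem_nhds hs] with z hz using Z1_eq hz
  have h1 : logDeriv Z1 s = 1 / (s - 1) + logDeriv riemannZeta s := by
    rw [logDeriv_apply, e.deriv_eq, e.eq_of_nhds, ← logDeriv_apply (fun z => (z - 1)*riemannZeta z), logDeriv_mul s hs' hz (by fun_prop) (differentiableAt_riemannZeta hs)]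
    congr 1; simp [logDeriv_apply]
  rw [h1, dslope_of_ne _ hs, slope_def_field, Z1_one, Z1_eq hs]; field_simp; ring
lemma zH_analytic {s : ℂ} (hs : 1 ≤ s.re) : AnalyticAt ℂ zH s := by
  have hz : Z1 s ≠ 0 := by
    by_cases h : s = 1
    · rw [h, Z1_one]; exact one_ne_zero
    · rw [Z1_eq h]; exact mul_ne_zero (sub_ne_zero.mpr h) (riemannZeta_ne_zero_of_one_le_re hs)
  have h1 : AnalyticAt ℂ Z1 s := Z1_diff.analyticAt s
  have h2 : Differentiable ℂ (dslope Z1 1) := by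
    have := (Complex.differentiableOn_dslope (f := Z1) (s := Set.univ) (c := 1) Filter.univ_mem).2 Z1_diff.differentiableOn
    exact differentiableOn_univ.mp this
  exact (h1.deriv.div h1 hz).add (h2.analyticAt s)
theorem zeta_deriv (k : ℕ) {ε : ℝ} (hε : 0 < ε) : ∃ C : ℝ, 0 < C ∧
    ∀ s : ℂ, 1 < s.re → s.re ≤ 2 → ‖iteratedDeriv k zG s‖ ≤ C*(|s.im| + 2)^ε := by
  obtain ⟨C1, hC1, h1⟩ := L_deriv k hε
  set η := min (ε/2) (1/2) with hη'
  have hη : 0 < η := lt_min (by positivity) (by norm_num)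
  have hη2 : η ≤ 1/2 := min_le_right _ _
  have hηε : 2*η ≤ ε := by linarith [min_le_left (ε/2) (1/2)]
  obtain ⟨A, hA, hb⟩ := gen_bound hη hη2
  have hcomp : IsCompact (Set.Icc (1:ℝ) 2 ×ℂ Set.Icc (-2:ℝ) 2) := isCompact_Icc.reProdIm isCompact_Icc
  obtain ⟨C2, hC2⟩ := hcomp.exists_bound_of_continuousOn (f := iteratedDeriv k zH) (by
    intro s hs
    have : AnalyticAt ℂ (deriv^[k] zH) s := AnalyticAt.iterated_deriv (zH_analytic (s := s) hs.1.1) k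
    rw [← iteratedDeriv_eq_iterate] at this
    exact this.continuousAt.continuousWithinAt)
  have hfe : (LFunction (1 : DirichletCharacter ℂ 1)) = riemannZeta := DirichletCharacter.LFunction_modOne_eq
  refine ⟨C1 + k.factorial*A / η^k + |C2|, by positivity, fun s hs hs2 => ?_⟩
  have hs1 : s ≠ 1 := by rintro rfl; simp at hs
  have hζ := riemannZeta_ne_zero_of_one_le_re hs.le
  have hQ1 : 1 ≤ (|s.im| + 2)^ε := Real.one_le_rpow (by linarith [abs_nonneg s.im]) hε.le
  have hT : 0 < k.factorial*A / η^k := by positivity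
  rcases le_total |s.im| 2 with ht | ht
  · have e : zG =ᶠ[nhds s] zH := by
      have : ∀ᶠ z in nhds s, 1 < z.re := (isOpen_lt continuous_const continuous_re).mem_nhds hs
      filter_upwards [this] with z hz
      exact zG_eq (by rintro rfl; simp at hz) (riemannZeta_ne_zero_of_one_le_re hz.le)
    rw [e.iteratedDeriv_eq k]
    have := hC2 s ⟨⟨hs.le, hs2⟩, abs_le.mp ht⟩
    have := le_abs_self C2
    have := abs_nonneg C2
    nlinarith
  · have hz : AnalyticAt ℂ riemannZeta s := DifferentiableOn.analyticAt (s := {1}ᶜ)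
        (fun z hz => (differentiableAt_riemannZeta hz).differentiableWithinAt) (isOpen_compl_singleton.mem_nhds hs1)
    have e : iteratedDeriv k zG s = iteratedDeriv k (logDeriv riemannZeta) s + iteratedDeriv k riemannZeta s := by
      have : zG = logDeriv riemannZeta + riemannZeta := rfl
      rw [this]; exact iteratedDeriv_add ((hz.deriv.div hz hζ).contDiffAt) hz.contDiffAt
    have hQe : Qc 1 s.im = |s.im| + 2 := by unfold Qc; simp
    have k1 := h1 1 1 s (Or.inr ⟨rfl, ht⟩) hs.le hs2
    rw [hfe, hQe] at k1
    have hball : ∀ w ∈ Metric.closedBall s η, DifferentiableAt ℂ riemannZeta w ∧ ‖riemannZeta w‖ ≤ A*(|s.im| + 2)^(2*η) := by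
      intro w hw
      obtain ⟨h1, h2, h3⟩ := gen_ball (q := 1) (χ := 1) hη2 (Or.inr ⟨rfl, ht⟩) hs.le hw
      have := hb 1 1 s.im w h1 h2 h3
      rwa [hfe, hQe] at this
    have k2 := norm_iteratedDeriv_le_of_forall_mem_sphere_norm_le (f := riemannZeta) (c := s) k hη
      (C := A*(|s.im| + 2)^(2*η)) (by
        refine DifferentiableOn.diffContOnCl fun w hw => ?_
        rw [closure_ball _ hη.ne'] at hw
        exact (hball w hw).1.differentiableWithinAt)
      (fun w hw => (hball w (Metric.sphere_subset_closedBall hw)).2)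
    have k3 : (|s.im| + 2)^(2*η) ≤ (|s.im| + 2)^ε := Real.rpow_le_rpow_of_exponent_le (by linarith [abs_nonneg s.im]) hηε
    rw [e]
    calc _ ≤ C1*(|s.im| + 2)^ε + k.factorial*(A*(|s.im| + 2)^ε) / η^k := by
          refine (norm_add_le _ _).trans (add_le_add k1 (k2.trans ?_))
          gcongr
      _ = (C1 + k.factorial*A / η^k)*(|s.im| + 2)^ε := by ring
      _ ≤ _ := by
        refine mul_le_mul_of_nonneg_right ?_ (by linarith)
        linarith [abs_nonneg C2]
end WG
end
section
open Complex MeasureTheory Filter Asymptotics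
namespace WG
lemma swap_sum {α : Type*} [MeasurableSpace α] (μ : Measure α) [IsFiniteMeasure μ] {b : ℕ → ℂ}
    (hb : Summable fun n => ‖b n‖) (E : ℕ → α → ℂ) (hE : ∀ n, AEStronglyMeasurable (E n) μ)
    (hE1 : ∀ n x, ‖E n x‖ ≤ 1) :
    ∑' n, b n * ∫ x, E n x ∂μ = ∫ x, ∑' n, b n*E n x ∂μ := by
  have hi : ∀ n, Integrable (E n) μ := fun n => (integrable_const (1:ℝ)).mono' (hE n) (Eventually.of_forall (hE1 n))
  rw [← integral_tsum_of_summable_integral_norm (F := fun n x => b n*E n x)]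
  · simp_rw [integral_const_mul]
  · exact fun n => (hi n).const_mul _
  · refine Summable.of_nonneg_of_le (fun n => integral_nonneg fun _ => norm_nonneg _) (fun n => ?_)
      (hb.mul_right (μ.real Set.univ))
    calc ∫ x, ‖b n*E n x‖ ∂μ ≤ ∫ x, ‖b n‖ ∂μ := by
          refine integral_mono ((hi n).const_mul _).norm (integrable_const _) fun x => ?_
          simp only [norm_mul]
          exact mul_le_of_le_one_right (norm_nonneg _) (hE1 n x)
      _ = _ := by simp [mul_comm]
noncomputable def Kf (w : ℝ) : ℝ := ‖∫ t in (0:ℝ)..1, cexp (I*w*t)‖ ^ 2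
lemma norm_cexp_I (x : ℝ) : ‖cexp (I*x)‖ = 1 := by rw [mul_comm]; exact Complex.norm_exp_ofReal_mul_I x
lemma Kf_nonneg (w : ℝ) : 0 ≤ Kf w := by unfold Kf; positivity
lemma Kf_le_one (w : ℝ) : Kf w ≤ 1 := by
  unfold Kf
  have : ‖∫ t in (0:ℝ)..1, cexp (I*w*t)‖ ≤ 1 * |1 - 0| := by
    refine intervalIntegral.norm_integral_le_of_norm_le_const fun t _ => ?_
    have := norm_cexp_I (w*t)
    push_cast at this
    rw [mul_assoc, this]
  norm_num at this
  exact pow_le_one₀ (norm_nonneg _) this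
lemma Kf_decay (w : ℝ) : Kf w*(1 + w^2) ≤ 5 := by
  have h1 := Kf_le_one w
  have h2 : Kf w*w^2 ≤ 4 := by
    by_cases hw : w = 0
    · simp [hw]
    have hc : (I*w : ℂ) ≠ 0 := mul_ne_zero I_ne_zero (by exact_mod_cast hw)
    unfold Kf; rw [integral_exp_mul_complex hc, norm_div]
    have e : ‖(I*w : ℂ)‖ = |w| := by simp
    rw [e, ← sq_abs w, div_pow, div_mul_cancel₀ _ (by positivity)]
    have h3 : ‖cexp (I*w*(1:ℝ)) - cexp (I*w*(0:ℝ))‖ ≤ 2 := by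
      refine (norm_sub_le _ _).trans ?_
      have := norm_cexp_I w
      simp [this]; norm_num
    nlinarith [norm_nonneg (cexp (I*w*(1:ℝ)) - cexp (I*w*(0:ℝ)))]
  linarith
lemma Kf_cont : Continuous Kf := by
  unfold Kf
  refine (Continuous.norm ?_).pow 2
  refine intervalIntegral.continuous_parametric_intervalIntegral_of_continuous' (f := fun (w t : ℝ) => cexp (I*w*t)) ?_ 0 1
  fun_prop
lemma Kf_le (w : ℝ) : Kf w ≤ 5*(1 + ‖w‖^2)^(-(2:ℝ)/2) := by
  have := Kf_decay w
  rw [show (-(2:ℝ)/2) = -1 by norm_num, Real.rpow_neg_one, Real.norm_eq_abs, sq_abs, ← div_eq_mul_inv, le_div_iff₀ (by positivity)]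
  exact this
lemma Kf_int : Integrable Kf := by
  refine ((integrable_rpow_neg_one_add_norm_sq (E := ℝ) (r := 2) (by simp)).const_mul 5).mono'
    Kf_cont.aestronglyMeasurable (Eventually.of_forall fun w => ?_)
  rw [Real.norm_of_nonneg (Kf_nonneg w)]; exact Kf_le w
lemma Kf_int_sqrt : Integrable fun w => Kf w*Real.sqrt |w| := by
  refine ((integrable_rpow_neg_one_add_norm_sq (E := ℝ) (r := 3/2) (by simp; norm_num)).const_mul 5).mono'
    (by have := Kf_cont; fun_prop) (Eventually.of_forall fun w => ?_)
  rw [Real.norm_of_nonneg (mul_nonneg (Kf_nonneg w) (Real.sqrt_nonneg _))]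
  have h2 : Real.sqrt |w| ≤ (1 + ‖w‖^2)^((1:ℝ)/4) := by
    rw [Real.sqrt_eq_rpow]
    calc |w| ^ ((1:ℝ)/2) = (|w|^2)^((1:ℝ)/4) := by rw [← Real.rpow_natCast, ← Real.rpow_mul (abs_nonneg w)]; norm_num
      _ ≤ _ := by rw [Real.norm_eq_abs]; gcongr; linarith
  calc Kf w*Real.sqrt |w| ≤ 5*(1 + ‖w‖^2)^(-(2:ℝ)/2)*(1 + ‖w‖^2)^((1:ℝ)/4) := by gcongr; exact Kf_le w
    _ = _ := by rw [mul_assoc, ← Real.rpow_add (by positivity)]; norm_num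
lemma Kf_int_pos : 0 < ∫ w, Kf w := by
  refine integral_pos_of_integrable_nonneg_nonzero Kf_cont Kf_int (fun w => Kf_nonneg w) (x := 0) ?_
  simp [Kf]
noncomputable def mu1 : Measure ℝ := volume.restrict (Set.Ioc 0 1)
instance : IsProbabilityMeasure mu1 := ⟨by simp [mu1]⟩
lemma Kf_rep (w : ℝ) : (Kf w : ℂ) = ∫ x : ℝ × ℝ, cexp (I*(w*(x.1 - x.2) : ℝ)) ∂(mu1.prod mu1) := by
  have h : (Kf w : ℂ) = (∫ t, cexp (I*w*t) ∂mu1) * ∫ t, cexp (-(I*w*t)) ∂mu1 := by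
    have e2 : ∫ t, cexp (-(I*w*t)) ∂mu1 = (starRingEnd ℂ) (∫ t, cexp (I*w*t) ∂mu1) := by
      rw [← integral_conj]
      congr 1; ext t
      rw [← Complex.exp_conj]; simp
    rw [e2, Complex.mul_conj, Complex.normSq_eq_norm_sq]; unfold Kf mu1; rw [intervalIntegral.integral_of_le zero_le_one]
  rw [h, ← integral_prod_mul]
  congr 1; ext x
  rw [← Complex.exp_add]; push_cast; ring_nf
lemma sum_Kf {b : ℕ → ℂ} (hb : Summable fun n => ‖b n‖) (u : ℕ → ℝ) {lam D : ℝ} (hl : 0 < lam)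
    (hD : ∀ y : ℝ, |y| ≤ lam → ‖∑' n, b n*cexp (I*(y*u n : ℝ))‖ ≤ D) (v : ℝ) :
    ‖∑' n, b n*(Kf (lam*(u n - v)) : ℂ)‖ ≤ D := by
  simp_rw [Kf_rep]
  rw [swap_sum (mu1.prod mu1) hb (fun n x => cexp (I*(lam*(u n - v)*(x.1 - x.2) : ℝ)))
    (fun n => by
      refine Continuous.aestronglyMeasurable ?_
      fun_prop) (fun n x => (norm_cexp_I _).le)]
  have hbd : ∀ᵐ x ∂(mu1.prod mu1), ‖∑' n, b n*cexp (I*(lam*(u n - v)*(x.1 - x.2) : ℝ))‖ ≤ D := by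
    have hmem : ∀ᵐ x ∂(mu1.prod mu1), x ∈ Set.Ioc (0:ℝ) 1 ×ˢ Set.Ioc (0:ℝ) 1 := by
      unfold mu1; rw [Measure.prod_restrict]; exact ae_restrict_mem (measurableSet_Ioc.prod measurableSet_Ioc)
    filter_upwards [hmem] with x hx
    obtain ⟨⟨h1, h2⟩, h3, h4⟩ := hx
    have h5 : |x.1 - x.2| ≤ 1 := by rw [abs_le]; constructor <;> linarith
    have := hD (lam*(x.1 - x.2)) (by
      rw [abs_mul, abs_of_pos hl]; nlinarith)
    have e : ∑' n, b n*cexp (I*(lam*(u n - v)*(x.1 - x.2) : ℝ)) =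
        cexp (I*(-(lam*v*(x.1 - x.2)) : ℝ)) * ∑' n, b n*cexp (I*(lam*(x.1 - x.2)*u n : ℝ)) := by
      rw [← tsum_mul_left]
      congr 1; ext n; rw [mul_left_comm, ← Complex.exp_add]
      congr 2; push_cast; ring
    rw [e, norm_mul, norm_cexp_I, one_mul]; exact this
  have := norm_integral_le_of_norm_le_const hbd
  simpa using this
lemma smooth_core : ∃ C : ℝ, 0 < C ∧ ∀ (b : ℕ → ℂ) (u : ℕ → ℝ) (lam D L v0 : ℝ) (φ : ℝ → ℂ),
    (Summable fun n => ‖b n‖) → 0 < lam → (∀ y : ℝ, |y| ≤ lam → ‖∑' n, b n*cexp (I*(y*u n : ℝ))‖ ≤ D) →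
    0 < L → (∀ x, ‖φ x‖ ≤ 1) → (∀ x, x ∉ Set.Icc v0 (v0 + 1) → φ x = 0) →
    (∀ x y, ‖φ x - φ y‖ ≤ L * |x - y|) →
    ‖∑' n, b n*φ (u n)‖ ≤ C*(lam*D + (∑' n, ‖b n‖)*Real.sqrt (L / lam)) := by
  set c := ∫ w, Kf w with hc
  have hc0 : 0 < c := Kf_int_pos
  set c' := ∫ w, Kf w*Real.sqrt |w| with hc'
  have hc'0 : 0 ≤ c' := integral_nonneg fun w => mul_nonneg (Kf_nonneg w) (Real.sqrt_nonneg _)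
  refine ⟨1/c + 2*c'/c, by positivity, ?_⟩
  intro b u lam D L v0 φ hb hl hD hL hφ1 hφ0 hlip
  have hD0 : 0 ≤ D := (norm_nonneg _).trans (hD 0 (by simp [hl.le]))
  have hS0 : 0 ≤ ∑' n, ‖b n‖ := tsum_nonneg fun n => norm_nonneg _
  have hφc : Continuous φ := by
    have : LipschitzWith (Real.toNNReal L) φ := LipschitzWith.of_dist_le_mul fun x y => by rw [dist_eq_norm, Real.coe_toNNReal _ hL.le]; exact hlip x y
    exact this.continuous
  have hKc := Kf_cont
  set μ := (volume : Measure ℝ).restrict (Set.Icc v0 (v0 + 1)) with hμ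
  have hμr : μ.real Set.univ = 1 := by simp [hμ, Measure.real]
  -- smoothed function
  set Φ : ℝ → ℂ := fun x => ∫ v, φ v*(Kf (lam*(x - v)) : ℂ) ∂μ with hΦ
  have hΦe : ∀ x, (lam : ℂ)*Φ x = ∫ w, φ (x - w / lam)*(Kf w : ℂ) := by
    intro x
    have e1 : Φ x = ∫ v, φ v*(Kf (lam*(x - v)) : ℂ) := by
      rw [hΦ, hμ]
      refine setIntegral_eq_integral_of_forall_compl_eq_zero fun v hv => ?_
      rw [hφ0 v hv, zero_mul]
    have e2 : ∫ v, φ v*(Kf (lam*(x - v)) : ℂ) = ∫ w, φ (x - w)*(Kf (lam*w) : ℂ) := by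
      rw [← integral_sub_left_eq_self (fun v => φ v*(Kf (lam*(x - v)) : ℂ)) volume x]; simp
    have e3 := Measure.integral_comp_mul_left (fun w => φ (x - w / lam)*(Kf w : ℂ)) lam
    rw [e1, e2]
    have e4 : (∫ w, φ (x - w)*(Kf (lam*w) : ℂ)) = ∫ w, φ (x - lam*w / lam)*(Kf (lam*w) : ℂ) := by congr 1; ext w; rw [mul_div_cancel_left₀ _ hl.ne']
    rw [e4, e3, abs_of_pos (by positivity), Complex.real_smul, ← mul_assoc]; push_cast; rw [mul_inv_cancel₀ (by exact_mod_cast hl.ne'), one_mul]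
  have hint1 : ∀ x, Integrable fun w => φ (x - w / lam)*(Kf w : ℂ) := by
    intro x
    refine Kf_int.mono' (by fun_prop) (Eventually.of_forall fun w => ?_)
    rw [norm_mul, Complex.norm_real, Real.norm_of_nonneg (Kf_nonneg w)]; exact mul_le_of_le_one_left (Kf_nonneg w) (hφ1 _)
  have herr : ∀ x, ‖(lam : ℂ)*Φ x - c*φ x‖ ≤ 2*c' * Real.sqrt (L / lam) := by
    intro x
    have e : (c*φ x : ℂ) = ∫ w, φ x*(Kf w : ℂ) := by rw [integral_const_mul, integral_complex_ofReal, mul_comm]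
    have hKi : Integrable (fun w => (Kf w : ℂ)) := Kf_int.ofReal
    rw [hΦe, e, ← integral_sub (hint1 x) (hKi.const_mul _)]
    calc _ ≤ ∫ w, 2*Real.sqrt (L / lam)*(Kf w*Real.sqrt |w|) := by
          refine norm_integral_le_of_norm_le (Kf_int_sqrt.const_mul _) (Eventually.of_forall fun w => ?_)
          rw [← sub_mul, norm_mul, Complex.norm_real, Real.norm_of_nonneg (Kf_nonneg w)]
          have h1 : ‖φ (x - w / lam) - φ x‖ ≤ L / lam * |w| := by
            refine (hlip _ _).trans (le_of_eq ?_)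
            rw [show x - w / lam - x = -(w/lam) by ring, abs_neg, abs_div, abs_of_pos hl]; ring
          have h2 : ‖φ (x - w / lam) - φ x‖ ≤ 2 := by
            refine (norm_sub_le _ _).trans ?_
            linarith [hφ1 (x - w/lam), hφ1 x]
          have h3 : ‖φ (x - w / lam) - φ x‖ ≤ 2*(Real.sqrt (L / lam)*Real.sqrt |w|) := by
            rw [← Real.sqrt_mul (by positivity)]
            refine abs_le_of_sq_le_sq' ?_ (by positivity) |>.2
            rw [mul_pow, Real.sq_sqrt (by positivity)]; nlinarith [norm_nonneg (φ (x - w / lam) - φ x)]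
          calc _ ≤ 2*(Real.sqrt (L / lam)*Real.sqrt |w|)*Kf w := by gcongr; exact Kf_nonneg w
            _ = _ := by ring
      _ = _ := by rw [integral_const_mul]; ring
  have hΦb : ∀ x, ‖Φ x‖ ≤ 1 := by
    intro x
    have : ∀ᵐ v ∂μ, ‖φ v*(Kf (lam*(x - v)) : ℂ)‖ ≤ 1 := Eventually.of_forall fun v => by
      rw [norm_mul, Complex.norm_real, Real.norm_of_nonneg (Kf_nonneg _)]; exact mul_le_one₀ (hφ1 v) (Kf_nonneg _) (Kf_le_one _)
    simpa [hμr] using norm_integral_le_of_norm_le_const this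
  have hmain : ‖∑' n, b n*Φ (u n)‖ ≤ D := by
    rw [hΦ, swap_sum μ hb (fun n v => φ v*(Kf (lam*(u n - v)) : ℂ)) (fun n => by
      refine Continuous.aestronglyMeasurable ?_; fun_prop) (fun n v => by
      rw [norm_mul, Complex.norm_real, Real.norm_of_nonneg (Kf_nonneg _)]
      exact mul_le_one₀ (hφ1 v) (Kf_nonneg _) (Kf_le_one _))]
    have : ∀ᵐ v ∂μ, ‖∑' n, b n*(φ v*(Kf (lam*(u n - v)) : ℂ))‖ ≤ D := Eventually.of_forall fun v => by
      simp_rw [mul_left_comm (b _) (φ v)]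
      rw [tsum_mul_left, norm_mul]; exact (mul_le_of_le_one_left (norm_nonneg _) (hφ1 v)).trans (sum_Kf hb u hl hD v)
    simpa [hμr] using norm_integral_le_of_norm_le_const this
  have hs1 : Summable fun n => b n*Φ (u n) := Summable.of_norm_bounded hb fun n => by rw [norm_mul]; exact mul_le_of_le_one_right (norm_nonneg _) (hΦb _)
  have hs2 : Summable fun n => b n*φ (u n) := Summable.of_norm_bounded hb fun n => by rw [norm_mul]; exact mul_le_of_le_one_right (norm_nonneg _) (hφ1 _)
  have e : (c:ℂ) * ∑' n, b n*φ (u n) = lam * ∑' n, b n*Φ (u n) - ∑' n, b n*(lam*Φ (u n) - c*φ (u n)) := by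
    rw [← tsum_mul_left, ← tsum_mul_left, ← (hs1.mul_left _).tsum_sub]
    · congr 1; ext n; ring
    · refine ((hs1.mul_left (lam:ℂ)).sub (hs2.mul_left (c:ℂ))).congr fun n => ?_
      ring
  have herrs : ‖∑' n, b n*(lam*Φ (u n) - c*φ (u n))‖ ≤ (∑' n, ‖b n‖)*(2*c' * Real.sqrt (L / lam)) := by
    rw [← tsum_mul_right]
    refine tsum_of_norm_bounded (hb.mul_right _).hasSum fun n => ?_
    rw [norm_mul]; gcongr; exact herr _
  have hfin : c * ‖∑' n, b n*φ (u n)‖ ≤ lam*D + (∑' n, ‖b n‖)*(2*c' * Real.sqrt (L / lam)) := by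
    calc c * ‖∑' n, b n*φ (u n)‖ = ‖(c:ℂ) * ∑' n, b n*φ (u n)‖ := by rw [norm_mul, Complex.norm_real, Real.norm_of_nonneg hc0.le]
      _ ≤ _ := by
        rw [e]
        refine (norm_sub_le _ _).trans (add_le_add ?_ herrs)
        rw [norm_mul, Complex.norm_real, Real.norm_of_nonneg hl.le]; gcongr
  rw [mul_comm, ← le_div_iff₀ hc0] at hfin
  refine hfin.trans ?_
  have h1 : 0 ≤ lam*D := by positivity
  have h2 : 0 ≤ (∑' n, ‖b n‖)*Real.sqrt (L / lam) := by positivity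
  have : (lam*D + (∑' n, ‖b n‖)*(2*c' * Real.sqrt (L / lam))) / c = 1/c*(lam*D) + 2*c'/c*((∑' n, ‖b n‖)*Real.sqrt (L / lam)) := by field_simp
  rw [this]
  have h3 : 0 ≤ 1/c := by positivity
  have h4 : 0 ≤ 2*c'/c := by positivity
  nlinarith [mul_nonneg h3 h2, mul_nonneg h4 h1]
lemma logMul_iter (a : ℕ → ℂ) (k n : ℕ) : (LSeries.logMul^[k] a) n = (Complex.log n)^k*a n := by
  induction k with
  | zero => simp
  | succ k ih => rw [Function.iterate_succ_apply', LSeries.logMul, ih]; ring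
lemma log_pow_le (k : ℕ) {δ x : ℝ} (hδ : 0 < δ) (hx : 1 ≤ x) : Real.log x^k ≤ k.factorial*(4/δ)^k*x^(δ/4) := by
  have h0 : 0 < x := by linarith
  have h1 : (δ/4*Real.log x)^k / k.factorial ≤ Real.exp (δ/4*Real.log x) := Real.pow_div_factorial_le_exp _ (by have := Real.log_nonneg hx; positivity) k
  rw [Real.rpow_def_of_pos h0, mul_comm (Real.log x) (δ/4)]; rw [div_le_iff₀ (by positivity), mul_pow] at h1
  calc Real.log x^k = (4/δ)^k*((δ/4)^k*Real.log x^k) := by rw [← mul_assoc, ← mul_pow]; field_simp; simp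
    _ ≤ (4/δ)^k*(Real.exp (δ/4*Real.log x)*k.factorial) := by gcongr
    _ = _ := by ring
lemma tsum_rpow_bound {δ : ℝ} (hδ : 0 < δ) : (Summable fun n : ℕ => (n:ℝ)^(-(1 + δ))) ∧ ∑' n : ℕ, (n:ℝ)^(-(1 + δ)) ≤ 1 + 1/δ := by
  have hs : Summable fun n : ℕ => (n:ℝ)^(-(1 + δ)) := Real.summable_nat_rpow.mpr (by linarith)
  refine ⟨hs, ?_⟩
  refine hs.tsum_le_of_sum_range_le fun N => ?_
  have h1 : ∀ N : ℕ, ∑ n ∈ Finset.range (N+1), (n:ℝ)^(-(1 + δ)) ≤ 1 + 1/δ - (1/δ)*(max N 1 : ℕ)^(-δ) := by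
    intro N
    induction N with
    | zero =>
      simp [Real.zero_rpow (by linarith : -(1+δ) ≠ 0)]
      rw [Real.zero_rpow (by linarith : -δ + -1 ≠ 0)]; norm_num
    | succ N ih =>
      rw [Finset.sum_range_succ]
      rcases Nat.eq_zero_or_pos N with rfl | hN
      · simp [Finset.sum_range_succ]
        rw [Real.zero_rpow (by linarith : -δ + -1 ≠ 0)]
      · rw [max_eq_left (by omega : 1 ≤ N)] at ih; rw [max_eq_left (by omega : 1 ≤ N+1)]
        have hN' : (0:ℝ) < N := by exact_mod_cast hN
        suffices h : ((N+1 : ℕ):ℝ)^(-(1+δ)) ≤ 1/δ*((N:ℝ)^(-δ) - ((N+1:ℕ):ℝ)^(-δ)) by linarith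
        have hx : (0:ℝ) < ((N+1:ℕ):ℝ) := by positivity
        have key : 1 + δ*(1/((N+1:ℕ):ℝ)) ≤ ((N:ℝ) / (N+1:ℕ))^(-δ) := by
          have e : ((N:ℝ) / (N+1:ℕ)) = 1 + -(1/((N+1:ℕ):ℝ)) := by push_cast; field_simp; ring
          rw [e]
          have h1 : (1/((N+1:ℕ):ℝ)) < 1 := by rw [div_lt_one hx]; push_cast; linarith
          have h2 := Real.add_one_le_exp (-δ*Real.log (1 + -(1/((N+1:ℕ):ℝ))))
          rw [Real.rpow_def_of_pos (by linarith), mul_comm (Real.log _) (-δ)]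
          have h3 := Real.log_le_sub_one_of_pos (x := 1 + -(1/((N+1:ℕ):ℝ))) (by linarith)
          nlinarith
        rw [Real.div_rpow hN'.le hx.le, le_div_iff₀ (by positivity)] at key
        have e2 : ((N+1 : ℕ):ℝ)^(-(1+δ)) = ((N+1:ℕ):ℝ)^(-δ)*(1/((N+1:ℕ):ℝ)) := by rw [show -(1+δ) = -δ + -1 by ring, Real.rpow_add hx, Real.rpow_neg_one, one_div]
        rw [e2, one_div δ, ← div_eq_inv_mul, le_div_iff₀ hδ]; linarith
  rcases N with _ | N
  · simp; positivity
  · refine (h1 N).trans ?_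
    have : 0 ≤ (1/δ)*((max N 1 : ℕ):ℝ)^(-δ) := by positivity
    linarith
lemma S_bound (k : ℕ) : ∃ C : ℝ, 0 < C ∧ ∀ (a : ℕ → ℂ) (δ : ℝ), 0 < δ → δ ≤ 1 → (∀ n, ‖a n‖ ≤ 1 + Real.log n) →
    (Summable fun n => ‖LSeries.term (LSeries.logMul^[k] a) ((1 + δ : ℝ) : ℂ) n‖) ∧
    ∑' n, ‖LSeries.term (LSeries.logMul^[k] a) ((1 + δ : ℝ) : ℂ) n‖ ≤ C*(1/δ)^(k+2) := by
  refine ⟨k.factorial*4^k*5*3, by positivity, fun a δ hδ hδ1 ha => ?_⟩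
  have hδ1' : 1 ≤ 1/δ := by rw [le_div_iff₀ hδ]; linarith
  have hb : ∀ n : ℕ, ‖LSeries.term (LSeries.logMul^[k] a) ((1 + δ : ℝ) : ℂ) n‖ ≤ (k.factorial*(4/δ)^k*(5/δ))*(n:ℝ)^(-(1 + δ/2)) := by
    intro n
    rcases Nat.eq_zero_or_pos n with rfl | hn
    · simp; positivity
    have hn1 : (1:ℝ) ≤ n := by exact_mod_cast hn
    have hn0 : (0:ℝ) < n := by linarith
    rw [LSeries.norm_term_eq, if_neg hn.ne', logMul_iter, norm_mul, norm_pow, ← Complex.natCast_log, Complex.norm_real,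
      Real.norm_of_nonneg (Real.log_nonneg hn1), Complex.ofReal_re]
    have h1 := log_pow_le k hδ hn1
    have h2 : 1 + Real.log n ≤ 5/δ*(n:ℝ)^(δ/4) := by
      have := log_pow_le 1 hδ hn1
      have h3 : 1 ≤ (n:ℝ)^(δ/4) := Real.one_le_rpow hn1 (by positivity)
      simp at this
      rw [div_eq_mul_one_div] at this ⊢
      nlinarith
    have e : (n:ℝ)^(-(1 + δ/2)) = (n:ℝ)^(δ/4)*(n:ℝ)^(δ/4) / (n:ℝ)^(1+δ) := by rw [← Real.rpow_add hn0, ← Real.rpow_sub hn0]; ring_nf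
    rw [e]
    calc Real.log n^k * ‖a n‖ / (n:ℝ)^(1+δ) ≤ (k.factorial*(4/δ)^k*(n:ℝ)^(δ/4))*(5/δ*(n:ℝ)^(δ/4)) / (n:ℝ)^(1+δ) := by
          have := Real.log_nonneg hn1
          gcongr; exact (ha n).trans h2
      _ = _ := by ring
  obtain ⟨hs, hs'⟩ := tsum_rpow_bound (δ := δ/2) (by linarith)
  have hsum := Summable.of_nonneg_of_le (fun n => norm_nonneg _) hb (hs.mul_left _)
  refine ⟨hsum, (hsum.tsum_le_tsum hb (hs.mul_left _)).trans ?_⟩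
  rw [tsum_mul_left]
  calc _ ≤ (k.factorial*(4/δ)^k*(5/δ))*(3*(1/δ)) := by
        gcongr
        refine hs'.trans ?_
        have : 1 / (δ/2) = 2*(1/δ) := by field_simp
        linarith
    _ = _ := by rw [div_pow, pow_add, div_pow]; field_simp; simp
noncomputable def clampR (a b x : ℝ) : ℝ := max a (min x b)
lemma clampR_mem {a b : ℝ} (h : a ≤ b) (x : ℝ) : clampR a b x ∈ Set.Icc a b := ⟨le_max_left _ _, max_le h (min_le_right _ _)⟩
lemma clampR_of_mem {a b x : ℝ} (hx : x ∈ Set.Icc a b) : clampR a b x = x := by unfold clampR; rw [min_eq_left hx.2, max_eq_right hx.1]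
lemma clampR_of_not_mem {a b x : ℝ} (h : a ≤ b) (hx : x ∉ Set.Icc a b) : clampR a b x = a ∨ clampR a b x = b := by
  unfold clampR
  by_cases h1 : a ≤ x
  · right
    have : b ≤ x := by by_contra h2; exact hx ⟨h1, by linarith⟩
    rw [min_eq_right this, max_eq_right h]
  · left
    rw [min_eq_left (by linarith), max_eq_left (by linarith)]
lemma clampR_lip (a b x y : ℝ) : |clampR a b x - clampR a b y| ≤ |x - y| := by
  unfold clampR
  refine (abs_max_sub_max_le_max a (min x b) a (min y b)).trans ?_
  rw [sub_self, abs_zero, max_eq_right (abs_nonneg _)]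
  refine (abs_min_sub_min_le_max x b y b).trans ?_
  simp
lemma psi_lip (k : ℕ) {σ v0 v1 N : ℝ} (hσ0 : 0 ≤ σ) (hσ : σ ≤ 2) (hv0 : 1 ≤ v0)
    (hN : ∀ v ∈ Set.Icc v0 v1, Real.exp (σ*v) / v^k ≤ N) {x y : ℝ} (hx : x ∈ Set.Icc v0 v1) (hy : y ∈ Set.Icc v0 v1) :
    |Real.exp (σ*y) / y^k - Real.exp (σ*x) / x^k| ≤ N*(k + 2) * |y - x| := by
  have hd : ∀ v ∈ Set.Icc v0 v1, HasDerivAt (fun v => Real.exp (σ*v) / v^k)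
      ((Real.exp (σ*v)*σ*v^k - Real.exp (σ*v)*(k*v^(k-1))) / (v^k)^2) v := by
    intro v hv
    have hvp : 0 < v := by linarith [hv.1]
    have h1 : HasDerivAt (fun v => Real.exp (σ*v)) (Real.exp (σ*v)*σ) v := by simpa using ((hasDerivAt_id v).const_mul σ).exp
    exact h1.div (hasDerivAt_pow k v) (by positivity)
  have := (convex_Icc v0 v1).norm_image_sub_le_of_norm_hasDerivWithin_le
    (f := fun v => Real.exp (σ*v) / v^k) (C := N*(k+2)) (fun v hv => (hd v hv).hasDerivWithinAt) (fun v hv => ?_) hx hy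
  · exact this
  · have hv1 : 1 ≤ v := hv0.trans hv.1
    have hvp : 0 < v := by linarith
    have e : (Real.exp (σ*v)*σ*v^k - Real.exp (σ*v)*(k*v^(k-1))) / (v^k)^2 = Real.exp (σ*v) / v^k*(σ - k / v) := by
      rcases k with _ | k
      · simp
      · simp only [Nat.add_sub_cancel]; field_simp; ring
    rw [e, Real.norm_eq_abs, abs_mul, abs_of_pos (by positivity)]
    have h2 : |σ - k / v| ≤ k + 2 := by
      have h3 : (k:ℝ) / v ≤ k := div_le_self (by positivity) hv1
      have h4 : 0 ≤ (k:ℝ) / v := by positivity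
      rw [abs_le]; constructor <;> linarith
    have := hN v hv
    have h0 : 0 ≤ Real.exp (σ*v) / v^k := by positivity
    gcongr; exact h0.trans this
def Adm (X M : ℝ) (g : ℝ → ℂ) : Prop := (∀ x, ‖g x‖ ≤ 1) ∧ (∀ x, x ≤ X ∨ 2*X ≤ x → g x = 0) ∧ ∀ x y, ‖g x - g y‖ ≤ M / X * |x - y|
lemma one_lt_log {X : ℝ} (hX : 3 ≤ X) : 1 < Real.log X := by rw [Real.lt_log_iff_exp_lt (by linarith)]; linarith [Real.exp_one_lt_d9]
lemma absc_le {a : ℕ → ℂ} (ha : ∀ n, ‖a n‖ ≤ 1 + Real.log n) : LSeries.abscissaOfAbsConv a ≤ (1:ℝ) := by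
  obtain ⟨C, -, h⟩ := S_bound 0
  refine LSeries.abscissaOfAbsConv_le_of_forall_lt_LSeriesSummable fun y hy => ?_
  have h1 := (h a (min (y-1) 1) (lt_min (by linarith) one_pos) (min_le_right _ _) ha).1
  simp only [Function.iterate_zero, id] at h1
  have h2 : LSeriesSummable a ((1 + min (y-1) 1 : ℝ) : ℂ) := h1.of_norm
  refine h2.of_re_le_re ?_
  simp only [ofReal_re]
  linarith [min_le_left (y-1) 1]
lemma tsum_term_eq (a : ℕ → ℂ) (σ y : ℝ) : ∑' n, LSeries.term a (σ:ℂ) n*cexp (I*(y*Real.log n : ℝ)) = LSeries a (σ - I*y) := by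
  unfold LSeries
  refine tsum_congr fun n => ?_
  rcases Nat.eq_zero_or_pos n with rfl | hn
  · simp
  have hn' : (n:ℂ) ≠ 0 := by exact_mod_cast hn.ne'
  rw [LSeries.term_of_ne_zero hn.ne', LSeries.term_of_ne_zero hn.ne', Complex.cpow_sub _ _ hn', show I*((y*Real.log n : ℝ):ℂ) = Complex.log n*(I*y) by
      push_cast; ring, ← Complex.cpow_def_of_ne_zero hn']
  have h2 : (n:ℂ)^(I*(y:ℂ)) ≠ 0 := by simp [Complex.cpow_eq_zero_iff, hn']
  field_simp
lemma main_bound (k : ℕ) : ∃ C : ℝ, 0 < C ∧ ∀ (a : ℕ → ℂ) (lam D X M : ℝ) (g : ℝ → ℂ), (∀ n, ‖a n‖ ≤ 1 + Real.log n) → 3 ≤ X → 0 < lam → 1 ≤ M →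
    (∀ y : ℝ, |y| ≤ lam → ‖iteratedDeriv k (LSeries a) (((1 + 1 / Real.log X : ℝ):ℂ) + I*y)‖ ≤ D) →
    Adm X M g →
    ‖∑' n : ℕ, a n*g n‖ ≤ C*X*(Real.log X)⁻¹^k*(lam*D + Real.log X^(k+2)*Real.sqrt (M / lam)) := by
  obtain ⟨C0, hC0, hcore⟩ := smooth_core
  obtain ⟨C1, hC1, hS⟩ := S_bound k
  refine ⟨12*C0*(1 + C1*Real.sqrt (k+4)), by positivity, ?_⟩
  intro a lam D X M g ha hX hlam hM hD ⟨hg1, hg0, hgl⟩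
  have hlX := one_lt_log hX
  set v0 := Real.log X with hv0
  set v1 := Real.log (2*X) with hv1
  have hX0 : 0 < X := by linarith
  have hv01 : v1 = v0 + Real.log 2 := by rw [hv1, Real.log_mul (by norm_num) hX0.ne']; ring
  have hl2 : 0 < Real.log 2 := Real.log_pos (by norm_num)
  have hl2' : Real.log 2 ≤ 1 := by linarith [Real.log_two_lt_d9]
  have hvle : v0 ≤ v1 := by linarith
  set δ := 1 / v0 with hδ
  have hδ0 : 0 < δ := by positivity
  have hδ1 : δ ≤ 1 := by rw [hδ, div_le_one (by linarith)]; exact hlX.le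
  set σ := 1 + δ with hσ
  set N := Real.exp (σ*v1) / v0^k with hN
  have hN0 : 0 < N := by positivity
  have hD0 : 0 ≤ D := (norm_nonneg _).trans (hD 0 (by simpa using hlam.le))
  have hψN : ∀ v ∈ Set.Icc v0 v1, Real.exp (σ*v) / v^k ≤ N := by
    intro v hv
    rw [hN]; gcongr
    · exact hv.2
    · exact hv.1
  have hNle : N ≤ 12*X*v0⁻¹^k := by
    rw [hN, inv_pow, ← div_eq_mul_inv]; gcongr
    have : σ*v1 = (Real.log X + Real.log 2) + 1 + δ*Real.log 2 := by rw [← hv0, hσ, hv01, hδ]; field_simp; ring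
    rw [this, Real.exp_add, Real.exp_add, Real.exp_add, Real.exp_log hX0, Real.exp_log (by norm_num)]
    have e1 := Real.exp_one_lt_d9
    have e2 : Real.exp (δ*Real.log 2) ≤ 2 := by
      calc _ ≤ Real.exp (Real.log 2) := Real.exp_le_exp.mpr (by nlinarith)
        _ = 2 := Real.exp_log (by norm_num)
    calc X*2*Real.exp 1*Real.exp (δ*Real.log 2) ≤ X*2*3*2 := by gcongr; linarith
      _ = _ := by ring
  set h : ℝ → ℂ := fun v => ((Real.exp (σ*v) / v^k / N : ℝ):ℂ)*g (Real.exp v) with hh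
  have hgL : ∀ x ∈ Set.Icc v0 v1, ∀ y ∈ Set.Icc v0 v1, ‖g (Real.exp x) - g (Real.exp y)‖ ≤ 2*M * |x - y| := by
    intro x hx y hy
    refine (hgl _ _).trans ?_
    have hex : |Real.exp x - Real.exp y| ≤ 2*X * |x - y| := by
      have := (convex_Icc v0 v1).norm_image_sub_le_of_norm_hasDerivWithin_le
        (f := Real.exp) (C := 2*X) (fun v hv => (Real.hasDerivAt_exp v).hasDerivWithinAt) (fun v hv => ?_) hy hx
      · exact this
      · rw [Real.norm_eq_abs, abs_of_pos (Real.exp_pos _)]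
        calc _ ≤ Real.exp v1 := Real.exp_le_exp.mpr hv.2
          _ = _ := Real.exp_log (by positivity)
    calc M / X * |Real.exp x - Real.exp y| ≤ M / X*(2*X * |x - y|) := by gcongr
      _ = _ := by field_simp
  have hψ1 : ∀ v ∈ Set.Icc v0 v1, ‖((Real.exp (σ*v) / v^k / N : ℝ):ℂ)‖ ≤ 1 := by
    intro v hv
    have hv' : 0 < v := by linarith [hv.1]
    rw [Complex.norm_real, Real.norm_of_nonneg (by positivity), div_le_one hN0]; exact hψN v hv
  have hhl : ∀ x ∈ Set.Icc v0 v1, ∀ y ∈ Set.Icc v0 v1, ‖h x - h y‖ ≤ (k + 4)*M * |x - y| := by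
    intro x hx y hy
    have e : h x - h y = ((Real.exp (σ*x) / x^k / N : ℝ):ℂ)*(g (Real.exp x) - g (Real.exp y)) +
      (((Real.exp (σ*x) / x^k / N : ℝ):ℂ) - ((Real.exp (σ*y) / y^k / N : ℝ):ℂ))*g (Real.exp y) := by rw [hh]; ring
    rw [e]
    refine (norm_add_le _ _).trans ?_
    rw [norm_mul, norm_mul]
    have h1 : ‖((Real.exp (σ*x) / x^k / N : ℝ):ℂ) - ((Real.exp (σ*y) / y^k / N : ℝ):ℂ)‖ ≤ (k+2) * |x - y| := by
      rw [← Complex.ofReal_sub, Complex.norm_real, ← sub_div, Real.norm_eq_abs, abs_div, abs_of_pos hN0, div_le_iff₀ hN0]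
      refine (psi_lip k (by positivity) (by linarith) hlX.le hψN hy hx).trans (le_of_eq (by ring))
    calc _ ≤ 1*(2*M * |x - y|) + ((k+2) * |x - y|)*1 := by
          gcongr
          · exact hψ1 x hx
          · exact hgL x hx y hy
          · exact hg1 _
      _ ≤ _ := by
          have : (k+2 : ℝ) * |x - y| * 1 ≤ (k+2) * |x-y| * M := by gcongr
          linarith
  set φ : ℝ → ℂ := fun v => h (clampR v0 v1 v) with hφ
  have hhe : h v0 = 0 ∧ h v1 = 0 := by
    constructor
    · simp only [hh, hv0, Real.exp_log hX0, hg0 X (Or.inl le_rfl), mul_zero]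
    · simp only [hh, hv1, Real.exp_log (show (0:ℝ) < 2*X by positivity), hg0 (2*X) (Or.inr le_rfl), mul_zero]
  have hφout : ∀ x, x ∉ Set.Icc v0 v1 → φ x = 0 := by
    intro x hx
    rcases clampR_of_not_mem hvle hx with h1 | h1 <;> simp only [hφ, h1, hhe]
  obtain ⟨hsum, hsle⟩ := hS a δ hδ0 hδ1 ha
  rw [← hσ] at hsum hsle
  have key := hcore (fun n => LSeries.term (LSeries.logMul^[k] a) (σ:ℂ) n) (fun n => Real.log n) lam D ((k+4)*M) v0 φ
    hsum hlam ?_ (by positivity) ?_ ?_ ?_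
  · have e : ∀ n : ℕ, LSeries.term (LSeries.logMul^[k] a) (σ:ℂ) n*φ (Real.log n) = (1/N:ℂ)*(a n*g n) := by
      intro n
      rcases Nat.eq_zero_or_pos n with rfl | hn
      · simp [hg0 0 (Or.inl hX0.le)]
      have hn0 : (0:ℝ) < n := by exact_mod_cast hn
      have hn' : (n:ℂ) ≠ 0 := by exact_mod_cast hn.ne'
      by_cases hm : Real.log n ∈ Set.Icc v0 v1
      · have hlog : 0 < Real.log n := by linarith [hm.1]
        have hlogc : ((Real.log n:ℝ):ℂ) ≠ 0 := by exact_mod_cast hlog.ne'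
        have hNc : (N:ℂ) ≠ 0 := by exact_mod_cast hN0.ne'
        have hp : (n:ℂ)^(σ:ℂ) = ((Real.exp (σ*Real.log n):ℝ):ℂ) := by rw [Complex.cpow_def_of_ne_zero hn', ← Complex.natCast_log]; push_cast; ring_nf
        have hpe : ((Real.exp (σ*Real.log n):ℝ):ℂ) ≠ 0 := by exact_mod_cast (Real.exp_pos _).ne'
        simp only [hφ, clampR_of_mem hm, hh, Real.exp_log hn0]
        rw [LSeries.term_of_ne_zero hn.ne', logMul_iter, hp, ← Complex.natCast_log]
        simp only [Complex.ofReal_div, Complex.ofReal_pow, Complex.ofReal_natCast]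
        field_simp
      · rw [hφout _ hm, hg0 n, mul_zero, mul_zero, mul_zero]
        by_contra hcon
        push Not at hcon
        exact hm ⟨Real.log_le_log hX0 hcon.1.le, Real.log_le_log hn0 hcon.2.le⟩
    simp_rw [e] at key
    rw [tsum_mul_left, norm_mul, norm_div, norm_one, Complex.norm_real, Real.norm_of_nonneg hN0.le, one_div, ← div_eq_inv_mul, div_le_iff₀ hN0] at key
    refine key.trans ?_
    have hsq : Real.sqrt ((k+4)*M / lam) = Real.sqrt (k+4)*Real.sqrt (M / lam) := by rw [mul_div_assoc, Real.sqrt_mul (by positivity)]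
    rw [hsq]
    have h1d : 1 / δ = v0 := by rw [hδ]; field_simp
    rw [h1d] at hsle
    calc _ ≤ C0*(lam*D + (C1*v0^(k+2))*(Real.sqrt (k+4)*Real.sqrt (M/lam)))*(12*X*v0⁻¹^k) := by gcongr
      _ ≤ C0*((1 + C1*Real.sqrt (k+4))*(lam*D + v0^(k+2)*Real.sqrt (M/lam)))*(12*X*v0⁻¹^k) := by
          gcongr
          have : 0 ≤ C1*Real.sqrt (k+4)*(lam*D) := by positivity
          have : 0 ≤ v0^(k+2)*Real.sqrt (M/lam) := by positivity
          linarith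
      _ = _ := by ring
  · intro y hy; rw [tsum_term_eq]
    have h1 := hD (-y) (by simpa using hy)
    rw [LSeries_iteratedDeriv] at h1
    · rw [norm_mul, norm_pow, norm_neg, norm_one, one_pow, one_mul] at h1
      convert h1 using 4
      push_cast; ring
    · refine (absc_le ha).trans_lt ?_
      have : (1:ℝ) < (((σ:ℝ):ℂ) + I*((-y:ℝ):ℂ)).re := by simp; linarith
      exact_mod_cast this
  · intro x
    have := clampR_mem hvle x
    simp only [hφ, hh]
    rw [norm_mul]; exact mul_le_one₀ (hψ1 _ this) (norm_nonneg _) (hg1 _)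
  · intro x hx
    refine hφout x fun hx' => hx ⟨hx'.1, by linarith [hx'.2]⟩
  · intro x y
    refine (hhl _ (clampR_mem hvle x) _ (clampR_mem hvle y)).trans ?_
    exact mul_le_mul_of_nonneg_left (clampR_lip _ _ _ _) (by positivity)
end WG
end
section
open Complex MeasureTheory Filter Asymptotics ArithmeticFunction
namespace WG
lemma app_bound (A B : ℕ) : ∃ k : ℕ, ∀ C2 : ℝ, 0 < C2 → ∃ X0 : ℝ, 3 ≤ X0 ∧ ∀ X ≥ X0, ∀ (a : ℕ → ℂ) (g : ℝ → ℂ), (∀ n, ‖a n‖ ≤ 1 + Real.log n) →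
    (∀ y : ℝ, ‖iteratedDeriv k (LSeries a) (((1 + 1 / Real.log X : ℝ):ℂ) + I*y)‖ ≤ C2*Real.log X^B*(|y| + 2)) →
    Adm X (Real.log X^B) g → ‖∑' n : ℕ, a n*g n‖ ≤ X*(Real.log X)⁻¹^A := by
  set m := 2*A + B + 6 with hm
  refine ⟨2*m + B + A + 1, fun C2 hC2 => ?_⟩
  set k := 2*m + B + A + 1 with hk
  obtain ⟨C, hC, h⟩ := main_bound k
  refine ⟨max 3 (Real.exp (C*(3*C2 + 1))), le_max_left _ _, fun X hX a g ha hd hg => ?_⟩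
  have hX3 : 3 ≤ X := (le_max_left _ _).trans hX
  have hX0 : 0 < X := by linarith
  have hlX := one_lt_log hX3
  have hlog : C*(3*C2 + 1) ≤ Real.log X := by rw [Real.le_log_iff_exp_le hX0]; exact (le_max_right _ _).trans hX
  set l := Real.log X with hl
  have hl0 : 0 < l := by linarith
  have hlm : 1 ≤ l^m := one_le_pow₀ hlX.le
  have := h a (l^m) (C2*l^B*(l^m + 2)) X (l^B) g ha hX3 (by positivity) (one_le_pow₀ hlX.le)
    (fun y hy => (hd y).trans (by gcongr)) hg
  refine this.trans ?_
  have hsq : Real.sqrt (l^B / l^m) = l⁻¹^(A+3) := by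
    have : l^B / l^m = (l⁻¹^(A+3))^2 := by rw [div_eq_iff (by positivity), hm, inv_pow, inv_pow]; field_simp; ring
    rw [this, Real.sqrt_sq (by positivity)]
  rw [hsq]
  have e1 : l⁻¹^k*(l^m*(C2*l^B*(3*l^m))) = 3*C2*l⁻¹^(A+1) := by rw [hk, inv_pow, inv_pow]; field_simp; ring
  have e2 : l⁻¹^k*(l^(k+2)*l⁻¹^(A+3)) = l⁻¹^(A+1) := by rw [inv_pow, inv_pow, inv_pow]; field_simp; ring
  calc C*X*l⁻¹^k*(l^m*(C2*l^B*(l^m + 2)) + l^(k+2)*l⁻¹^(A+3))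
      ≤ C*X*l⁻¹^k*(l^m*(C2*l^B*(3*l^m)) + l^(k+2)*l⁻¹^(A+3)) := by gcongr; linarith
    _ = C*X*(l⁻¹^k*(l^m*(C2*l^B*(3*l^m))) + l⁻¹^k*(l^(k+2)*l⁻¹^(A+3))) := by ring
    _ = X*(C*(3*C2 + 1)*l⁻¹^(A+1)) := by rw [e1, e2]; ring
    _ ≤ X*(l*l⁻¹^(A+1)) := by gcongr
    _ = _ := by rw [pow_succ]; field_simp
lemma re_line {X y : ℝ} (hX : 3 ≤ X) : 1 < (((1 + 1 / Real.log X : ℝ):ℂ) + I*y).re ∧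
    (((1 + 1 / Real.log X : ℝ):ℂ) + I*y).re ≤ 2 ∧ (((1 + 1 / Real.log X : ℝ):ℂ) + I*y).im = y := by
  have h := one_lt_log hX
  have h0 : 0 < 1 / Real.log X := by positivity
  have h1 : 1 / Real.log X ≤ 1 := by rw [div_le_one (by linarith)]; exact h.le
  have e : (((1 + 1 / Real.log X : ℝ):ℂ) + I*y).re = 1 + 1 / Real.log X := by rw [Complex.add_re, Complex.ofReal_re]; simp
  have e' : (((1 + 1 / Real.log X : ℝ):ℂ) + I*y).im = y := by rw [Complex.add_im, Complex.ofReal_im]; simp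
  refine ⟨by rw [e]; linarith, by rw [e]; linarith, e'⟩
lemma char_bound (A B : ℕ) : ∃ X0 : ℝ, 3 ≤ X0 ∧ ∀ X ≥ X0, ∀ (q : ℕ) [NeZero q] (χ : DirichletCharacter ℂ q) (g : ℝ → ℂ),
    χ ≠ 1 → (q:ℝ) ≤ Real.log X^B → Adm X (Real.log X^B) g →
    ‖∑' n : ℕ, (χ n*Λ n)*g n‖ ≤ X*(Real.log X)⁻¹^A := by
  obtain ⟨k, hk⟩ := app_bound A B
  obtain ⟨C2, hC2, hd⟩ := L_deriv k (ε := 1) one_pos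
  obtain ⟨X0, hX0, h⟩ := hk C2 hC2
  refine ⟨X0, hX0, fun X hX q _ χ g hχ hq hg => ?_⟩
  refine h X hX (fun n => χ n*Λ n) g (fun n => ?_) (fun y => ?_) hg
  · rw [norm_mul, Complex.norm_real, Real.norm_of_nonneg vonMangoldt_nonneg]
    have h1 := DirichletCharacter.norm_le_one χ (n : ZMod q)
    have h2 := vonMangoldt_le_log (n := n)
    have h3 := vonMangoldt_nonneg (n := n)
    nlinarith
  · obtain ⟨r1, r2, r3⟩ := re_line (X := X) (y := y) (hX0.trans hX)
    have e : LSeries (fun n => χ n*Λ n) =ᶠ[nhds (((1 + 1 / Real.log X : ℝ):ℂ) + I*y)] -(logDeriv (DirichletCharacter.LFunction χ)) := by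
      have ho : IsOpen {s : ℂ | 1 < s.re} := isOpen_lt continuous_const Complex.continuous_re
      filter_upwards [ho.mem_nhds r1] with s hs
      have hs' : 1 < s.re := hs
      have := DirichletCharacter.LSeries_twist_vonMangoldt_eq χ hs'
      have e0 : (fun n : ℕ => χ n*(Λ n : ℂ)) = ((fun n : ℕ => χ n)*fun n : ℕ => (Λ n:ℂ)) := rfl
      rw [e0, this, Pi.neg_apply, logDeriv_apply, DirichletCharacter.LFunction_eq_LSeries χ hs', neg_div]; congr 2
      refine Filter.EventuallyEq.deriv_eq ?_
      filter_upwards [ho.mem_nhds hs] with z hz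
      rw [DirichletCharacter.LFunction_eq_LSeries χ hz]
    rw [e.iteratedDeriv_eq, iteratedDeriv_neg, norm_neg]
    refine (hd q χ _ (Or.inl hχ) r1.le r2).trans ?_
    rw [r3, Real.rpow_one, Qc, mul_assoc]; gcongr
lemma lam_bound (A B : ℕ) : ∃ X0 : ℝ, 3 ≤ X0 ∧ ∀ X ≥ X0, ∀ (g : ℝ → ℂ), Adm X (Real.log X^B) g → ‖∑' n : ℕ, ((Λ n : ℂ) - 1)*g n‖ ≤ X*(Real.log X)⁻¹^A := by
  obtain ⟨k, hk⟩ := app_bound A B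
  obtain ⟨C2, hC2, hd⟩ := zeta_deriv k (ε := 1) one_pos
  obtain ⟨X0, hX0, h⟩ := hk C2 hC2
  refine ⟨X0, hX0, fun X hX g hg => ?_⟩
  refine h X hX (fun n => (Λ n:ℂ) - 1) g (fun n => ?_) (fun y => ?_) hg
  · refine (norm_sub_le _ _).trans ?_
    rw [norm_one, Complex.norm_real, Real.norm_of_nonneg vonMangoldt_nonneg]
    have h2 := vonMangoldt_le_log (n := n)
    linarith
  · obtain ⟨r1, r2, r3⟩ := re_line (X := X) (y := y) (hX0.trans hX)
    have hl := one_lt_log (hX0.trans hX)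
    have e : LSeries (fun n => (Λ n:ℂ) - 1) =ᶠ[nhds (((1 + 1 / Real.log X : ℝ):ℂ) + I*y)] -zG := by
      have ho : IsOpen {s : ℂ | 1 < s.re} := isOpen_lt continuous_const Complex.continuous_re
      filter_upwards [ho.mem_nhds r1] with s hs
      have hs' : 1 < s.re := hs
      have e0 : (fun n : ℕ => (Λ n:ℂ) - 1) = ((fun n : ℕ => (Λ n:ℂ)) - (1 : ℕ → ℂ)) := rfl
      rw [e0, LSeries_sub (LSeriesSummable_vonMangoldt hs') (LSeriesSummable_one_iff.mpr hs'),
        LSeries_vonMangoldt_eq_deriv_riemannZeta_div hs', LSeries_one_eq_riemannZeta hs', Pi.neg_apply, zG, logDeriv_apply]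
      ring
    rw [e.iteratedDeriv_eq, iteratedDeriv_neg, norm_neg]
    refine (hd _ r1 r2).trans ?_
    rw [r3, Real.rpow_one]
    have : 1 ≤ Real.log X^B := one_le_pow₀ hl.le
    have : 0 ≤ C2*(|y| + 2) := by positivity
    nlinarith
lemma sum_int_bound {X M : ℝ} {g : ℝ → ℂ} (hX : 3 ≤ X) (hM : 0 ≤ M) (hg : Adm X M g) {N : ℕ} (hN : 2*X ≤ N) : ‖∑ n ∈ Finset.range N, g n - ∫ x, g x‖ ≤ 3*M := by
  obtain ⟨hg1, hg0, hgl⟩ := hg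
  have hX0 : 0 < X := by linarith
  have hc : Continuous g := by
    have : LipschitzWith (Real.toNNReal (M/X)) g := LipschitzWith.of_dist_le_mul fun x y => by
      rw [Real.coe_toNNReal _ (by positivity), dist_eq_norm, Real.dist_eq]; exact hgl x y
    exact this.continuous
  set K := ⌈2*X⌉₊ with hK
  have hKX : 2*X ≤ K := Nat.le_ceil _
  have hKX' : (K:ℝ) ≤ 2*X + 1 := (Nat.ceil_lt_add_one (by positivity)).le
  have hKN : K ≤ N := Nat.ceil_le.mpr hN
  have e1 : ∑ n ∈ Finset.range N, g n = ∑ n ∈ Finset.range K, g n := by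
    symm
    refine Finset.sum_subset (Finset.range_mono hKN) fun n _ hn => ?_
    rw [Finset.mem_range, not_lt] at hn; exact hg0 _ (Or.inr (hKX.trans (by exact_mod_cast hn)))
  have e2 : ∫ x, g x = ∑ n ∈ Finset.range K, ∫ x in (n:ℝ)..((n+1:ℕ):ℝ), g x := by
    rw [intervalIntegral.sum_integral_adjacent_intervals (a := fun n : ℕ => (n:ℝ)) (fun k _ => hc.intervalIntegrable _ _)]
    rw [intervalIntegral.integral_of_le (by simp)]
    symm
    refine setIntegral_eq_integral_of_forall_compl_eq_zero fun x hx => ?_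
    rw [Set.mem_Ioc, not_and_or, not_lt, not_le] at hx
    rcases hx with hx | hx
    · simp at hx; exact hg0 x (Or.inl (by linarith))
    · exact hg0 x (Or.inr (by linarith))
  rw [e1, e2, ← Finset.sum_sub_distrib]
  have hb : ∀ n ∈ Finset.range K, ‖g n - ∫ x in (n:ℝ)..((n+1:ℕ):ℝ), g x‖ ≤ M / X := by
    intro n _
    have : g n - ∫ x in (n:ℝ)..((n+1:ℕ):ℝ), g x = ∫ x in (n:ℝ)..((n+1:ℕ):ℝ), (g n - g x) := by
      rw [intervalIntegral.integral_sub intervalIntegrable_const (hc.intervalIntegrable _ _), intervalIntegral.integral_const]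
      simp
    rw [this]
    have h := intervalIntegral.norm_integral_le_of_norm_le_const (a := (n:ℝ)) (b := ((n+1:ℕ):ℝ)) (f := fun x => g n - g x) (C := M/X)
      fun x hx => by
        rw [Set.uIoc_of_le (by push_cast; linarith)] at hx
        refine (hgl _ _).trans ?_
        have : |(n:ℝ) - x| ≤ 1 := by
          have h1 := hx.1
          have h2 := hx.2
          push_cast at h2
          rw [abs_le]; constructor <;> linarith
        calc M / X * |(n:ℝ) - x| ≤ M / X*1 := by gcongr
          _ = _ := mul_one _
    simpa using h
  calc _ ≤ ∑ n ∈ Finset.range K, M / X := (norm_sum_le _ _).trans (Finset.sum_le_sum hb)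
    _ = K*(M/X) := by simp
    _ ≤ (3*X)*(M/X) := by gcongr; linarith
    _ = _ := by field_simp
lemma noncoprime_bound (q N : ℕ) (hq : q ≠ 0) : ∑ n ∈ (Finset.range N).filter (fun n => ¬ n.Coprime q), Λ n ≤ q*((Nat.log 2 N + 1)*Real.log N) := by
  have hsub : ((Finset.range N).filter (fun n => ¬ n.Coprime q)).filter (fun n => Λ n ≠ 0) ⊆
      (q.primeFactors ×ˢ Finset.range (Nat.log 2 N + 1)).image (fun x => x.1^x.2) := by
    intro n hn; simp only [Finset.mem_filter, Finset.mem_range, ne_eq] at hn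
    obtain ⟨⟨hnN, hco⟩, hL⟩ := hn
    rw [vonMangoldt_eq_zero_iff, not_not, isPrimePow_nat_iff] at hL
    obtain ⟨p, k, hp, hk, rfl⟩ := hL
    change ¬ Nat.Coprime _ _ at hco
    rw [Nat.coprime_pow_left_iff hk, hp.coprime_iff_not_dvd, not_not] at hco; rw [Finset.mem_image]
    refine ⟨(p, k), ?_, rfl⟩
    rw [Finset.mem_product]
    refine ⟨Nat.mem_primeFactors.mpr ⟨hp, hco, hq⟩, ?_⟩
    rw [Finset.mem_range, Nat.lt_succ_iff]
    refine Nat.le_log_of_pow_le (by norm_num) ?_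
    exact (Nat.pow_le_pow_left hp.two_le k).trans hnN.le
  have hcard := (Finset.card_le_card hsub).trans Finset.card_image_le
  rw [Finset.card_product, Finset.card_range] at hcard
  have h2 : q.primeFactors.card ≤ q := by
    have : q.primeFactors ⊆ Finset.Icc 1 q := fun p hp => by
      rw [Finset.mem_Icc]
      have := Nat.mem_primeFactors.mp hp
      exact ⟨this.1.pos, Nat.le_of_dvd (Nat.pos_of_ne_zero hq) this.2.1⟩
    simpa using Finset.card_le_card this
  rw [← Finset.sum_filter_ne_zero]
  have hlN : 0 ≤ Real.log N := Real.log_natCast_nonneg N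
  calc _ ≤ ∑ n ∈ ((Finset.range N).filter (fun n => ¬ n.Coprime q)).filter (fun n => Λ n ≠ 0), Real.log N := by
        refine Finset.sum_le_sum fun n hn => ?_
        simp only [Finset.mem_filter, Finset.mem_range, ne_eq] at hn
        refine vonMangoldt_le_log.trans ?_
        have hn0 : 0 < n := Nat.pos_of_ne_zero fun h => hn.2 (by simp [h])
        exact Real.log_le_log (by exact_mod_cast hn0) (by exact_mod_cast hn.1.1.le)
    _ ≤ (q*(Nat.log 2 N + 1) : ℕ)*Real.log N := by rw [Finset.sum_const, nsmul_eq_mul]; gcongr; exact hcard.trans (Nat.mul_le_mul_right _ h2)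
    _ = _ := by push_cast; ring
theorem SW (A B : ℕ) : ∃ X0 : ℝ, 3 ≤ X0 ∧ ∀ X ≥ X0, ∀ (q : ℕ) [NeZero q] (b : ZMod q) (g : ℝ → ℂ) (N : ℕ),
    IsUnit b → (q:ℝ) ≤ Real.log X^B → Adm X (Real.log X^B) g → 2*X ≤ N →
    ‖∑ n ∈ Finset.range N, (vonMangoldt.residueClass b n : ℂ)*g n - (q.totient : ℂ)⁻¹ * ∫ x, g x‖ ≤ X*(Real.log X)⁻¹^A := by
  obtain ⟨X1, h31, h1⟩ := char_bound (A+1) B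
  obtain ⟨X2, h32, h2⟩ := lam_bound (A+1) B
  have hev : ∀ᶠ X : ℝ in atTop, (Real.log X)^(2*B+A+3) ≤ X := by
    have := (isLittleO_log_rpow_rpow_atTop (2*B+A+3 : ℕ) (zero_lt_one)).bound (zero_lt_one)
    filter_upwards [this, eventually_ge_atTop 3] with X hX h3
    rw [Real.rpow_natCast, Real.rpow_one, one_mul] at hX; exact (le_abs_self _).trans (hX.trans (le_of_eq (abs_of_pos (by linarith))))
  obtain ⟨X3, h3⟩ := eventually_atTop.mp hev
  refine ⟨max (max X1 X2) (max X3 (Real.exp 100)), le_max_of_le_left (le_max_of_le_left h31), ?_⟩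
  intro X hX q _ b g N hb hq hg hN
  have hXa : X1 ≤ X := (le_max_left _ _).trans ((le_max_left _ _).trans hX)
  have hXb : X2 ≤ X := (le_max_right _ _).trans ((le_max_left _ _).trans hX)
  have hXc : X3 ≤ X := (le_max_left _ _).trans ((le_max_right _ _).trans hX)
  have hXd : Real.exp 100 ≤ X := (le_max_right _ _).trans ((le_max_right _ _).trans hX)
  have hX3 : 3 ≤ X := h31.trans hXa
  have hX0 : 0 < X := by linarith
  have hpow := h3 X hXc
  have hl100 : 100 ≤ Real.log X := by rwa [Real.le_log_iff_exp_le hX0]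
  set l := Real.log X with hl
  have hl0 : 0 < l := by linarith
  have hg' := hg
  obtain ⟨hg1, hg0, hgl⟩ := hg'
  set K := ⌈2*X⌉₊ with hK
  have hKX : 2*X ≤ K := Nat.le_ceil _
  have hKX' : (K:ℝ) ≤ 3*X := by have := (Nat.ceil_lt_add_one (a := 2*X) (by positivity)).le; linarith
  have hKN : K ≤ N := Nat.ceil_le.mpr hN
  have hfin : ∀ (c : ℕ → ℂ) (N : ℕ), 2*X ≤ N → ∑' n : ℕ, c n*g n = ∑ n ∈ Finset.range N, c n*g n := by
    intro c N hN
    refine tsum_eq_sum fun n hn => ?_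
    rw [Finset.mem_range, not_lt] at hn; rw [hg0 _ (Or.inr (hN.trans (by exact_mod_cast hn))), mul_zero]
  rw [← hfin _ N hN, hfin _ K hKX]
  have hφ : (0:ℝ) < q.totient := by exact_mod_cast Nat.totient_pos.mpr (Nat.pos_of_ne_zero (NeZero.ne q))
  have hφc : (q.totient:ℂ) ≠ 0 := by exact_mod_cast hφ.ne'
  have e1 : ∑ n ∈ Finset.range K, (vonMangoldt.residueClass b n : ℂ)*g n =
      (q.totient:ℂ)⁻¹ * ∑ χ : DirichletCharacter ℂ q, χ b⁻¹ * ∑ n ∈ Finset.range K, (χ n*Λ n)*g n := by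
    simp_rw [vonMangoldt.residueClass_apply hb, Finset.mul_sum, Finset.sum_mul]
    rw [Finset.sum_comm]
    refine Finset.sum_congr rfl fun χ _ => Finset.sum_congr rfl fun n _ => by ring
  have hprin : ‖∑ n ∈ Finset.range K, ((1 : DirichletCharacter ℂ q) n*Λ n)*g n - ∫ x, g x‖ ≤ q*((Nat.log 2 K + 1)*Real.log K) + X*l⁻¹^(A+1) + 3*l^B := by
    have d : ∑ n ∈ Finset.range K, ((1 : DirichletCharacter ℂ q) n*Λ n)*g n - ∫ x, g x =
       -(∑ n ∈ (Finset.range K).filter (fun n => ¬ n.Coprime q), (Λ n:ℂ)*g n) + ∑ n ∈ Finset.range K, ((Λ n:ℂ) - 1)*g n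
        + (∑ n ∈ Finset.range K, g n - ∫ x, g x) := by
      have e3 : ∑ n ∈ (Finset.range K).filter (fun n => ¬ n.Coprime q), (Λ n:ℂ)*g n =
          ∑ n ∈ Finset.range K, (Λ n:ℂ)*g n - ∑ n ∈ Finset.range K, ((1 : DirichletCharacter ℂ q) n*Λ n)*g n := by
        rw [Finset.sum_filter, ← Finset.sum_sub_distrib]
        refine Finset.sum_congr rfl fun n _ => ?_
        by_cases hn : n.Coprime q
        · rw [if_neg (by simpa using hn), MulChar.one_apply ((ZMod.isUnit_iff_coprime n q).mpr hn)]; ring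
        · rw [if_pos hn, MulChar.map_nonunit _ (fun h => hn ((ZMod.isUnit_iff_coprime n q).mp h))]; ring
      rw [e3]; simp_rw [sub_mul, one_mul]
      rw [Finset.sum_sub_distrib]; ring
    rw [d]
    refine (norm_add₃_le).trans ?_
    gcongr
    · rw [norm_neg]
      refine le_trans ?_ (noncoprime_bound q K (NeZero.ne q))
      refine (norm_sum_le _ _).trans (Finset.sum_le_sum fun n _ => ?_)
      rw [norm_mul, Complex.norm_real, Real.norm_of_nonneg vonMangoldt_nonneg]; exact mul_le_of_le_one_right vonMangoldt_nonneg (hg1 _)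
    · rw [← hfin _ K hKX]; exact h2 X hXb g hg
    · exact sum_int_bound hX3 (by positivity) hg hKX
  have hpol : q*((Nat.log 2 K + 1)*Real.log K) ≤ 8*l^(B+2) := by
    have hK1 : (1:ℝ) ≤ K := by linarith
    have hlK : Real.log K ≤ 2*l := by
      have : Real.log K ≤ Real.log (X^2) := Real.log_le_log (by linarith) (by nlinarith)
      rwa [Real.log_pow] at this
    have hlK2 : (Nat.log 2 K:ℝ) ≤ 3*l := by
      have h5 : ((2^(Nat.log 2 K) : ℕ):ℝ) ≤ K := by exact_mod_cast Nat.pow_log_le_self 2 (by intro h; rw [h] at hK1; norm_num at hK1)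
      have h6 := Real.log_le_log (by positivity) h5
      push_cast at h6
      rw [Real.log_pow] at h6
      have := Real.log_two_gt_d9
      have h7 : (0:ℝ) ≤ Nat.log 2 K := by positivity
      nlinarith
    have hlK0 : 0 ≤ Real.log K := Real.log_nonneg hK1
    calc q*((Nat.log 2 K + 1)*Real.log K) ≤ l^B*((3*l + l)*(2*l)) := by gcongr; linarith
      _ = _ := by ring
  have htot : 8*l^(B+2) + X*l⁻¹^(A+1) + 3*l^B ≤ 12*(X*l⁻¹^(A+1)) := by
    have a1 : l^(B+2) ≤ X*l⁻¹^(A+1) := by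
      rw [inv_pow, ← div_eq_mul_inv, le_div_iff₀ (by positivity), ← pow_add]; exact (pow_le_pow_right₀ (by linarith) (by omega)).trans hpow
    have a2 : l^B ≤ l^(B+2) := pow_le_pow_right₀ (by linarith) (by omega)
    linarith
  have hXl : 0 ≤ X*l⁻¹^(A+1) := by positivity
  have hcardφ : (Finset.univ : Finset (DirichletCharacter ℂ q)).card = q.totient := by
    rw [Finset.card_univ, ← Nat.card_eq_fintype_card, DirichletCharacter.card_eq_totient_of_hasEnoughRootsOfUnity]
  rw [e1, ← mul_sub, norm_mul, norm_inv, Complex.norm_natCast]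
  have e4 : ∑ χ : DirichletCharacter ℂ q, χ b⁻¹ * ∑ n ∈ Finset.range K, (χ n*Λ n)*g n - ∫ x, g x =
      ∑ χ : DirichletCharacter ℂ q, (χ b⁻¹ * ∑ n ∈ Finset.range K, (χ n*Λ n)*g n - if χ = 1 then ∫ x, g x else 0) := by
    rw [Finset.sum_sub_distrib, Finset.sum_ite_eq' Finset.univ]; simp
  have hfinal : ‖∑ χ : DirichletCharacter ℂ q, χ b⁻¹ * ∑ n ∈ Finset.range K, (χ n*Λ n)*g n - ∫ x, g x‖ ≤ q.totient*(12*(X*l⁻¹^(A+1))) := by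
    rw [e4, ← hcardφ, ← nsmul_eq_mul]
    refine (norm_sum_le _ _).trans (Finset.sum_le_card_nsmul _ _ _ fun χ _ => ?_)
    by_cases hχ : χ = 1
    · subst hχ; rw [if_pos rfl]
      have hu : IsUnit b⁻¹ := by
        obtain ⟨u, rfl⟩ := hb
        rw [ZMod.inv_coe_unit]; exact Units.isUnit _
      rw [MulChar.one_apply hu, one_mul]; exact hprin.trans (by linarith)
    · rw [if_neg hχ, sub_zero, norm_mul, ← hfin _ K hKX]
      have t1 := DirichletCharacter.norm_le_one χ (b⁻¹)
      have t2 := h1 X hXa q χ g hχ hq hg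
      calc _ ≤ 1*(X*l⁻¹^(A+1)) := by gcongr
        _ ≤ _ := by linarith
  calc _ ≤ (q.totient:ℝ)⁻¹*(q.totient*(12*(X*l⁻¹^(A+1)))) := by gcongr
    _ = 12*(X*l⁻¹^(A+1)) := by field_simp
    _ ≤ l*(X*l⁻¹^(A+1)) := by gcongr; linarith
    _ = _ := by rw [pow_succ]; field_simp
end WG
end
section
open Complex Finset
namespace WG
noncomputable def ee (x : ℝ) : ℂ := cexp (2*Real.pi*x*I)
lemma ee_add (x y : ℝ) : ee (x + y) = ee x*ee y := by unfold ee; rw [← Complex.exp_add]; push_cast; ring_nf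
lemma ee_zero : ee 0 = 1 := by simp [ee]
lemma norm_ee (x : ℝ) : ‖ee x‖ = 1 := by
  unfold ee
  have : (2*Real.pi*x*I : ℂ) = ((2*Real.pi*x : ℝ) : ℂ)*I := by push_cast; ring
  rw [this, Complex.norm_exp_ofReal_mul_I]
lemma ee_int (n : ℤ) : ee n = 1 := by
  unfold ee
  rw [show (2*Real.pi*(n:ℝ)*I : ℂ) = n*(2*Real.pi*I) by push_cast; ring]
  exact Complex.exp_int_mul_two_pi_mul_I n
lemma ee_neg (x : ℝ) : ee (-x) = (starRingEnd ℂ) (ee x) := by unfold ee; rw [← Complex.exp_conj]; simp [Complex.conj_ofNat]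
lemma ee_sub (x y : ℝ) : ee (x - y) = ee x*(starRingEnd ℂ) (ee y) := by rw [sub_eq_add_neg, ee_add, ee_neg]
noncomputable def nd (x : ℝ) : ℝ := |x - round x|
lemma nd_nonneg (x : ℝ) : 0 ≤ nd x := abs_nonneg _
lemma nd_le_half (x : ℝ) : nd x ≤ 1/2 := abs_sub_round x
lemma norm_ee_sub_one (x : ℝ) : 4*nd x ≤ ‖ee x - 1‖ := by
  have e : ee x = ee (x - round x) := by
    have := ee_add (x - round x) (round x)
    rw [ee_int, mul_one, sub_add_cancel] at this; exact this
  rw [e]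
  have h := nd_le_half x
  unfold nd at h ⊢
  set t := x - round x
  have e2 : ee t = cexp (I*((2*Real.pi*t : ℝ):ℂ)) := by unfold ee; push_cast; ring_nf
  rw [e2, Complex.norm_exp_I_mul_ofReal_sub_one, Real.norm_eq_abs, abs_mul, abs_of_pos (two_pos : (0:ℝ) < 2)]
  have h3 := Real.mul_abs_le_abs_sin (x := 2*Real.pi*t / 2) (by
    rw [abs_div, abs_mul, abs_of_pos Real.two_pi_pos, abs_of_pos (two_pos : (0:ℝ) < 2)]
    have := Real.pi_pos
    nlinarith)
  have e3 : 2 / Real.pi * |2*Real.pi*t / 2| = 2 * |t| := by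
    have := Real.pi_pos
    rw [abs_div, abs_mul, abs_of_pos Real.two_pi_pos, abs_of_pos (two_pos : (0:ℝ) < 2)]; field_simp
  linarith
/-- truncated reciprocal of the distance to the nearest integer: min(N, 1/‖x‖) -/
noncomputable def W (N x : ℝ) : ℝ := N / max 1 (N*nd x)
lemma W_nonneg {N : ℝ} (hN : 0 ≤ N) (x : ℝ) : 0 ≤ W N x := div_nonneg hN (le_max_of_le_left zero_le_one)
lemma W_le {N : ℝ} (hN : 0 ≤ N) (x : ℝ) : W N x ≤ N := div_le_self hN (le_max_left _ _)
lemma W_le_inv {N x d : ℝ} (hN : 0 < N) (hd : 0 < d) (h : d ≤ nd x) : W N x ≤ 1 / d := by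
  unfold W; rw [div_le_div_iff₀ (lt_max_of_lt_left one_pos) hd, one_mul]; exact (mul_le_mul_of_nonneg_left h hN.le).trans (le_max_right _ _)
lemma le_W {N x t : ℝ} (h1 : t ≤ N) (ht : 0 ≤ t) (h2 : t*nd x ≤ 1) : t ≤ W N x := by
  unfold W; rw [le_div_iff₀ (lt_max_of_lt_left one_pos)]
  rcases le_total 1 (N*nd x) with h | h
  · rw [max_eq_right h]; nlinarith
  · rw [max_eq_left h]; linarith
lemma W_neg (N x : ℝ) : W N (-x) = W N x := by
  unfold W; congr 2
  have h : nd (-x) = nd x := by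
    unfold nd
    have h1 := round_le (-x) (-(round x))
    have h2 := round_le x (-(round (-x)))
    push_cast at h1 h2
    have e1 : |(-x) - -(round x:ℝ)| = |x - round x| := by rw [← abs_neg]; ring_nf
    have e2 : |x - -(round (-x):ℝ)| = |-x - round (-x)| := by rw [← abs_neg]; ring_nf
    rw [e1] at h1; rw [e2] at h2; exact le_antisymm h1 h2
  rw [h]
lemma geom_range (θ c : ℝ) (a : ℤ) (L : ℕ) (N : ℝ) (hN : (L:ℝ) ≤ N) : ‖∑ i ∈ range L, ee (θ*((a + i : ℤ):ℝ) + c)‖ ≤ W N θ := by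
  refine le_W ?_ (norm_nonneg _) ?_
  · refine (norm_sum_le _ _).trans ?_
    simp only [norm_ee, sum_const, card_range, nsmul_eq_mul, mul_one]; exact hN
  · have htel : (ee θ - 1) * ∑ i ∈ range L, ee (θ*((a + i : ℤ):ℝ) + c) = ee (θ*((a + L : ℤ):ℝ) + c) - ee (θ*(a:ℝ) + c) := by
      rw [Finset.mul_sum]
      have := Finset.sum_range_sub (fun i : ℕ => ee (θ*((a + i : ℤ):ℝ) + c)) L
      simp only [Nat.cast_zero, add_zero] at this
      rw [← this]
      refine sum_congr rfl fun i _ => ?_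
      have : θ*((a + (i+1:ℕ) : ℤ):ℝ) + c = θ + (θ*((a + i : ℤ):ℝ) + c) := by push_cast; ring
      rw [this, ee_add θ]; ring
    have h1 := congrArg norm htel
    rw [norm_mul] at h1
    have h2 : ‖ee (θ*((a + L : ℤ):ℝ) + c) - ee (θ*(a:ℝ) + c)‖ ≤ 2 := by
      refine (norm_sub_le _ _).trans ?_
      rw [norm_ee, norm_ee]; norm_num
    have h3 := norm_ee_sub_one θ
    have h4 := norm_nonneg (∑ i ∈ range L, ee (θ*((a + i : ℤ):ℝ) + c))
    nlinarith
lemma ordConn_eq {s : Finset ℤ} (hs : ∀ x ∈ s, ∀ y ∈ s, ∀ z, x ≤ z → z ≤ y → z ∈ s) : ∃ a : ℤ, s = (range s.card).image (fun i : ℕ => a + (i:ℤ)) := by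
  rcases s.eq_empty_or_nonempty with rfl | hne
  · exact ⟨0, by simp⟩
  · have hI : s = Icc (s.min' hne) (s.max' hne) := by
      ext z; rw [mem_Icc]; exact ⟨fun h => ⟨s.min'_le z h, s.le_max' z h⟩, fun h => hs _ (s.min'_mem hne) _ (s.max'_mem hne) z h.1 h.2⟩
    refine ⟨s.min' hne, ?_⟩
    have hc : s.card = (s.max' hne + 1 - s.min' hne).toNat := by
      conv_lhs => rw [hI]
      exact Int.card_Icc _ _
    have hle : s.min' hne ≤ s.max' hne := s.min'_le _ (s.max'_mem hne)
    ext z; rw [mem_image]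
    constructor
    · intro hz
      have h1 := s.min'_le z hz
      have h2 := s.le_max' z hz
      exact ⟨(z - s.min' hne).toNat, by rw [mem_range]; omega, by omega⟩
    · rintro ⟨i, hi, rfl⟩
      rw [mem_range] at hi; exact hs _ (s.min'_mem hne) _ (s.max'_mem hne) _ (by omega) (by omega)
lemma geom_conn (θ c N : ℝ) (s : Finset ℤ) (hs : ∀ x ∈ s, ∀ y ∈ s, ∀ z, x ≤ z → z ≤ y → z ∈ s)
    (hN : (s.card:ℝ) ≤ N) : ‖∑ n ∈ s, ee (θ*(n:ℝ) + c)‖ ≤ W N θ := by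
  obtain ⟨a, ha⟩ := ordConn_eq hs
  have : ∑ n ∈ s, ee (θ*(n:ℝ) + c) = ∑ i ∈ range s.card, ee (θ*((a + i : ℤ):ℝ) + c) := by
    conv_lhs => rw [ha]
    rw [sum_image (by intro i _ j _ h; simpa using h)]
  rw [this]; exact geom_range θ c a _ N hN
lemma valMinAbs_le (q : ℕ) [NeZero q] (R k : ℤ) : (((R : ZMod q).valMinAbs).natAbs : ℤ) ≤ |R - k*q| := by
  have h := ZMod.natAbs_min_of_le_div_two q (R : ZMod q).valMinAbs (R - k*q) (by
    push_cast; simp) (ZMod.natAbs_valMinAbs_le _)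
  rw [← Int.natCast_natAbs]; exact_mod_cast h
lemma block_nd {α : ℝ} {a : ℤ} {q : ℕ} [NeZero q] (hα : |α - a / q| ≤ 1 / (q:ℝ)^2) (y0 : ℝ) (j : ℕ) (hj : j < q) :
    (((⌊q*(α*y0)⌋ + a*j : ℤ) : ZMod q).valMinAbs.natAbs : ℝ) - 2 ≤ q*nd (α*(y0 + j)) := by
  have hq : (0:ℝ) < q := by exact_mod_cast Nat.pos_of_ne_zero (NeZero.ne q)
  set R : ℤ := ⌊q*(α*y0)⌋ + a*j with hR
  set k := round (α*(y0 + j))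
  have h1 := valMinAbs_le q R k
  have h1' : (((R : ZMod q).valMinAbs).natAbs : ℝ) ≤ |(R:ℝ) - k*q| := by
    have := (Int.cast_le (R := ℝ)).mpr h1
    simpa only [Int.cast_natCast, Int.cast_abs, Int.cast_sub, Int.cast_mul] using this
  have e : q*nd (α*(y0 + j)) = |q*(α*(y0 + j)) - k*q| := by
    unfold nd; rw [show q*(α*(y0 + j)) - k*q = q*(α*(y0 + j) - k) by ring, abs_mul, abs_of_pos hq]
  rw [e]
  have hθ : |q*(α - a/q)*j| ≤ 1 := by
    rw [abs_mul, abs_mul, abs_of_pos hq, Nat.abs_cast]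
    have : (j:ℝ) ≤ q := by exact_mod_cast hj.le
    calc q * |α - a/q| * j ≤ q*(1/(q:ℝ)^2)*q := by gcongr
      _ = 1 := by field_simp
  have hd : |(R:ℝ) - q*(α*(y0 + j))| ≤ 2 := by
    have f1 := Int.floor_le (q*(α*y0))
    have f2 := Int.lt_floor_add_one (q*(α*y0))
    have : (R:ℝ) - q*(α*(y0 + j)) = (⌊q*(α*y0)⌋ - q*(α*y0)) - q*(α - a/q)*j := by rw [hR]; push_cast; field_simp; ring
    rw [this]; rw [abs_le] at hθ ⊢
    constructor <;> linarith
  have := abs_sub_abs_le_abs_sub ((R:ℝ) - k*q) (q*(α*(y0 + j)) - k*q)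
  rw [sub_sub_sub_cancel_right] at this; linarith
lemma harm_le (q : ℕ) : ∑ t ∈ Icc 1 q, (1:ℝ)/t ≤ 1 + Real.log q := by
  have := harmonic_le_one_add_log q
  rw [harmonic_eq_sum_Icc] at this; push_cast at this
  simpa [one_div] using this
lemma block_sum {α : ℝ} {a : ℤ} {q : ℕ} [NeZero q] (hc : IsCoprime a (q:ℤ)) (hα : |α - a / q| ≤ 1 / (q:ℝ)^2)
    (y0 : ℝ) {N : ℝ} (hN : 0 < N) :
    ∑ j ∈ range q, W N (α*(y0 + j)) ≤ 5*N + 2*(q*(1 + Real.log q)) := by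
  have hq : (0:ℝ) < q := by exact_mod_cast Nat.pos_of_ne_zero (NeZero.ne q)
  set G : ℕ → ℝ := fun t => if t ≤ 2 then N else q / ((t:ℝ) - 2) with hG
  have hG0 : ∀ t, 0 ≤ G t := by
    intro t; simp only [hG]; split_ifs with h
    · exact hN.le
    · push Not at h
      have : (2:ℝ) < t := by exact_mod_cast h
      exact div_nonneg hq.le (by linarith)
  set r : ℕ → ZMod q := fun j => ((⌊q*(α*y0)⌋ + a*j : ℤ) : ZMod q) with hr
  have hWG : ∀ j ∈ range q, W N (α*(y0 + j)) ≤ G ((r j).valMinAbs.natAbs) := by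
    intro j hj
    have h := block_nd hα y0 j (mem_range.mp hj)
    simp only [hG, hr]
    split_ifs with h2
    · exact W_le hN.le _
    · push Not at h2
      have h2' : (2:ℝ) < (((⌊q*(α*y0)⌋ + a*j : ℤ) : ZMod q).valMinAbs.natAbs : ℝ) := by exact_mod_cast h2
      have := W_le_inv (N := N) (x := α*(y0 + j)) (d := ((((⌊q*(α*y0)⌋ + a*j : ℤ) : ZMod q).valMinAbs.natAbs : ℝ) - 2)/q) hN
        (div_pos (by linarith) hq) (by rw [div_le_iff₀ hq]; linarith)
      rwa [one_div_div] at this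
  refine (sum_le_sum hWG).trans ?_
  have hinj : Set.InjOn (fun j => (r j).valMinAbs) (range q : Set ℕ) := by
    intro i hi j hj hij
    have h1 : r i = r j := ZMod.injective_valMinAbs hij
    simp only [hr] at h1
    push_cast at h1
    have h2 := add_left_cancel h1
    have hu : IsUnit (a : ZMod q) := by
      obtain ⟨u, v, huv⟩ := hc
      refine IsUnit.of_mul_eq_one (u : ZMod q) ?_
      have := congrArg (Int.cast : ℤ → ZMod q) huv
      push_cast at this
      rw [ZMod.natCast_self, mul_zero, add_zero] at this
      rw [mul_comm]; exact this
    have h3 := hu.mul_left_cancel h2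
    rw [ZMod.natCast_eq_natCast_iff'] at h3; rw [coe_range, Set.mem_Iio] at hi hj
    rwa [Nat.mod_eq_of_lt hi, Nat.mod_eq_of_lt hj] at h3
  have hsub : (range q).image (fun j => (r j).valMinAbs) ⊆ Icc (-(q:ℤ)) q := by
    intro z hz; rw [mem_image] at hz
    obtain ⟨j, _, rfl⟩ := hz
    have := ZMod.natAbs_valMinAbs_le (r j)
    rw [mem_Icc]; omega
  calc ∑ j ∈ range q, G ((r j).valMinAbs.natAbs) = ∑ z ∈ (range q).image (fun j => (r j).valMinAbs), G z.natAbs := by rw [sum_image hinj]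
    _ ≤ ∑ z ∈ Icc (-(q:ℤ)) q, G z.natAbs := sum_le_sum_of_subset_of_nonneg hsub fun z _ _ => hG0 _
    _ ≤ ∑ z ∈ Icc (-2:ℤ) 2, N + (∑ t ∈ Icc 1 q, (q:ℝ)/t + ∑ t ∈ Icc 1 q, (q:ℝ)/t) := by
        have hcov : Icc (-(q:ℤ)) q ⊆ Icc (-2:ℤ) 2 ∪ ((Icc 1 q).image (fun t : ℕ => (t:ℤ)+2) ∪ (Icc 1 q).image (fun t : ℕ => -((t:ℤ)+2))) := by
          intro z hz; rw [mem_Icc] at hz; simp only [mem_union, mem_Icc, mem_image]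
          by_cases h1 : 2 < z
          · right; left; exact ⟨(z-2).toNat, by omega, by omega⟩
          · by_cases h2 : z < -2
            · right; right; exact ⟨(-z-2).toNat, by omega, by omega⟩
            · left; omega
        have hun : ∀ (s t : Finset ℤ), ∑ z ∈ s ∪ t, G z.natAbs ≤ ∑ z ∈ s, G z.natAbs + ∑ z ∈ t, G z.natAbs := by
          intro s t; rw [← sum_union_inter]; linarith [sum_nonneg (s := s ∩ t) (f := fun z : ℤ => G z.natAbs) fun z _ => hG0 _]
        refine (sum_le_sum_of_subset_of_nonneg hcov fun z _ _ => hG0 _).trans ((hun _ _).trans (add_le_add ?_ ((hun _ _).trans (add_le_add ?_ ?_))))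
        · refine sum_le_sum fun z hz => ?_
          rw [mem_Icc] at hz
          simp only [hG]; rw [if_pos (by omega)]
        · rw [sum_image (by intro i _ j _ h; simpa using h)]
          refine sum_le_sum fun t ht => ?_
          rw [mem_Icc] at ht
          have e : ((t:ℤ)+2).natAbs = t + 2 := by omega
          simp only [hG]; rw [e, if_neg (by omega)]; push_cast; simp
        · rw [sum_image (by intro i _ j _ h; simpa using h)]
          refine sum_le_sum fun t ht => ?_
          rw [mem_Icc] at ht
          have e : (-((t:ℤ)+2)).natAbs = t + 2 := by omega
          simp only [hG]; rw [e, if_neg (by omega)]; push_cast; simp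
    _ ≤ _ := by
        have e : ∑ t ∈ Icc 1 q, (q:ℝ)/t = q * ∑ t ∈ Icc 1 q, (1:ℝ)/t := by rw [mul_sum]; exact sum_congr rfl fun t _ => by ring
        have := mul_le_mul_of_nonneg_left (harm_le q) hq.le
        rw [e]
        have e5 : ∑ z ∈ Icc (-2:ℤ) 2, N = 5*N := by rw [sum_const, show (Icc (-2:ℤ) 2).card = 5 from rfl]; simp
        linarith
lemma W_sum {α : ℝ} {a : ℤ} {q : ℕ} [NeZero q] (hc : IsCoprime a (q:ℤ)) (hα : |α - a / q| ≤ 1 / (q:ℝ)^2)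
    {N : ℝ} (hN : 0 < N) (Y : ℕ) :
    ∑ y ∈ range Y, W N (α*y) ≤ ((Y:ℝ)/q + 1)*(5*N + 2*(q*(1 + Real.log q))) := by
  have hq' : 0 < q := Nat.pos_of_ne_zero (NeZero.ne q)
  have hq : (0:ℝ) < q := by exact_mod_cast hq'
  have hlq : 0 ≤ Real.log q := Real.log_natCast_nonneg q
  have hblock : ∀ b : ℕ, ∑ y ∈ range (b*q), W N (α*y) ≤ b*(5*N + 2*(q*(1 + Real.log q))) := by
    intro b
    induction b with
    | zero => simp
    | succ b ih =>
      rw [add_mul, one_mul, sum_range_add]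
      have := block_sum hc hα ((b*q : ℕ):ℝ) hN
      push_cast at this ⊢
      linarith
  have hsub : range Y ⊆ range ((Y/q+1)*q) := by
    refine range_mono ?_
    have := Nat.lt_div_mul_add (a := Y) hq'
    nlinarith
  refine (sum_le_sum_of_subset_of_nonneg hsub fun y _ _ => W_nonneg hN.le _).trans ((hblock _).trans ?_)
  gcongr; push_cast; gcongr; exact Nat.cast_div_le
end WG
end
section
open Finset
namespace WG
/-- number of divisors, as a real number -/
noncomputable def dd (y : ℕ) : ℝ := (y.divisors.card : ℝ)
lemma dd_nonneg (y : ℕ) : 0 ≤ dd y := by unfold dd; positivity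
lemma dd_mul_le (a b : ℕ) : dd (a*b) ≤ dd a*dd b := by unfold dd; rw [Nat.divisors_mul]; exact_mod_cast Finset.card_mul_le
lemma div_moment (r Y : ℕ) : ∑ y ∈ Icc 1 Y, dd y^r / y ≤ (1 + Real.log Y)^(2^r) := by
  induction r with
  | zero => simpa using harm_le Y
  | succ r ih =>
    have h0 : 0 ≤ ∑ y ∈ Icc 1 Y, dd y^r / y := sum_nonneg fun y _ => by have := dd_nonneg y; positivity
    refine le_trans ?_ (le_of_le_of_eq (pow_le_pow_left₀ h0 ih 2) (by rw [← pow_mul, ← pow_succ]))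
    rw [sq, sum_mul_sum, ← sum_product']
    calc ∑ y ∈ Icc 1 Y, dd y^(r+1) / y ≤ ∑ y ∈ Icc 1 Y, ∑ x ∈ ((Icc 1 Y ×ˢ Icc 1 Y).filter (fun x => x.1*x.2 ≤ Y)) with x.1*x.2 = y,
          (dd x.1^r / x.1)*(dd x.2^r / x.2) := by
          refine sum_le_sum fun y hy => ?_
          rw [mem_Icc] at hy
          have hset : ((Icc 1 Y ×ˢ Icc 1 Y).filter (fun x => x.1*x.2 ≤ Y)).filter (fun x => x.1*x.2 = y) = y.divisorsAntidiagonal := by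
            ext ⟨a, b⟩
            simp only [mem_filter, mem_product, mem_Icc, Nat.mem_divisorsAntidiagonal]
            constructor
            · rintro ⟨_, h⟩; exact ⟨h, by omega⟩
            · rintro ⟨h, _⟩
              have ha : 0 < a := Nat.pos_of_ne_zero fun h' => by subst h'; simp at h; omega
              have hb : 0 < b := Nat.pos_of_ne_zero fun h' => by subst h'; simp at h; omega
              have h1 : a ≤ a*b := Nat.le_mul_of_pos_right a hb
              have h2 : b ≤ a*b := Nat.le_mul_of_pos_left b ha
              omega
          rw [hset]
          have hcard : dd y = ∑ x ∈ y.divisorsAntidiagonal, (1:ℝ) := by unfold dd; rw [Nat.sum_divisorsAntidiagonal (fun _ _ => (1:ℝ))]; simp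
          rw [pow_succ, mul_div_right_comm]
          nth_rw 2 [hcard]
          rw [mul_sum]
          refine sum_le_sum fun x hx => ?_
          have hx' := (Nat.mem_divisorsAntidiagonal.mp hx).1
          rw [mul_one, div_mul_div_comm, ← hx', ← mul_pow]; push_cast
          have := dd_mul_le x.1 x.2
          have := dd_nonneg (x.1*x.2)
          gcongr
      _ = ∑ x ∈ (Icc 1 Y ×ˢ Icc 1 Y).filter (fun x => x.1*x.2 ≤ Y), (dd x.1^r / x.1)*(dd x.2^r / x.2) := by
          refine sum_fiberwise_of_maps_to (fun x hx => ?_) _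
          simp only [mem_filter, mem_product, mem_Icc] at hx ⊢
          exact ⟨Nat.mul_pos hx.1.1.1 hx.1.2.1, hx.2⟩
      _ ≤ _ := by
          refine sum_le_sum_of_subset_of_nonneg (filter_subset _ _) fun x _ _ => ?_
          have := dd_nonneg x.1
          have := dd_nonneg x.2
          positivity
lemma div_moment' (r Y : ℕ) : ∑ y ∈ Icc 1 Y, dd y^r ≤ Y*(1 + Real.log Y)^(2^r) := by
  refine le_trans ?_ (mul_le_mul_of_nonneg_left (div_moment r Y) (by positivity))
  rw [mul_sum]
  refine sum_le_sum fun y hy => ?_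
  rw [mem_Icc] at hy
  have h1 : (0:ℝ) < y := by exact_mod_cast hy.1
  have h2 : (y:ℝ) ≤ Y := by exact_mod_cast hy.2
  rw [← mul_div_assoc, le_div_iff₀ h1, mul_comm]
  have := dd_nonneg y
  gcongr
lemma count_tuples {r : ℕ} (S : Finset (Fin r → ℤ)) (y : ℕ) (hy : y ≠ 0) (hS : ∀ v ∈ S, (∏ i, v i).natAbs ∣ y) : (S.card : ℝ) ≤ 2^r*dd y^r := by
  have hsub : S ⊆ Fintype.piFinset (fun _ : Fin r => (y.divisors.image (fun d : ℕ => (d:ℤ))) ∪ (y.divisors.image (fun d : ℕ => -(d:ℤ)))) := by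
    intro v hv; rw [Fintype.mem_piFinset]; intro i
    have h1 : (v i).natAbs ∣ y := by
      refine dvd_trans ?_ (hS v hv)
      exact Int.natAbs_dvd_natAbs.mpr (dvd_prod_of_mem v (mem_univ i))
    rw [mem_union, mem_image, mem_image]
    rcases Int.natAbs_eq (v i) with h | h
    · left; exact ⟨_, Nat.mem_divisors.mpr ⟨h1, hy⟩, h.symm⟩
    · right; exact ⟨_, Nat.mem_divisors.mpr ⟨h1, hy⟩, h.symm⟩
  have h2 := card_le_card hsub
  rw [Fintype.card_piFinset, prod_const, card_univ, Fintype.card_fin] at h2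
  have h3 := card_union_le (y.divisors.image (fun d : ℕ => (d:ℤ))) (y.divisors.image (fun d : ℕ => -(d:ℤ)))
  have h4 : (y.divisors.image (fun d : ℕ => (d:ℤ))).card ≤ y.divisors.card := card_image_le
  have h5 : (y.divisors.image (fun d : ℕ => -(d:ℤ))).card ≤ y.divisors.card := card_image_le
  have h6 : S.card ≤ (2*y.divisors.card)^r := h2.trans (Nat.pow_le_pow_left (by omega) r)
  unfold dd; rw [← mul_pow]; exact_mod_cast h6
lemma sum_tuples {r : ℕ} (K : Fin r → ℕ) (c : ℕ) (hc : 1 ≤ c) (α N P : ℝ) (hN : 0 ≤ N) (hP : 0 < P) (hK : ∀ i, P ≤ K i) :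
    ∑ v ∈ Fintype.piFinset (fun i => Icc (-(K i:ℤ)) (K i)), W N (α*((c * ∏ i, v i : ℤ):ℝ)) ≤
    N*(r*((∏ i, (2*(K i:ℝ) + 1)) / P)) + 2^r * ∑ y ∈ Icc 1 (c * ∏ i, K i), dd y^r*W N (α*y) := by
  set S := Fintype.piFinset (fun i => Icc (-(K i:ℤ)) (K i)) with hS
  rw [← sum_filter_add_sum_filter_not S (fun v => ∏ i, v i = 0)]
  refine add_le_add ?_ ?_
  · refine (sum_le_sum fun v _ => W_le hN _).trans ?_
    rw [sum_const, nsmul_eq_mul, mul_comm]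
    refine mul_le_mul_of_nonneg_left ?_ hN
    have hsub : S.filter (fun v => ∏ i, v i = 0) ⊆ univ.biUnion (fun i => S.filter (fun v => v i = 0)) := by
      intro v hv; rw [mem_filter, prod_eq_zero_iff] at hv
      obtain ⟨h1, i, _, h2⟩ := hv
      rw [mem_biUnion]; exact ⟨i, mem_univ i, mem_filter.mpr ⟨h1, h2⟩⟩
    have h1 := (card_le_card hsub).trans card_biUnion_le
    have h2 : ∀ i : Fin r, ((S.filter (fun v => v i = 0)).card : ℝ) ≤ (∏ i, (2*(K i:ℝ) + 1)) / P := by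
      intro i; rw [le_div_iff₀ hP]
      have hsub2 : S.filter (fun v => v i = 0) ⊆ Fintype.piFinset (fun j => if j = i then {0} else Icc (-(K j:ℤ)) (K j)) := by
        intro v hv; rw [mem_filter, hS, Fintype.mem_piFinset] at hv; rw [Fintype.mem_piFinset]; intro j
        split_ifs with hj
        · subst hj; simpa using hv.2
        · exact hv.1 j
      have h3 := card_le_card hsub2
      rw [Fintype.card_piFinset] at h3
      have h4 : ((S.filter (fun v => v i = 0)).card : ℝ) ≤ ∏ j, (if j = i then 1 else (2*(K j:ℝ) + 1)) := by
        refine (Nat.cast_le.mpr h3).trans (le_of_eq ?_)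
        push_cast
        refine prod_congr rfl fun j _ => ?_
        split_ifs
        · simp
        · rw [Int.card_Icc]
          have : ((K j:ℤ) + 1 - -(K j:ℤ)).toNat = 2*K j + 1 := by omega
          rw [this]; push_cast; ring
      have h5 : (∏ j, (if j = i then 1 else (2*(K j:ℝ) + 1)))*(2*(K i:ℝ) + 1) = ∏ i, (2*(K i:ℝ) + 1) := by
        rw [← mul_prod_erase univ _ (mem_univ i), ← mul_prod_erase univ (fun i => 2*(K i:ℝ) + 1) (mem_univ i), if_pos rfl, one_mul, mul_comm]
        congr 1
        refine prod_congr rfl fun j hj => ?_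
        rw [if_neg (ne_of_mem_erase hj)]
      rw [← h5]
      have h6 : P ≤ 2*(K i:ℝ) + 1 := by have := hK i; linarith
      gcongr
    have h1' : ((S.filter (fun v => ∏ i, v i = 0)).card : ℝ) ≤ ∑ i : Fin r, ((S.filter (fun v => v i = 0)).card : ℝ) := by exact_mod_cast h1
    refine h1'.trans ((sum_le_sum fun i _ => h2 i).trans ?_)
    simp
  · rw [mul_sum]
    have hmaps : ∀ v ∈ S.filter (fun v => ¬ ∏ i, v i = 0), c*(∏ i, v i).natAbs ∈ Icc 1 (c * ∏ i, K i) := by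
      intro v hv; rw [mem_filter, hS, Fintype.mem_piFinset] at hv; rw [mem_Icc]
      refine ⟨Nat.mul_pos hc (Int.natAbs_pos.mpr hv.2), Nat.mul_le_mul_left c ?_⟩
      rw [← Int.natAbsHom_apply, map_prod]
      refine prod_le_prod' fun i _ => ?_
      have := hv.1 i
      rw [mem_Icc] at this
      rw [Int.natAbsHom_apply]; omega
    rw [← sum_fiberwise_of_maps_to hmaps]
    refine sum_le_sum fun y hy => ?_
    rw [mem_Icc] at hy
    have hval : ∀ v ∈ (S.filter (fun v => ¬ ∏ i, v i = 0)).filter (fun v => c*(∏ i, v i).natAbs = y), W N (α*((c * ∏ i, v i : ℤ):ℝ)) = W N (α*y) := by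
      intro v hv; rw [mem_filter] at hv; rw [← hv.2]
      generalize (∏ i, v i) = z
      rcases le_total 0 z with h | h
      · lift z to ℕ using h
        simp
      · obtain ⟨m, rfl⟩ := Int.exists_eq_neg_ofNat h
        rw [← W_neg, ← mul_neg]; simp
    rw [sum_congr rfl hval, sum_const, nsmul_eq_mul, ← mul_assoc]
    refine mul_le_mul_of_nonneg_right (count_tuples _ y (by omega) fun v hv => ?_) (W_nonneg hN _)
    rw [mem_filter] at hv; exact Dvd.intro_left _ hv.2
lemma dW_sum {α : ℝ} {a : ℤ} {q : ℕ} [NeZero q] (hc : IsCoprime a (q:ℤ)) (hα : |α - a / q| ≤ 1 / (q:ℝ)^2)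
    {N P L : ℝ} (hP : 1 ≤ P) (hN : P ≤ N) (hqP : P ≤ q) (Y : ℕ) (hYP : P ≤ Y) (hqY : q*P ≤ Y*N)
    (hLq : 1 + Real.log q ≤ L) (hLY : 1 + Real.log Y ≤ L) (r : ℕ) :
    ∑ y ∈ Icc 1 Y, dd y^r*W N (α*y) ≤ 6*(Y*N*L^(4^r) / Real.sqrt P) := by
  have hN0 : 0 < N := by linarith
  have hY0 : (0:ℝ) < Y := by linarith
  have hq0 : (0:ℝ) < q := by linarith
  have hlq : 0 ≤ Real.log q := Real.log_natCast_nonneg q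
  have hL1 : 1 ≤ L := by linarith
  have hP0 : 0 < P := by linarith
  have cs := sum_mul_sq_le_sq_mul_sq (Icc 1 Y) (fun y => dd y^r) (fun y : ℕ => W N (α*y))
  have h1 : ∑ y ∈ Icc 1 Y, (dd y^r)^2 ≤ Y*L^(4^r) := by
    simp_rw [← pow_mul]
    refine (div_moment' (r*2) Y).trans ?_
    rw [show 2^(r*2) = 4^r by rw [mul_comm, pow_mul]; norm_num]
    have : 0 ≤ 1 + Real.log Y := by linarith [Real.log_natCast_nonneg Y]
    gcongr
  have h2 : ∑ y ∈ Icc 1 Y, (W N (α*y))^2 ≤ N*(36*(Y*N*L / P)) := by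
    calc _ ≤ ∑ y ∈ Icc 1 Y, N*W N (α*y) := by
          refine sum_le_sum fun y _ => ?_
          rw [sq]; exact mul_le_mul_of_nonneg_right (W_le hN0.le _) (W_nonneg hN0.le _)
      _ ≤ ∑ y ∈ range (Y+1), N*W N (α*y) := by
          refine sum_le_sum_of_subset_of_nonneg (fun y hy => ?_) fun y _ _ => mul_nonneg hN0.le (W_nonneg hN0.le _)
          rw [mem_Icc] at hy; rw [mem_range]; omega
      _ = N * ∑ y ∈ range (Y+1), W N (α*y) := by rw [mul_sum]
      _ ≤ N*(36*(Y*N*L / P)) := by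
          gcongr
          refine (W_sum hc hα hN0 (Y+1)).trans ?_
          have a1 : 5*N + 2*(q*(1 + Real.log q)) ≤ 5*N*L + 2*(q*L) := by
            have : q*(1 + Real.log q) ≤ q*L := by gcongr
            nlinarith
          have a2 : ((Y+1:ℕ):ℝ)/q + 1 ≤ 2*Y/q + 1 := by
            push_cast
            have : (Y:ℝ) + 1 ≤ 2*Y := by linarith
            gcongr
          calc _ ≤ (2*Y/q + 1)*(5*N*L + 2*(q*L)) := by gcongr
            _ = L*(10*(Y*N / q) + 4*Y + 5*N + 2*q) := by field_simp; ring
            _ ≤ L*(10*(Y*N / P) + 4*(Y*N / P) + 5*(Y*N / P) + 2*(Y*N / P)) := by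
                have b1 : Y ≤ Y*N / P := by rw [le_div_iff₀ hP0]; gcongr
                have b2 : N ≤ Y*N / P := by rw [le_div_iff₀ hP0, mul_comm]; gcongr
                have b3 : q ≤ Y*N / P := by rw [le_div_iff₀ hP0]; exact hqY
                gcongr
            _ = 21*(Y*N*L / P) := by ring
            _ ≤ 36*(Y*N*L / P) := by gcongr; norm_num
  have hnn : 0 ≤ 6*(Y*N*L^(4^r) / Real.sqrt P) := by positivity
  refine abs_le_of_sq_le_sq' (cs.trans ?_) hnn |>.2
  calc _ ≤ (Y*L^(4^r))*(N*(36*(Y*N*L / P))) := by gcongr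
    _ = 36*(Y^2*N^2*L^(4^r)*L / P) := by ring
    _ ≤ 36*(Y^2*N^2*L^(4^r)*L^(4^r) / P) := by gcongr; exact le_self_pow₀ hL1 (by positivity)
    _ = (6*(Y*N*L^(4^r) / Real.sqrt P))^2 := by rw [mul_pow, div_pow, Real.sq_sqrt hP0.le]; ring
lemma core_tuples (r : ℕ) {α : ℝ} {a : ℤ} {q : ℕ} [NeZero q] (hc : IsCoprime a (q:ℤ)) (hα : |α - a / q| ≤ 1 / (q:ℝ)^2)
    {N P L : ℝ} (hP : 1 ≤ P) (hN : P ≤ N) (hqP : P ≤ q) (K : Fin r → ℕ) (c Y : ℕ) (hc1 : 1 ≤ c) (hY : Y = c * ∏ i, K i)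
    (hYP : P ≤ Y) (hqY : q*P ≤ Y*N)
    (hLq : 1 + Real.log q ≤ L) (hLY : 1 + Real.log Y ≤ L) (hK : ∀ i, P ≤ K i) :
    ∑ v ∈ Fintype.piFinset (fun i => Icc (-(K i:ℤ)) (K i)), W N (α*((c * ∏ i, v i : ℤ):ℝ)) ≤ (r*3^r + 6*2^r)*(Y*N*L^(4^r) / Real.sqrt P) := by
  have hP0 : 0 < P := by linarith
  have hN0 : 0 < N := by linarith
  have hY0 : (0:ℝ) < Y := by linarith
  have hlq : 0 ≤ Real.log q := Real.log_natCast_nonneg q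
  have hL1 : 1 ≤ L := by linarith
  refine (sum_tuples K c hc1 α N P hN0.le hP0 hK).trans ?_
  rw [add_mul]
  refine add_le_add ?_ ?_
  · have h1 : ∏ i, (2*(K i:ℝ) + 1) ≤ 3^r*Y := by
      have : ∏ i, (2*(K i:ℝ) + 1) ≤ ∏ i, (3*(K i:ℝ)) := by
        refine prod_le_prod (fun i _ => by positivity) fun i _ => ?_
        have := hK i; linarith
      refine this.trans ?_
      rw [prod_mul_distrib, prod_const, card_univ, Fintype.card_fin]; gcongr
      rw [hY]; push_cast
      have : (1:ℝ) ≤ c := by exact_mod_cast hc1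
      exact le_mul_of_one_le_left (by positivity) this
    have h2 : 1 / P ≤ L^(4^r) / Real.sqrt P := by
      have h3 : 1 ≤ L^(4^r) := one_le_pow₀ hL1
      have h4 : Real.sqrt P ≤ P := by rw [Real.sqrt_le_left hP0.le]; nlinarith
      have : 0 < Real.sqrt P := Real.sqrt_pos.mpr hP0
      gcongr
    calc N*(r*((∏ i, (2*(K i:ℝ) + 1)) / P)) ≤ N*(r*((3^r*Y) / P)) := by gcongr
      _ = r*3^r*(Y*N*(1 / P)) := by ring
      _ ≤ r*3^r*(Y*N*(L^(4^r) / Real.sqrt P)) := by gcongr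
      _ = _ := by ring
  · have := dW_sum hc hα hP hN hqP Y hYP hqY hLq hLY r
    rw [← hY]
    calc _ ≤ 2^r*(6*(Y*N*L^(4^r) / Real.sqrt P)) := by gcongr
      _ = _ := by ring
/-- multiplicative difference -/
noncomputable def dlt (h : ℤ) (Φ : ℤ → ℂ) : ℤ → ℂ := fun n => Φ (n + h)*(starRingEnd ℂ) (Φ n)
lemma vdc_eq (J : Finset ℤ) (K : ℕ) (hJ : ∀ x ∈ J, ∀ y ∈ J, |x - y| ≤ K) (Φ : ℤ → ℂ) (h0 : ∀ n, n ∉ J → Φ n = 0) :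
    ((‖∑ n ∈ J, Φ n‖^2 : ℝ) : ℂ) = ∑ h ∈ Icc (-(K:ℤ)) K, ∑ n ∈ J, dlt h Φ n := by
  push_cast; rw [← Complex.mul_conj', map_sum, sum_mul_sum, sum_comm, sum_comm (s := Icc (-(K:ℤ)) K)]
  refine sum_congr rfl fun n hn => ?_
  have h1 : ∑ h ∈ Icc (-(K:ℤ)) K, dlt h Φ n = ∑ m ∈ (Icc (-(K:ℤ)) K).image (fun h => n + h), Φ m*(starRingEnd ℂ) (Φ n) := by
    rw [sum_image (by intro a _ b _ h; simpa using h)]; rfl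
  rw [h1]
  refine sum_subset (fun m hm => ?_) fun m _ hm => ?_
  · rw [mem_image]
    refine ⟨m - n, ?_, by ring⟩
    rw [mem_Icc]; exact abs_le.mp (hJ m hm n hn)
  · rw [h0 m hm, zero_mul]
lemma cs_card {ι : Type*} (S : Finset ι) (f : ι → ℂ) : ‖∑ s ∈ S, f s‖^2 ≤ S.card * ∑ s ∈ S, ‖f s‖^2 := by
  refine le_trans (pow_le_pow_left₀ (norm_nonneg _) (norm_sum_le _ _) 2) ?_
  exact sq_sum_le_card_mul_sum_sq
lemma vdc {ι : Type*} (S : Finset ι) (J : Finset ℤ) (K : ℕ) (hJ : ∀ x ∈ J, ∀ y ∈ J, |x - y| ≤ K) (Φ : ι → ℤ → ℂ)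
    (h0 : ∀ s n, n ∉ J → Φ s n = 0) :
    ‖∑ s ∈ S, ∑ n ∈ J, Φ s n‖^2 ≤ S.card * ‖∑ x ∈ S ×ˢ Icc (-(K:ℤ)) K, ∑ n ∈ J, dlt x.2 (Φ x.1) n‖ := by
  refine (cs_card _ _).trans (mul_le_mul_of_nonneg_left ?_ (by positivity))
  have : ((∑ s ∈ S, ‖∑ n ∈ J, Φ s n‖^2 : ℝ) : ℂ) = ∑ x ∈ S ×ˢ Icc (-(K:ℤ)) K, ∑ n ∈ J, dlt x.2 (Φ x.1) n := by
    rw [sum_product, Complex.ofReal_sum]; exact sum_congr rfl fun s _ => vdc_eq J K hJ (Φ s) (h0 s)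
  rw [← this, Complex.norm_real]; exact le_abs_self _
lemma dlt_zero {J : Finset ℤ} {Φ : ℤ → ℂ} (h0 : ∀ n, n ∉ J → Φ n = 0) (h : ℤ) : ∀ n, n ∉ J → dlt h Φ n = 0 := by intro n hn; simp [dlt, h0 n hn]
lemma vdc3 {ι : Type*} (S : Finset ι) (J : Finset ℤ) (K : ℕ) (hJ : ∀ x ∈ J, ∀ y ∈ J, |x - y| ≤ K) (Φ : ι → ℤ → ℂ)
    (h0 : ∀ s n, n ∉ J → Φ s n = 0) :
    ‖∑ s ∈ S, ∑ n ∈ J, Φ s n‖^8 ≤ S.card^7*(2*K+1)^4 * ‖∑ x ∈ ((S ×ˢ Icc (-(K:ℤ)) K) ×ˢ Icc (-(K:ℤ)) K) ×ˢ Icc (-(K:ℤ)) K,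
        ∑ n ∈ J, dlt x.2 (dlt x.1.2 (dlt x.1.1.2 (Φ x.1.1.1))) n‖ := by
  have h1 := vdc S J K hJ Φ h0
  have h2 := vdc (S ×ˢ Icc (-(K:ℤ)) K) J K hJ (fun x => dlt x.2 (Φ x.1)) (fun s => dlt_zero (h0 _) _)
  have h3 := vdc ((S ×ˢ Icc (-(K:ℤ)) K) ×ˢ Icc (-(K:ℤ)) K) J K hJ (fun x => dlt x.2 (dlt x.1.2 (Φ x.1.1)))
    (fun s => dlt_zero (dlt_zero (h0 _) _) _)
  have hK : ((Icc (-(K:ℤ)) K).card : ℝ) = 2*K + 1 := by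
    rw [Int.card_Icc]
    have : ((K:ℤ) + 1 - -K).toNat = 2*K + 1 := by omega
    rw [this]; push_cast; ring
  simp only [card_product, Nat.cast_mul, hK] at h2 h3
  set A := ‖∑ s ∈ S, ∑ n ∈ J, Φ s n‖
  set B := ‖∑ x ∈ S ×ˢ Icc (-(K:ℤ)) K, ∑ n ∈ J, dlt x.2 (Φ x.1) n‖
  set C := ‖∑ x ∈ (S ×ˢ Icc (-(K:ℤ)) K) ×ˢ Icc (-(K:ℤ)) K, ∑ n ∈ J, dlt x.2 (dlt x.1.2 (Φ x.1.1)) n‖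
  set D := ‖∑ x ∈ ((S ×ˢ Icc (-(K:ℤ)) K) ×ˢ Icc (-(K:ℤ)) K) ×ˢ Icc (-(K:ℤ)) K, ∑ n ∈ J, dlt x.2 (dlt x.1.2 (dlt x.1.1.2 (Φ x.1.1.1))) n‖
  have hB0 : 0 ≤ B := norm_nonneg _
  have hC0 : 0 ≤ C := norm_nonneg _
  set s : ℝ := (S.card : ℝ)
  set k : ℝ := 2*K + 1 with hk
  have hk0 : 0 ≤ k := by positivity
  have hs0 : 0 ≤ s := by positivity
  calc A^8 = (A^2)^4 := by ring
    _ ≤ (s*B)^4 := by gcongr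
    _ = s^4*(B^2)^2 := by ring
    _ ≤ s^4*(s*k*C)^2 := by gcongr
    _ = s^6*k^2*C^2 := by ring
    _ ≤ s^6*k^2*(s*k*k*D) := by gcongr
    _ = _ := by ring
open Classical in
/-- phase with domain -/
noncomputable def P1 (c : ℝ) (D : ℤ → Prop) (r : ℤ → ℤ) : ℤ → ℂ := fun n => if D n then ee (c*r n) else 0
def sh (h : ℤ) (D : ℤ → Prop) : ℤ → Prop := fun n => D (n + h) ∧ D n
def df (h : ℤ) (r : ℤ → ℤ) : ℤ → ℤ := fun n => r (n + h) - r n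
lemma dlt_P1 (h : ℤ) (c : ℝ) (D : ℤ → Prop) (r : ℤ → ℤ) : dlt h (P1 c D r) = P1 c (sh h D) (df h r) := by
  funext n
  unfold dlt P1 sh df
  by_cases h1 : D (n+h) <;> by_cases h2 : D n <;> simp [h1, h2]
  rw [← ee_sub]; congr 1; ring
def OC (D : ℤ → Prop) : Prop := ∀ x y z, D x → D y → x ≤ z → z ≤ y → D z
lemma OC.sh {D : ℤ → Prop} (hD : OC D) (h : ℤ) : OC (sh h D) := fun x y z hx hy h1 h2 => ⟨hD _ _ _ hx.1 hy.1 (by omega) (by omega), hD _ _ _ hx.2 hy.2 h1 h2⟩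
lemma df5 (h1 h2 h3 h4 n : ℤ) : df h4 (df h3 (df h2 (df h1 (fun n => n^5)))) n = 60*(h1*h2*h3*h4)*(2*n + (h1 + h2 + h3 + h4)) := by unfold df; ring
lemma norm_P1_le (c : ℝ) (D : ℤ → Prop) (r : ℤ → ℤ) (n : ℤ) : ‖P1 c D r n‖ ≤ 1 := by
  unfold P1; split_ifs <;> simp [norm_ee]
/-- linear phase sum -/
lemma P1_lin (c θ c' : ℝ) (D : ℤ → Prop) (hD : OC D) (r : ℤ → ℤ) (hr : ∀ n, c*r n = θ*n + c') (J : Finset ℤ) (N : ℝ)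
    (hJ : (J.card:ℝ) ≤ N) (hDJ : ∀ n, D n → n ∈ J) : ‖∑ n ∈ J, P1 c D r n‖ ≤ W N θ := by
  classical
  have : ∑ n ∈ J, P1 c D r n = ∑ n ∈ J.filter D, ee (θ*n + c') := by
    rw [sum_filter]
    refine sum_congr rfl fun n _ => ?_
    unfold P1
    by_cases h : D n <;> simp [h, hr]
  rw [this]
  refine geom_conn θ c' N _ (fun x hx y hy z h1 h2 => ?_) (le_trans (by exact_mod_cast card_filter_le _ _) hJ)
  rw [mem_filter] at *
  have := hD x y z hx.2 hy.2 h1 h2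
  exact ⟨hDJ z this, this⟩
lemma card_H (K : ℕ) : ((Icc (-(K:ℤ)) K).card : ℝ) = 2*K + 1 := by
  rw [Int.card_Icc]
  have : ((K:ℤ) + 1 - -K).toNat = 2*K + 1 := by omega
  rw [this]; push_cast; ring
/-- Type I -/
lemma weyl_interval {α : ℝ} {a : ℤ} {q : ℕ} [NeZero q] (hc : IsCoprime a (q:ℤ)) (hα : |α - a / q| ≤ 1 / (q:ℝ)^2)
    {P L : ℝ} (hP : 1 ≤ P) (hqP : P ≤ q) (N k : ℕ) (hk : 1 ≤ k) (hN : P ≤ N)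
    (hqY : q*P ≤ (120*k^5*N^4)*N) (hLq : 1 + Real.log q ≤ L) (hLY : 1 + Real.log (120*k^5*N^4) ≤ L)
    (D : ℤ → Prop) (hD : OC D) (hDN : ∀ n, D n → n ∈ Ioc (0:ℤ) N) :
    ‖∑ n ∈ Ioc (0:ℤ) N, P1 (α*k^5) D (fun n => n^5) n‖^16 ≤ 3^11*420*120*(k^5*(N:ℝ)^16*L^256 / Real.sqrt P) := by
  set J := Ioc (0:ℤ) N with hJdef
  set H := Icc (-(N:ℤ)) N with hH
  have hN1 : (1:ℝ) ≤ N := hP.trans hN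
  have hcard : (J.card : ℝ) ≤ N := by simp [hJdef]
  have hJ : ∀ x ∈ J, ∀ y ∈ J, |x - y| ≤ N := by
    intro x hx y hy; rw [hJdef, mem_Ioc] at hx hy
    rw [abs_le]; omega
  have h0 : ∀ n, n ∉ J → P1 (α*k^5) D (fun n => n^5) n = 0 := by intro n hn; unfold P1; rw [if_neg fun h => hn (hDN n h)]
  have h1 := vdc {()} J N hJ (fun _ => P1 (α*k^5) D (fun n => n^5)) (fun _ => h0)
  have h2 := vdc3 (({()} : Finset Unit) ×ˢ H) J N hJ (fun x => dlt x.2 (P1 (α*k^5) D (fun n => n^5))) (fun s => dlt_zero h0 _)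
  rw [sum_singleton, card_singleton, Nat.cast_one, one_mul] at h1; rw [card_product, card_singleton, one_mul, card_H] at h2
  have h3 : ‖∑ n ∈ J, P1 (α*k^5) D (fun n => n^5) n‖^16 ≤ (2*N+1)^7*(2*N+1)^4*_ :=
    calc _ = (‖∑ n ∈ J, P1 (α*k^5) D (fun n => n^5) n‖^2)^8 := by ring
      _ ≤ _ := by gcongr
      _ ≤ _ := h2
  clear h1 h2
  have hcore := core_tuples 4 hc hα hP hN hqP (fun _ => N) (120*k^5) (120*k^5*N^4)
    (by have : 0 < k^5 := Nat.pow_pos hk; omega) (by simp) (by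
      push_cast
      have hk' : (1:ℝ) ≤ k := by exact_mod_cast hk
      have e1 : (1:ℝ) ≤ k^5 := one_le_pow₀ hk'
      have e2 : (N:ℝ) ≤ N^4 := le_self_pow₀ hN1 (by norm_num)
      have e3 : (1:ℝ)*N ≤ (120*k^5)*N^4 := mul_le_mul (by linarith) e2 (by linarith) (by positivity)
      linarith) (by push_cast; exact hqY) hLq (by push_cast; exact hLY) (fun _ => hN)
  have h4 : ‖∑ x ∈ (((({()} : Finset Unit) ×ˢ H) ×ˢ H) ×ˢ H) ×ˢ H, ∑ n ∈ J, dlt x.2 (dlt x.1.2 (dlt x.1.1.2 (dlt x.1.1.1.2 (P1 (α*k^5) D (fun n => n^5))))) n‖ ≤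
      ∑ v ∈ Fintype.piFinset (fun _ : Fin 4 => H), W N (α*(((120*k^5 : ℕ) * ∏ i, v i : ℤ):ℝ)) := by
    refine (norm_sum_le _ _).trans ?_
    refine (sum_le_sum (g := fun x => W N (α*(((120*k^5 : ℕ) * ∏ i, ![x.1.1.1.2, x.1.1.2, x.1.2, x.2] i : ℤ):ℝ))) fun x hx => ?_).trans ?_
    · simp only [dlt_P1]
      obtain ⟨⟨⟨⟨_, a1⟩, a2⟩, a3⟩, a4⟩ := x
      simp only
      refine P1_lin _ _ (α*k^5*(60*(a1*a2*a3*a4)*(a1 + a2 + a3 + a4))) _ ((((hD.sh _).sh _).sh _).sh _) _ (fun n => ?_) _ _ hcard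
        (fun n hn => hDN n hn.2.2.2.2)
      rw [df5, Fin.prod_univ_four]; simp; ring
    · rw [← sum_image (f := fun v : Fin 4 → ℤ => W N (α*(((120*k^5 : ℕ) * ∏ i, v i : ℤ):ℝ)))
        (g := fun x : (((Unit × ℤ) × ℤ) × ℤ) × ℤ => ![x.1.1.1.2, x.1.1.2, x.1.2, x.2])]
      · refine sum_le_sum_of_subset_of_nonneg (fun v hv => ?_) fun v _ _ => W_nonneg (by positivity) _
        rw [mem_image] at hv
        obtain ⟨x, hx, rfl⟩ := hv
        simp only [mem_product] at hx
        rw [Fintype.mem_piFinset]; intro i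
        fin_cases i <;> simp <;> tauto
      · rintro ⟨⟨⟨⟨_, a1⟩, a2⟩, a3⟩, a4⟩ _ ⟨⟨⟨⟨_, b1⟩, b2⟩, b3⟩, b4⟩ _ h
        have e0 := congrFun h 0
        have e1 := congrFun h 1
        have e2 := congrFun h 2
        have e3 := congrFun h 3
        simp at e0 e1 e2 e3
        simp [*]
  have h5 := h4.trans hcore
  refine h3.trans ((mul_le_mul_of_nonneg_left h5 (by positivity)).trans ?_)
  have hsP : 0 < Real.sqrt P := Real.sqrt_pos.mpr (by linarith)
  have hL0 : 0 ≤ L := le_trans (by have := Real.log_natCast_nonneg q; linarith) hLq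
  have : (2*(N:ℝ) + 1)^7*(2*N + 1)^4 ≤ 3^11*N^11 := by rw [← pow_add, ← mul_pow]; gcongr; linarith
  calc _ ≤ (3^11*N^11)*(((4:ℕ)*3^4 + 6*2^4)*((120*k^5*N^4 : ℕ)*N*L^(4^4) / Real.sqrt P)) := by gcongr
    _ = _ := by push_cast; ring
open Classical in
noncomputable def F2 (α : ℝ) (E : ℤ → ℤ → Prop) (p r : ℤ → ℤ) (m n : ℤ) : ℂ := if E m n then ee (α*(p m*r n)) else 0
def shm (h : ℤ) (E : ℤ → ℤ → Prop) : ℤ → ℤ → Prop := fun m n => E (m + h) n ∧ E m n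
def shn (h : ℤ) (E : ℤ → ℤ → Prop) : ℤ → ℤ → Prop := fun m n => E m (n + h) ∧ E m n
lemma F2_eq_n (α : ℝ) (E : ℤ → ℤ → Prop) (p r : ℤ → ℤ) (m : ℤ) : F2 α E p r m = P1 (α*p m) (E m) r := by
  funext n; unfold F2 P1; rw [mul_assoc]
lemma F2_eq_m (α : ℝ) (E : ℤ → ℤ → Prop) (p r : ℤ → ℤ) (n : ℤ) : (fun m => F2 α E p r m n) = P1 (α*r n) (fun m => E m n) p := by
  funext m; unfold F2 P1; rw [mul_assoc, mul_comm (r n : ℝ)]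
lemma dlt_F2_n (α : ℝ) (E : ℤ → ℤ → Prop) (p r : ℤ → ℤ) (m h : ℤ) : dlt h (F2 α E p r m) = F2 α (shn h E) p (df h r) m := by rw [F2_eq_n, F2_eq_n, dlt_P1]; rfl
lemma dlt_F2_m (α : ℝ) (E : ℤ → ℤ → Prop) (p r : ℤ → ℤ) (n h : ℤ) :
    dlt h (fun m => F2 α E p r m n) = (fun m => F2 α (shm h E) (df h p) r m n) := by rw [F2_eq_m, F2_eq_m, dlt_P1]; rfl
/-- admissible domains -/
def Dom (I J : Finset ℤ) (E : ℤ → ℤ → Prop) : Prop := (∀ m n, E m n → m ∈ I ∧ n ∈ J) ∧ ∀ m, OC (E m)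
lemma Dom.shm {I J : Finset ℤ} {E : ℤ → ℤ → Prop} (h : Dom I J E) (k : ℤ) : Dom I J (shm k E) :=
  ⟨fun m n hE => h.1 m n hE.2, fun m x y z hx hy h1 h2 => ⟨h.2 _ x y z hx.1 hy.1 h1 h2, h.2 _ x y z hx.2 hy.2 h1 h2⟩⟩
lemma Dom.shn {I J : Finset ℤ} {E : ℤ → ℤ → Prop} (h : Dom I J E) (k : ℤ) : Dom I J (shn k E) := ⟨fun m n hE => h.1 m n hE.2, fun m => (h.2 m).sh k⟩
lemma Dom.zn {I J : Finset ℤ} {E : ℤ → ℤ → Prop} (h : Dom I J E) (α : ℝ) (p r : ℤ → ℤ) (m : ℤ) :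
    ∀ n, n ∉ J → F2 α E p r m n = 0 := by intro n hn; unfold F2; rw [if_neg fun hE => hn (h.1 m n hE).2]
lemma Dom.zm {I J : Finset ℤ} {E : ℤ → ℤ → Prop} (h : Dom I J E) (α : ℝ) (p r : ℤ → ℤ) (n : ℤ) :
    ∀ m, m ∉ I → F2 α E p r m n = 0 := by intro m hm; unfold F2; rw [if_neg fun hE => hm (h.1 m n hE).1]
lemma cs_mul {ι : Type*} (S : Finset ι) (f g : ι → ℂ) : ‖∑ s ∈ S, f s*g s‖^2 ≤ (∑ s ∈ S, ‖f s‖^2) * ∑ s ∈ S, ‖g s‖^2 := by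
  refine le_trans (pow_le_pow_left₀ (norm_nonneg _) (norm_sum_le _ _) 2) ?_
  simp only [norm_mul]
  exact sum_mul_sq_le_sq_mul_sq S _ _
lemma typeII_step1 (α : ℝ) (I J : Finset ℤ) (M N : ℕ) (hI : ∀ x ∈ I, ∀ y ∈ I, |x - y| ≤ M) (hJ : ∀ x ∈ J, ∀ y ∈ J, |x - y| ≤ N)
    (E : ℤ → ℤ → Prop) (hE : Dom I J E) (p r : ℤ → ℤ) (a b : ℤ → ℂ) (ha : ∀ m, m ∉ I → a m = 0) :
    ‖∑ m ∈ I, ∑ n ∈ J, a m*b n*F2 α E p r m n‖^4 ≤ (∑ m ∈ I, ‖a m‖^2)^2*(∑ n ∈ J, ‖b n‖^2)^2 *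
      ‖∑ x ∈ (Icc (-(M:ℤ)) M ×ˢ Icc (-(N:ℤ)) N) ×ˢ J, ∑ m ∈ I, F2 α (shn x.1.2 (shm x.1.1 E)) (df x.1.1 p) (df x.1.2 r) m x.2‖ := by
  set A := ∑ m ∈ I, ‖a m‖^2 with hA
  set B := ∑ n ∈ J, ‖b n‖^2 with hB
  set Hm := Icc (-(M:ℤ)) M
  set Hn := Icc (-(N:ℤ)) N
  have hB0 : 0 ≤ B := sum_nonneg fun _ _ => by positivity
  have h1 : ‖∑ m ∈ I, ∑ n ∈ J, a m*b n*F2 α E p r m n‖^2 ≤ B * ∑ n ∈ J, ‖∑ m ∈ I, a m*F2 α E p r m n‖^2 := by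
    rw [sum_comm]
    refine le_trans (le_of_eq ?_) (cs_mul J b _)
    congr 2
    refine sum_congr rfl fun n _ => ?_
    rw [mul_sum]; exact sum_congr rfl fun m _ => by ring
  have h2 : ((∑ n ∈ J, ‖∑ m ∈ I, a m*F2 α E p r m n‖^2 : ℝ) : ℂ) =
      ∑ x ∈ Hm ×ˢ I, (a (x.2 + x.1)*(starRingEnd ℂ) (a x.2)) * ∑ n ∈ J, F2 α (shm x.1 E) (df x.1 p) r x.2 n := by
    rw [Complex.ofReal_sum, sum_product]
    have : ∀ n ∈ J, ((‖∑ m ∈ I, a m*F2 α E p r m n‖^2 : ℝ) : ℂ) = ∑ h ∈ Hm, ∑ m ∈ I, (a (m + h)*(starRingEnd ℂ) (a m))*F2 α (shm h E) (df h p) r m n := by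
      intro n _; rw [vdc_eq I M hI (fun m => a m*F2 α E p r m n) (fun m hm => by rw [ha m hm, zero_mul])]
      refine sum_congr rfl fun h _ => sum_congr rfl fun m _ => ?_
      rw [← congrFun (dlt_F2_m α E p r n h) m]; unfold dlt; simp only [map_mul]
      ring
    rw [sum_congr rfl this, sum_comm]
    refine sum_congr rfl fun h _ => ?_
    rw [sum_comm]
    refine sum_congr rfl fun m _ => ?_
    rw [mul_sum]
  have h3 : (∑ n ∈ J, ‖∑ m ∈ I, a m*F2 α E p r m n‖^2)^2 ≤ A^2 * ∑ x ∈ Hm ×ˢ I, ‖∑ n ∈ J, F2 α (shm x.1 E) (df x.1 p) r x.2 n‖^2 := by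
    have h4 := cs_mul (Hm ×ˢ I) (fun x => a (x.2 + x.1)*(starRingEnd ℂ) (a x.2))
      (fun x => ∑ n ∈ J, F2 α (shm x.1 E) (df x.1 p) r x.2 n)
    rw [← h2, Complex.norm_real, Real.norm_eq_abs, sq_abs] at h4
    refine h4.trans (mul_le_mul_of_nonneg_right ?_ (sum_nonneg fun _ _ => by positivity))
    rw [sum_product_right, sq A]
    nth_rw 2 [hA]
    rw [mul_sum]
    refine sum_le_sum fun m _ => ?_
    simp only [norm_mul, RCLike.norm_conj, mul_pow]
    rw [← sum_mul]
    refine mul_le_mul_of_nonneg_right ?_ (by positivity)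
    have h5 : ∑ h ∈ Hm, ‖a (m + h)‖^2 = ∑ k ∈ Hm.image (fun h => m + h), ‖a k‖^2 := by rw [sum_image (by intro x _ y _ h; simpa using h)]
    rw [h5]
    rw [← sum_filter_of_ne (p := fun k => k ∈ I) (fun k _ hk => by
      by_contra hk'
      exact hk (by rw [ha k hk']; simp))]
    exact sum_le_sum_of_subset_of_nonneg (fun k hk => (mem_filter.mp hk).2) fun _ _ _ => by positivity
  have h6 : ((∑ x ∈ Hm ×ˢ I, ‖∑ n ∈ J, F2 α (shm x.1 E) (df x.1 p) r x.2 n‖^2 : ℝ):ℂ) =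
      ∑ x ∈ (Hm ×ˢ Hn) ×ˢ J, ∑ m ∈ I, F2 α (shn x.1.2 (shm x.1.1 E)) (df x.1.1 p) (df x.1.2 r) m x.2 := by
    rw [Complex.ofReal_sum, sum_product, sum_product, sum_product]
    refine sum_congr rfl fun h _ => ?_
    simp only
    have : ∀ m ∈ I, ((‖∑ n ∈ J, F2 α (shm h E) (df h p) r m n‖^2 : ℝ) : ℂ) = ∑ g ∈ Hn, ∑ n ∈ J, F2 α (shn g (shm h E)) (df h p) (df g r) m n := by
      intro m _; rw [vdc_eq J N hJ _ ((hE.shm h).zn α _ _ m)]; simp only [dlt_F2_n]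
      rfl
    rw [sum_congr rfl this, sum_comm]
    refine sum_congr rfl fun g _ => ?_
    rw [sum_comm]
  rw [← h6, Complex.norm_real, Real.norm_eq_abs, abs_of_nonneg (sum_nonneg fun _ _ => by positivity)]
  calc _ = (‖∑ m ∈ I, ∑ n ∈ J, a m*b n*F2 α E p r m n‖^2)^2 := by ring
    _ ≤ (B * ∑ n ∈ J, ‖∑ m ∈ I, a m*F2 α E p r m n‖^2)^2 := by gcongr
    _ = B^2*(∑ n ∈ J, ‖∑ m ∈ I, a m*F2 α E p r m n‖^2)^2 := by ring
    _ ≤ B^2*(A^2*_) := by gcongr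
    _ = _ := by ring
lemma typeII_step2 (α : ℝ) (I J : Finset ℤ) (M N : ℕ) (hI : ∀ x ∈ I, ∀ y ∈ I, |x - y| ≤ M)
    (E : ℤ → ℤ → ℤ → ℤ → Prop) (hE : ∀ h g, Dom I J (E h g)) (p r : ℤ → ℤ → ℤ) :
    ‖∑ x ∈ (Icc (-(M:ℤ)) M ×ˢ Icc (-(N:ℤ)) N) ×ˢ J, ∑ m ∈ I, F2 α (E x.1.1 x.1.2) (p x.1.1) (r x.1.2) m x.2‖^8 ≤ ((2*M+1)*(2*N+1)*J.card)^7*(2*M+1)^4 *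
      ‖∑ x ∈ ((((Icc (-(M:ℤ)) M ×ˢ Icc (-(N:ℤ)) N) ×ˢ Icc (-(M:ℤ)) M) ×ˢ Icc (-(M:ℤ)) M) ×ˢ Icc (-(M:ℤ)) M) ×ˢ I,
        ∑ n ∈ J, F2 α (shm x.1.2 (shm x.1.1.2 (shm x.1.1.1.2 (E x.1.1.1.1.1 x.1.1.1.1.2))))
          (df x.1.2 (df x.1.1.2 (df x.1.1.1.2 (p x.1.1.1.1.1)))) (r x.1.1.1.1.2) x.2 n‖ := by
  have h := vdc3 ((Icc (-(M:ℤ)) M ×ˢ Icc (-(N:ℤ)) N) ×ˢ J) I M hI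
    (fun x m => F2 α (E x.1.1 x.1.2) (p x.1.1) (r x.1.2) m x.2) (fun x => (hE _ _).zm α _ _ _)
  simp only [dlt_F2_m] at h
  rw [card_product, card_product, Nat.cast_mul, Nat.cast_mul, card_H, card_H] at h
  refine h.trans (le_of_eq ?_)
  congr 2
  simp only [sum_product]
  refine sum_congr rfl fun h1 _ => sum_congr rfl fun g1 _ => ?_
  rw [sum_comm]
  refine sum_congr rfl fun h2 _ => ?_
  rw [sum_comm]
  refine sum_congr rfl fun h3 _ => ?_
  rw [sum_comm]
  refine sum_congr rfl fun h4 _ => ?_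
  rw [sum_comm]
lemma typeII_num {T A B Q R Z M N : ℝ} (hT : 0 ≤ T) (hA : 0 ≤ A) (hB : 0 ≤ B) (hQ : 0 ≤ Q) (hR : 0 ≤ R) (hZ : 0 ≤ Z) (hM : 1 ≤ M) (hN : 1 ≤ N)
    (h1 : T^4 ≤ A^2*B^2*Q) (h2 : Q^8 ≤ ((2*M + 1)*(2*N + 1)*N)^7*(2*M + 1)^4*R)
    (h3 : R^8 ≤ ((2*M + 1)*(2*N + 1)*(2*M + 1)*(2*M + 1)*(2*M + 1)*M)^7*(2*N + 1)^4*(180219*(57600*M^5*N^4*N*Z))) :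
    T^256 ≤ 3^183*(180219*57600)*((A*B*(M*N))^128*Z) := by
  have hM3 : 2*M + 1 ≤ 3*M := by linarith
  have hN3 : 2*N + 1 ≤ 3*N := by linarith
  have h2' : Q^8 ≤ 3^18*M^11*N^14*R := by
    refine h2.trans ?_
    calc _ ≤ ((3*M)*(3*N)*N)^7*(3*M)^4*R := by gcongr
      _ = _ := by ring
  have h3' : R^8 ≤ 3^39*M^35*N^11*(180219*(57600*M^5*N^4*N*Z)) := by
    refine h3.trans ?_
    calc _ ≤ ((3*M)*(3*N)*(3*M)*(3*M)*(3*M)*M)^7*(3*N)^4*(180219*(57600*M^5*N^4*N*Z)) := by gcongr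
      _ = _ := by ring
  calc T^256 = (T^4)^64 := by rw [← pow_mul]
    _ ≤ (A^2*B^2*Q)^64 := by gcongr
    _ = (A*B)^128*(Q^8)^8 := by ring
    _ ≤ (A*B)^128*(3^18*M^11*N^14*R)^8 := by gcongr
    _ = (A*B)^128*((3^18*M^11*N^14)^8*R^8) := by rw [mul_pow _ R]
    _ ≤ (A*B)^128*((3^18*M^11*N^14)^8*(3^39*M^35*N^11*(180219*(57600*M^5*N^4*N*Z)))) := by gcongr
    _ = _ := by
      rw [mul_pow (A*B) (M*N)]
      generalize (A*B)^128 = U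
      ring
lemma typeII_step3 (α : ℝ) (I J : Finset ℤ) (M N : ℕ) (hIdef : I = Ioc (M:ℤ) (2*M)) (hJc : (J.card:ℝ) = N)
    (E : ℤ → ℤ → Prop) (hE : Dom I J E) (p : ℤ → ℤ) (hp : p = fun x => x^5) (K : Fin 9 → ℕ) (hK : K = ![M, M, M, M, 8*M, N, N, N, N]) :
    ‖∑ x ∈ ((((((((Icc (-(M:ℤ)) M ×ˢ Icc (-(N:ℤ)) N) ×ˢ Icc (-(M:ℤ)) M) ×ˢ Icc (-(M:ℤ)) M) ×ˢ Icc (-(M:ℤ)) M) ×ˢ I) ×ˢ Icc (-(N:ℤ)) N)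
      ×ˢ Icc (-(N:ℤ)) N) ×ˢ Icc (-(N:ℤ)) N), ∑ n ∈ J, F2 α (shn x.2 (shn x.1.2 (shn x.1.1.2 (shm x.1.1.1.1.2 (shm x.1.1.1.1.1.2 (shm x.1.1.1.1.1.1.2
          (shn x.1.1.1.1.1.1.1.2 (shm x.1.1.1.1.1.1.1.1 E))))))))
          (df x.1.1.1.1.2 (df x.1.1.1.1.1.2 (df x.1.1.1.1.1.1.2 (df x.1.1.1.1.1.1.1.1 p))))
          (df x.2 (df x.1.2 (df x.1.1.2 (df x.1.1.1.1.1.1.1.2 p)))) x.1.1.1.2 n‖ ≤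
      ∑ v ∈ Fintype.piFinset (fun i => Icc (-(K i:ℤ)) (K i)), W N (α*(((7200:ℕ) * ∏ i, v i : ℤ):ℝ)) := by
  refine (norm_sum_le _ _).trans ?_
  set φ : (((((((((ℤ × ℤ) × ℤ) × ℤ) × ℤ) × ℤ) × ℤ) × ℤ) × ℤ)) → (Fin 9 → ℤ) := fun x => ![x.1.1.1.1.2, x.1.1.1.1.1.2, x.1.1.1.1.1.1.2, x.1.1.1.1.1.1.1.1,
      2*x.1.1.1.2 + (x.1.1.1.1.1.1.1.1 + x.1.1.1.1.1.1.2 + x.1.1.1.1.1.2 + x.1.1.1.1.2),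
      x.2, x.1.2, x.1.1.2, x.1.1.1.1.1.1.1.2] with hφ
  refine (sum_le_sum (g := fun x => W N (α*(((7200:ℕ) * ∏ i, φ x i : ℤ):ℝ))) fun x hx => ?_).trans ?_
  · rw [F2_eq_n]
    obtain ⟨⟨⟨⟨⟨⟨⟨⟨h1, g1⟩, h2⟩, h3⟩, h4⟩, m⟩, g2⟩, g3⟩, g4⟩ := x
    simp only [hφ]
    have hdom := (((((((hE.shm h1).shn g1).shm h2).shm h3).shm h4).shn g2).shn g3).shn g4
    refine P1_lin _ _ (α*((60*(h1*h2*h3*h4)*(2*m + (h1 + h2 + h3 + h4)))*(60*(g1*g2*g3*g4)*(g1 + g2 + g3 + g4)))) _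
      (hdom.2 m) _ (fun n => ?_) _ _ hJc.le (fun n hn => (hdom.1 m n hn).2)
    rw [hp, df5, df5]; simp [Fin.prod_univ_succ]
    ring
  · rw [← sum_image (f := fun v : Fin 9 → ℤ => W N (α*(((7200:ℕ) * ∏ i, v i : ℤ):ℝ))) (g := φ)]
    · refine sum_le_sum_of_subset_of_nonneg (fun v hv => ?_) fun v _ _ => W_nonneg (by positivity) _
      rw [mem_image] at hv
      obtain ⟨x, hx, rfl⟩ := hv
      simp only [mem_product, mem_Icc, hIdef, mem_Ioc] at hx
      rw [Fintype.mem_piFinset]; intro i; rw [mem_Icc]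
      fin_cases i <;> simp [hφ, hK] <;> omega
    · rintro ⟨⟨⟨⟨⟨⟨⟨⟨h1, g1⟩, h2⟩, h3⟩, h4⟩, m⟩, g2⟩, g3⟩, g4⟩ _ ⟨⟨⟨⟨⟨⟨⟨⟨h1', g1'⟩, h2'⟩, h3'⟩, h4'⟩, m'⟩, g2'⟩, g3'⟩, g4'⟩ _ h
      have e0 := congrFun h 0
      have e1 := congrFun h 1
      have e2 := congrFun h 2
      have e3 := congrFun h 3
      have e4 := congrFun h 4
      have e5 := congrFun h 5
      have e6 := congrFun h 6
      have e7 := congrFun h 7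
      have e8 := congrFun h 8
      simp [hφ] at e0 e1 e2 e3 e4 e5 e6 e7 e8
      have e4' : m = m' := by omega
      simp [*]
lemma typeII {α : ℝ} {a : ℤ} {q : ℕ} [NeZero q] (hc : IsCoprime a (q:ℤ)) (hα : |α - a / q| ≤ 1 / (q:ℝ)^2)
    {P L : ℝ} (hP : 1 ≤ P) (hqP : P ≤ q) (M N : ℕ) (hM : P ≤ M) (hN : P ≤ N)
    (hqY : q*P ≤ 57600*M^5*N^4*N) (hLq : 1 + Real.log q ≤ L) (hLY : 1 + Real.log (57600*M^5*N^4) ≤ L)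
    (E : ℤ → ℤ → Prop) (hE : Dom (Ioc (M:ℤ) (2*M)) (Ioc (N:ℤ) (2*N)) E)
    (u b : ℤ → ℂ) (hu : ∀ m, m ∉ Ioc (M:ℤ) (2*M) → u m = 0) :
    ‖∑ m ∈ Ioc (M:ℤ) (2*M), ∑ n ∈ Ioc (N:ℤ) (2*N), u m*b n*F2 α E (fun x => x^5) (fun x => x^5) m n‖^256 ≤
      3^183*(180219*57600)*(((∑ m ∈ Ioc (M:ℤ) (2*M), ‖u m‖^2)*(∑ n ∈ Ioc (N:ℤ) (2*N), ‖b n‖^2)*(M*N))^128*L^(4^9) / Real.sqrt P) := by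
  set I := Ioc (M:ℤ) (2*M) with hIdef
  set J := Ioc (N:ℤ) (2*N) with hJdef
  have hM1 : (1:ℝ) ≤ M := hP.trans hM
  have hN1 : (1:ℝ) ≤ N := hP.trans hN
  have hM1' : 1 ≤ M := by exact_mod_cast hM1
  have hN1' : 1 ≤ N := by exact_mod_cast hN1
  have hJc : (J.card:ℝ) = N := by
    rw [hJdef, Int.card_Ioc]
    have : (2*(N:ℤ) - N).toNat = N := by omega
    rw [this]
  have hIc : (I.card:ℝ) = M := by
    rw [hIdef, Int.card_Ioc]
    have : (2*(M:ℤ) - M).toNat = M := by omega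
    rw [this]
  have hI : ∀ x ∈ I, ∀ y ∈ I, |x - y| ≤ M := by
    intro x hx y hy; rw [hIdef, mem_Ioc] at hx hy
    rw [abs_le]; omega
  have hJ : ∀ x ∈ J, ∀ y ∈ J, |x - y| ≤ N := by
    intro x hx y hy; rw [hJdef, mem_Ioc] at hx hy
    rw [abs_le]; omega
  set p : ℤ → ℤ := fun x => x^5 with hp
  have h1 := typeII_step1 α I J M N hI hJ E hE p p u b hu
  have h2 := typeII_step2 α I J M N hI (fun h g => shn g (shm h E)) (fun h g => (hE.shm h).shn g) (fun h => df h p) (fun h => df h p)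
  have h3 := vdc3 (((((Icc (-(M:ℤ)) M ×ˢ Icc (-(N:ℤ)) N) ×ˢ Icc (-(M:ℤ)) M) ×ˢ Icc (-(M:ℤ)) M) ×ˢ Icc (-(M:ℤ)) M) ×ˢ I) J N hJ
    (fun x => F2 α (shm x.1.2 (shm x.1.1.2 (shm x.1.1.1.2 (shn x.1.1.1.1.2 (shm x.1.1.1.1.1 E)))))
          (df x.1.2 (df x.1.1.2 (df x.1.1.1.2 (df x.1.1.1.1.1 p)))) (df x.1.1.1.1.2 p) x.2)
    (fun x => ((((hE.shm _).shn _).shm _).shm _ |>.shm _).zn α _ _ _)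
  simp only [dlt_F2_n, card_product, Nat.cast_mul, card_H] at h3
  rw [hIc] at h3; rw [hJc] at h2
  set K : Fin 9 → ℕ := ![M, M, M, M, 8*M, N, N, N, N] with hK
  have hcore := core_tuples 9 hc hα hP hN hqP K 7200 (57600*M^5*N^4) (by norm_num)
    (by rw [hK]; simp [Fin.prod_univ_succ]; ring) (by
      push_cast
      have e1 : (1:ℝ) ≤ M^5 := one_le_pow₀ hM1
      have e2 : (N:ℝ) ≤ N^4 := le_self_pow₀ hN1 (by norm_num)
      have e3 : (1:ℝ)*N ≤ (57600*M^5)*N^4 := mul_le_mul (by linarith) e2 (by linarith) (by positivity)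
      linarith) (by push_cast; exact hqY) hLq (by push_cast; exact hLY) (by
        intro i; rw [hK]; fin_cases i <;> simp <;> linarith)
  have h4 := typeII_step3 α I J M N hIdef hJc E hE p hp K hK
  have h5 := h4.trans hcore
  have h6 := h3.trans (mul_le_mul_of_nonneg_left h5 (by positivity))
  clear h3 h4 h5 hcore
  have hsP : 0 < Real.sqrt P := Real.sqrt_pos.mpr (by linarith)
  have hL0 : 0 ≤ L := le_trans (by have := Real.log_natCast_nonneg q; linarith) hLq
  set A := ∑ m ∈ I, ‖u m‖^2
  set B := ∑ n ∈ J, ‖b n‖^2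
  have hA0 : 0 ≤ A := sum_nonneg fun _ _ => by positivity
  have hB0 : 0 ≤ B := sum_nonneg fun _ _ => by positivity
  rw [mul_div_assoc]
  refine typeII_num (norm_nonneg _) hA0 hB0 (norm_nonneg _) (norm_nonneg _) (by positivity) hM1 hN1 h1 h2 (h6.trans (le_of_eq ?_))
  congr 1; push_cast; rw [mul_div_assoc]; norm_num
end WG
end
section
open Finset ArithmeticFunction
open scoped ArithmeticFunction.Moebius ArithmeticFunction.zeta
namespace WG
/-- truncation to `n ≤ U` -/
noncomputable def trunc (U : ℕ) (f : ArithmeticFunction ℝ) : ArithmeticFunction ℝ := ⟨fun n => if n ≤ U then f n else 0, by simp⟩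
noncomputable def Sw (f : ArithmeticFunction ℝ) (E : ℕ → ℂ) (y : ℕ) : ℂ := ∑ m ∈ Ioc 0 y, (f m : ℂ)*E m
lemma Sw_add (f g : ArithmeticFunction ℝ) (E : ℕ → ℂ) (y : ℕ) : Sw (f + g) E y = Sw f E y + Sw g E y := by
  unfold Sw; rw [← sum_add_distrib]; refine sum_congr rfl fun m _ => ?_
  rw [ArithmeticFunction.add_apply]; push_cast; ring
lemma Sw_neg (f : ArithmeticFunction ℝ) (E : ℕ → ℂ) (y : ℕ) : Sw (-f) E y = -Sw f E y := by
  unfold Sw; rw [← sum_neg_distrib]; refine sum_congr rfl fun m _ => ?_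
  simp
lemma Sw_mul (f g : ArithmeticFunction ℝ) (E : ℕ → ℂ) (y : ℕ) : Sw (f*g) E y = ∑ d ∈ Ioc 0 y, (f d : ℂ) * ∑ e ∈ Ioc 0 (y / d), (g e : ℂ)*E (d*e) := by
  unfold Sw
  have h1 : ∀ m ∈ Ioc 0 y, (((f*g) m : ℝ) : ℂ)*E m = ∑ x ∈ (Ioc 0 y ×ˢ Ioc 0 y).filter (fun x => x.1*x.2 = m), (f x.1 : ℂ)*((g x.2 : ℂ)*E (x.1*x.2)) := by
    intro m hm; rw [mem_Ioc] at hm; rw [ArithmeticFunction.mul_apply, Nat.divisorsAntidiagonal_eq_prod_filter_of_le (by omega) hm.2]; push_cast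
    rw [sum_mul]
    refine sum_congr rfl fun x hx => ?_
    rw [(mem_filter.mp hx).2]; ring
  rw [sum_congr rfl h1]
  have h2 : ∀ m ∈ Ioc 0 y, (Ioc 0 y ×ˢ Ioc 0 y).filter (fun x => x.1*x.2 = m) = ((Ioc 0 y ×ˢ Ioc 0 y).filter (fun x => x.1*x.2 ≤ y)).filter (fun x => x.1*x.2 = m) := by
    intro m hm; rw [mem_Ioc] at hm
    ext x; simp only [mem_filter]; constructor
    · rintro ⟨h, h'⟩; exact ⟨⟨h, by omega⟩, h'⟩
    · rintro ⟨⟨h, _⟩, h'⟩; exact ⟨h, h'⟩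
  rw [sum_congr rfl fun m hm => by rw [h2 m hm], sum_fiberwise_of_maps_to, sum_filter, sum_product]
  · refine sum_congr rfl fun d hd => ?_
    rw [mem_Ioc] at hd; rw [mul_sum, ← sum_filter]
    refine sum_congr ?_ fun _ _ => rfl
    ext e; simp only [mem_filter, mem_Ioc]
    rw [Nat.le_div_iff_mul_le hd.1, mul_comm e d]
    constructor
    · rintro ⟨h, h'⟩; exact ⟨h.1, h'⟩
    · rintro ⟨h, h'⟩
      have := Nat.le_mul_of_pos_left e hd.1
      exact ⟨⟨h, by omega⟩, h'⟩
  · intro x hx; simp only [mem_filter, mem_product, mem_Ioc] at hx ⊢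
    exact ⟨Nat.mul_pos hx.1.1.1 hx.1.2.1, hx.2⟩
/-- the type II coefficient -/
noncomputable def bV (U : ℕ) : ArithmeticFunction ℝ := (ζ : ArithmeticFunction ℝ)*((μ : ArithmeticFunction ℝ) - trunc U (μ : ArithmeticFunction ℝ))
lemma vaughan (U : ℕ) : vonMangoldt = trunc U vonMangoldt + trunc U (μ : ArithmeticFunction ℝ)*log +
    -((trunc U vonMangoldt*trunc U (μ : ArithmeticFunction ℝ))*(ζ : ArithmeticFunction ℝ)) + (vonMangoldt - trunc U vonMangoldt)*bV U := by
  unfold bV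
  have h1 : (ζ : ArithmeticFunction ℝ)*(μ : ArithmeticFunction ℝ) = 1 := coe_zeta_mul_coe_moebius
  have h2 : (ζ : ArithmeticFunction ℝ)*vonMangoldt = log := zeta_mul_vonMangoldt
  rw [← h2]
  generalize trunc U vonMangoldt = a
  generalize trunc U (μ : ArithmeticFunction ℝ) = b
  linear_combination (-(vonMangoldt - a))*h1
lemma abs_moebius_real (n : ℕ) : |((μ : ArithmeticFunction ℝ) n)| ≤ 1 := by rw [intCoe_apply]; exact_mod_cast abs_moebius_le_one
lemma bV_abs (U n : ℕ) : |bV U n| ≤ dd n := by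
  unfold bV dd; rw [coe_zeta_mul_apply]
  refine (abs_sum_le_sum_abs _ _).trans ?_
  rw [card_eq_sum_ones]; push_cast
  refine sum_le_sum fun i _ => ?_
  rw [sub_eq_add_neg, ArithmeticFunction.add_apply, ArithmeticFunction.neg_apply]; simp only [trunc, ArithmeticFunction.coe_mk]
  split_ifs
  · simp
  · simpa using abs_moebius_real i
lemma bV_zero {U n : ℕ} (h : n ≤ U) : bV U n = 0 := by
  unfold bV; rw [coe_zeta_mul_apply]
  refine sum_eq_zero fun i hi => ?_
  have := Nat.divisor_le hi
  rw [sub_eq_add_neg, ArithmeticFunction.add_apply, ArithmeticFunction.neg_apply]; simp only [trunc, ArithmeticFunction.coe_mk]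
  rw [if_pos (by omega)]; ring
lemma trunc_mul_abs (U n : ℕ) : |(trunc U vonMangoldt*trunc U (μ : ArithmeticFunction ℝ)) n| ≤ Real.log n := by
  rw [← log_apply, ← vonMangoldt_mul_zeta, ArithmeticFunction.mul_apply, ArithmeticFunction.mul_apply]
  refine (abs_sum_le_sum_abs _ _).trans (sum_le_sum fun x hx => ?_)
  rw [abs_mul]
  have h0 := vonMangoldt_nonneg (n := x.1)
  have hx2 : x.2 ≠ 0 := fun h => by
    rw [Nat.mem_divisorsAntidiagonal] at hx
    rw [h, mul_zero] at hx; exact hx.2 hx.1.symm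
  refine mul_le_mul ?_ ?_ (abs_nonneg _) h0
  · simp only [trunc, ArithmeticFunction.coe_mk]
    split_ifs
    · rw [abs_of_nonneg h0]
    · simpa using h0
  · rw [natCoe_apply, zeta_apply_ne hx2]; simp only [trunc, ArithmeticFunction.coe_mk]
    split_ifs
    · simpa using abs_moebius_real x.2
    · simp
lemma trunc_mul_zero {U n : ℕ} (f g : ArithmeticFunction ℝ) (h : U*U < n) : (trunc U f*trunc U g) n = 0 := by
  rw [ArithmeticFunction.mul_apply]
  refine sum_eq_zero fun x hx => ?_
  rw [Nat.mem_divisorsAntidiagonal] at hx; simp only [trunc, ArithmeticFunction.coe_mk]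
  by_cases h1 : x.1 ≤ U
  · by_cases h2 : x.2 ≤ U
    · have := Nat.mul_le_mul h1 h2; omega
    · simp [h2]
  · simp [h1]
/-- Abel: remove a logarithm -/
lemma log_abel (z : ℕ → ℂ) (E : ℕ) (R : ℝ) (hR : ∀ j, ‖∑ e ∈ Ioc j E, z e‖ ≤ R) : ‖∑ e ∈ Ioc 0 E, ((log e : ℝ) : ℂ)*z e‖ ≤ R*Real.log E := by
  have h1 : ∀ e : ℕ, 0 < e → Real.log e = ∑ j ∈ Ioo 0 e, (Real.log (j + 1 : ℕ) - Real.log j) := by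
    intro e he
    induction e, he using Nat.le_induction with
    | base => rw [show Ioo 0 1 = ∅ from rfl]; simp
    | succ e he ih =>
      have : Ioo 0 (e+1) = insert e (Ioo 0 e) := by ext x; simp only [mem_Ioo, mem_insert]; omega
      rw [this, sum_insert (by simp), ← ih]; ring
  rcases Nat.eq_zero_or_pos E with rfl | hE
  · simp
  have h2 : ∑ e ∈ Ioc 0 E, ((log e : ℝ) : ℂ)*z e = ∑ j ∈ Ioo 0 E, ((Real.log (j + 1 : ℕ) - Real.log j : ℝ) : ℂ) * ∑ e ∈ Ioc j E, z e := by
    have : ∀ e ∈ Ioc 0 E, ((log e : ℝ) : ℂ)*z e = ∑ j ∈ Ioo 0 E, if j < e then ((Real.log (j + 1 : ℕ) - Real.log j : ℝ) : ℂ)*z e else 0 := by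
      intro e he; rw [mem_Ioc] at he; rw [log_apply, h1 e he.1, Complex.ofReal_sum, sum_mul, ← sum_filter]
      refine sum_congr ?_ fun _ _ => rfl
      ext j; simp only [mem_filter, mem_Ioo]; omega
    rw [sum_congr rfl this, sum_comm]
    refine sum_congr rfl fun j hj => ?_
    rw [mul_sum, ← sum_filter]
    refine sum_congr ?_ fun _ _ => rfl
    rw [mem_Ioo] at hj
    ext e; simp only [mem_filter, mem_Ioc]; omega
  rw [h2, h1 E hE, mul_sum]
  refine norm_sum_le_of_le _ fun j hj => ?_
  rw [mem_Ioo] at hj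
  have h3 : 0 ≤ Real.log (j + 1 : ℕ) - Real.log j := by
    rw [sub_nonneg]
    exact Real.log_le_log (by exact_mod_cast hj.1) (by push_cast; linarith)
  rw [norm_mul, Complex.norm_real, Real.norm_of_nonneg h3, mul_comm]; exact mul_le_mul_of_nonneg_right (hR j) h3
/-- natural intervals to integer intervals -/
lemma sum_Ioc_cast (a b : ℕ) (f : ℤ → ℂ) : ∑ m ∈ Ioc (a:ℤ) b, f m = ∑ m ∈ Ioc a b, f (m:ℤ) := by
  symm
  refine sum_nbij' (fun m => (m:ℤ)) (fun m => m.toNat) ?_ ?_ ?_ ?_ ?_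
  · intro m hm; rw [mem_Ioc] at *; omega
  · intro m hm; rw [mem_Ioc] at *; omega
  · intro m hm; simp
  · intro m hm; rw [mem_Ioc] at hm; simp; omega
  · intro m _; rfl
lemma dyadic_sum (U k : ℕ) (f : ℕ → ℂ) : ∑ m ∈ Ioc U (2^k*U), f m = ∑ i ∈ range k, ∑ m ∈ Ioc (2^i*U) (2*(2^i*U)), f m := by
  induction k with
  | zero => simp
  | succ k ih =>
    rw [sum_range_succ, ← ih, ← sum_Ioc_consecutive f (n := 2^k*U)]
    · rw [pow_succ]; congr 3; ring
    · exact Nat.le_mul_of_pos_left U (by positivity)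
    · exact Nat.mul_le_mul_right U (Nat.pow_le_pow_right (by norm_num) (by omega))
lemma ev_log (C : ℝ) : ∃ X0 : ℝ, ∀ X ≥ X0, C ≤ Real.log X ∧ C ≤ X := by
  refine ⟨Real.exp |C|, fun X hX => ?_⟩
  have hX0 : 0 < X := lt_of_lt_of_le (Real.exp_pos _) hX
  refine ⟨?_, ?_⟩
  · exact (le_abs_self C).trans ((Real.le_log_iff_exp_le hX0).mpr hX)
  · have := Real.add_one_le_exp |C|
    have := le_abs_self C
    linarith
lemma ev_pow (C : ℝ) (k : ℕ) : ∃ X0 : ℝ, ∀ X ≥ X0, C*Real.log X^k ≤ X := by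
  have h1 := (Real.isLittleO_pow_log_id_atTop (n := k)).def (c := 1 / (|C| + 1)) (by positivity)
  obtain ⟨X0, hX0⟩ := Filter.eventually_atTop.mp h1
  refine ⟨max X0 1, fun X hX => ?_⟩
  have h2 := hX0 X ((le_max_left _ _).trans hX)
  have hX1 : 1 ≤ X := (le_max_right _ _).trans hX
  have hl : 0 ≤ Real.log X := Real.log_nonneg hX1
  rw [id, Real.norm_of_nonneg (by positivity), Real.norm_of_nonneg (by positivity)] at h2
  calc C*Real.log X^k ≤ (|C| + 1)*Real.log X^k := by gcongr; linarith [le_abs_self C]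
    _ ≤ (|C| + 1)*(1 / (|C| + 1)*X) := by gcongr
    _ = X := by field_simp
/-- minor arc condition for fifth powers -/
def MA (B : ℕ) (X α : ℝ) (a : ℤ) (q : ℕ) : Prop := IsCoprime a (q:ℤ) ∧ |α - a / q| ≤ 1 / (q:ℝ)^2 ∧ Real.log X^B ≤ q ∧ q*Real.log X^B ≤ X^5
lemma MA.mono {B B' : ℕ} {X α : ℝ} {a : ℤ} {q : ℕ} (h : MA B X α a q) (hB : B' ≤ B) (hl : 1 ≤ Real.log X) : MA B' X α a q := by
  have := pow_le_pow_right₀ hl hB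
  exact ⟨h.1, h.2.1, this.trans h.2.2.1, (mul_le_mul_of_nonneg_left this (by positivity)).trans h.2.2.2⟩
lemma typeI_bound (A b : ℕ) : ∃ B : ℕ, ∃ X0 : ℝ, ∀ X ≥ X0, ∀ (α : ℝ) (a : ℤ) (q : ℕ), MA B X α a q → ∀ k : ℕ, 1 ≤ k → (k:ℝ) ≤ Real.log X^b → ∀ j E : ℕ, (k:ℝ)*E ≤ 2*X →
      ‖∑ e ∈ Ioc j E, ee (α*((k*e : ℕ):ℝ)^5)‖ ≤ X*(Real.log X)⁻¹^A := by
  obtain ⟨C, hC⟩ : ∃ C : ℝ, C = 3^11*420*120*3^16*20^256 := ⟨_, rfl⟩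
  obtain ⟨X1, hX1⟩ := ev_log (max C 100000)
  obtain ⟨B', hB'⟩ : ∃ B', B' = 5*b + 256 + 16*A + 1 := ⟨_, rfl⟩
  obtain ⟨X2, hX2⟩ := ev_pow 1 (2*B' + b)
  refine ⟨2*B', max X1 X2, fun X hX α a q hMA k hk hkb j E hkE => ?_⟩
  obtain ⟨hl, hX⟩ := (⟨hX1 X ((le_max_left _ _).trans hX), hX2 X ((le_max_right _ _).trans hX)⟩ : _ ∧ _)
  set l := Real.log X with hldef
  have hlC : C ≤ l := (le_max_left _ _).trans hl.1
  have hl1 : 100000 ≤ l := (le_max_right _ _).trans hl.1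
  have hXb : 100000 ≤ X := (le_max_right _ _).trans hl.2
  have hX0 : 0 < X := by linarith
  obtain ⟨hco, hα, hq1, hq2⟩ := hMA
  have hlp : ∀ i : ℕ, 1 ≤ l^i := fun i => one_le_pow₀ (by linarith)
  have hq0 : 1 ≤ (q:ℝ) := (hlp _).trans hq1
  have : NeZero q := ⟨fun h => by rw [h] at hq0; norm_num at hq0⟩
  have hk1 : (1:ℝ) ≤ k := by exact_mod_cast hk
  have hkX : l^(2*B')*k ≤ X := by
    calc l^(2*B')*k ≤ l^(2*B')*l^b := by gcongr
      _ = 1*l^(2*B'+b) := by rw [one_mul, pow_add]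
      _ ≤ X := hX
  have hkX' : (k:ℝ) ≤ X := le_trans (by have := hlp (2*B'); nlinarith) hkX
  set N := ⌈2*X / k⌉₊ with hN
  have hN1 : 2*X ≤ k*N := by
    have := Nat.le_ceil (2*X / k)
    rw [div_le_iff₀ (by linarith)] at this; linarith [mul_comm (k:ℝ) N]
  have hN2 : k*(N:ℝ) ≤ 3*X := by
    have := Nat.ceil_lt_add_one (a := 2*X / k) (by positivity)
    rw [← hN] at this
    calc k*(N:ℝ) ≤ k*(2*X / k + 1) := by gcongr
      _ = 2*X + k := by field_simp
      _ ≤ _ := by linarith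
  have hN3 : (N:ℝ) ≤ 3*X := le_trans (le_mul_of_one_le_left (by positivity) hk1) hN2
  have hPN : l^(2*B') ≤ N := by
    have : k*l^(2*B') ≤ k*N := by linarith
    exact le_of_mul_le_mul_left this (by linarith)
  have hN0 : (1:ℝ) ≤ N := (hlp _).trans hPN
  have hEN : E ≤ N := by
    have : (k:ℝ)*E ≤ k*N := by linarith
    exact_mod_cast le_of_mul_le_mul_left this (by linarith)
  have hkN5 : (k:ℝ)^5*N^5 = (k*N)^5 := by ring
  have hmain := weyl_interval hco hα (P := l^(2*B')) (L := 20*l) (hlp _) hq1 N k hk hPN (by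
      calc (q:ℝ)*l^(2*B') ≤ X^5 := hq2
        _ ≤ (k*N)^5 := by gcongr; linarith
        _ ≤ 120*(k*N)^5 := by linarith [show 0 ≤ (k*(N:ℝ))^5 by positivity]
        _ = _ := by ring) (by
      have h1 : (q:ℝ) ≤ X^5 := le_trans (le_mul_of_one_le_right (by positivity) (hlp _)) hq2
      have := Real.log_le_log (by linarith) h1
      rw [Real.log_pow] at this; push_cast at this; linarith) (by
      have h1 : 120*(k:ℝ)^5*N^4 ≤ X^6 := by
        calc 120*(k:ℝ)^5*(N:ℝ)^4 ≤ 120*(k:ℝ)^5*((N:ℝ)^4*N) := by gcongr; exact le_mul_of_one_le_right (by positivity) hN0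
          _ = 120*((k:ℝ)*N)^5 := by ring
          _ ≤ 120*(3*X)^5 := by gcongr
          _ = 29160*X^5 := by ring
          _ ≤ X*X^5 := by gcongr; linarith
          _ = X^6 := by ring
      have := Real.log_le_log (by positivity) h1
      rw [Real.log_pow] at this; push_cast at this; linarith)
    (fun n => (j:ℤ) < n ∧ n ≤ E) (fun x y z hx hy h1 h2 => ⟨by linarith [hx.1], by linarith [hy.2]⟩)
    (fun n hn => by rw [mem_Ioc]; omega)
  have hsum : ∑ n ∈ Ioc (0:ℤ) N, P1 (α*k^5) (fun n => (j:ℤ) < n ∧ n ≤ E) (fun n => n^5) n = ∑ e ∈ Ioc j E, ee (α*((k*e : ℕ):ℝ)^5) := by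
    have : ∑ e ∈ Ioc j E, ee (α*((k*e : ℕ):ℝ)^5) = ∑ e ∈ Ioc (j:ℤ) E, ee (α*((k:ℝ)*e)^5) := by rw [sum_Ioc_cast]; simp
    rw [this]; simp only [P1]
    rw [← sum_filter]
    refine sum_congr ?_ fun n _ => ?_
    · ext n; simp only [mem_filter, mem_Ioc]; omega
    · congr 1; push_cast; ring
  rw [hsum, show 2*B' = B' * 2 by ring, pow_mul, Real.sqrt_sq (by positivity)] at hmain
  refine le_of_pow_le_pow_left₀ (n := 16) (by norm_num) (by positivity) (hmain.trans ?_)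
  have h0 : 0 < l := by linarith
  calc _ ≤ 3^11*420*120*((l^b)^5*(3*X)^16*(20*l)^256 / l^B') := by gcongr
    _ = C*(X^16*(l^(5*b+256) / l^B')) := by rw [hC, pow_add l (5*b) 256, mul_comm 5 b, pow_mul]; ring
    _ ≤ l*(X^16*(l^(5*b+256) / l^B')) := by gcongr
    _ = (X*l⁻¹^A)^16 := by rw [hB', mul_pow, ← pow_mul, inv_pow, pow_add l (5*b+256+16*A) 1, pow_add l (5*b+256) (16*A), mul_comm A 16]; field_simp
end WG
end
section
open Finset ArithmeticFunction
namespace WG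
noncomputable def B2 (α : ℝ) (y : ℕ) (u b : ℕ → ℝ) (M N : ℕ) : ℂ :=
  ∑ m ∈ Ioc M (2*M), ∑ n ∈ Ioc N (2*N), if m*n ≤ y then (u m : ℂ)*(b n : ℂ)*ee (α*((m*n : ℕ):ℝ)^5) else 0
lemma sum_Ioc_cast_real (a b : ℕ) (f : ℤ → ℝ) : ∑ m ∈ Ioc (a:ℤ) b, f m = ∑ m ∈ Ioc a b, f (m:ℤ) := by
  have h := sum_Ioc_cast a b (fun m => (f m : ℂ))
  exact_mod_cast h
lemma B2_typeII {α : ℝ} {a : ℤ} {q : ℕ} [NeZero q] (hc : IsCoprime a (q:ℤ)) (hα : |α - a / q| ≤ 1 / (q:ℝ)^2)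
    {P L : ℝ} (hP : 1 ≤ P) (hqP : P ≤ q) (M N : ℕ) (hM : P ≤ M) (hN : P ≤ N)
    (hqY : q*P ≤ 57600*M^5*N^4*N) (hLq : 1 + Real.log q ≤ L) (hLY : 1 + Real.log (57600*M^5*N^4) ≤ L)
    (y : ℕ) (u b : ℕ → ℝ) :
    ‖B2 α y u b M N‖^256 ≤ 3^183*(180219*57600)*(((∑ m ∈ Ioc M (2*M), (u m)^2)*(∑ n ∈ Ioc N (2*N), (b n)^2)*(M*N))^128*L^(4^9) / Real.sqrt P) := by
  have h := typeII hc hα hP hqP M N hM hN hqY hLq hLY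
    (fun m n => m ∈ Ioc (M:ℤ) (2*M) ∧ n ∈ Ioc (N:ℤ) (2*N) ∧ m*n ≤ y)
    ⟨fun m n h => ⟨h.1, h.2.1⟩, fun m x z w hx hz h1 h2 => ⟨hx.1, by
      have := hx.2.1; have := hz.2.1; rw [mem_Ioc] at *; omega, by
      have hm := hx.1
      rw [mem_Ioc] at hm
      exact (mul_le_mul_of_nonneg_left h2 (by omega)).trans hz.2.2⟩⟩
    (fun m => if m ∈ Ioc (M:ℤ) (2*M) then ((u m.toNat : ℝ) : ℂ) else 0) (fun n => ((b n.toNat : ℝ):ℂ)) (fun m hm => if_neg hm)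
  rw [show (2*(M:ℤ)) = ((2*M:ℕ):ℤ) by push_cast; rfl, show (2*(N:ℤ)) = ((2*N:ℕ):ℤ) by push_cast; rfl] at h
  simp only [sum_Ioc_cast, sum_Ioc_cast_real] at h
  have e1 : B2 α y u b M N = ∑ m ∈ Ioc M (2*M), ∑ n ∈ Ioc N (2*N), (if (m:ℤ) ∈ Ioc (M:ℤ) ((2*M:ℕ):ℤ) then ((u (m:ℤ).toNat : ℝ) : ℂ) else 0)
      * ((b (n:ℤ).toNat : ℝ):ℂ)*F2 α (fun m n => m ∈ Ioc (M:ℤ) ((2*M:ℕ):ℤ) ∧ n ∈ Ioc (N:ℤ) ((2*N:ℕ):ℤ) ∧ m*n ≤ y) (fun x => x^5) (fun x => x^5) m n := by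
    unfold B2 F2
    refine sum_congr rfl fun m hm => sum_congr rfl fun n hn => ?_
    have hm' : (m:ℤ) ∈ Ioc (M:ℤ) ((2*M:ℕ):ℤ) := by rw [mem_Ioc] at *; omega
    have hn' : (n:ℤ) ∈ Ioc (N:ℤ) ((2*N:ℕ):ℤ) := by rw [mem_Ioc] at *; omega
    have : ((m:ℤ)*n ≤ y) ↔ m*n ≤ y := by exact_mod_cast Iff.rfl
    rw [if_pos hm']; simp only [hm', hn', this, true_and, Int.toNat_natCast]
    split_ifs
    · push_cast; rw [mul_pow]
    · simp
  have e2 : ∑ m ∈ Ioc M (2*M), ‖(if (m:ℤ) ∈ Ioc (M:ℤ) ((2*M:ℕ):ℤ) then ((u (m:ℤ).toNat : ℝ) : ℂ) else 0)‖^2 = ∑ m ∈ Ioc M (2*M), (u m)^2 := by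
    refine sum_congr rfl fun m hm => ?_
    have hm' : (m:ℤ) ∈ Ioc (M:ℤ) ((2*M:ℕ):ℤ) := by rw [mem_Ioc] at *; omega
    rw [if_pos hm', Complex.norm_real, Real.norm_eq_abs, sq_abs, Int.toNat_natCast]
  have e3 : ∑ n ∈ Ioc N (2*N), ‖((b (n:ℤ).toNat : ℝ):ℂ)‖^2 = ∑ n ∈ Ioc N (2*N), (b n)^2 := by
    refine sum_congr rfl fun m hm => ?_
    rw [Complex.norm_real, Real.norm_eq_abs, sq_abs, Int.toNat_natCast]
  rw [e1]; rw [e2, e3] at h; exact h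
lemma B2_trivial (α : ℝ) (y : ℕ) (u b : ℕ → ℝ) (M N : ℕ) : ‖B2 α y u b M N‖ ≤ (∑ m ∈ Ioc M (2*M), |u m|) * ∑ n ∈ Ioc N (2*N), |b n| := by
  unfold B2; rw [sum_mul_sum]
  refine (norm_sum_le _ _).trans (sum_le_sum fun m _ => (norm_sum_le _ _).trans (sum_le_sum fun n _ => ?_))
  split_ifs
  · rw [norm_mul, norm_mul, norm_ee, Complex.norm_real, Complex.norm_real, mul_one]; rfl
  · simp; positivity
lemma B2_zero (α : ℝ) (y : ℕ) (u b : ℕ → ℝ) (M N : ℕ) (h : y < M*N) : B2 α y u b M N = 0 := by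
  refine sum_eq_zero fun m hm => sum_eq_zero fun n hn => if_neg ?_
  rw [mem_Ioc] at *
  have := Nat.mul_le_mul hm.1.le hn.1.le
  omega
lemma dd_block (r N : ℕ) (b : ℕ → ℝ) (hb : ∀ n, |b n| ≤ dd n) (l : ℝ) (hl : 1 + Real.log (2*N) ≤ l) : ∑ n ∈ Ioc N (2*N), |b n|^r ≤ 2*N*l^(2^r) := by
  calc ∑ n ∈ Ioc N (2*N), |b n|^r ≤ ∑ n ∈ Icc 1 (2*N), |b n|^r := by
        refine sum_le_sum_of_subset_of_nonneg (fun x hx => ?_) fun _ _ _ => by positivity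
        rw [mem_Ioc] at hx; rw [mem_Icc]; omega
    _ ≤ ∑ n ∈ Icc 1 (2*N), dd n^r := sum_le_sum fun n _ => by gcongr; exact hb n
    _ ≤ _ := div_moment' r (2*N)
    _ ≤ _ := by
      push_cast
      have : 0 ≤ Real.log (2*N) := by
        have := Real.log_natCast_nonneg (2*N); push_cast at this; exact this
      gcongr
lemma typeII_dyadic (A : ℕ) : ∃ b B : ℕ, ∃ X0 : ℝ, ∀ X ≥ X0, ∀ (α : ℝ) (a : ℤ) (q : ℕ), MA B X α a q →
    ∀ M N y : ℕ, Real.log X^b ≤ M → Real.log X^b ≤ N → (y:ℝ) ≤ 2*X → ∀ u v : ℕ → ℝ, (∀ m, |u m| ≤ Real.log m) → (∀ n, |v n| ≤ dd n) →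
      ‖B2 α y u v M N‖ ≤ X*(Real.log X)⁻¹^A := by
  obtain ⟨e, he⟩ : ∃ e : ℕ, e = 4^9 := ⟨_, rfl⟩
  obtain ⟨C, hC⟩ : ∃ C : ℝ, C = 3^183*(180219*57600)*(648^128*2^256*20^e) := ⟨_, rfl⟩
  obtain ⟨X1, hX1⟩ := ev_log (max C (2^30))
  obtain ⟨b', hb'⟩ : ∃ b', b' = 768 + e + 256*A + 1 := ⟨_, rfl⟩
  refine ⟨2*b', 2*b' + 5*(A + 4), X1, fun X hX α a q hMA M N y hM hN hy u v hu hv => ?_⟩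
  have hl := hX1 X hX
  set l := Real.log X with hldef
  have hlC : C ≤ l := (le_max_left _ _).trans hl.1
  have hl1 : 2^30 ≤ l := (le_max_right _ _).trans hl.1
  have hXb : 2^30 ≤ X := (le_max_right _ _).trans hl.2
  have hX0 : 0 < X := by linarith
  obtain ⟨hco, hα, hq1, hq2⟩ := hMA
  rw [← hldef] at hq1 hq2
  have hl0 : 0 < l := by linarith
  have hlp : ∀ i : ℕ, 1 ≤ l^i := fun i => one_le_pow₀ (by linarith)
  have hq0 : 1 ≤ (q:ℝ) := (hlp _).trans hq1
  have : NeZero q := ⟨fun h => by rw [h] at hq0; norm_num at hq0⟩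
  rcases lt_or_ge y (M*N) with hyMN | hyMN
  · rw [B2_zero _ _ _ _ _ _ hyMN]; simp; positivity
  have hMN : (M:ℝ)*N ≤ 2*X := le_trans (by exact_mod_cast hyMN) hy
  have hM1 : (1:ℝ) ≤ M := (hlp _).trans hM
  have hN1 : (1:ℝ) ≤ N := (hlp _).trans hN
  have hMX : (M:ℝ) ≤ 2*X := (le_mul_of_one_le_right (by positivity) hN1).trans hMN
  have hNX : (N:ℝ) ≤ 2*X := (le_mul_of_one_le_left (by positivity) hM1).trans hMN
  have hlog4 : Real.log (4*X) ≤ 2*l := by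
    rw [Real.log_mul (by norm_num) hX0.ne']
    have := Real.log_le_sub_one_of_pos (show (0:ℝ) < 4 by norm_num)
    linarith
  have hum : ∀ m ∈ Ioc M (2*M), |u m| ≤ 2*l := by
    intro m hm; rw [mem_Ioc] at hm
    have : (m:ℝ) ≤ 2*M := by exact_mod_cast hm.2
    have hm0 : (0:ℝ) < m := by exact_mod_cast (by omega : 0 < m)
    exact (hu m).trans ((Real.log_le_log hm0 (by linarith)).trans hlog4)
  have hcard : (#(Ioc M (2*M)):ℝ) = M := by rw [Nat.card_Ioc]; congr 1; omega
  have hu1 : ∑ m ∈ Ioc M (2*M), |u m| ≤ M*(2*l) := by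
    refine (sum_le_card_nsmul _ _ _ hum).trans (le_of_eq ?_)
    rw [nsmul_eq_mul, hcard]
  have hu2 : ∑ m ∈ Ioc M (2*M), (u m)^2 ≤ M*(2*l)^2 := by
    refine (sum_le_card_nsmul _ _ ((2*l)^2) (fun m hm => ?_)).trans (le_of_eq ?_)
    · rw [← sq_abs]; gcongr; exact hum m hm
    rw [nsmul_eq_mul, hcard]
  have hlogN : 1 + Real.log (2*N) ≤ 3*l := by
    have := (Real.log_le_log (by linarith) (by linarith : 2*(N:ℝ) ≤ 4*X)).trans hlog4
    linarith
  have hv1 := dd_block 1 N v hv _ hlogN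
  have hv2 := dd_block 2 N v hv _ hlogN
  simp only [pow_one, sq_abs] at hv1 hv2
  rcases le_or_gt ((M:ℝ)*N) (X / l^(A+4)) with hs | hs
  · calc ‖B2 α y u v M N‖ ≤ _ := B2_trivial _ _ _ _ _ _
      _ ≤ (M*(2*l))*(2*N*(3*l)^2) := by gcongr
      _ = 36*l^3*(M*N) := by ring
      _ ≤ l*l^3*(X / l^(A+4)) := by gcongr; linarith
      _ = X*l⁻¹^A := by rw [pow_add, inv_pow]; field_simp
  · have hmain := B2_typeII hco hα (P := l^(2*b')) (L := 20*l) (hlp _) ((pow_le_pow_right₀ (by linarith) (by omega)).trans hq1)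
      M N hM hN (by
        rw [pow_add, ← mul_assoc] at hq2
        calc (q:ℝ)*l^(2*b') ≤ X^5 / l^(5*(A+4)) := by rw [le_div_iff₀ (by positivity)]; exact hq2
          _ = (X / l^(A+4))^5 := by rw [div_pow, ← pow_mul, mul_comm 5]
          _ ≤ ((M:ℝ)*N)^5 := by gcongr
          _ ≤ 57600*((M:ℝ)*N)^5 := by
            have : 0 ≤ ((M:ℝ)*N)^5 := by positivity
            linarith
          _ = _ := by ring) (by
        have h1 : (q:ℝ) ≤ X^5 := le_trans (le_mul_of_one_le_right (by positivity) (hlp _)) hq2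
        have := Real.log_le_log (by linarith) h1
        rw [Real.log_pow] at this; push_cast at this; linarith) (by
        have h1 : 57600*(M:ℝ)^5*(N:ℝ)^4 ≤ X^6 := by
          calc 57600*(M:ℝ)^5*(N:ℝ)^4 ≤ 57600*(M:ℝ)^5*((N:ℝ)^4*N) := by gcongr; exact le_mul_of_one_le_right (by positivity) hN1
            _ = 57600*((M:ℝ)*N)^5 := by ring
            _ ≤ 57600*(2*X)^5 := by gcongr
            _ = 1843200*X^5 := by ring
            _ ≤ X*X^5 := by gcongr; linarith
            _ = X^6 := by ring
        have := Real.log_le_log (by positivity) h1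
        rw [Real.log_pow] at this; push_cast at this; linarith) y u v
    rw [← he, show 2*b' = b' * 2 by ring, pow_mul, Real.sqrt_sq (by positivity)] at hmain
    refine le_of_pow_le_pow_left₀ (n := 256) (by norm_num) (by positivity) (hmain.trans ?_)
    have hs1 : 0 ≤ ∑ m ∈ Ioc M (2*M), (u m)^2 := sum_nonneg fun _ _ => by positivity
    have hs2 : 0 ≤ ∑ m ∈ Ioc N (2*N), (v m)^2 := sum_nonneg fun _ _ => by positivity
    calc _ ≤ 3^183*(180219*57600)*(((M*(2*l)^2)*(2*N*(3*l)^(2^2))*(M*N))^128*(20*l)^e / l^b') := by gcongr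
      _ = 3^183*(180219*57600)*((648*l^6*((M:ℝ)*N)^2)^128*(20*l)^e / l^b') := by congr 4; ring
      _ ≤ 3^183*(180219*57600)*((648*l^6*(2*X)^2)^128*(20*l)^e / l^b') := by gcongr
      _ = C*(X^256*(l^(768+e) / l^b')) := by
        have q1 : (648*l^6*(2*X)^2)^128 = 648^128*(l^768*(2^256*X^256)) := by
          rw [mul_pow, mul_pow, mul_pow, mul_pow, ← pow_mul, ← pow_mul, ← pow_mul, mul_assoc]
        rw [hC, pow_add l 768 e, mul_pow (20:ℝ) l e, q1]
        generalize (3:ℝ)^183 = c1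
        generalize (648:ℝ)^128 = c2
        generalize (2:ℝ)^256 = c3
        generalize X^256 = c4
        generalize l^768 = c5
        ring
      _ ≤ l*(X^256*(l^(768+e) / l^b')) := by gcongr
      _ = (X*l⁻¹^A)^256 := by
        have q2 : l^b' = l^(768+e)*l^(A*256)*l := by rw [hb', ← pow_add, ← pow_succ]; congr 1; ring
        rw [q2, mul_pow X, ← pow_mul, inv_pow]; field_simp
end WG
end
section
open Finset ArithmeticFunction
open scoped ArithmeticFunction.Moebius ArithmeticFunction.zeta
namespace WG
lemma supp_bound (y V : ℕ) (c : ℕ → ℝ) (z : ℕ → ℂ) (C R : ℝ) (hC : 0 ≤ C) (hR : 0 ≤ R) (h0 : ∀ d, V < d → c d = 0)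
    (h1 : ∀ d, 1 ≤ d → d ≤ V → |c d| ≤ C) (h2 : ∀ d, 1 ≤ d → d ≤ V → ‖z d‖ ≤ R) :
    ‖∑ d ∈ Ioc 0 y, (c d : ℂ)*z d‖ ≤ V*(C*R) := by
  calc ‖∑ d ∈ Ioc 0 y, (c d : ℂ)*z d‖ ≤ ∑ d ∈ Ioc 0 y, if d ≤ V then C*R else 0 := by
        refine (norm_sum_le _ _).trans (sum_le_sum fun d hd => ?_)
        rw [mem_Ioc] at hd
        split_ifs with h
        · rw [norm_mul, Complex.norm_real, Real.norm_eq_abs]; exact mul_le_mul (h1 d hd.1 h) (h2 d hd.1 h) (norm_nonneg _) hC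
        · rw [h0 d (by omega)]; simp
    _ = ∑ d ∈ (Ioc 0 y).filter (· ≤ V), C*R := by rw [sum_filter]
    _ ≤ ∑ d ∈ Ioc 0 V, C*R := by
        refine sum_le_sum_of_subset_of_nonneg (fun x hx => ?_) fun _ _ _ => by positivity
        rw [mem_filter, mem_Ioc] at hx; rw [mem_Ioc]; omega
    _ = _ := by rw [sum_const, Nat.card_Ioc, nsmul_eq_mul, Nat.sub_zero]
lemma Sw_blocks (α : ℝ) (y U K : ℕ) (hK : y ≤ 2^K*U) (u v : ArithmeticFunction ℝ) (hu : ∀ m, m ≤ U → u m = 0)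
    (hv : ∀ m, m ≤ U → v m = 0) :
    Sw (u*v) (fun m => ee (α*((m:ℕ):ℝ)^5)) y = ∑ i ∈ range K, ∑ j ∈ range K, B2 α y u v (2^i*U) (2^j*U) := by
  have key : Sw (u*v) (fun m => ee (α*((m:ℕ):ℝ)^5)) y = ∑ d ∈ Ioc U (2^K*U), ∑ e ∈ Ioc U (2^K*U),
      if d*e ≤ y then (u d : ℂ)*(v e : ℂ)*ee (α*((d*e : ℕ):ℝ)^5) else 0 := by
    rw [Sw_mul]
    have h1 : ∀ d ∈ Ioc 0 y, (u d : ℂ) * ∑ e ∈ Ioc 0 (y/d), (v e : ℂ)*ee (α*((d*e : ℕ):ℝ)^5) =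
        ∑ e ∈ Ioc U (2^K*U), if d*e ≤ y then (u d : ℂ)*(v e : ℂ)*ee (α*((d*e : ℕ):ℝ)^5) else 0 := by
      intro d hd; rw [mem_Ioc] at hd; rw [mul_sum, ← sum_filter]
      symm
      refine sum_subset_zero_on_sdiff (fun e he => ?_) (fun e he => ?_) (fun e he => by ring)
      · rw [mem_filter, mem_Ioc] at he; rw [mem_Ioc, Nat.le_div_iff_mul_le hd.1]
        exact ⟨by omega, by rw [mul_comm]; exact he.2⟩
      · rw [mem_sdiff, mem_filter, mem_Ioc, mem_Ioc, Nat.le_div_iff_mul_le hd.1] at he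
        have : e ≤ U := by
          by_contra hc
          refine he.2 ⟨⟨by omega, ?_⟩, by rw [mul_comm]; exact he.1.2⟩
          have : e ≤ e*d := Nat.le_mul_of_pos_right e hd.1
          omega
        rw [hv e this]; simp
    rw [sum_congr rfl h1]
    have h2 : ∀ d ∈ Ioc U (2^K*U) \ Ioc 0 y, ∑ e ∈ Ioc U (2^K*U), (if d*e ≤ y then (u d : ℂ)*(v e : ℂ)*ee (α*((d*e : ℕ):ℝ)^5) else 0) = 0 := by
      intro d hd; rw [mem_sdiff, mem_Ioc, mem_Ioc] at hd
      refine sum_eq_zero fun e he => if_neg ?_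
      rw [mem_Ioc] at he
      have : d ≤ d*e := Nat.le_mul_of_pos_right d (by omega)
      omega
    have h3 : ∀ d ∈ Ioc 0 y \ Ioc U (2^K*U), ∑ e ∈ Ioc U (2^K*U), (if d*e ≤ y then (u d : ℂ)*(v e : ℂ)*ee (α*((d*e : ℕ):ℝ)^5) else 0) = 0 := by
      intro d hd; rw [mem_sdiff, mem_Ioc, mem_Ioc] at hd
      refine sum_eq_zero fun e he => ?_
      rw [hu d (by omega)]; simp
    have e1 := sum_subset_zero_on_sdiff (subset_union_left (s₁ := Ioc 0 y) (s₂ := Ioc U (2^K*U)))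
      (fun d hd => h2 d (by rw [union_sdiff_left] at hd; exact hd)) (fun d _ => rfl)
    have e2 := sum_subset_zero_on_sdiff (subset_union_right (s₁ := Ioc 0 y) (s₂ := Ioc U (2^K*U)))
      (fun d hd => h3 d (by rw [union_sdiff_right] at hd; exact hd)) (fun d _ => rfl)
    exact e1.trans e2.symm
  rw [key, dyadic_sum]
  refine sum_congr rfl fun i _ => ?_
  unfold B2; rw [sum_comm (s := range K)]
  refine sum_congr rfl fun d _ => ?_
  exact dyadic_sum U K _
theorem expsum5 (A : ℕ) : ∃ B : ℕ, ∃ X0 : ℝ, ∀ X ≥ X0, ∀ (α : ℝ) (a : ℤ) (q : ℕ), MA B X α a q →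
    ∀ y : ℕ, (y:ℝ) ≤ 2*X → ‖∑ m ∈ Ioc 0 y, ((vonMangoldt m : ℝ) : ℂ)*ee (α*(m:ℝ)^5)‖ ≤ X*(Real.log X)⁻¹^A := by
  obtain ⟨b, B2', X2, hII⟩ := typeII_dyadic (A + 4)
  obtain ⟨A1, hA1⟩ : ∃ A1, A1 = A + 4*b + 6 := ⟨_, rfl⟩
  obtain ⟨B1, X1, hI⟩ := typeI_bound A1 (2*b+2)
  obtain ⟨X3, hX3⟩ := ev_log 100
  obtain ⟨X4, hX4⟩ := ev_pow 1 (A + 1 + 2*b + 2)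
  refine ⟨max B1 B2', max (max X1 X2) (max X3 X4), fun X hX α a q hMA y hy => ?_⟩
  obtain ⟨hl, hX100⟩ := hX3 X (le_trans (by simp) hX)
  have hbig := hX4 X (le_trans (by simp) hX)
  have hI := hI X (le_trans (by simp) hX) α a q (hMA.mono (le_max_left _ _) (by linarith))
  have hII := hII X (le_trans (by simp) hX) α a q (hMA.mono (le_max_right _ _) (by linarith))
  set l := Real.log X with hldef
  have hX0 : 0 < X := by linarith
  have hl0 : 0 < l := by linarith
  have hlp : ∀ i : ℕ, 1 ≤ l^i := fun i => one_le_pow₀ (by linarith)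
  rcases Nat.eq_zero_or_pos y with rfl | hy0
  · simp; positivity
  have hy1 : (1:ℝ) ≤ y := by exact_mod_cast hy0
  have hlogy : Real.log y ≤ 2*l := by
    refine (Real.log_le_log (by linarith) hy).trans ?_
    rw [Real.log_mul (by norm_num) hX0.ne']
    have := Real.log_le_sub_one_of_pos (show (0:ℝ) < 2 by norm_num)
    linarith
  obtain ⟨U, hU⟩ : ∃ U : ℕ, U = ⌈l^b⌉₊ := ⟨_, rfl⟩
  have hU1 : l^b ≤ U := hU ▸ Nat.le_ceil _
  have hU2 : (U:ℝ) ≤ l^(b+1) := by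
    have := Nat.ceil_lt_add_one (a := l^b) (by positivity)
    rw [← hU] at this
    have h1 := hlp b
    calc (U:ℝ) ≤ l^b + 1 := this.le
      _ ≤ l^b + l^b := by linarith
      _ = l^b*2 := by ring
      _ ≤ l^b*l := by gcongr; linarith
      _ = _ := (pow_succ _ _).symm
  have hU0 : (1:ℝ) ≤ U := (hlp _).trans hU1
  have hU0' : 1 ≤ U := by exact_mod_cast hU0
  have hUU : ((U*U : ℕ):ℝ) ≤ l^(2*b+2) := by
    push_cast
    calc (U:ℝ)*U ≤ l^(b+1)*l^(b+1) := by gcongr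
      _ = _ := by rw [← pow_add]; congr 1; ring
  set E : ℕ → ℂ := fun m => ee (α*((m:ℕ):ℝ)^5) with hE
  set R := X*l⁻¹^A1 with hR
  have hR0 : 0 ≤ R := by positivity
  set Z := X*l⁻¹^(A+1) with hZ
  -- (i)
  have t1 : ‖Sw (trunc U vonMangoldt) E y‖ ≤ Z := by
    have h := supp_bound y U (fun d => trunc U vonMangoldt d) E U 1 (by positivity) (by norm_num)
      (fun d hd => by change (if d ≤ U then _ else _) = _; rw [if_neg (by omega)]) (fun d h1 hd => by
        change |if d ≤ U then _ else _| ≤ _; rw [if_pos hd, abs_of_nonneg vonMangoldt_nonneg]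
        have : (d:ℝ) ≤ U := by exact_mod_cast hd
        exact vonMangoldt_le_log.trans ((Real.log_le_self (by positivity)).trans this))
      (fun d _ _ => by rw [hE]; simp only [norm_ee]; rfl)
    refine h.trans ?_
    rw [hZ, inv_pow, ← div_eq_mul_inv, le_div_iff₀ (by positivity), mul_one, ← Nat.cast_mul]
    calc _ ≤ l^(2*b+2)*l^(A+1) := by gcongr
      _ = 1*l^(A+1+2*b+2) := by rw [← pow_add, one_mul]; congr 1; ring
      _ ≤ X := hbig
  have hRZ : l^(2*b+2)*(l^(2*b+2)*(l*R)) ≤ Z := by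
    have : l^(2*b+2)*(l^(2*b+2)*(l*R)) = Z := by
      rw [hR, hZ, hA1, show A + 4*b + 6 = (2*b+2) + ((2*b+2) + (1 + (A + 1))) by ring, pow_add l⁻¹ (2*b+2) _, pow_add l⁻¹ (2*b+2) _, pow_add l⁻¹ 1 _]
      simp only [inv_pow, pow_one]
      have h1 : l^(2*b+2) ≠ 0 := by positivity
      have h2 : l^(A+1) ≠ 0 := by positivity
      generalize l^(2*b+2) = w1 at *
      generalize l^(A+1) = w2 at *
      field_simp
    exact this.le
  have hdy : ∀ d : ℕ, 1 ≤ d → (d:ℝ)*(y / d : ℕ) ≤ 2*X := by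
    intro d hd
    refine le_trans ?_ hy
    exact_mod_cast Nat.mul_div_le y d
  have t2 : ‖Sw (trunc U (μ : ArithmeticFunction ℝ)*log) E y‖ ≤ Z := by
    rw [Sw_mul]
    have h := supp_bound y U (fun d => trunc U (μ : ArithmeticFunction ℝ) d) (fun d => ∑ e ∈ Ioc 0 (y/d), ((log e : ℝ):ℂ)*E (d*e)) 1 (R*(2*l)) (by positivity) (by positivity)
      (fun d hd => by change (if d ≤ U then _ else _) = _; rw [if_neg (by omega)]) (fun d h1 hd => by
        change |if d ≤ U then _ else _| ≤ _; rw [if_pos hd]; exact abs_moebius_real d)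
      (fun d h1 hd => by
        have hd1 : (d:ℝ) ≤ l^(2*b+2) := by
          have : (d:ℝ) ≤ U := by exact_mod_cast hd
          exact this.trans (hU2.trans (pow_le_pow_right₀ (by linarith) (by omega)))
        refine (log_abel (fun e => E (d*e)) (y/d) R (fun j => hI d h1 hd1 j (y/d) (hdy d h1))).trans ?_
        gcongr
        rcases Nat.eq_zero_or_pos (y/d) with h0 | h0
        · rw [h0]; simp; linarith
        refine (Real.log_le_log (by exact_mod_cast h0) ?_).trans hlogy
        exact_mod_cast Nat.div_le_self y d)
    refine h.trans (le_trans ?_ hRZ)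
    rw [one_mul]
    have hUl : (U:ℝ) ≤ l^(2*b+2) := hU2.trans (pow_le_pow_right₀ (by linarith) (by omega))
    calc (U:ℝ)*(R*(2*l)) ≤ l^(2*b+2)*(R*(2*l)) := by gcongr
      _ = l^(2*b+2)*(2*(l*R)) := by ring
      _ ≤ l^(2*b+2)*(l^(2*b+2)*(l*R)) := by
        gcongr
        calc (2:ℝ) ≤ l := by linarith
          _ = l^1 := (pow_one _).symm
          _ ≤ _ := pow_le_pow_right₀ (by linarith) (by omega)
  have t3 : ‖Sw (-((trunc U vonMangoldt*trunc U (μ : ArithmeticFunction ℝ))*(ζ : ArithmeticFunction ℝ))) E y‖ ≤ Z := by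
    rw [Sw_neg, norm_neg, Sw_mul]
    have h := supp_bound y (U*U) (fun d => (trunc U vonMangoldt*trunc U (μ : ArithmeticFunction ℝ)) d) (fun d => ∑ e ∈ Ioc 0 (y/d), (((ζ : ArithmeticFunction ℝ) e : ℝ):ℂ)*E (d*e))
      ((U*U:ℕ):ℝ) R (by positivity) (by positivity)
      (fun d hd => trunc_mul_zero _ _ hd) (fun d h1 hd => by
        refine (trunc_mul_abs U d).trans ((Real.log_le_self (by positivity)).trans ?_)
        exact_mod_cast hd)
      (fun d h1 hd => by
        have hd1 : (d:ℝ) ≤ l^(2*b+2) := le_trans (by exact_mod_cast hd) hUU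
        refine le_trans (le_of_eq ?_) (hI d h1 hd1 0 (y/d) (hdy d h1))
        congr 1
        refine sum_congr rfl fun e he => ?_
        rw [mem_Ioc] at he; rw [natCoe_apply, zeta_apply_ne (by omega)]
        simp [hE])
    refine h.trans (le_trans ?_ hRZ)
    gcongr; exact le_mul_of_one_le_left hR0 (by linarith)
  have t4 : ‖Sw ((vonMangoldt - trunc U vonMangoldt)*bV U) E y‖ ≤ Z := by
    have hw : ∀ m, (vonMangoldt - trunc U vonMangoldt) m = if m ≤ U then 0 else vonMangoldt m := by
      intro m; rw [sub_eq_add_neg, ArithmeticFunction.add_apply, ArithmeticFunction.neg_apply, ← sub_eq_add_neg]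
      change _ - (if m ≤ U then _ else _) = _
      split_ifs <;> simp
    obtain ⟨K, hKdef⟩ : ∃ K, K = Nat.log 2 y + 1 := ⟨_, rfl⟩
    have hK1 : y < 2^K := hKdef ▸ Nat.lt_pow_succ_log_self (by norm_num) y
    have hK2 : (K:ℝ) ≤ 4*l := by
      have h1 : (2:ℝ)^(Nat.log 2 y) ≤ y := by exact_mod_cast Nat.pow_log_le_self 2 (by omega)
      have h2 := Real.log_le_log (by positivity) h1
      rw [Real.log_pow] at h2
      have h3 := Real.log_two_gt_d9
      have h4 : (Nat.log 2 y : ℝ)*0.69 ≤ Nat.log 2 y*Real.log 2 := by gcongr; linarith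
      rw [hKdef]; push_cast; linarith
    rw [Sw_blocks α y U K (le_trans hK1.le (Nat.le_mul_of_pos_right _ (by omega))) _ _ (fun m hm => by rw [hw, if_pos hm]) (fun m hm => bV_zero hm)]
    have hblock : ∀ i : ℕ, l^b ≤ ((2^i*U : ℕ):ℝ) := by
      intro i
      refine hU1.trans ?_
      exact_mod_cast Nat.le_mul_of_pos_left U (by positivity)
    calc _ ≤ ∑ i ∈ range K, ∑ j ∈ range K, X*l⁻¹^(A+4) := by
          refine (norm_sum_le _ _).trans (sum_le_sum fun i _ => (norm_sum_le _ _).trans (sum_le_sum fun j _ => ?_))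
          refine hII _ _ y (hblock i) (hblock j) hy _ _ (fun m => ?_) (fun m => bV_abs U m)
          rw [hw]
          split_ifs
          · simp; exact Real.log_natCast_nonneg m
          · rw [abs_of_nonneg vonMangoldt_nonneg]; exact vonMangoldt_le_log
      _ = K*(K*(X*l⁻¹^(A+4))) := by simp [sum_const]
      _ ≤ (4*l)*((4*l)*(X*l⁻¹^(A+4))) := by gcongr
      _ = (16 / l)*Z := by rw [hZ, show A + 4 = A + 1 + 3 by ring, pow_add l⁻¹ (A+1) 3]; field_simp; ring
      _ ≤ 1*Z := by
        gcongr
        rw [div_le_one hl0]; linarith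
      _ = Z := one_mul _
  have hfin : Sw vonMangoldt E y = Sw (trunc U vonMangoldt) E y + Sw (trunc U (μ : ArithmeticFunction ℝ)*log) E y +
      Sw (-((trunc U vonMangoldt*trunc U (μ : ArithmeticFunction ℝ))*(ζ : ArithmeticFunction ℝ))) E y +
      Sw ((vonMangoldt - trunc U vonMangoldt)*bV U) E y := by rw [← Sw_add, ← Sw_add, ← Sw_add, ← vaughan]
  change ‖Sw vonMangoldt E y‖ ≤ _
  rw [hfin]
  calc _ ≤ Z + Z + Z + Z := (norm_add_le _ _).trans (add_le_add ((norm_add_le _ _).trans (add_le_add ((norm_add_le _ _).trans (add_le_add t1 t2)) t3)) t4)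
    _ = (4 / l)*(X*l⁻¹^A) := by rw [hZ, pow_succ]; field_simp; ring
    _ ≤ 1*(X*l⁻¹^A) := by gcongr; rw [div_le_one hl0]; linarith
    _ = _ := one_mul _
end WG
end
section
open Finset
namespace WG
noncomputable def rho (d : ℕ) : ℕ := Nat.card {u : (ZMod d)ˣ // u^3 = 1}
lemma rho_mul {m n : ℕ} (h : m.Coprime n) : rho (m*n) = rho m*rho n := by
  unfold rho; rw [← Nat.card_prod]
  let e : (ZMod (m*n))ˣ ≃* (ZMod m)ˣ × (ZMod n)ˣ := (Units.mapEquiv (ZMod.chineseRemainder h).toMulEquiv).trans MulEquiv.prodUnits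
  refine Nat.card_congr ((e.toEquiv.subtypeEquiv (q := fun x => x.1^3 = 1 ∧ x.2^3 = 1) fun u => ?_).trans (Equiv.subtypeProdEquivProd (p := fun u : (ZMod m)ˣ => u^3 = 1) (q := fun u : (ZMod n)ˣ => u^3 = 1)))
  rw [← (map_eq_one_iff e e.injective), map_pow]; exact Prod.ext_iff
lemma rho_prime_pow {p k : ℕ} (hp : p.Prime) (hk : 0 < k) : rho (p^k) ≤ 3 := by
  unfold rho
  have : NeZero (p^k) := ⟨pow_ne_zero _ hp.ne_zero⟩
  by_cases h2 : p = 2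
  · subst h2
    have : ∀ u : (ZMod (2^k))ˣ, u^3 = 1 → u = 1 := by
      intro u hu
      have h1 : orderOf u ∣ 3 := orderOf_dvd_of_pow_eq_one hu
      have h3 : orderOf u ∣ 2^(k-1) := by
        have := orderOf_dvd_card (x := u)
        rw [ZMod.card_units_eq_totient, Nat.totient_prime_pow hp hk] at this; simpa using this
      have h4 : Nat.Coprime 3 (2^(k-1)) := Nat.Coprime.pow_right _ (by norm_num)
      have h5 := Nat.dvd_gcd h1 h3
      rw [h4] at h5; exact orderOf_eq_one_iff.mp (Nat.dvd_one.mp h5)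
    have : Subsingleton {u : (ZMod (2^k))ˣ // u^3 = 1} := ⟨fun a b => Subtype.ext ((this _ a.2).trans (this _ b.2).symm)⟩
    have := Finite.card_le_one_iff_subsingleton.mpr this
    omega
  · have := ZMod.isCyclic_units_of_prime_pow p hp h2 k
    rw [Nat.card_eq_fintype_card, Fintype.card_subtype]; exact IsCyclic.card_pow_eq_one_le (by norm_num)
lemma rho_le (d : ℕ) (hd : d ≠ 0) : (rho d : ℝ) ≤ dd d^2 := by
  induction d using Nat.recOnPosPrimePosCoprime with
  | zero => exact absurd rfl hd
  | one =>
    have : Subsingleton {u : (ZMod 1)ˣ // u^3 = 1} := ⟨fun a b => Subtype.ext (Subsingleton.elim _ _)⟩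
    have : rho 1 ≤ 1 := Finite.card_le_one_iff_subsingleton.mpr this
    simp [dd]; exact_mod_cast this
  | prime_pow p n hp hn =>
    have h1 : (rho (p^n) : ℝ) ≤ 3 := by exact_mod_cast rho_prime_pow hp hn
    have h2 : dd (p^n) = n + 1 := by unfold dd; rw [Nat.divisors_prime_pow hp]; simp
    have h3 : (1:ℝ) ≤ n := by exact_mod_cast hn
    rw [h2]; nlinarith
  | coprime a b ha hb hab iha ihb =>
    rw [rho_mul hab]
    have : dd (a*b) = dd a*dd b := by unfold dd; rw [hab.card_divisors_mul]; push_cast; rfl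
    rw [this, mul_pow]; push_cast
    have := iha (by omega)
    have := ihb (by omega)
    gcongr
lemma landreau (z r m : ℕ) (hz : 1 ≤ z) (hm : 1 ≤ m) (h : m ≤ z^r) : ∃ d, d ∣ m ∧ d ≤ z ∧ dd m ≤ (2*dd d)^r := by
  induction r generalizing m with
  | zero => exact ⟨1, one_dvd _, hz, by have : m = 1 := by simp at h; omega
                                        subst this; simp [dd]⟩
  | succ r ih =>
    have hpos : ∀ d, 1 ≤ d → 1 ≤ dd d := fun d hd => by unfold dd; exact_mod_cast Nat.pos_of_ne_zero (by simp; omega)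
    rcases le_or_gt m z with hmz | hmz
    · refine ⟨m, dvd_rfl, hmz, ?_⟩
      have := hpos m hm
      calc dd m ≤ (2*dd m)^1 := by linarith
        _ ≤ _ := pow_le_pow_right₀ (by linarith) (by omega)
    · obtain ⟨a, ha, hmax⟩ := exists_max_image (m.divisors.filter (· ≤ z)) id ⟨1, by simp; omega⟩
      simp only [mem_filter, Nat.mem_divisors] at ha hmax
      obtain ⟨⟨⟨b, hb⟩, _⟩, haz⟩ := ha
      have hb1 : b ≠ 1 := fun h => by subst h; omega
      obtain ⟨p, hp, c, hc⟩ := Nat.exists_prime_and_dvd hb1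
      have ha0 : 1 ≤ a := Nat.pos_of_ne_zero fun h => by subst h; simp at hb; omega
      have hc0 : 1 ≤ c := Nat.pos_of_ne_zero fun h => by subst h; simp at hc; subst hc; simp at hb; omega
      have hmm : m = a*p*c := by rw [hb, hc]; ring
      have hap : z < a*p := by
        by_contra hcon
        have := hmax (a*p) ⟨⟨⟨c, hmm⟩, by omega⟩, by omega⟩
        simp only [id] at this
        have := hp.two_le
        nlinarith
      have hcr : c ≤ z^r := by
        by_contra hcon
        have : z*z^r < (a*p)*c := Nat.mul_lt_mul'' hap (by omega)
        rw [pow_succ, mul_comm] at h; omega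
      obtain ⟨d, hd, hdz, hdd⟩ := ih c hc0 hcr
      have hdp : dd p = 2 := by unfold dd; rw [hp.divisors, card_pair hp.one_lt.ne]; norm_num
      have h1 : dd m ≤ (2*dd a)*(2*dd d)^r := by
        calc dd m ≤ dd (a*p)*dd c := by rw [hmm]; exact dd_mul_le _ _
          _ ≤ (dd a*dd p)*(2*dd d)^r := by
            have := dd_nonneg c; have := dd_nonneg a; have := dd_nonneg p
            gcongr; exact dd_mul_le _ _
          _ = _ := by rw [hdp]; ring
      have := dd_nonneg d
      have := dd_nonneg a
      rcases le_total (dd a) (dd d) with hh | hh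
      · refine ⟨d, hd.trans ⟨a*p, by rw [hmm]; ring⟩, hdz, h1.trans ?_⟩
        rw [pow_succ']; gcongr
      · refine ⟨a, ⟨p*c, by rw [hmm]; ring⟩, haz, h1.trans ?_⟩
        rw [pow_succ']; gcongr
lemma landreau_sum (z m : ℕ) (hz : 1 ≤ z) (hm : 1 ≤ m) (h : m ≤ z^4) : dd m ≤ ∑ d ∈ Icc 1 z, if d ∣ m then (2*dd d)^4 else 0 := by
  obtain ⟨d, hd, hdz, hdd⟩ := landreau z 4 m hz hm h
  have hd1 : d ∈ Icc 1 z := by rw [mem_Icc]; exact ⟨Nat.pos_of_dvd_of_pos hd hm, hdz⟩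
  have h1 := single_le_sum (f := fun d => if d ∣ m then (2*dd d)^4 else 0) (fun i _ => by
    have := dd_nonneg i; split_ifs <;> positivity) hd1
  simp only [if_pos hd] at h1
  exact hdd.trans h1
lemma dd_crude (m : ℕ) (hm : 1 ≤ m) (r : ℕ) : dd m^r ≤ m*(1 + Real.log m)^(2^r) :=
  (single_le_sum (f := fun y => dd y^r) (fun i _ => by have := dd_nonneg i; positivity) (mem_Icc.mpr ⟨hm, le_rfl⟩)).trans (div_moment' r m)
lemma cube_count (S : Finset ℕ) (z Y d : ℕ) (h3 : ∀ y ∈ S, y.Prime ∧ z < y ∧ y ≤ Y) (hd : 1 ≤ d) (hdz : d ≤ z) (hzY : z ≤ Y) (c : ZMod d) :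
    ((S.filter (fun y : ℕ => (y:ZMod d)^3 = c)).card : ℝ) ≤ dd d^2*(2*Y / d) := by
  have : NeZero d := ⟨by omega⟩
  rcases (S.filter (fun y : ℕ => (y:ZMod d)^3 = c)).eq_empty_or_nonempty with he | ⟨y0, hy0⟩
  · rw [he]; simp; positivity
  have hcop : ∀ y ∈ S, Nat.Coprime y d := fun y hy => by
    obtain ⟨hp, hzy, _⟩ := h3 y hy
    exact (Nat.Prime.coprime_iff_not_dvd hp).mpr fun h => by have := Nat.le_of_dvd hd h; omega
  rw [mem_filter] at hy0
  set u : ℕ → (ZMod d)ˣ := fun y => if h : Nat.Coprime y d then ZMod.unitOfCoprime y h else 1 with hu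
  have hu1 : ∀ y ∈ S, ((u y : (ZMod d)ˣ) : ZMod d) = y := fun y hy => by rw [hu]; simp only [dif_pos (hcop y hy)]; rfl
  have hcard := card_le_mul_card_image_of_maps_to (s := S.filter (fun y : ℕ => (y:ZMod d)^3 = c)) (t := univ.filter (fun v : (ZMod d)ˣ => v^3 = 1))
    (f := fun y => u y*(u y0)⁻¹) (fun y hy => by
      rw [mem_filter] at hy; rw [mem_filter]
      refine ⟨mem_univ _, ?_⟩
      have : u y^3 = u y0^3 := by
        ext; push_cast; rw [hu1 y hy.1, hu1 y0 hy0.1, hy.2, hy0.2]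
      rw [mul_pow, this, ← mul_pow, mul_inv_cancel, one_pow]) (Y / d + 1) (fun b _ => by
      rw [← card_range (Y/d+1)]
      refine card_le_card_of_injOn (fun y => y / d) (fun y hy => ?_) (fun y hy y' hy' hyy => ?_)
      · simp only [coe_filter, mem_filter, Set.mem_ofPred_eq] at hy
        simp only [coe_range, Set.mem_Iio]
        have := Nat.div_le_div_right (c := d) (h3 y hy.1.1).2.2
        omega
      · simp only [coe_filter, mem_filter, Set.mem_ofPred_eq] at hy hy'
        have h1 : u y = u y' := mul_right_cancel (hy.2.trans hy'.2.symm)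
        have h2 : (y : ZMod d) = y' := by rw [← hu1 y hy.1.1, ← hu1 y' hy'.1.1, h1]
        rw [ZMod.natCast_eq_natCast_iff'] at h2; rw [← Nat.div_add_mod y d, ← Nat.div_add_mod y' d, h2]; simp only at hyy
        rw [hyy])
  have hr : #(univ.filter (fun v : (ZMod d)ˣ => v^3 = 1)) = rho d := by unfold rho; rw [Nat.card_eq_fintype_card, Fintype.card_subtype]
  rw [hr] at hcard
  have hd0 : (0:ℝ) < d := by exact_mod_cast hd
  have h1 : (((Y/d : ℕ)):ℝ) + 1 ≤ 2*Y / d := by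
    have h2 : (((Y/d : ℕ)):ℝ) ≤ Y / d := Nat.cast_div_le
    have h3 : (1:ℝ) ≤ Y / d := by rw [one_le_div hd0]; exact_mod_cast hdz.trans hzY
    rw [mul_div_assoc]; linarith
  calc _ ≤ (((Y / d + 1)*rho d : ℕ) : ℝ) := by exact_mod_cast hcard
    _ = rho d*(((Y/d : ℕ)):ℝ) + rho d*1 := by push_cast; ring
    _ = rho d*((((Y/d : ℕ)):ℝ) + 1) := by ring
    _ ≤ _ := by
      have := rho_le d (by omega)
      gcongr
lemma sq_count (S : Finset ℕ) (hS : ∀ x ∈ S, 1 ≤ x) (D : ℤ) (hD : D ≠ 0) : (((S ×ˢ S).filter (fun x => (x.1:ℤ)^2 - x.2^2 = D)).card : ℝ) ≤ dd D.natAbs := by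
  unfold dd
  refine Nat.cast_le.mpr (card_le_card_of_injOn (fun x => x.1 + x.2) (fun x hx => ?_) (fun x hx y hy hxy => ?_))
  · simp only [coe_filter, mem_product, Set.mem_ofPred_eq] at hx
    rw [mem_coe, Nat.mem_divisors]
    refine ⟨?_, Int.natAbs_ne_zero.mpr hD⟩
    rw [← Int.natCast_dvd, ← hx.2]
    exact ⟨x.1 - x.2, by push_cast; ring⟩
  · simp only [coe_filter, mem_product, Set.mem_ofPred_eq] at hx hy
    simp only at hxy
    have h1 : ((x.1:ℤ) + x.2) = y.1 + y.2 := by exact_mod_cast hxy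
    have h0 : ((x.1:ℤ) + x.2) ≠ 0 := by have := hS _ hx.1.1; omega
    have h2 : ((x.1:ℤ) + x.2)*(x.1 - x.2) = (x.1 + x.2)*(y.1 - y.2) := by
      have e1 := hx.2; have e2 := hy.2
      calc ((x.1:ℤ) + x.2)*(x.1 - x.2) = (x.1:ℤ)^2 - x.2^2 := by ring
        _ = (y.1:ℤ)^2 - y.2^2 := by rw [e1, e2]
        _ = (y.1 + y.2)*(y.1 - y.2) := by ring
        _ = _ := by rw [h1]
    have h3 := mul_left_cancel₀ h0 h2
    ext <;> omega
lemma cub_count (S : Finset ℕ) (hS : ∀ x ∈ S, 1 ≤ x) (D : ℤ) (hD : D ≠ 0) : (((S ×ˢ S).filter (fun x => (x.1:ℤ)^3 - x.2^3 = D)).card : ℝ) ≤ dd D.natAbs := by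
  unfold dd
  refine Nat.cast_le.mpr (card_le_card_of_injOn (fun x => x.1^2 + x.1*x.2 + x.2^2) (fun x hx => ?_) (fun x hx y hy hxy => ?_))
  · simp only [coe_filter, mem_product, Set.mem_ofPred_eq] at hx
    rw [mem_coe, Nat.mem_divisors]
    refine ⟨?_, Int.natAbs_ne_zero.mpr hD⟩
    rw [← Int.natCast_dvd, ← hx.2]
    exact ⟨x.1 - x.2, by push_cast; ring⟩
  · simp only [coe_filter, mem_product, Set.mem_ofPred_eq] at hx hy
    simp only at hxy
    have h1 : ((x.1:ℤ)^2 + x.1*x.2 + x.2^2) = y.1^2 + y.1*y.2 + y.2^2 := by exact_mod_cast hxy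
    have hx0 : (0:ℤ) < x.1 := by exact_mod_cast hS _ hx.1.1
    have h0 : ((x.1:ℤ)^2 + x.1*x.2 + x.2^2) ≠ 0 := by positivity
    have h2 : ((x.1:ℤ)^2 + x.1*x.2 + x.2^2)*(x.1 - x.2) = ((x.1:ℤ)^2 + x.1*x.2 + x.2^2)*(y.1 - y.2) := by
      have e1 := hx.2; have e2 := hy.2
      calc ((x.1:ℤ)^2 + x.1*x.2 + x.2^2)*(x.1 - x.2) = (x.1:ℤ)^3 - x.2^3 := by ring
        _ = (y.1:ℤ)^3 - y.2^3 := by rw [e1, e2]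
        _ = (y.1^2 + y.1*y.2 + y.2^2)*(y.1 - y.2) := by ring
        _ = _ := by rw [h1]
    have h3 := mul_left_cancel₀ h0 h2
    have h4 : ((x.1:ℤ) + x.2)^2 = (y.1 + y.2)^2 := by
      have e : ∀ a b : ℤ, 3*(a + b)^2 = 4*(a^2 + a*b + b^2) - (a - b)^2 := fun a b => by ring
      have e1 := e x.1 x.2
      have e2 := e y.1 y.2
      rw [h1, h3] at e1; linarith
    have h5 := (sq_eq_sq₀ (by positivity) (by positivity)).mp h4
    ext <;> omega
lemma ind_pairs {S : Finset ℕ} (k : ℕ) (D : ℤ) : ∑ x ∈ S, ∑ x' ∈ S, (if (x:ℤ)^k - (x':ℤ)^k = D then (1:ℝ) else 0) =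
    (((S ×ˢ S).filter (fun x => (x.1:ℤ)^k - x.2^k = D)).card : ℝ) := by rw [← sum_product', sum_boole]
lemma ind_diag {S : Finset ℕ} (k : ℕ) (hk : k ≠ 0) (X : ℕ) (hS : ∀ x ∈ S, 1 ≤ x ∧ x ≤ X) : ∑ x ∈ S, ∑ x' ∈ S, (if (x:ℤ)^k - (x':ℤ)^k = 0 then (1:ℝ) else 0) ≤ X := by
  have h1 : ∀ x ∈ S, ∑ x' ∈ S, (if (x:ℤ)^k - (x':ℤ)^k = 0 then (1:ℝ) else 0) = 1 := by
    intro x hx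
    refine (sum_congr rfl fun x' _ => ?_).trans ((sum_ite_eq S x (fun _ => (1:ℝ))).trans (if_pos hx))
    congr 1; rw [sub_eq_zero]
    exact propext ⟨fun h => by
      have : x^k = x'^k := by exact_mod_cast h
      exact Nat.pow_left_injective hk this, fun h => by rw [h]⟩
  rw [sum_congr rfl h1]
  have : S ⊆ Icc 1 X := fun x hx => mem_Icc.mpr (hS x hx)
  have := card_le_card this
  simp at this ⊢
  exact this
lemma V_count (S2 S3 S6 : Finset ℕ) (z X Y Z : ℕ) (Mb : ℝ) (hz : 1 ≤ z) (h2 : ∀ x ∈ S2, 1 ≤ x ∧ x ≤ X)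
    (h3 : ∀ y ∈ S3, y.Prime ∧ z < y ∧ y ≤ Y) (h6 : ∀ w ∈ S6, 1 ≤ w ∧ w ≤ Z) (hD : Y^3 + Z^6 ≤ z^4) (hzY : z ≤ Y)
    (hM : ∀ m, 1 ≤ m → m ≤ z^4 → dd m ≤ Mb) :
    ∑ i ∈ S2 ×ˢ (S3 ×ˢ S6), ∑ j ∈ S2 ×ˢ (S3 ×ˢ S6), (if i.1^2 + (i.2.1^3 + i.2.2^6) = j.1^2 + (j.2.1^3 + j.2.2^6) then (1:ℝ) else 0) ≤
      X*(Z*Y + Z^2*Mb) + 32*(Y^2*Z^2)*(1 + Real.log z)^64 := by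
  have hMb : 0 ≤ Mb := le_trans (dd_nonneg 1) (hM 1 le_rfl (Nat.one_le_pow _ _ hz))
  have c6 : (#S6:ℝ) ≤ Z := by
    have : S6 ⊆ Icc 1 Z := fun x hx => mem_Icc.mpr (h6 x hx)
    have := card_le_card this
    simp at this; exact_mod_cast this
  have h3' : ∀ y ∈ S3, 1 ≤ y ∧ y ≤ Y := fun y hy => ⟨(h3 y hy).1.one_le, (h3 y hy).2.2⟩
  have c3 : (#S3:ℝ) ≤ Y := by
    have : S3 ⊆ Icc 1 Y := fun x hx => mem_Icc.mpr (h3' x hx)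
    have := card_le_card this
    simp at this; exact_mod_cast this
  set T := S3 ×ˢ S6 with hT
  set D : ℕ × ℕ → ℕ × ℕ → ℤ := fun q q' => ((q'.1:ℤ)^3 + q'.2^6) - (q.1^3 + q.2^6) with hDdef
  have step1 : ∑ i ∈ S2 ×ˢ T, ∑ j ∈ S2 ×ˢ T, (if i.1^2 + (i.2.1^3 + i.2.2^6) = j.1^2 + (j.2.1^3 + j.2.2^6) then (1:ℝ) else 0) =
      ∑ q ∈ T, ∑ q' ∈ T, ∑ x ∈ S2, ∑ x' ∈ S2, (if (x:ℤ)^2 - (x':ℤ)^2 = D q q' then (1:ℝ) else 0) := by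
    simp only [sum_product_right (s := S2)]
    refine sum_congr rfl fun q _ => ?_
    rw [sum_comm]
    refine sum_congr rfl fun q' _ => sum_congr rfl fun x _ => sum_congr rfl fun x' _ => ?_
    congr 1; rw [hDdef]; simp only
    apply propext
    rw [sub_eq_sub_iff_add_eq_add, ← add_comm ((x':ℤ)^2)]; exact_mod_cast Iff.rfl
  have hDb : ∀ q ∈ T, ∀ q' ∈ T, (D q q').natAbs ≤ z^4 := by
    intro q hq q' hq'
    rw [hT, mem_product] at hq hq'
    have e1 : q.1^3 ≤ Y^3 := Nat.pow_le_pow_left (h3' _ hq.1).2 3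
    have e2 : q.2^6 ≤ Z^6 := Nat.pow_le_pow_left (h6 _ hq.2).2 6
    have e3 : q'.1^3 ≤ Y^3 := Nat.pow_le_pow_left (h3' _ hq'.1).2 3
    have e4 : q'.2^6 ≤ Z^6 := Nat.pow_le_pow_left (h6 _ hq'.2).2 6
    have : D q q' = ((q'.1^3 + q'.2^6 : ℕ):ℤ) - ((q.1^3 + q.2^6 : ℕ):ℤ) := by rw [hDdef]; push_cast; rfl
    rw [this]; omega
  have step2 : ∀ q ∈ T, ∀ q' ∈ T, ∑ x ∈ S2, ∑ x' ∈ S2, (if (x:ℤ)^2 - (x':ℤ)^2 = D q q' then (1:ℝ) else 0) ≤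
      X*(if D q q' = 0 then 1 else 0) + ∑ d ∈ Icc 1 z, (if (d:ℤ) ∣ D q q' then (2*dd d)^4 else 0) := by
    intro q hq q' hq'
    have hnn : 0 ≤ ∑ d ∈ Icc 1 z, (if (d:ℤ) ∣ D q q' then (2*dd d)^4 else 0) := sum_nonneg fun d _ => by
      have := dd_nonneg d; split_ifs <;> positivity
    by_cases h0 : D q q' = 0
    · rw [if_pos h0, mul_one]; rw [h0] at hnn ⊢
      linarith [ind_diag 2 (by norm_num) X h2]
    · rw [if_neg h0, mul_zero, zero_add, ind_pairs]
      refine (sq_count S2 (fun x hx => (h2 x hx).1) _ h0).trans ((landreau_sum z _ hz (Int.natAbs_pos.mpr h0) (hDb q hq q' hq')).trans (le_of_eq ?_))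
      refine sum_congr rfl fun d _ => ?_
      congr 1; exact propext Int.natCast_dvd.symm
  have step3 : ∑ q ∈ T, ∑ q' ∈ T, (if D q q' = 0 then (1:ℝ) else 0) ≤ Z*Y + Z^2*Mb := by
    have e : ∑ q ∈ T, ∑ q' ∈ T, (if D q q' = 0 then (1:ℝ) else 0) = ∑ w ∈ S6, ∑ w' ∈ S6, ∑ y ∈ S3, ∑ y' ∈ S3, (if (y:ℤ)^3 - (y':ℤ)^3 = (w':ℤ)^6 - w^6 then (1:ℝ) else 0) := by
      simp only [hT, sum_product_right (s := S3)]
      refine sum_congr rfl fun q _ => ?_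
      rw [sum_comm]
      refine sum_congr rfl fun q' _ => sum_congr rfl fun x _ => sum_congr rfl fun x' _ => ?_
      congr 1; apply propext
      rw [hDdef]
      constructor <;> intro h <;> simp only at * <;> linarith
    rw [e]
    calc _ ≤ ∑ w ∈ S6, ∑ w' ∈ S6, ((if w = w' then (Y:ℝ) else 0) + Mb) := by
          refine sum_le_sum fun w hw => sum_le_sum fun w' hw' => ?_
          by_cases hww : w = w'
          · rw [if_pos hww, hww, sub_self]; linarith [ind_diag 3 (by norm_num) Y h3']
          · rw [if_neg hww, zero_add, ind_pairs]
            have hne : (w':ℤ)^6 - (w:ℤ)^6 ≠ 0 := by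
              rw [sub_ne_zero]; intro h
              have : w'^6 = w^6 := by exact_mod_cast h
              exact hww (Nat.pow_left_injective (by norm_num) this).symm
            refine (cub_count S3 (fun x hx => (h3' x hx).1) _ hne).trans (hM _ (Int.natAbs_pos.mpr hne) ?_)
            have e2 : w^6 ≤ Z^6 := Nat.pow_le_pow_left (h6 _ hw).2 6
            have e4 : w'^6 ≤ Z^6 := Nat.pow_le_pow_left (h6 _ hw').2 6
            have : ((w':ℤ)^6 - w^6) = ((w'^6 : ℕ):ℤ) - ((w^6 : ℕ):ℤ) := by push_cast; rfl
            rw [this]; omega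
      _ = #S6*Y + #S6*(#S6*Mb) := by
          simp only [sum_add_distrib, sum_const, nsmul_eq_mul, mul_add]
          congr 1; rw [sum_congr rfl (fun w hw => (sum_ite_eq S6 w (fun _ => (Y:ℝ))).trans (if_pos hw))]; simp
      _ ≤ Z*Y + Z*(Z*Mb) := by gcongr
      _ = _ := by ring
  have step4 : ∑ q ∈ T, ∑ q' ∈ T, ∑ d ∈ Icc 1 z, (if (d:ℤ) ∣ D q q' then (2*dd d)^4 else 0) ≤ 32*(Y^2*Z^2)*(1 + Real.log z)^64 := by
    have e : ∑ q ∈ T, ∑ q' ∈ T, ∑ d ∈ Icc 1 z, (if (d:ℤ) ∣ D q q' then (2*dd d)^4 else 0) =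
        ∑ d ∈ Icc 1 z, (2*dd d)^4 * ∑ q' ∈ T, ∑ w ∈ S6, ∑ y ∈ S3, (if (d:ℤ) ∣ D (y, w) q' then (1:ℝ) else 0) := by
      calc _ = ∑ d ∈ Icc 1 z, ∑ q' ∈ T, ∑ q ∈ T, (if (d:ℤ) ∣ D q q' then (2*dd d)^4 else 0) := by
            rw [sum_comm, sum_comm (s := Icc 1 z)]; exact sum_congr rfl fun q' _ => sum_comm
        _ = _ := by
            refine sum_congr rfl fun d _ => ?_
            rw [mul_sum]
            refine sum_congr rfl fun q' _ => ?_
            rw [hT, sum_product_right, mul_sum]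
            refine sum_congr rfl fun w _ => ?_
            rw [mul_sum]
            exact sum_congr rfl fun y _ => by split_ifs <;> simp
    rw [e]
    calc _ ≤ ∑ d ∈ Icc 1 z, (2*dd d)^4*((Y*Z)*(Z*(dd d^2*(2*Y / d)))) := by
          refine sum_le_sum fun d hd => ?_
          rw [mem_Icc] at hd
          have := dd_nonneg d
          gcongr
          calc _ ≤ ∑ q' ∈ T, ∑ w ∈ S6, dd d^2*(2*Y / d) := by
                refine sum_le_sum fun q' hq' => sum_le_sum fun w hw => ?_
                rw [sum_boole]
                refine le_trans (le_of_eq ?_) (cube_count S3 z Y d h3 hd.1 hd.2 hzY ((q'.1:ZMod d)^3 + q'.2^6 - w^6))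
                congr 2
                refine filter_congr fun y _ => ?_
                rw [← ZMod.intCast_zmod_eq_zero_iff_dvd] <;> try infer_instance
                rw [hDdef]; push_cast
                constructor <;> intro h
                · linear_combination -h
                · linear_combination -h
            _ = (#S3 * #S6)*(#S6*(dd d^2*(2*Y / d))) := by rw [sum_const, sum_const, hT, card_product]; simp
            _ ≤ _ := by gcongr
      _ = 32*(Y^2*Z^2) * ∑ d ∈ Icc 1 z, dd d^6 / d := by rw [mul_sum]; exact sum_congr rfl fun d _ => by ring
      _ ≤ _ := by gcongr; exact div_moment 6 z
  rw [step1]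
  calc _ ≤ ∑ q ∈ T, ∑ q' ∈ T, ((X:ℝ)*(if D q q' = 0 then (1:ℝ) else 0) + ∑ d ∈ Icc 1 z, (if (d:ℤ) ∣ D q q' then (2*dd d)^4 else 0)) :=
        sum_le_sum fun q hq => sum_le_sum fun q' hq' => step2 q hq q' hq'
    _ = (X:ℝ)*(∑ q ∈ T, ∑ q' ∈ T, (if D q q' = 0 then (1:ℝ) else 0)) + ∑ q ∈ T, ∑ q' ∈ T, ∑ d ∈ Icc 1 z, (if (d:ℤ) ∣ D q q' then (2*dd d)^4 else 0) := by
        simp only [sum_add_distrib, mul_sum]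
    _ ≤ _ := by gcongr
lemma ee_integral (m : ℤ) : ∫ α in (0:ℝ)..1, ee (α*m) = if m = 0 then 1 else 0 := by
  split_ifs with h
  · subst h; simp [ee_zero]
  · unfold ee
    have h1 : (2*Real.pi*m*Complex.I : ℂ) ≠ 0 := by simp [h, Real.pi_ne_zero, Complex.I_ne_zero]
    have h2 := integral_exp_mul_complex (a := 0) (b := 1) h1
    have h3 : Complex.exp (2*Real.pi*m*Complex.I) = 1 := by
      have := ee_int m
      unfold ee at this; exact_mod_cast this
    simp only [Complex.ofReal_one, mul_one, Complex.ofReal_zero, mul_zero, Complex.exp_zero, h3, sub_self, zero_div] at h2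
    rw [← h2]
    congr 1; ext α; push_cast; ring_nf
lemma ee_cont (m : ℝ) : Continuous fun α : ℝ => ee (α*m) := by unfold ee; fun_prop
lemma parseval_le {ι : Type*} (I : Finset ι) (c : ι → ℝ) (m : ι → ℕ) (C : ℝ) (hc : ∀ i ∈ I, |c i| ≤ C) :
    ∫ α in (0:ℝ)..1, ‖∑ i ∈ I, (c i : ℂ)*ee (α*m i)‖^2 ≤ C^2 * ∑ i ∈ I, ∑ j ∈ I, (if m i = m j then (1:ℝ) else 0) := by
  have key : ((∫ α in (0:ℝ)..1, ‖∑ i ∈ I, (c i : ℂ)*ee (α*m i)‖^2 : ℝ) : ℂ) = ((∑ i ∈ I, ∑ j ∈ I, c i*c j*(if m i = m j then (1:ℝ) else 0) : ℝ) : ℂ) := by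
    rw [← intervalIntegral.integral_ofReal]
    have h1 : ∀ α : ℝ, ((‖∑ i ∈ I, (c i : ℂ)*ee (α*m i)‖^2 : ℝ) : ℂ) = ∑ i ∈ I, ∑ j ∈ I, (c i*c j : ℂ)*ee (α*((m i : ℤ) - m j : ℤ)) := by
      intro α; rw [Complex.ofReal_pow, ← Complex.mul_conj', map_sum, sum_mul_sum]
      refine sum_congr rfl fun i _ => sum_congr rfl fun j _ => ?_
      push_cast; rw [mul_sub, ee_sub, map_mul, Complex.conj_ofReal]; ring
    simp only [h1]
    have hintg : ∀ i j, IntervalIntegrable (fun α : ℝ => (c i*c j : ℂ)*ee (α*((m i : ℤ) - m j : ℤ))) MeasureTheory.volume 0 1 :=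
      fun i j => (continuous_const.mul (ee_cont _)).intervalIntegrable _ _
    rw [intervalIntegral.integral_finsetSum fun i _ => ?_]
    · rw [Complex.ofReal_sum]
      refine sum_congr rfl fun i _ => ?_
      rw [Complex.ofReal_sum, intervalIntegral.integral_finsetSum fun j _ => hintg i j]
      refine sum_congr rfl fun j _ => ?_
      rw [intervalIntegral.integral_const_mul, ee_integral]; simp only [sub_eq_zero, Nat.cast_inj]
      push_cast
      split_ifs <;> simp
    · exact (continuous_finsetSum _ fun j _ => continuous_const.mul (ee_cont _)).intervalIntegrable _ _
  rw [Complex.ofReal_inj.mp key, mul_sum]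
  refine sum_le_sum fun i hi => ?_
  rw [mul_sum]
  refine sum_le_sum fun j hj => ?_
  have h1 := hc i hi
  have h2 := hc j hj
  have h3 : c i*c j ≤ C^2 := by
    refine (le_abs_self _).trans ?_
    rw [abs_mul, sq]; exact mul_le_mul h1 h2 (abs_nonneg _) ((abs_nonneg _).trans h1)
  split_ifs <;> linarith
noncomputable def rt (k n : ℕ) : ℝ := (n:ℝ)^((k:ℝ)⁻¹)
noncomputable def TT (u : ℝ) : ℝ := max 0 (1 - |14*u - 2|)
noncomputable def cl (x : ℝ) : ℝ := max 0 (min 1 x)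
/-- smooth weight -/
noncomputable def hw (k n : ℕ) (x : ℝ) : ℝ := cl (x / rt k n)^(k-1)*TT (cl (x / rt k n)^k)
def Sp (k n : ℕ) : Finset ℕ := (range (n+1)).filter (fun p => p.Prime ∧ n < 14*p^k ∧ p^k ≤ n)
noncomputable def ff (k n : ℕ) (α : ℝ) : ℂ := ∑ p ∈ Sp k n, ((Real.log p*hw k n p : ℝ) : ℂ)*ee (α*((p^k : ℕ) : ℝ))
lemma rt_nonneg (k n : ℕ) : 0 ≤ rt k n := by unfold rt; positivity
lemma rt_pow (k n : ℕ) (hk : k ≠ 0) : rt k n^k = n := Real.rpow_inv_natCast_pow (Nat.cast_nonneg _) hk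
lemma rt_pos (k n : ℕ) (hn : 0 < n) : 0 < rt k n := by unfold rt; positivity
lemma TT_nonneg (u : ℝ) : 0 ≤ TT u := le_max_left _ _
lemma TT_le (u : ℝ) : TT u ≤ 1 := max_le (by norm_num) (by linarith [abs_nonneg (14*u-2)])
lemma cl_nonneg (u : ℝ) : 0 ≤ cl u := le_max_left _ _
lemma cl_le (u : ℝ) : cl u ≤ 1 := max_le (by norm_num) (min_le_left _ _)
lemma hw_nonneg (k n : ℕ) (x : ℝ) : 0 ≤ hw k n x := mul_nonneg (pow_nonneg (cl_nonneg _) _) (TT_nonneg _)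
lemma hw_le (k n : ℕ) (x : ℝ) : hw k n x ≤ 1 := mul_le_one₀ (pow_le_one₀ (cl_nonneg _) (cl_le _)) (TT_nonneg _) (TT_le _)
lemma rt_eq (k j n : ℕ) (hk : k ≠ 0) (hj : j ≠ 0) : rt k n = rt (k*j) n^j := by
  refine (pow_left_inj₀ (rt_nonneg _ _) (pow_nonneg (rt_nonneg _ _) _) hk).mp ?_
  rw [rt_pow k n hk, ← pow_mul, mul_comm j k, rt_pow _ _ (mul_ne_zero hk hj)]
lemma mem_Sp {k n p : ℕ} : p ∈ Sp k n ↔ p ≤ n ∧ p.Prime ∧ n < 14*p^k ∧ p^k ≤ n := by simp [Sp, Nat.lt_succ_iff]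
lemma coef_le {k n p : ℕ} (hp : p ∈ Sp k n) : |Real.log p*hw k n p| ≤ Real.log n := by
  obtain ⟨h1, h2, -⟩ := mem_Sp.mp hp
  have h3 : 0 ≤ Real.log p := Real.log_natCast_nonneg _
  have h4 : Real.log p ≤ Real.log n := Real.log_le_log (by exact_mod_cast h2.pos) (by exact_mod_cast h1)
  rw [abs_of_nonneg (mul_nonneg h3 (hw_nonneg _ _ _))]; nlinarith [hw_le k n p, hw_nonneg k n p]
lemma ff_prod (n : ℕ) (α : ℝ) : ff 2 n α*(ff 3 n α*ff 6 n α) = ∑ i ∈ Sp 2 n ×ˢ (Sp 3 n ×ˢ Sp 6 n),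
    (((Real.log i.1*hw 2 n i.1)*((Real.log i.2.1*hw 3 n i.2.1)*(Real.log i.2.2*hw 6 n i.2.2)) : ℝ) : ℂ)*ee (α*((i.1^2 + (i.2.1^3 + i.2.2^6) : ℕ) : ℝ)) := by
  unfold ff; rw [sum_mul_sum, sum_mul_sum, sum_product]
  refine sum_congr rfl fun x _ => ?_
  rw [sum_product, ← mul_sum, ← sum_product', mul_sum, sum_product]
  refine sum_congr rfl fun y _ => sum_congr rfl fun z _ => ?_
  simp only [Nat.cast_add, mul_add, ee_add, Complex.ofReal_mul]
  ring
lemma V_mean : ∃ n0 : ℕ, ∀ n ≥ n0, ∫ α in (0:ℝ)..1, ‖ff 2 n α*(ff 3 n α*ff 6 n α)‖^2 ≤ n*Real.log n^71 := by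
  obtain ⟨X1, hX1⟩ := ev_log (2^70)
  obtain ⟨X2, hX2⟩ := ev_pow (81*13^256) 256
  obtain ⟨c, hc⟩ : ∃ c : ℝ, c = max (max X1 X2) 9 := ⟨_, rfl⟩
  refine ⟨⌈c^12⌉₊, fun n hn => ?_⟩
  obtain ⟨u, hu⟩ : ∃ u, u = rt 12 n := ⟨_, rfl⟩
  have hun : u^12 = n := by rw [hu]; exact rt_pow 12 n (by norm_num)
  have hc9 : 9 ≤ c := hc ▸ le_max_right _ _
  have hcu : c ≤ u := by
    have h1 : c^12 ≤ u^12 := by rw [hun]; exact (Nat.le_ceil _).trans (by exact_mod_cast hn)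
    exact (pow_le_pow_iff_left₀ (by linarith) (hu ▸ rt_nonneg _ _) (by norm_num)).mp h1
  have hu9 : 9 ≤ u := hc9.trans hcu
  have hl := (hX1 u (le_trans (hc ▸ (le_max_left _ _).trans (le_max_left _ _)) hcu)).1
  have hp := hX2 u (le_trans (hc ▸ (le_max_right _ _).trans (le_max_left _ _)) hcu)
  have hlu : Real.log n = 12*Real.log u := by rw [← hun, Real.log_pow]; norm_num
  set l := Real.log u with hldef
  have hl70 : (100:ℝ) ≤ l := le_trans (by norm_num) hl
  have hroot : ∀ (j : ℕ) (p : ℕ) (k : ℕ), k ≠ 0 → j*k = 12 → p^k ≤ n → p ≤ ⌊u^j⌋₊ := by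
    intro j p k hk hjk hpn
    refine Nat.le_floor ?_
    refine (pow_le_pow_iff_left₀ (by positivity) (by positivity) hk).mp ?_
    rw [← pow_mul, hjk, hun]; exact_mod_cast hpn
  have hfl : ∀ j, ((⌊u^j⌋₊:ℕ):ℝ) ≤ u^j := fun j => Nat.floor_le (by positivity)
  obtain ⟨z, hz⟩ : ∃ z, z = ⌈2*u^3⌉₊ := ⟨_, rfl⟩
  have hz1 : 2*u^3 ≤ z := hz ▸ Nat.le_ceil _
  have hu3 : 1 ≤ u^3 := one_le_pow₀ (by linarith)
  have hz2 : (z:ℝ) ≤ 3*u^3 := by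
    have := Nat.ceil_lt_add_one (show 0 ≤ 2*u^3 by positivity)
    rw [← hz] at this; linarith
  have hz0 : 1 ≤ z := by
    have : (1:ℝ) ≤ z := by linarith
    exact_mod_cast this
  have hlz : Real.log z ≤ 4*l := by
    have h1 : (z:ℝ) ≤ u^4 := by
      have : u^4 = u*u^3 := by ring
      rw [this]; nlinarith
    calc Real.log z ≤ Real.log (u^4) := Real.log_le_log (by positivity) h1
      _ = _ := by rw [Real.log_pow, ← hldef]; norm_num
  have hlz0 : 0 ≤ Real.log z := Real.log_natCast_nonneg _
  have hV := V_count (Sp 2 n) (Sp 3 n) (Sp 6 n) z ⌊u^6⌋₊ ⌊u^4⌋₊ ⌊u^2⌋₊ (u^2) hz0 ?_ ?_ ?_ ?_ ?_ ?_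
  rotate_left
  · intro x hx
    obtain ⟨h1, h2, h3, h4⟩ := mem_Sp.mp hx
    exact ⟨h2.one_le, hroot 6 x 2 (by norm_num) (by norm_num) h4⟩
  · intro y hy
    obtain ⟨h1, h2, h3, h4⟩ := mem_Sp.mp hy
    refine ⟨h2, ?_, hroot 4 y 3 (by norm_num) (by norm_num) h4⟩
    have h5 : (u^4/3)^3 < (y:ℝ)^3 := by
      have : (n:ℝ) < 14*(y:ℝ)^3 := by exact_mod_cast h3
      rw [← hun] at this
      have e : (u^4/3)^3 = u^12/27 := by ring
      rw [e]
      have : 0 < u^12 := by positivity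
      linarith
    have h6 := lt_of_pow_lt_pow_left₀ 3 (Nat.cast_nonneg y) h5
    have : (z:ℝ) < y := by
      have e : u^4 = u*u^3 := by ring
      rw [e] at h6; nlinarith
    exact_mod_cast this
  · intro x hx
    obtain ⟨h1, h2, h3, h4⟩ := mem_Sp.mp hx
    exact ⟨h2.one_le, hroot 2 x 6 (by norm_num) (by norm_num) h4⟩
  · have h1 : ((⌊u^4⌋₊:ℕ):ℝ)^3 ≤ (u^4)^3 := by gcongr; exact hfl 4
    have h2 : ((⌊u^2⌋₊:ℕ):ℝ)^6 ≤ (u^2)^6 := by gcongr; exact hfl 2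
    have h3 : (2*u^3)^4 ≤ (z:ℝ)^4 := by gcongr
    have h4 : 0 < u^12 := by positivity
    have : ((⌊u^4⌋₊:ℕ):ℝ)^3 + ((⌊u^2⌋₊:ℕ):ℝ)^6 ≤ (z:ℝ)^4 := by
      ring_nf at h1 h2 h3 ⊢
      linarith
    exact_mod_cast this
  · refine Nat.le_floor (hz2.trans ?_)
    have e : u^4 = u*u^3 := by ring
    rw [e]; nlinarith
  · intro m hm hmz
    have h1 := dd_crude m hm 8
    have hm1 : (1:ℝ) ≤ m := by exact_mod_cast hm
    have h2 : (m:ℝ) ≤ 81*u^12 := by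
      calc (m:ℝ) ≤ (z:ℝ)^4 := by exact_mod_cast hmz
        _ ≤ (3*u^3)^4 := by gcongr
        _ = _ := by ring
    have h3 : Real.log m ≤ 12*l + 5 := by
      calc Real.log m ≤ Real.log (u^12*81) := Real.log_le_log (by linarith) (by linarith)
        _ = 12*l + Real.log 81 := by rw [Real.log_mul (by positivity) (by norm_num), Real.log_pow, ← hldef]; norm_num
        _ ≤ _ := by
          have : Real.log 81 ≤ 5 := by
            rw [show (81:ℝ) = 3^4 by norm_num, Real.log_pow]
            have := Real.log_three_lt_d9
            push_cast; linarith
          linarith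
    have h4 : 0 ≤ Real.log m := Real.log_nonneg hm1
    have h5 : dd m^8 ≤ (u^2)^8 := by
      calc dd m^8 ≤ m*(1 + Real.log m)^256 := h1
        _ ≤ (81*u^12)*(13*l)^256 := by gcongr; linarith
        _ = u^12*(81*13^256*l^256) := by rw [mul_pow]; ring
        _ ≤ u^12*u^4 := by
          gcongr
          refine hp.trans ?_
          exact le_self_pow₀ (by linarith) (by norm_num)
        _ = _ := by ring
    exact (pow_le_pow_iff_left₀ (dd_nonneg m) (by positivity) (by norm_num)).mp h5
  have hP := parseval_le (Sp 2 n ×ˢ (Sp 3 n ×ˢ Sp 6 n)) (fun i => (Real.log i.1*hw 2 n i.1)*((Real.log i.2.1*hw 3 n i.2.1)*(Real.log i.2.2*hw 6 n i.2.2)))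
    (fun i => i.1^2 + (i.2.1^3 + i.2.2^6)) (Real.log n*(Real.log n*Real.log n)) ?_
  rotate_left
  · intro i hi; rw [mem_product, mem_product] at hi
    have h0 : 0 ≤ Real.log n := Real.log_natCast_nonneg _
    rw [abs_mul (_*_), abs_mul (Real.log i.2.1*_)]
    exact mul_le_mul (coef_le hi.1) (mul_le_mul (coef_le hi.2.1) (coef_le hi.2.2) (abs_nonneg _) h0) (by positivity) h0
  simp only [ff_prod]
  refine hP.trans ((mul_le_mul_of_nonneg_left hV (sq_nonneg _)).trans ?_)
  calc _ ≤ (Real.log n*(Real.log n*Real.log n))^2*(u^6*(u^2*u^4 + (u^2)^2*u^2) + 32*((u^4)^2*(u^2)^2)*(1 + Real.log z)^64) := by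
        gcongr <;> apply hfl
    _ = n*(Real.log n^6*(2 + 32*(1 + Real.log z)^64)) := by rw [← hun]; ring
    _ ≤ n*(Real.log n^6*(Real.log n*Real.log n^64)) := by
        have h1 : 1 + Real.log z ≤ Real.log n := by linarith
        have h2 : (1 + Real.log z)^64 ≤ Real.log n^64 := by gcongr
        have h3 : 1 ≤ Real.log n^64 := one_le_pow₀ (by linarith)
        have h4 : 34 ≤ Real.log n := by linarith
        gcongr; nlinarith
    _ = _ := by ring
noncomputable abbrev st (q : ℕ) [NeZero q] : AddChar (ZMod q) ℂ := ZMod.stdAddChar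
noncomputable def Sk (k q : ℕ) [NeZero q] (a : ZMod q) : ℂ := ∑ b : (ZMod q)ˣ, st q (a*(b:ZMod q)^k)
noncomputable def PS (q : ℕ) [NeZero q] (a : ZMod q) : ℂ := Sk 2 q a^2*Sk 3 q a^2*Sk 6 q a^2*Sk 5 q a
noncomputable def AN (n q : ℕ) [NeZero q] : ℂ := ((q.totient:ℂ)⁻¹)^7 * ∑ a : (ZMod q)ˣ, PS q a*st q (-((n:ZMod q)*a))
noncomputable def AA (n q : ℕ) : ℂ := if h : q = 0 then 0 else haveI : NeZero q := ⟨h⟩; AN n q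
lemma AA_eq (n q : ℕ) [h : NeZero q] : AA n q = AN n q := by unfold AA; rw [dif_neg h.1]
lemma std_mul (q r : ℕ) [NeZero q] [NeZero r] [NeZero (q*r)] (h : q.Coprime r) : ∃ (u : (ZMod q)ˣ) (v : (ZMod r)ˣ), ∀ x : ZMod (q*r),
    st (q*r) x = st q (u*(ZMod.chineseRemainder h x).1)*st r (v*(ZMod.chineseRemainder h x).2) := by
  obtain ⟨s, t, hst⟩ := Nat.isCoprime_iff_coprime.mpr h
  have hu : IsUnit ((t:ℤ) : ZMod q) := by
    refine IsUnit.of_mul_eq_one ((r:ℕ):ZMod q) ?_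
    have := congrArg (fun z : ℤ => (z : ZMod q)) hst
    simpa using this
  have hv : IsUnit ((s:ℤ) : ZMod r) := by
    refine IsUnit.of_mul_eq_one ((q:ℕ):ZMod r) ?_
    have := congrArg (fun z : ℤ => (z : ZMod r)) hst
    simpa using this
  refine ⟨hu.unit, hv.unit, fun x => ?_⟩
  obtain ⟨j, rfl⟩ := ZMod.intCast_surjective x
  rw [map_intCast (ZMod.chineseRemainder h), Prod.fst_intCast, Prod.snd_intCast, IsUnit.unit_spec, IsUnit.unit_spec, ← Int.cast_mul, ← Int.cast_mul,
    ZMod.stdAddChar_coe, ZMod.stdAddChar_coe, ZMod.stdAddChar_coe, ← Complex.exp_add]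
  congr 1
  have hq : (q:ℂ) ≠ 0 := NeZero.ne _
  have hr : (r:ℂ) ≠ 0 := NeZero.ne _
  have hst' : (s:ℂ)*q + t*r = 1 := by exact_mod_cast hst
  push_cast; field_simp; linear_combination (-j : ℂ)*hst'
noncomputable def crt (q r : ℕ) (h : q.Coprime r) : (ZMod (q*r))ˣ ≃* (ZMod q)ˣ × (ZMod r)ˣ := (Units.mapEquiv (ZMod.chineseRemainder h).toMulEquiv).trans MulEquiv.prodUnits
lemma crt_spec (q r : ℕ) (h : q.Coprime r) (b : (ZMod (q*r))ˣ) : ZMod.chineseRemainder h (b : ZMod (q*r)) = (((crt q r h b).1 : ZMod q), ((crt q r h b).2 : ZMod r)) := rfl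
lemma AN_mul (n q r : ℕ) [NeZero q] [NeZero r] [NeZero (q*r)] (h : q.Coprime r) : AN n (q*r) = AN n q*AN n r := by
  obtain ⟨u, v, huv⟩ := std_mul q r h
  have hS : ∀ (k : ℕ) (a : ZMod (q*r)), Sk k (q*r) a = Sk k q (u*(ZMod.chineseRemainder h a).1)*Sk k r (v*(ZMod.chineseRemainder h a).2) := by
    intro k a; unfold Sk; rw [sum_mul_sum, ← Fintype.sum_prod_type', ← (crt q r h).toEquiv.sum_comp]
    refine sum_congr rfl fun b _ => ?_
    rw [huv, map_mul (ZMod.chineseRemainder h), map_pow (ZMod.chineseRemainder h), crt_spec]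
    simp only [Prod.fst_mul, Prod.pow_fst, Prod.snd_mul, Prod.pow_snd, mul_assoc]
    rfl
  have hP : ∀ a : ZMod (q*r), PS (q*r) a = PS q (u*(ZMod.chineseRemainder h a).1)*PS r (v*(ZMod.chineseRemainder h a).2) := by
    intro a; unfold PS; simp only [hS]; ring
  unfold AN; rw [Nat.totient_mul h]; rw [mul_mul_mul_comm, sum_mul_sum, ← Fintype.sum_prod_type']; congr 1
  · push_cast; rw [mul_inv, mul_pow]
  · rw [← ((crt q r h).toEquiv.trans ((Equiv.mulLeft u).prodCongr (Equiv.mulLeft v))).sum_comp]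
    refine sum_congr rfl fun a _ => ?_
    rw [hP, huv, map_neg (ZMod.chineseRemainder h), map_mul (ZMod.chineseRemainder h), map_natCast (ZMod.chineseRemainder h), crt_spec]
    simp only [Prod.fst_neg, Prod.fst_mul, Prod.snd_neg, Prod.snd_mul, Prod.fst_natCast, Prod.snd_natCast, Equiv.trans_apply, Equiv.prodCongr_apply,
      MulEquiv.toEquiv_eq_coe, Prod.map_fst, Prod.map_snd, Equiv.coe_mulLeft, Units.val_mul, MulEquiv.coe_toEquiv]
    rw [mul_mul_mul_comm]
    congr 3 <;> ring_nf
lemma AA_mul (n q r : ℕ) (h : q.Coprime r) : AA n (q*r) = AA n q*AA n r := by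
  rcases eq_or_ne q 0 with rfl | hq
  · simp [AA]
  rcases eq_or_ne r 0 with rfl | hr
  · simp [AA]
  have : NeZero q := ⟨hq⟩
  have : NeZero r := ⟨hr⟩
  have : NeZero (q*r) := ⟨mul_ne_zero hq hr⟩
  rw [AA_eq, AA_eq, AA_eq, AN_mul n q r h]
lemma AA_one (n : ℕ) : AA n 1 = 1 := by
  rw [AA_eq]
  have : ∀ x : ZMod 1, st 1 x = 1 := fun x => by rw [Subsingleton.elim x 0]; simp
  simp [AN, PS, Sk, this]
lemma Sk_zero (k q p : ℕ) [NeZero q] (hp : p.Prime) (hpq : p^2 ∣ q) (hk : ¬ p ∣ k) (a : (ZMod q)ˣ) : Sk k q a = 0 := by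
  obtain ⟨s, hs⟩ := hpq
  have hp0 := hp.pos
  obtain ⟨r, hr⟩ : ∃ r, r = p*s := ⟨_, rfl⟩
  have hqr : q = p*r := by rw [hs, hr]; ring
  have hr2 : (r:ZMod q)^2 = 0 := by
    rw [← Nat.cast_pow, ZMod.natCast_eq_zero_iff]
    exact ⟨s, by rw [hqr, hr]; ring⟩
  have hpow : ∀ (t : ZMod q) (j : ℕ), (1 + r*t)^j = 1 + j*(r*t) := by
    intro t j
    induction j with
    | zero => simp
    | succ j ih =>
      rw [pow_succ, ih]; push_cast; linear_combination (j*t^2)*hr2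
  have hS : ∀ t : ℕ, Sk k q a = ∑ b : (ZMod q)ˣ, st q ((a:ZMod q)*(b:ZMod q)^k)*st q ((a:ZMod q)*(b:ZMod q)^k*k*r)^t := by
    intro t
    let c : (ZMod q)ˣ := ⟨1 + r*t, 1 - r*t, by linear_combination (-t^2 : ZMod q)*hr2, by linear_combination (-t^2 : ZMod q)*hr2⟩
    unfold Sk; rw [← Equiv.sum_comp (Equiv.mulRight c)]
    refine sum_congr rfl fun b _ => ?_
    rw [← AddChar.map_nsmul_eq_pow, ← AddChar.map_add_eq_mul]; congr 1; simp only [Equiv.coe_mulRight, Units.val_mul, mul_pow, nsmul_eq_mul]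
    rw [show (c : ZMod q)^k = 1 + k*(r*t) from hpow t k]; ring
  have h0 : (p:ℂ)*Sk k q a = 0 := by
    rw [← nsmul_eq_mul, ← card_range p, ← sum_const, sum_congr rfl fun t _ => hS t, sum_comm]
    refine sum_eq_zero fun b _ => ?_
    rw [← mul_sum]
    refine mul_eq_zero_of_right _ ?_
    set ζ := st q ((a:ZMod q)*(b:ZMod q)^k*k*r) with hζ
    have h1 : ζ^p = 1 := by
      rw [hζ, ← AddChar.map_nsmul_eq_pow, nsmul_eq_mul]
      have : ((p:ZMod q))*r = 0 := by rw [← Nat.cast_mul, ← hqr]; simp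
      rw [show (p:ZMod q)*((a:ZMod q)*(b:ZMod q)^k*k*r) = (a*b^k*k)*(p*r) by ring, this]; simp
    have h2 : ζ ≠ 1 := by
      intro h; rw [hζ, ← AddChar.map_zero_eq_one (ZMod.stdAddChar (N := q)), ZMod.injective_stdAddChar.eq_iff] at h
      have h3 : (k:ZMod q)*r = 0 := by
        have : ((a*b^k : (ZMod q)ˣ) : ZMod q)*((k:ZMod q)*r) = 0 := by rw [← h]; push_cast; ring
        exact (Units.mul_right_eq_zero _).mp this
      rw [← Nat.cast_mul, ZMod.natCast_eq_zero_iff, hqr] at h3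
      refine hk (Nat.dvd_of_mul_dvd_mul_right ?_ h3)
      rcases Nat.eq_zero_or_pos r with h | h
      · rw [h, mul_zero] at hqr; exact absurd hqr (NeZero.ne q)
      · exact h
    have h3 := mul_geom_sum ζ p
    rw [h1, sub_self] at h3; exact (mul_eq_zero.mp h3).resolve_left (sub_ne_zero.mpr h2)
  exact (mul_eq_zero.mp h0).resolve_left (by exact_mod_cast hp.ne_zero)
lemma AA_zero (n q p : ℕ) (hp : p.Prime) (hpq : p^2 ∣ q) : AA n q = 0 := by
  rcases eq_or_ne q 0 with rfl | hq
  · simp [AA]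
  have : NeZero q := ⟨hq⟩
  rw [AA_eq]
  refine mul_eq_zero_of_right _ (sum_eq_zero fun a _ => mul_eq_zero_of_left ?_ _)
  unfold PS
  by_cases h5 : p = 5
  · rw [Sk_zero 2 q p hp hpq (by rw [h5]; norm_num)]; ring
  · rw [Sk_zero 5 q p hp hpq (fun h => h5 ((Nat.prime_dvd_prime_iff_eq hp (by norm_num)).mp h))]; ring
end WG
end
section
open Finset Pointwise
namespace WG
def Fx (q : ℕ) (x : ((ZMod q)ˣ × (ZMod q)ˣ) × ((ZMod q)ˣ × (ZMod q)ˣ) × ((ZMod q)ˣ × (ZMod q)ˣ) × (ZMod q)ˣ) : ZMod q :=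
  ((x.1.1:ZMod q)^2 + (x.1.2:ZMod q)^2) + (((x.2.1.1:ZMod q)^3 + (x.2.1.2:ZMod q)^3) + (((x.2.2.1.1:ZMod q)^6 + (x.2.2.1.2:ZMod q)^6) + (x.2.2.2:ZMod q)^5))
lemma rep_mul {q : ℕ} [NeZero q] {α β : Type*} [Fintype α] [Fintype β] (F : α → ZMod q) (G : β → ZMod q) (a : ZMod q) :
    (∑ x, st q (a*F x))*(∑ y, st q (a*G y)) = ∑ z : α × β, st q (a*(F z.1 + G z.2)) := by
  rw [sum_mul_sum, ← Fintype.sum_prod_type']; exact sum_congr rfl fun z _ => by rw [mul_add, AddChar.map_add_eq_mul]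
lemma PS_rep (q : ℕ) [NeZero q] (a : ZMod q) : PS q a = ∑ x, st q (a*Fx q x) := by
  unfold PS Fx Sk; rw [mul_assoc, mul_assoc, sq, sq, sq, rep_mul, rep_mul, rep_mul, rep_mul, rep_mul, rep_mul]
lemma sum_units (p : ℕ) [Fact p.Prime] (f : ZMod p → ℂ) : ∑ a, f a = f 0 + ∑ a : (ZMod p)ˣ, f a := by
  rw [← add_sum_erase univ f (mem_univ 0), sum_subtype (univ.erase 0) (p := (· ≠ 0)) (by simp), ← unitsEquivNeZero.sum_comp]; rfl
lemma one_add_AA (n p : ℕ) [Fact p.Prime] : 1 + AA n p = ((p*((p:ℝ)-1)⁻¹^7 * #{x | Fx p x = n} : ℝ) : ℂ) := by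
  have hp := Fact.out (p := p.Prime)
  have h1 : (1:ℝ) < p := by exact_mod_cast hp.one_lt
  have h0 : PS p 0 = ((p:ℂ)-1)^7 := by
    have : ∀ k, Sk k p 0 = (p:ℂ) - 1 := by intro k; unfold Sk; simp [ZMod.card_units_eq_totient, Nat.totient_prime hp, Nat.cast_sub hp.one_le]
    unfold PS; simp only [this]; ring
  have h2 := sum_units p (fun a => PS p a*st p (-((n:ZMod p)*a)))
  have h3 : ∑ a : ZMod p, PS p a*st p (-((n:ZMod p)*a)) = p * #{x | Fx p x = n} := by
    simp only [PS_rep, sum_mul]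
    rw [sum_comm, Finset.card_filter, Nat.cast_sum, mul_sum]
    refine sum_congr rfl fun x _ => ?_
    have := AddChar.sum_mulShift (Fx p x - n) (ZMod.isPrimitive_stdAddChar p)
    rw [ZMod.card] at this
    rw [show (∑ a : ZMod p, st p (a*Fx p x)*st p (-((n:ZMod p)*a))) = ∑ a : ZMod p, st p (a*(Fx p x - n)) from
      sum_congr rfl fun a _ => by rw [← AddChar.map_add_eq_mul]; congr 1; ring, this]
    simp only [sub_eq_zero]
    split_ifs <;> simp
  rw [AA_eq, AN, Nat.totient_prime hp, Nat.cast_sub hp.one_le, Nat.cast_one]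
  simp only [h0, mul_zero, neg_zero, AddChar.map_zero_eq_one, mul_one] at h2
  rw [h3] at h2
  have h4 : ((p:ℂ)-1) ≠ 0 := by
    have : (p:ℝ)-1 ≠ 0 := by linarith
    exact_mod_cast this
  rw [← sub_eq_iff_eq_add'.mpr h2]; push_cast; field_simp; ring
lemma root_card (p : ℕ) [Fact p.Prime] (k : ℕ) (hk : 0 < k) (c t : (ZMod p)) (hc : c ≠ 0) : #{b : (ZMod p)ˣ | c*(b:ZMod p)^k = t} ≤ k := by
  classical
  calc #{b : (ZMod p)ˣ | c*(b:ZMod p)^k = t} ≤ #(Polynomial.nthRoots k (t/c)).toFinset := by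
        refine card_le_card_of_injOn (fun b => (b:ZMod p)) ?_ (fun a _ b _ h => Units.ext h)
        intro b hb; simp only [coe_filter, mem_univ, true_and, Set.mem_ofPred_eq] at hb
        simp only [mem_coe, Multiset.mem_toFinset, Polynomial.mem_nthRoots hk]
        rw [eq_div_iff hc, mul_comm, hb]
    _ ≤ _ := (Multiset.toFinset_card_le _).trans (Polynomial.card_nthRoots _ _)
lemma Sk_bound (k p : ℕ) [Fact p.Prime] (hk : 0 < k) (a : (ZMod p)ˣ) : ‖Sk k p a‖^2 ≤ k^2*p := by
  have hp := Fact.out (p := p.Prime)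
  have h1 : (1:ℝ) < p := by exact_mod_cast hp.one_lt
  have hU : (#(univ : Finset (ZMod p)ˣ) : ℝ) = p - 1 := by rw [card_univ, ZMod.card_units_eq_totient, Nat.totient_prime hp, Nat.cast_sub hp.one_le, Nat.cast_one]
  have hm : ∑ a : ZMod p, ‖Sk k p a‖^2 ≤ p*((p - 1)*k) := by
    have e : ((∑ a : ZMod p, ‖Sk k p a‖^2 : ℝ) : ℂ) = ((p * ∑ c : (ZMod p)ˣ, (#{b : (ZMod p)ˣ | 1*(b:ZMod p)^k = (c:ZMod p)^k} : ℝ) : ℝ) : ℂ) := by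
      rw [Complex.ofReal_sum]
      calc _ = ∑ a : ZMod p, ∑ c : (ZMod p)ˣ, ∑ b : (ZMod p)ˣ, st p (a*((b:ZMod p)^k - (c:ZMod p)^k)) := by
            refine sum_congr rfl fun a _ => ?_
            rw [Complex.ofReal_pow, ← Complex.mul_conj', Sk, map_sum, sum_mul_sum, sum_comm]
            refine sum_congr rfl fun c _ => sum_congr rfl fun b _ => ?_
            rw [← AddChar.map_neg_eq_conj, ← AddChar.map_add_eq_mul]
            congr 1; ring
        _ = ∑ c : (ZMod p)ˣ, ∑ b : (ZMod p)ˣ, ∑ a : ZMod p, st p (a*((b:ZMod p)^k - (c:ZMod p)^k)) := by rw [sum_comm]; exact sum_congr rfl fun c _ => sum_comm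
        _ = _ := by
            rw [mul_sum, Complex.ofReal_sum]
            refine sum_congr rfl fun c _ => ?_
            rw [Finset.card_filter, Nat.cast_sum, mul_sum, Complex.ofReal_sum]
            refine sum_congr rfl fun b _ => ?_
            have := AddChar.sum_mulShift ((b:ZMod p)^k - (c:ZMod p)^k) (ZMod.isPrimitive_stdAddChar p)
            rw [this, ZMod.card]; simp only [sub_eq_zero, one_mul]
            split_ifs <;> simp
    rw [Complex.ofReal_inj.mp e, ← hU, ← nsmul_eq_mul (#univ), ← sum_const]; gcongr with c _
    exact_mod_cast root_card p k hk 1 _ one_ne_zero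
  have h2 : (p - 1) * ‖Sk k p a‖^2 ≤ k*(p*((p-1)*k)) := by
    calc (p - 1) * ‖Sk k p a‖^2 = ∑ c : (ZMod p)ˣ, ‖Sk k p (a*(c:ZMod p)^k)‖^2 := by
          rw [← hU, ← nsmul_eq_mul, ← sum_const]
          refine sum_congr rfl fun c _ => ?_
          congr 2
          unfold Sk; rw [← Equiv.sum_comp (Equiv.mulLeft c)]
          refine sum_congr rfl fun b _ => ?_
          simp only [Equiv.coe_mulLeft, Units.val_mul, mul_pow, mul_assoc]
      _ = ∑ t : ZMod p, ∑ c ∈ univ.filter (fun c : (ZMod p)ˣ => (a:ZMod p)*(c:ZMod p)^k = t), ‖Sk k p (a*(c:ZMod p)^k)‖^2 :=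
          (sum_fiberwise univ (fun c : (ZMod p)ˣ => (a:ZMod p)*(c:ZMod p)^k) (fun c => ‖Sk k p (a*(c:ZMod p)^k)‖^2)).symm
      _ ≤ ∑ t : ZMod p, k * ‖Sk k p t‖^2 := by
          refine sum_le_sum fun t _ => ?_
          rw [sum_congr rfl (g := fun _ => ‖Sk k p t‖^2) (fun c hc => by rw [(mem_filter.mp hc).2]), sum_const, nsmul_eq_mul]
          gcongr; exact root_card p k hk a t a.ne_zero
      _ ≤ _ := by rw [← mul_sum]; gcongr
  have h3 : (0:ℝ) < p - 1 := by linarith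
  refine le_of_mul_le_mul_left (h2.trans (le_of_eq (by ring))) h3
lemma AA_prime (n p : ℕ) (hp : p.Prime) : ‖AA n p‖ ≤ 2^16 / p^2 := by
  have : Fact p.Prime := ⟨hp⟩
  have h2 : (2:ℝ) ≤ p := by exact_mod_cast hp.two_le
  have hS : ∀ k a, ‖Sk k p a‖ ≤ (p:ℝ) - 1 := by
    intro k a; unfold Sk
    refine (norm_sum_le_of_le _ (fun (b : (ZMod p)ˣ) _ => (show ‖st p (a*(b:ZMod p)^k)‖ ≤ 1 by rw [ZMod.stdAddChar_apply, Circle.norm_coe]))).trans ?_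
    simp [ZMod.card_units_eq_totient, Nat.totient_prime hp, Nat.cast_sub hp.one_le]
  have hP : ∀ a : (ZMod p)ˣ, ‖PS p a‖ ≤ (2^2*p)*(3^2*p)*(6^2*p)*(p-1) := by
    intro a; unfold PS; rw [norm_mul, norm_mul, norm_mul, norm_pow, norm_pow, norm_pow]
    have := Sk_bound 2 p (by norm_num) a
    have := Sk_bound 3 p (by norm_num) a
    have := Sk_bound 6 p (by norm_num) a
    push_cast at *
    gcongr; exact hS _ _
  rw [AA_eq, AN, norm_mul, norm_pow, norm_inv, Complex.norm_natCast, Nat.totient_prime hp, Nat.cast_sub hp.one_le, Nat.cast_one]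
  have h3 : ‖∑ a : (ZMod p)ˣ, PS p a*st p (-((n:ZMod p)*a))‖ ≤ (p-1)*((2^2*p)*(3^2*p)*(6^2*p)*(p-1)) := by
    refine (norm_sum_le _ _).trans ?_
    calc _ ≤ ∑ a : (ZMod p)ˣ, ((2^2*p)*(3^2*p)*(6^2*p)*((p:ℝ)-1)) := by
          refine sum_le_sum fun a _ => ?_
          rw [norm_mul, ZMod.stdAddChar_apply, Circle.norm_coe, mul_one]; exact hP a
      _ = _ := by rw [sum_const, card_univ, ZMod.card_units_eq_totient, Nat.totient_prime hp, nsmul_eq_mul, Nat.cast_sub hp.one_le, Nat.cast_one]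
  obtain ⟨m, hm⟩ : ∃ m : ℝ, m = p - 1 := ⟨_, rfl⟩
  have hm1 : (p:ℝ) = m + 1 := by linarith
  have hm2 : (p:ℝ) ≤ 2*m := by linarith
  have hm0 : 0 < m := by linarith
  rw [← hm] at h3 ⊢
  calc _ ≤ m⁻¹^7*(m*((2^2*p)*(3^2*p)*(6^2*p)*m)) := by gcongr
    _ = 1296*p^5 / (m^5*p^2) := by field_simp; norm_num
    _ ≤ 1296*(2*m)^5 / (m^5*p^2) := by gcongr
    _ = 41472 / p^2 := by field_simp; norm_num
    _ ≤ _ := by gcongr; norm_num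
lemma sol2 : Fx 2 ((1,1),(1,1),(1,1),1) = 1 := by decide
lemma sol3 : ∀ m : ZMod 3, ∃ x y z : (ZMod 3)ˣ, Fx 3 ((1,1),(x,y),(1,1),z) = m := by decide
lemma local_sol (n p : ℕ) [Fact p.Prime] (hn : ¬ 2 ∣ n) : ∃ x, Fx p x = n := by
  classical
  have hp := Fact.out (p := p.Prime)
  rcases lt_or_ge p 5 with h5 | h5
  · have : p = 2 ∨ p = 3 := by
      have := hp.two_le
      interval_cases p <;> simp_all
      exact absurd hp (by norm_num)
    rcases this with rfl | rfl
    · refine ⟨((1,1),(1,1),(1,1),1), ?_⟩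
      have : n % 2 = 1 := by omega
      have h : (n : ZMod 2) = 1 := by rw [← ZMod.natCast_mod, this]; rfl
      rw [h]; exact sol2
    · generalize (n:ZMod 3) = m
      obtain ⟨x, y, z, h⟩ := sol3 m
      exact ⟨_, h⟩
  · have hQ : ∀ k, 0 < k → p - 1 ≤ k * #(univ.image (fun b : (ZMod p)ˣ => (b:ZMod p)^k)) := by
      intro k hk
      have := card_le_mul_card_image (s := (univ : Finset (ZMod p)ˣ)) (f := fun b : (ZMod p)ˣ => (b:ZMod p)^k) k
        (fun t _ => by simpa using root_card p k hk 1 t one_ne_zero)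
      rwa [card_univ, ZMod.card_units_eq_totient, Nat.totient_prime hp] at this
    have h2 := hQ 2 (by norm_num)
    have h3 := hQ 3 (by norm_num)
    set Q2 := univ.image (fun b : (ZMod p)ˣ => (b:ZMod p)^2) with hQ2
    set Q3 := univ.image (fun b : (ZMod p)ˣ => (b:ZMod p)^3) with hQ3
    have n2 : Q2.Nonempty := univ_nonempty.image _
    have n3 : Q3.Nonempty := univ_nonempty.image _
    have c1 := ZMod.cauchy_davenport hp n2 n2
    have c2 := ZMod.cauchy_davenport hp n3 n3
    have c3 := ZMod.cauchy_davenport hp (n2.add n2) (n3.add n3)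
    have hfull : (Q2 + Q2) + (Q3 + Q3) = univ := by
      apply eq_univ_of_card
      rw [ZMod.card]
      refine le_antisymm ((card_le_univ _).trans (by rw [ZMod.card])) ?_
      omega
    have hmem : (n:ZMod p) - 3 ∈ (Q2 + Q2) + (Q3 + Q3) := by rw [hfull]; exact mem_univ _
    simp only [mem_add, hQ2, hQ3, mem_image, mem_univ, true_and] at hmem
    obtain ⟨_, ⟨_, ⟨x1, rfl⟩, _, ⟨x2, rfl⟩, rfl⟩, _, ⟨_, ⟨x3, rfl⟩, _, ⟨x4, rfl⟩, rfl⟩, h⟩ := hmem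
    refine ⟨((x1,x2),(x3,x4),(1,1),1), ?_⟩
    simp only [Fx, Units.val_one, one_pow]
    linear_combination h
end WG
end
section
open Finset
namespace WG
lemma AA_le_dd (n q : ℕ) : ‖AA n q‖ ≤ dd q^16 / q^2 := by
  induction q using Nat.recOnPosPrimePosCoprime with
  | prime_pow p m hp hm =>
    rcases (show m = 1 ∨ 2 ≤ m by omega) with rfl | h
    · rw [pow_one]
      refine (AA_prime n p hp).trans (le_of_eq ?_)
      simp [dd, hp.divisors, card_pair hp.one_lt.ne]
    · rw [AA_zero n (p^m) p hp (pow_dvd_pow p h), norm_zero]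
      have := dd_nonneg (p^m)
      positivity
  | zero => simp [AA]
  | one => rw [AA_one]; simp [dd]
  | coprime a b _ _ hab iha ihb =>
    rw [AA_mul n a b hab, norm_mul]
    have e : dd (a*b) = dd a*dd b := by unfold dd; rw [hab.card_divisors_mul]; push_cast; ring
    rw [e]; push_cast
    calc _ ≤ (dd a^16/a^2)*(dd b^16/b^2) := mul_le_mul iha ihb (norm_nonneg _) (by have := dd_nonneg a; positivity)
      _ = _ := by rw [mul_pow, mul_pow, div_mul_div_comm]
lemma AA_unif : ∃ C > 0, ∀ n q : ℕ, ‖AA n q‖ ≤ C*(q:ℝ)^(-(3/2) : ℝ) := by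
  obtain ⟨K, hK⟩ : ∃ K : ℕ, K = 2^64 := ⟨_, rfl⟩
  have hK0 : 0 < K := by rw [hK]; positivity
  obtain ⟨C, hC⟩ : ∃ C : ℝ, C = (K:ℝ)^K*Real.exp 1 := ⟨_, rfl⟩
  have hC0 : 0 < C := by rw [hC]; positivity
  refine ⟨C^((1/4):ℝ), by positivity, fun n q => ?_⟩
  rcases Nat.eq_zero_or_pos q with rfl | hq
  · simp [AA]
  have hq1 : (1:ℝ) ≤ q := by exact_mod_cast hq
  have hq0 : (0:ℝ) < q := by linarith
  have h1 := dd_crude q hq 64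
  rw [← hK] at h1
  have h2 : (1 + Real.log q)^K ≤ C*q := by
    have h3 : 1 + Real.log q ≤ K*(Real.exp 1*q)^((K:ℝ)⁻¹) := by
      have := Real.log_le_rpow_div (x := Real.exp 1*q) (ε := (K:ℝ)⁻¹) (by positivity) (by positivity)
      rw [Real.log_mul (Real.exp_ne_zero _) hq0.ne', Real.log_exp, div_inv_eq_mul, mul_comm _ (K:ℝ)] at this; exact this
    calc (1 + Real.log q)^K ≤ (K*(Real.exp 1*q)^((K:ℝ)⁻¹))^K := by gcongr
      _ = C*q := by rw [mul_pow, Real.rpow_inv_natCast_pow (by positivity) hK0.ne', hC]; ring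
  have h4 : (dd q^16)^4 ≤ (C^((1/4):ℝ)*(q:ℝ)^((1/2):ℝ))^4 := by
    rw [mul_pow, ← Real.rpow_natCast (C^((1/4):ℝ)), ← Real.rpow_natCast ((q:ℝ)^((1/2):ℝ)), ← Real.rpow_mul hC0.le, ← Real.rpow_mul hq0.le]; norm_num
    rw [← pow_mul]
    calc dd q^64 ≤ q*(1 + Real.log q)^K := h1
      _ ≤ q*(C*q) := by gcongr
      _ = _ := by ring
  have h5 := (pow_le_pow_iff_left₀ (by have := dd_nonneg q; positivity) (by positivity) (by norm_num)).mp h4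
  refine (AA_le_dd n q).trans ?_
  calc dd q^16 / q^2 ≤ (C^((1/4):ℝ)*(q:ℝ)^((1/2):ℝ)) / (q:ℝ)^2 := by gcongr
    _ = C^((1/4):ℝ)*(q:ℝ)^(-(3/2) : ℝ) := by
      rw [mul_div_assoc]; congr 1
      rw [← Real.rpow_natCast, ← Real.rpow_sub hq0]; norm_num
lemma AA_factor (n p : ℕ) (hp : p.Prime) (hn : ¬ 2 ∣ n) : ∃ r : ℝ, ∑' e, AA n (p^e) = r ∧ ((p:ℝ)+1)⁻¹^6 ≤ r ∧ 1 - 2^16/(p:ℝ)^2 ≤ r := by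
  have : Fact p.Prime := ⟨hp⟩
  have hp1 : (1:ℝ) < p := by exact_mod_cast hp.one_lt
  have h1 : ∑' e, AA n (p^e) = 1 + AA n p := by
    rw [tsum_eq_sum (s := range 2)]
    · simp [sum_range_succ, AA_one]
    · intro e he
      exact AA_zero n _ p hp (pow_dvd_pow p (by simp at he; omega))
  have h2 := one_add_AA n p
  refine ⟨_, h1.trans h2, ?_, ?_⟩
  · obtain ⟨x, hx⟩ := local_sol n p hn
    have h3 : 1 ≤ #{x | Fx p x = n} := card_pos.mpr ⟨x, by simpa using hx⟩
    have h3' : (1:ℝ) ≤ #{x | Fx p x = n} := by exact_mod_cast h3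
    have h4 : (0:ℝ) < p - 1 := by linarith
    calc ((p:ℝ)+1)⁻¹^6 ≤ ((p:ℝ)-1)⁻¹^6 := by gcongr; linarith
      _ = ((p:ℝ)-1)*((p:ℝ)-1)⁻¹^7*1 := by field_simp
      _ ≤ _ := by gcongr; linarith
  · have h3 := AA_prime n p hp
    have h4 : AA n p = (((p*((p:ℝ)-1)⁻¹^7 * #{x | Fx p x = n} : ℝ) - 1 : ℝ) : ℂ) := by rw [Complex.ofReal_sub, ← h2]; simp
    rw [h4, Complex.norm_real] at h3
    have := (abs_le.mp h3).1
    linarith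
lemma prod_ge {ι : Type*} [DecidableEq ι] (s : Finset ι) (a : ι → ℝ) (h : ∀ i ∈ s, 0 ≤ a i ∧ a i ≤ 1) : 1 - ∑ i ∈ s, a i ≤ ∏ i ∈ s, (1 - a i) := by
  induction s using Finset.induction_on with
  | empty => simp
  | insert i s hi ih =>
    rw [sum_insert hi, prod_insert hi]
    have h1 := h i (mem_insert_self _ _)
    have h2 := ih fun j hj => h j (mem_insert_of_mem hj)
    have h3 : 0 ≤ ∑ j ∈ s, a j := sum_nonneg fun j hj => (h j (mem_insert_of_mem hj)).1
    nlinarith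
lemma sing_lower : ∃ c > 0, ∃ P0 : ℕ, ∀ P ≥ P0, ∀ n : ℕ, ¬ 2 ∣ n → c ≤ (∑ q ∈ range (P+1), AA n q).re := by
  obtain ⟨C, hC0, hC⟩ := AA_unif
  have hs0 : Summable fun q : ℕ => (q:ℝ)^(-(3/2) : ℝ) := Real.summable_nat_rpow.mpr (by norm_num)
  have hs : Summable fun q : ℕ => C*(q:ℝ)^(-(3/2) : ℝ) := hs0.mul_left C
  have hA : ∀ n, Summable fun q => ‖AA n q‖ := fun n => Summable.of_nonneg_of_le (fun _ => norm_nonneg _) (hC n) hs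
  have hsq : Summable fun p : ℕ => 2^16/(p:ℝ)^2 := by
    have := (Real.summable_one_div_nat_pow.mpr (show 1 < 2 by norm_num)).mul_left (2^16 : ℝ)
    exact this.congr fun p => by rw [mul_one_div]
  obtain ⟨F, hF⟩ := summable_iff_vanishing_norm.mp hsq (1/2) (by norm_num)
  obtain ⟨c, hc⟩ : ∃ c : ℝ, c = (∏ p ∈ F, ((p:ℝ)+1)⁻¹^6)*(1/2) := ⟨_, rfl⟩
  have hc0 : 0 < c := by rw [hc]; exact mul_pos (prod_pos fun p _ => by positivity) (by norm_num)
  have hfull : ∀ n : ℕ, ¬ 2 ∣ n → c ≤ (∑' q, AA n q).re := by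
    intro n hn
    have ht := EulerProduct.eulerProduct (AA_one n) (fun {a b} h => AA_mul n a b h) (hA n) (by simp [AA])
    refine ge_of_tendsto ((Complex.continuous_re.tendsto _).comp ht) (Filter.Eventually.of_forall fun N => ?_)
    choose! r hr1 hr2 hr3 using fun p hp => AA_factor n p hp hn
    simp only [Function.comp]
    rw [prod_congr rfl fun p hp => hr1 p (Nat.prime_of_mem_primesBelow hp), ← Complex.ofReal_prod, Complex.ofReal_re]
    rw [← prod_inter_mul_prod_sdiff _ F, hc]
    have hone : ∀ p : ℕ, ((p:ℝ)+1)⁻¹^6 ≤ 1 := fun p => pow_le_one₀ (by positivity) (inv_le_one_of_one_le₀ (by linarith [Nat.cast_nonneg (α := ℝ) p]))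
    have hpos : ∀ p ∈ N.primesBelow, 0 ≤ r p := fun p hp => le_trans (by positivity) (hr2 p (Nat.prime_of_mem_primesBelow hp))
    have hb : (1/2 : ℝ) ≤ ∏ p ∈ N.primesBelow \ F, r p := by
      have hv := hF (N.primesBelow \ F) sdiff_disjoint
      rw [Real.norm_of_nonneg (sum_nonneg fun p _ => by positivity)] at hv
      have h1 := prod_ge (N.primesBelow \ F) (fun p => 2^16/(p:ℝ)^2) (fun p hp => ⟨by positivity,
        (single_le_sum (f := fun p : ℕ => 2^16/(p:ℝ)^2) (fun i _ => by positivity) hp).trans (by linarith)⟩)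
      refine le_trans (by linarith) (h1.trans (prod_le_prod (fun p hp => ?_) (fun p hp => ?_)))
      · have := (single_le_sum (f := fun p : ℕ => 2^16/(p:ℝ)^2) (fun i _ => by positivity) hp)
        linarith
      · exact hr3 p (Nat.prime_of_mem_primesBelow (mem_sdiff.mp hp).1)
    refine mul_le_mul ?_ hb (by norm_num) (prod_nonneg fun p hp => hpos p (mem_inter.mp hp).1)
    calc ∏ p ∈ F, ((p:ℝ)+1)⁻¹^6 ≤ ∏ p ∈ N.primesBelow ∩ F, ((p:ℝ)+1)⁻¹^6 :=
          Finset.prod_le_prod_of_subset_of_le_one inter_subset_right (fun i _ => by positivity) (fun p _ _ => hone p)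
      _ ≤ _ := prod_le_prod (fun i _ => by positivity) fun p hp => hr2 p (Nat.prime_of_mem_primesBelow (mem_inter.mp hp).1)
  have ht := tendsto_sum_nat_add fun q : ℕ => C*(q:ℝ)^(-(3/2) : ℝ)
  obtain ⟨P0, hP0⟩ := Filter.eventually_atTop.mp (ht.eventually (gt_mem_nhds (show (0:ℝ) < c/2 by positivity)))
  refine ⟨c/2, by positivity, P0, fun P hP n hn => ?_⟩
  have h1 := hP0 (P+1) (by omega)
  have hsum : Summable (AA n) := (hA n).of_norm
  have h2 := hsum.sum_add_tsum_nat_add (P+1)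
  have h3 : ‖∑' i, AA n (i + (P+1))‖ ≤ ∑' i : ℕ, C*((i + (P+1) : ℕ):ℝ)^(-(3/2) : ℝ) := tsum_of_norm_bounded ((summable_nat_add_iff (P+1)).mpr hs).hasSum fun i => hC n _
  have h4 := hfull n hn
  rw [← h2, Complex.add_re] at h4
  have h5 := (Complex.re_le_norm (∑' i, AA n (i + (P+1))))
  linarith
/-- scale of the prime variables of exponent `k` -/
noncomputable def XX (k n : ℕ) : ℝ := ((n:ℝ)/14)^((k:ℝ)⁻¹)
noncomputable def gg (k n : ℕ) (β x : ℝ) : ℂ := (hw k n x : ℂ)*ee (β*n*cl (x / rt k n)^k)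
lemma XX_pow (k n : ℕ) (hk : k ≠ 0) : XX k n^k = n/14 := Real.rpow_inv_natCast_pow (by positivity) hk
lemma XX_nonneg (k n : ℕ) : 0 ≤ XX k n := by unfold XX; positivity
lemma XX_le (k n : ℕ) : XX k n ≤ rt k n := by unfold XX rt; gcongr; linarith [Nat.cast_nonneg (α := ℝ) n]
lemma ev_X (k : ℕ) (hk : k ≠ 0) (C : ℝ) : ∃ n0 : ℕ, ∀ n ≥ n0, C ≤ XX k n ∧ 14 ≤ XX k n ∧ Real.log n ≤ 2*k*Real.log (XX k n) ∧ Real.log (XX k n) ≤ Real.log n := by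
  refine ⟨⌈14*(max C 14)^k⌉₊, fun n hn => ?_⟩
  have h1 : 14*(max C 14)^k ≤ n := (Nat.le_ceil _).trans (by exact_mod_cast hn)
  have h2 : (max C 14)^k ≤ XX k n^k := by rw [XX_pow k n hk]; linarith
  have h3 : max C 14 ≤ XX k n := (pow_le_pow_iff_left₀ (by positivity) (XX_nonneg _ _) hk).mp h2
  have h4 : 14 ≤ XX k n := (le_max_right _ _).trans h3
  have h5 : (n:ℝ) = 14*XX k n^k := by rw [XX_pow k n hk]; ring
  have h6 : Real.log n = Real.log 14 + k*Real.log (XX k n) := by rw [h5, Real.log_mul (by norm_num) (by positivity), Real.log_pow]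
  have h7 : Real.log 14 ≤ Real.log (XX k n) := Real.log_le_log (by norm_num) h4
  have h8 : 0 ≤ Real.log 14 := Real.log_nonneg (by norm_num)
  have h9 : (1:ℝ) ≤ k := by exact_mod_cast Nat.one_le_iff_ne_zero.mpr hk
  refine ⟨(le_max_left _ _).trans h3, h4, ?_, ?_⟩
  · nlinarith
  · nlinarith
lemma cl_eq {x : ℝ} (h0 : 0 ≤ x) (h1 : x ≤ 1) : cl x = x := by simp [cl, h0, h1]
lemma cl_one {x : ℝ} (h1 : 1 ≤ x) : cl x = 1 := by simp [cl, h1]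
lemma cl_zero {x : ℝ} (h1 : x ≤ 0) : cl x = 0 := by unfold cl; exact max_eq_left ((min_le_right _ _).trans h1)
lemma TT_zero {u : ℝ} (h : u ≤ 1/14 ∨ 3/14 ≤ u) : TT u = 0 := by
  refine max_eq_left ?_
  rcases h with h | h
  · rw [abs_of_nonpos (by linarith)]; linarith
  · rw [abs_of_nonneg (by linarith)]; linarith
lemma hw_zero (k n : ℕ) (hk : k ≠ 0) (hn : 0 < n) (x : ℝ) (h : x ≤ 0 ∨ 14*x^k ≤ n ∨ (0 ≤ x ∧ 3*n ≤ 14*x^k)) : hw k n x = 0 := by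
  have hr := rt_pos k n hn
  have hn' : (0:ℝ) < n := by exact_mod_cast hn
  unfold hw; rw [TT_zero, mul_zero]
  rcases le_total x 0 with hx | hx
  · left; rw [cl_zero (div_nonpos_of_nonpos_of_nonneg hx hr.le), zero_pow hk]; norm_num
  have hd : (x / rt k n)^k = x^k / n := by rw [div_pow, rt_pow k n hk]
  rcases le_total 1 (x / rt k n) with h1 | h1
  · right; rw [cl_one h1]; norm_num
  rw [cl_eq (by positivity) h1, hd]
  rcases h with h | h | h
  · have : x = 0 := le_antisymm h hx
    left; rw [this, zero_pow hk]; norm_num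
  · left; rw [div_le_iff₀ hn']; linarith
  · right; rw [le_div_iff₀ hn']; linarith [h.2]
lemma hw_zero' (k n : ℕ) (hk : 2 ≤ k) (hn : 0 < n) (x : ℝ) (h : x ≤ XX k n ∨ 2*XX k n ≤ x) : hw k n x = 0 := by
  have hX := XX_pow k n (by omega)
  have hX0 := XX_nonneg k n
  refine hw_zero k n (by omega) hn x ?_
  rcases h with h | h
  · rcases le_total x 0 with hx | hx
    · exact Or.inl hx
    · have : x^k ≤ XX k n^k := by gcongr
      right; left; linarith
  · have h1 : (2*XX k n)^k ≤ x^k := by gcongr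
    have h2 : (2:ℝ)^2 ≤ 2^k := pow_le_pow_right₀ (by norm_num) hk
    rw [mul_pow, hX] at h1
    have h3 : (2:ℝ)^2*((n:ℝ)/14) ≤ 2^k*((n:ℝ)/14) := by gcongr
    right; right
    refine ⟨by linarith, ?_⟩
    have := Nat.cast_nonneg (α := ℝ) n
    linarith
lemma gg_eq (k n : ℕ) (hk : k ≠ 0) (hn : 0 < n) (β x : ℝ) : gg k n β x = (hw k n x : ℂ)*ee (β*x^k) := by
  unfold gg
  have hr := rt_pos k n hn
  by_cases h : x ≤ 0 ∨ rt k n ≤ x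
  · have : hw k n x = 0 := by
      rcases h with h | h
      · exact hw_zero k n hk hn x (Or.inl h)
      · have h0 : rt k n^k ≤ x^k := by gcongr
        rw [rt_pow k n hk] at h0; exact hw_zero k n hk hn x (Or.inr (Or.inr ⟨by linarith, by linarith [Nat.cast_nonneg (α := ℝ) n]⟩))
    rw [this]; simp
  · push Not at h
    rw [cl_eq (div_nonneg h.1.le hr.le) ((div_le_one hr).mpr h.2.le), div_pow, rt_pow k n hk]
    have hn' : (n:ℝ) ≠ 0 := by positivity
    congr 2
    field_simp
lemma ee_lip (x y : ℝ) : ‖ee x - ee y‖ ≤ 7 * |x - y| := by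
  have h1 : ee x - ee y = ee y*(Complex.exp (Complex.I*((2*Real.pi*(x - y) : ℝ) : ℂ)) - 1) := by
    rw [mul_sub, mul_one]; unfold ee; rw [← Complex.exp_add]; congr 2
    push_cast; ring
  rw [h1, norm_mul, norm_ee, one_mul]
  refine (Real.norm_exp_I_mul_ofReal_sub_one_le).trans ?_
  rw [Real.norm_eq_abs, abs_mul, abs_of_nonneg (by positivity)]
  have := Real.pi_lt_d2
  gcongr; linarith
lemma cl_lip (x y : ℝ) : |cl x - cl y| ≤ |x - y| := by
  unfold cl
  calc _ ≤ |min 1 x - min 1 y| := by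
        have := abs_max_sub_max_le_max 0 (min 1 x) 0 (min 1 y)
        simpa using this
    _ ≤ _ := by
        have := abs_min_sub_min_le_max 1 x 1 y
        simpa using this
lemma TT_lip (x y : ℝ) : |TT x - TT y| ≤ 14 * |x - y| := by
  unfold TT
  have h1 := abs_max_sub_max_le_max 0 (1 - |14*x-2|) 0 (1 - |14*y-2|)
  have h2 := abs_abs_sub_abs_le (14*y-2) (14*x-2)
  simp only [sub_self, abs_zero] at h1
  refine (h1.trans (max_le (abs_nonneg _) le_rfl)).trans ?_
  rw [show 1 - |14*x-2| - (1 - |14*y-2|) = |14*y-2| - |14*x-2| by ring]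
  refine h2.trans (le_of_eq ?_)
  rw [show 14*y-2 - (14*x-2) = -(14*(x-y)) by ring, abs_neg, abs_mul]; norm_num
lemma pow_lip (a b : ℝ) (ha : 0 ≤ a) (ha1 : a ≤ 1) (hb : 0 ≤ b) (hb1 : b ≤ 1) (k : ℕ) : |a^k - b^k| ≤ k * |a - b| := by
  induction k with
  | zero => simp
  | succ k ih =>
    rw [show a^(k+1) - b^(k+1) = a*(a^k - b^k) + (a - b)*b^k by ring]
    refine (abs_add_le _ _).trans ?_
    rw [abs_mul, abs_mul, abs_of_nonneg ha, abs_of_nonneg (pow_nonneg hb k)]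
    have h1 : a * |a^k - b^k| ≤ 1 * |a^k - b^k| := by gcongr
    have h2 : |a - b| * b^k ≤ |a - b| * 1 := by gcongr; exact pow_le_one₀ hb hb1
    push_cast; linarith
lemma mul_lip {a b c d : ℂ} {r s : ℝ} (ha : ‖a‖ ≤ 1) (hd : ‖d‖ ≤ 1) (h1 : ‖a - c‖ ≤ r) (h2 : ‖b - d‖ ≤ s) : ‖a*b - c*d‖ ≤ r + s := by
  rw [show a*b - c*d = (a - c)*d + a*(b - d) by ring]
  refine (norm_add_le _ _).trans (add_le_add ?_ ?_)
  · rw [norm_mul]; exact (mul_le_of_le_one_right (norm_nonneg _) hd).trans h1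
  · rw [norm_mul]; exact (mul_le_of_le_one_left (norm_nonneg _) ha).trans h2
lemma gg_adm (k n : ℕ) (hk : 2 ≤ k) (hn : 0 < n) (β : ℝ) : Adm (XX k n) (k*(15 + 7*(|β| * n))) (gg k n β) := by
  have hr := rt_pos k n hn
  have hX : 0 < XX k n := by unfold XX; positivity
  refine ⟨fun x => ?_, fun x hx => ?_, fun x y => ?_⟩
  · unfold gg; rw [norm_mul, norm_ee, mul_one, Complex.norm_real, Real.norm_of_nonneg (hw_nonneg _ _ _)]; exact hw_le _ _ _
  · unfold gg
    rw [hw_zero' k n hk hn x hx]; simp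
  · unfold gg hw
    have hc := (cl_lip (x / rt k n) (y / rt k n))
    rw [← sub_div, abs_div, abs_of_pos hr] at hc
    obtain ⟨u, hu⟩ : ∃ u, u = cl (x / rt k n) := ⟨_, rfl⟩
    obtain ⟨v, hv⟩ : ∃ v, v = cl (y / rt k n) := ⟨_, rfl⟩
    rw [← hu, ← hv] at hc ⊢
    have hu0 : 0 ≤ u := hu ▸ cl_nonneg _
    have hu1 : u ≤ 1 := hu ▸ cl_le _
    have hv0 : 0 ≤ v := hv ▸ cl_nonneg _
    have hv1 : v ≤ 1 := hv ▸ cl_le _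
    obtain ⟨t, ht⟩ : ∃ t, t = |x - y| / rt k n := ⟨_, rfl⟩
    rw [← ht] at hc
    have hk1 : ((k-1:ℕ):ℝ) ≤ k := by exact_mod_cast Nat.sub_le _ _
    have p1 : |u^(k-1) - v^(k-1)| ≤ k*t := (pow_lip u v hu0 hu1 hv0 hv1 _).trans (by gcongr)
    have p2 : |u^k - v^k| ≤ k*t := (pow_lip u v hu0 hu1 hv0 hv1 _).trans (by gcongr)
    have p3 := (TT_lip (u^k) (v^k)).trans (mul_le_mul_of_nonneg_left p2 (by norm_num))
    have p4 : ‖ee (β*n*u^k) - ee (β*n*v^k)‖ ≤ 7*(|β| * n*(k*t)) := by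
      refine (ee_lip _ _).trans ?_
      rw [← mul_sub, abs_mul, abs_mul, Nat.abs_cast]; gcongr
    have nrm : ∀ z : ℝ, 0 ≤ z → z ≤ 1 → ‖(z:ℂ)‖ ≤ 1 := fun z h0 h1 => by rw [Complex.norm_real, Real.norm_of_nonneg h0]; exact h1
    have q1 : ‖((u^(k-1)*TT (u^k) : ℝ) : ℂ) - ((v^(k-1)*TT (v^k) : ℝ) : ℂ)‖ ≤ k*t + 14*(k*t) := by
      rw [Complex.ofReal_mul, Complex.ofReal_mul]
      refine mul_lip (nrm _ (by positivity) (pow_le_one₀ hu0 hu1)) (nrm _ (TT_nonneg _) (TT_le _)) ?_ ?_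
      · rw [← Complex.ofReal_sub, Complex.norm_real]; exact p1
      · rw [← Complex.ofReal_sub, Complex.norm_real]; exact p3
    refine (mul_lip (nrm _ (mul_nonneg (by positivity) (TT_nonneg _)) (mul_le_one₀ (pow_le_one₀ hu0 hu1) (TT_nonneg _) (TT_le _))) (norm_ee _).le q1 p4).trans ?_
    have ht' : t ≤ |x - y| / XX k n := by rw [ht]; gcongr; exact XX_le k n
    calc _ = (k*(15 + 7*(|β| * n)))*t := by ring
      _ ≤ (k*(15 + 7*(|β| * n)))*(|x - y| / XX k n) := by gcongr
      _ = _ := by ring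
/-- real kernel of the singular integral -/
noncomputable def kap (t : ℝ) : ℝ := ∫ w in (0:ℝ)..(1/14), 2*((1 - 14*w)*Real.cos (2*Real.pi*t*w))
lemma TT_cont : Continuous TT := by unfold TT; fun_prop
lemma ee_continuous : Continuous ee := by unfold ee; fun_prop
lemma kap_cont : Continuous kap := by
  unfold kap; apply intervalIntegral.continuous_parametric_intervalIntegral_of_continuous'
  fun_prop
lemma kap_le (t : ℝ) : |kap t| ≤ 1 := by
  have h := intervalIntegral.norm_integral_le_of_norm_le_const (a := 0) (b := 1/14) (C := 2) (f := fun w => 2*((1 - 14*w)*Real.cos (2*Real.pi*t*w))) ?_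
  · unfold kap; rw [← Real.norm_eq_abs]
    refine h.trans ?_
    norm_num
  · intro w hw; rw [Set.uIoc_of_le (by norm_num), Set.mem_Ioc] at hw
    rw [Real.norm_eq_abs, abs_mul, abs_mul, abs_of_nonneg (show (0:ℝ) ≤ 1 - 14*w by linarith), abs_of_nonneg (by norm_num : (0:ℝ) ≤ 2)]
    have := Real.abs_cos_le_one (2*Real.pi*t*w)
    have h2 : (1 - 14*w) * |Real.cos (2*Real.pi*t*w)| ≤ 1*1 := by gcongr; linarith
    linarith
lemma kap_low (t : ℝ) (ht : |t| ≤ 1) : 1/28 ≤ kap t := by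
  have h : ∫ w in (0:ℝ)..(1/14), (1 - 14*w) = 1/28 := by
    rw [intervalIntegral.integral_sub (by simp) (by apply Continuous.intervalIntegrable; fun_prop), intervalIntegral.integral_const_mul, integral_id]
    norm_num
  rw [← h]; unfold kap
  refine intervalIntegral.integral_mono_on (by norm_num) (by apply Continuous.intervalIntegrable; fun_prop) (by apply Continuous.intervalIntegrable; fun_prop) fun w hw => ?_
  have hc : 1/2 ≤ Real.cos (2*Real.pi*t*w) := by
    rw [← Real.cos_pi_div_three, ← Real.cos_abs (2*Real.pi*t*w)]
    have hp := Real.pi_pos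
    refine Real.cos_le_cos_of_nonneg_of_le_pi (abs_nonneg _) (by linarith) ?_
    rw [abs_mul, abs_mul, abs_of_nonneg (by positivity : 0 ≤ 2*Real.pi), abs_of_nonneg hw.1]
    calc 2*Real.pi * |t| * w ≤ 2*Real.pi*1*(1/14) := by
          gcongr
          exacts [hw.1, hw.2]
      _ ≤ _ := by linarith
  have : 0 ≤ 1 - 14*w := by linarith [hw.2]
  nlinarith
lemma kap_nonneg (t : ℝ) : 0 ≤ kap t := by
  by_cases ht : t = 0
  · exact le_trans (by norm_num) (kap_low t (by simp [ht]))
  have hs : 2*Real.pi*t ≠ 0 := by have := Real.pi_pos; positivity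
  unfold kap
  obtain ⟨s, hs'⟩ : ∃ s, s = 2*Real.pi*t := ⟨_, rfl⟩
  rw [← hs'] at hs ⊢
  rw [intervalIntegral.integral_eq_sub_of_hasDerivAt (f := fun w => 2*((1 - 14*w)*Real.sin (s*w) / s - 14*Real.cos (s*w) / s^2))]
  · simp only [mul_zero, Real.sin_zero, Real.cos_zero]
    have := Real.cos_le_one (s*(1/14))
    have e : 2*((1 - 14*(1/14))*Real.sin (s*(1/14)) / s - 14*Real.cos (s*(1/14)) / s^2) - 2*(0 / s - 14*1 / s^2) = 28*(1 - Real.cos (s*(1/14))) / s^2 := by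
      field_simp; ring
    rw [e]; exact div_nonneg (by linarith) (by positivity)
  · intro w _
    have h1 : HasDerivAt (fun w : ℝ => s*w) s w := by simpa using (hasDerivAt_id w).const_mul s
    have h2 : HasDerivAt (fun w : ℝ => 1 - 14*w) (-14) w := by simpa using ((hasDerivAt_id w).const_mul 14).const_sub 1
    have h3 := (((h2.mul h1.sin).div_const s).sub ((h1.cos.const_mul 14).div_const (s^2))).const_mul 2
    refine h3.congr_deriv ?_
    field_simp; ring
  · apply Continuous.intervalIntegrable; fun_prop
lemma K_eq (t : ℝ) : ∫ u in (0:ℝ)..1, (TT u : ℂ)*ee (t*u) = ee (t/7)*kap t := by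
  have hcont : Continuous fun u : ℝ => (TT u : ℂ)*ee (t*u) := (Complex.continuous_ofReal.comp TT_cont).mul (ee_continuous.comp (by fun_prop))
  have hi : ∀ a b, IntervalIntegrable (fun u : ℝ => (TT u : ℂ)*ee (t*u)) MeasureTheory.volume a b := fun a b => hcont.intervalIntegrable a b
  have hz : ∀ a b : ℝ, a ≤ b → (b ≤ 1/14 ∨ 3/14 ≤ a) → ∫ u in a..b, (TT u : ℂ)*ee (t*u) = 0 := by
    intro a b hab h; rw [intervalIntegral.integral_congr (g := fun _ => (0:ℂ)), intervalIntegral.integral_zero]; intro u hu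
    rw [Set.uIcc_of_le hab] at hu; simp only
    rw [TT_zero (h.imp (fun h => hu.2.trans h) (fun h => h.trans hu.1))]; simp
  rw [← intervalIntegral.integral_add_adjacent_intervals (hi 0 (1/14)) (hi _ _), hz 0 (1/14) (by norm_num) (Or.inl le_rfl), zero_add,
    ← intervalIntegral.integral_add_adjacent_intervals (hi (1/14) (3/14)) (hi _ _), hz (3/14) 1 (by norm_num) (Or.inr le_rfl), add_zero,
    ← intervalIntegral.integral_add_adjacent_intervals (hi (1/14) (1/7)) (hi _ _)]
  have e1 : ∫ u in (1/14:ℝ)..(1/7), (TT u : ℂ)*ee (t*u) = ∫ w in (0:ℝ)..(1/14), (TT (1/7 - w) : ℂ)*ee (t*(1/7 - w)) := by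
    rw [intervalIntegral.integral_comp_sub_left (fun u => (TT u : ℂ)*ee (t*u))]; norm_num
  have e2 : ∫ u in (1/7:ℝ)..(3/14), (TT u : ℂ)*ee (t*u) = ∫ w in (0:ℝ)..(1/14), (TT (1/7 + w) : ℂ)*ee (t*(1/7 + w)) := by
    rw [intervalIntegral.integral_comp_add_left (fun u => (TT u : ℂ)*ee (t*u))]; norm_num
  rw [e1, e2, ← intervalIntegral.integral_add (f := fun w : ℝ => (TT (1/7 - w) : ℂ)*ee (t*(1/7 - w))) (g := fun w : ℝ => (TT (1/7 + w) : ℂ)*ee (t*(1/7 + w))) ((hcont.comp (by fun_prop : Continuous fun w : ℝ => 1/7 - w)).intervalIntegrable _ _)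
    ((hcont.comp (by fun_prop : Continuous fun w : ℝ => 1/7 + w)).intervalIntegrable _ _)]
  unfold kap; rw [← intervalIntegral.integral_ofReal, ← intervalIntegral.integral_const_mul]
  refine intervalIntegral.integral_congr fun w hw => ?_
  rw [Set.uIcc_of_le (by norm_num)] at hw
  have t1 : TT (1/7 - w) = 1 - 14*w := by
    unfold TT; rw [show 14*(1/7-w)-2 = -(14*w) by ring, abs_neg, abs_of_nonneg (by linarith [hw.1]), max_eq_right (by linarith [hw.2])]
  have t2 : TT (1/7 + w) = 1 - 14*w := by unfold TT; rw [show 14*(1/7+w)-2 = 14*w by ring, abs_of_nonneg (by linarith [hw.1]), max_eq_right (by linarith [hw.2])]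
  simp only [t1, t2]
  rw [show t*(1/7 - w) = t/7 + -(t*w) by ring, show t*(1/7 + w) = t/7 + t*w by ring, ee_add, ee_add]
  have hc : ee (-(t*w)) + ee (t*w) = 2*(Real.cos (2*Real.pi*t*w) : ℂ) := by
    rw [Complex.ofReal_cos, Complex.two_cos]; unfold ee; rw [add_comm]
    congr 2 <;> push_cast <;> ring
  push_cast at hc ⊢
  linear_combination (1 - 14*(w:ℂ))*ee (t/7)*hc
lemma gg_int (k n : ℕ) (hk : 2 ≤ k) (hn : 0 < n) (β : ℝ) : ∫ x, gg k n β x = (rt k n / k : ℝ)*(ee (β*n / 7)*kap (β*n)) := by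
  have hr := rt_pos k n hn
  have hk0 : (k:ℝ) ≠ 0 := by positivity
  rw [← K_eq]
  have h1 : ∫ x, gg k n β x = ∫ x in (0:ℝ)..(rt k n), gg k n β x := by
    rw [intervalIntegral.integral_of_le hr.le]
    symm
    refine MeasureTheory.setIntegral_eq_integral_of_forall_compl_eq_zero fun x hx => ?_
    unfold gg; rw [hw_zero k n (by omega) hn x, Complex.ofReal_zero, zero_mul]; rw [Set.mem_Ioc, not_and_or, not_lt, not_le] at hx
    rcases hx with hx | hx
    · exact Or.inl hx
    · have h0 : rt k n^k ≤ x^k := by gcongr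
      rw [rt_pow k n (by omega)] at h0; exact Or.inr (Or.inr ⟨by linarith, by linarith [Nat.cast_nonneg (α := ℝ) n]⟩)
  have hcont : Continuous fun u : ℝ => (TT u : ℂ)*ee (β*n*u) := (Complex.continuous_ofReal.comp TT_cont).mul (ee_continuous.comp (by fun_prop))
  have h2 := intervalIntegral.integral_deriv_smul_comp (a := 0) (b := rt k n) (f := fun x => (x / rt k n)^k) (f' := fun x => k*(x / rt k n)^(k-1) / rt k n)
    (g := fun u : ℝ => (TT u : ℂ)*ee (β*n*u)) (fun x _ => by
      have := ((hasDerivAt_id x).div_const (rt k n)).pow k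
      refine this.congr_deriv ?_
      simp; ring) (by fun_prop) hcont
  rw [h1]; simp only [zero_div, zero_pow (show k ≠ 0 by omega), div_self hr.ne', one_pow] at h2
  rw [← h2, ← intervalIntegral.integral_const_mul]
  refine intervalIntegral.integral_congr fun x hx => ?_
  rw [Set.uIcc_of_le hr.le] at hx; simp only [Function.comp, gg, hw]
  rw [cl_eq (div_nonneg hx.1 hr.le) ((div_le_one hr).mpr hx.2), Complex.real_smul]
  have hrc : (rt k n : ℂ) ≠ 0 := by exact_mod_cast hr.ne'
  have hkc : (k:ℂ) ≠ 0 := by exact_mod_cast hk0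
  push_cast; field_simp
end WG
end
section
open Finset ArithmeticFunction
namespace WG
noncomputable def lam (k n : ℕ) (α : ℝ) : ℂ := ∑ m ∈ range (n+1), ((vonMangoldt m : ℝ) : ℂ)*((hw k n m : ℂ)*ee (α*(m:ℝ)^k))
lemma ff_lam (k n : ℕ) (hk : 2 ≤ k) (hn : 0 < n) (hX : 1 ≤ XX k n) (α : ℝ) : ‖lam k n α - ff k n α‖ ≤ 2 * √(2*XX k n)*Real.log (2*XX k n) := by
  have hf : ff k n α = ∑ m ∈ (range (n+1)).filter Nat.Prime, ((vonMangoldt m : ℝ) : ℂ)*((hw k n m : ℂ)*ee (α*(m:ℝ)^k)) := by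
    unfold ff
    have hs : Sp k n ⊆ (range (n+1)).filter Nat.Prime := fun p hp => by rw [Sp, mem_filter] at hp; exact mem_filter.mpr ⟨hp.1, hp.2.1⟩
    rw [← sum_subset hs]
    · refine sum_congr rfl fun p hp => ?_
      rw [vonMangoldt_apply_prime (mem_Sp.mp hp).2.1]; push_cast; ring
    · intro p hp hp'
      rw [mem_filter] at hp
      have : hw k n p = 0 := by
        refine hw_zero k n (by omega) hn p ?_
        by_contra! hc
        apply hp'
        rw [Sp, mem_filter]
        refine ⟨hp.1, hp.2, by exact_mod_cast hc.2.1, ?_⟩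
        have h1 := hc.2.2 (Nat.cast_nonneg p)
        by_contra! h2
        have h3 : n < 14*p^k := by exact_mod_cast hc.2.1
        have h4 : (n:ℝ) < (p:ℝ)^k := by exact_mod_cast h2
        linarith
      rw [this]; simp
  rw [hf, lam, ← sum_filter_add_sum_filter_not (range (n+1)) Nat.Prime, add_sub_cancel_left]
  have hb := Chebyshev.abs_psi_sub_theta_le_sqrt_mul_log (x := 2*XX k n) (by linarith)
  refine le_trans ?_ ((le_abs_self _).trans hb)
  rw [Chebyshev.psi_sub_theta_eq_sum_not_prime]
  calc _ ≤ ∑ m ∈ (range (n+1)).filter (fun m => ¬ m.Prime), vonMangoldt m*hw k n m := by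
        refine (norm_sum_le _ _).trans (sum_le_sum fun m _ => le_of_eq ?_)
        rw [norm_mul, norm_mul, norm_ee, mul_one, Complex.norm_real, Complex.norm_real, Real.norm_of_nonneg vonMangoldt_nonneg, Real.norm_of_nonneg (hw_nonneg _ _ _)]
    _ = ∑ m ∈ ((range (n+1)).filter (fun m => ¬ m.Prime)).filter (fun m => m ∈ Ioc 0 ⌊2*XX k n⌋₊), vonMangoldt m*hw k n m := by
        symm
        refine sum_filter_of_ne fun m _ hm => ?_
        by_contra hc
        apply hm
        rw [mem_Ioc, not_and_or, not_lt, not_le] at hc; rw [hw_zero' k n hk hn m ?_, mul_zero]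
        rcases hc with hc | hc
        · left; rw [Nat.le_zero.mp hc]; simp; linarith
        · right; exact ((Nat.floor_lt (by linarith)).mp hc).le
    _ ≤ ∑ m ∈ ((range (n+1)).filter (fun m => ¬ m.Prime)).filter (fun m => m ∈ Ioc 0 ⌊2*XX k n⌋₊), vonMangoldt m :=
        sum_le_sum fun m _ => mul_le_of_le_one_right vonMangoldt_nonneg (hw_le _ _ _)
    _ ≤ _ := by
        refine sum_le_sum_of_subset_of_nonneg (fun m hm => ?_) fun _ _ _ => vonMangoldt_nonneg
        rw [mem_filter, mem_filter] at hm; exact mem_filter.mpr ⟨hm.2, hm.1.2⟩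
lemma st_ee (q : ℕ) [NeZero q] (j : ℤ) : st q (j : ZMod q) = ee (j / q) := by
  rw [ZMod.stdAddChar_coe]; unfold ee; congr 1
  push_cast; ring
lemma lam_major (k n q : ℕ) [NeZero q] (hk : k ≠ 0) (hn : 0 < n) (a : ℤ) (β : ℝ) : ‖lam k n (a / q + β) - ∑ u : (ZMod q)ˣ, st q ((a : ZMod q)*(u : ZMod q)^k) *
      ∑ m ∈ range (n+1), (vonMangoldt.residueClass (u : ZMod q) m : ℂ)*gg k n β m‖ ≤ q*((Nat.log 2 (n+1) + 1)*Real.log ((n+1 : ℕ) : ℝ)) := by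
  refine le_trans ?_ (noncoprime_bound q (n+1) (NeZero.ne q))
  simp only [mul_sum]
  rw [sum_comm, lam, ← sum_sub_distrib, sum_filter]
  refine (norm_sum_le _ _).trans (sum_le_sum fun m _ => ?_)
  have hee : (hw k n m : ℂ)*ee ((a / q + β)*(m:ℝ)^k) = st q ((a:ZMod q)*(m:ZMod q)^k)*gg k n β m := by
    have : ((a:ZMod q)*(m:ZMod q)^k) = ((a*(m:ℤ)^k : ℤ) : ZMod q) := by push_cast; rfl
    rw [this, st_ee, gg_eq k n hk hn, add_mul, ee_add]; push_cast; rw [div_mul_eq_mul_div]; ring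
  rw [hee]
  by_cases h : ¬ m.Coprime q
  · rw [if_pos h, sum_eq_zero, sub_zero]
    · rw [norm_mul, norm_mul, AddChar.norm_apply, one_mul, Complex.norm_real, Real.norm_of_nonneg vonMangoldt_nonneg, gg, norm_mul, norm_ee, mul_one, Complex.norm_real, Real.norm_of_nonneg (hw_nonneg _ _ _)]
      exact mul_le_of_le_one_right vonMangoldt_nonneg (hw_le _ _ _)
    · intro u _; rw [vonMangoldt.residueClass, Set.indicator_of_notMem]
      · simp
      · intro hm; rw [Set.mem_ofPred_eq] at hm; exact h ((ZMod.isUnit_iff_coprime m q).mp (hm ▸ u.isUnit))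
  · rw [if_neg h]; rw [not_not] at h; rw [sum_eq_single (ZMod.unitOfCoprime m h)]
    · rw [ZMod.coe_unitOfCoprime, vonMangoldt.residueClass, Set.indicator_of_mem (by rw [Set.mem_ofPred_eq])]
      rw [show ∀ x y z : ℂ, x*(y*z) - y*(x*z) = 0 by intros; ring, norm_zero]
    · intro u _ hu; rw [vonMangoldt.residueClass, Set.indicator_of_notMem]
      · simp
      · intro hm; rw [Set.mem_ofPred_eq] at hm; exact hu (Units.ext (by rw [ZMod.coe_unitOfCoprime, hm]))
    · simp
/-- major arc main term -/
noncomputable def gm (k n q : ℕ) [NeZero q] (a : ZMod q) (β : ℝ) : ℂ := (q.totient : ℂ)⁻¹*Sk k q a*((rt k n / k : ℝ)*(ee (β*n / 7)*kap (β*n)))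
set_option maxHeartbeats 2000000 in
lemma ff_major (k : ℕ) (hk : 2 ≤ k) (A B : ℕ) : ∃ n0 : ℕ, ∀ n ≥ n0, ∀ (q : ℕ) [NeZero q] (a : ℤ) (β : ℝ), (q:ℝ) ≤ Real.log n^B → |β| * n ≤ Real.log n^B →
    ‖ff k n (a / q + β) - gm k n q a β‖ ≤ rt k n*(Real.log n)⁻¹^A := by
  obtain ⟨C, hC⟩ : ∃ C : ℝ, C = 22*(k*(2*k:ℝ)^(A+B+2)) := ⟨_, rfl⟩
  have hk2 : (2:ℝ) ≤ k := by exact_mod_cast hk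
  have hC1 : 44 ≤ C := by
    have : (1:ℝ) ≤ (2*k:ℝ)^(A+B+2) := one_le_pow₀ (by linarith)
    rw [hC]; nlinarith
  obtain ⟨X1, -, hX1⟩ := SW (A+B+2) (B+1)
  obtain ⟨X2, hX2⟩ := ev_log C
  obtain ⟨X3, hX3⟩ := ev_pow (C^2) (2*A+B+10)
  obtain ⟨n0, hn0⟩ := ev_X k (by omega) (max X1 (max X2 X3))
  refine ⟨max n0 3, fun n hn q _ a β hq hβ => ?_⟩
  have hn3 : 3 ≤ n := (le_max_right _ _).trans hn
  obtain ⟨hXX, hX14, hl1, hl2⟩ := hn0 n ((le_max_left _ _).trans hn)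
  have hln := one_lt_log (X := (n:ℝ)) (by exact_mod_cast hn3)
  have hsw := hX1 (XX k n) ((le_max_left _ _).trans hXX) q
  have hlC := (hX2 (XX k n) (((le_max_left _ _).trans (le_max_right _ _)).trans hXX)).1
  have hpow := hX3 (XX k n) (((le_max_right _ _).trans (le_max_right _ _)).trans hXX)
  have hadm := gg_adm k n hk (by omega) β
  have hintg := gg_int k n hk (by omega) β
  have hmaj := lam_major k n q (by omega) (by omega) a β
  have hff := ff_lam k n hk (by omega) (by linarith) (a / q + β)
  have hXr := XX_le k n
  have hXk := XX_pow k n (by omega)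
  obtain ⟨X, hX⟩ : ∃ X, X = XX k n := ⟨_, rfl⟩
  rw [← hX] at hX14 hl1 hl2 hsw hlC hpow hadm hff hXr hXk
  obtain ⟨l, hl⟩ : ∃ l, l = Real.log X := ⟨_, rfl⟩
  rw [← hl] at hl1 hl2 hsw hlC hpow
  have hl0 : 44 ≤ l := hC1.trans hlC
  have hX0 : 0 < X := by linarith
  have hkA : ∀ j ≤ A+B+2, (2*k:ℝ)^j*22*k ≤ l := fun j hj => by
    refine le_trans ?_ hlC
    rw [hC]
    have : (2*k:ℝ)^j ≤ (2*k:ℝ)^(A+B+2) := pow_le_pow_right₀ (by linarith) hj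
    nlinarith
  have hB : Real.log n^B*22*k ≤ l^(B+1) := by
    calc Real.log n^B*22*k ≤ (2*k*l)^B*22*k := by gcongr
      _ = ((2*k:ℝ)^B*22*k)*l^B := by rw [mul_pow]; ring
      _ ≤ l*l^B := by gcongr; exact hkA B (by omega)
      _ = _ := by ring
  have hB1 : 1 ≤ Real.log n^B := one_le_pow₀ hln.le
  have hqB : (q:ℝ) ≤ l^(B+1) := by nlinarith
  have hadm' : Adm X (l^(B+1)) (gg k n β) := by
    refine ⟨hadm.1, hadm.2.1, fun x y => (hadm.2.2 x y).trans ?_⟩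
    gcongr; nlinarith
  have h2n : 2*X ≤ ((n+1:ℕ):ℝ) := by
    have : X ≤ X^k := le_self_pow₀ (by linarith) (by omega)
    push_cast; linarith
  -- target
  obtain ⟨L, hL⟩ : ∃ L, L = (2*k*l)⁻¹^A := ⟨_, rfl⟩
  have hLn : L ≤ (Real.log n)⁻¹^A := by rw [hL]; gcongr
  have hL0 : 0 < L := by rw [hL]; positivity
  have hLl : L*(2*k*l)^A = 1 := by rw [hL, ← mul_pow, inv_mul_cancel₀ (by positivity), one_pow]
  have e1 : ‖∑ u : (ZMod q)ˣ, st q ((a : ZMod q)*(u : ZMod q)^k) * ∑ m ∈ range (n+1), (vonMangoldt.residueClass (u : ZMod q) m : ℂ)*gg k n β m - gm k n q a β‖ ≤ X*L / 3 := by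
    have hg : gm k n q a β = ∑ u : (ZMod q)ˣ, st q ((a : ZMod q)*(u : ZMod q)^k)*((q.totient:ℂ)⁻¹ * ∫ x, gg k n β x) := by rw [gm, Sk, ← sum_mul, hintg]; ring
    rw [hg, ← sum_sub_distrib]
    calc _ ≤ ∑ u : (ZMod q)ˣ, X*l⁻¹^(A+B+2) := by
          refine (norm_sum_le _ _).trans (sum_le_sum fun u _ => ?_)
          rw [← mul_sub, norm_mul, AddChar.norm_apply, one_mul]; exact hsw u (gg k n β) (n+1) u.isUnit hqB hadm' h2n
      _ ≤ l^(B+1)*(X*l⁻¹^(A+B+2)) := by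
          rw [sum_const, nsmul_eq_mul, card_univ, ZMod.card_units_eq_totient]; gcongr; exact le_trans (by exact_mod_cast Nat.totient_le q) hqB
      _ = X*(l⁻¹^A*l⁻¹) := by
          rw [show A+B+2 = (B+1) + (A+1) by omega, pow_add l⁻¹ (B+1)]
          have : l^(B+1)*l⁻¹^(B+1) = 1 := by rw [← mul_pow, mul_inv_cancel₀ (by positivity), one_pow]
          linear_combination (X*l⁻¹^(A+1))*this
      _ = X*L*((2*k:ℝ)^A / l) := by rw [hL, inv_pow, inv_pow, mul_pow]; field_simp
      _ ≤ X*L*(1/3) := by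
          refine mul_le_mul_of_nonneg_left ?_ (by positivity)
          rw [div_le_div_iff₀ (by linarith) (by norm_num)]
          have := hkA A (by omega)
          have h0 : (0:ℝ) < (2*k:ℝ)^A := by positivity
          nlinarith
      _ = _ := by ring
  -- crude polynomial bound
  have hpoly : ∀ D j, 0 ≤ D → D ≤ C^2 → j + A ≤ 2*A+B+10 - 1 → D*l^j ≤ X*L / 3 := by
    intro D j hD0 hD hj
    have h1 : D*l^j*((2*k*l)^A*3) ≤ X := by
      refine le_trans ?_ hpow
      calc D*l^j*((2*k*l)^A*3) = D*(l^(j+A)*((2*k:ℝ)^A*3)) := by rw [mul_pow, pow_add]; ring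
        _ ≤ C^2*(l^(j+A)*l) := by
            gcongr
            have := hkA A (by omega)
            have h0 : (0:ℝ) < (2*k:ℝ)^A := by positivity
            nlinarith
        _ = C^2*l^(j+A+1) := by ring
        _ ≤ _ := mul_le_mul_of_nonneg_left (pow_le_pow_right₀ (by linarith) (by omega)) (by positivity)
    calc D*l^j = D*l^j*((2*k*l)^A*3)*(L/3) := by linear_combination (-(D*l^j))*hLl
      _ ≤ X*(L/3) := by gcongr
      _ = _ := by ring
  have e2 : q*((Nat.log 2 (n+1) + 1)*Real.log ((n+1 : ℕ) : ℝ)) ≤ X*L / 3 := by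
    have hlog : Real.log ((n+1:ℕ):ℝ) ≤ 4*k*l := by
      calc Real.log ((n+1:ℕ):ℝ) ≤ Real.log ((n:ℝ)^2) := Real.log_le_log (by positivity) (by
            have : n + 1 ≤ n^2 := by nlinarith
            exact_mod_cast this)
        _ ≤ _ := by rw [Real.log_pow]; push_cast; linarith
    have hlog2 : (Nat.log 2 (n+1) : ℝ) ≤ 8*k*l := by
      have h1 : (2:ℝ)^(Nat.log 2 (n+1)) ≤ ((n+1:ℕ):ℝ) := by exact_mod_cast Nat.pow_log_le_self 2 (by omega)
      have h2 := Real.log_le_log (by positivity) h1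
      rw [Real.log_pow] at h2
      have := Real.log_two_gt_d9
      have h3 : (Nat.log 2 (n+1) : ℝ)*(1/2) ≤ Nat.log 2 (n+1)*Real.log 2 := by gcongr; linarith
      linarith
    calc _ ≤ l^(B+1)*((8*k*l + k*l)*(4*k*l)) := by gcongr; nlinarith
      _ = (36*(k:ℝ)^2)*l^(B+3) := by ring
      _ ≤ _ := by
          refine hpoly _ _ (by positivity) ?_ (by omega)
          have : 22*k ≤ C := by
            rw [hC]
            have : (1:ℝ) ≤ (2*k:ℝ)^(A+B+2) := one_le_pow₀ (by linarith)
            nlinarith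
          nlinarith
  have e3 : 2 * √(2*X)*Real.log (2*X) ≤ X*L / 3 := by
    have h1 : Real.log (2*X) ≤ 2*l := by
      calc Real.log (2*X) ≤ Real.log (X^2) := Real.log_le_log (by positivity) (by nlinarith)
        _ = _ := by rw [Real.log_pow, hl]; norm_num
    have h2 : √(2*X)*(C*l^(A+2)) ≤ 2*X := by
      have : C*l^(A+2) ≤ √(2*X) := by
        refine Real.le_sqrt_of_sq_le ?_
        calc (C*l^(A+2))^2 = C^2*l^(2*A+4) := by ring
          _ ≤ C^2*l^(2*A+B+10) := mul_le_mul_of_nonneg_left (pow_le_pow_right₀ (by linarith) (by omega)) (by positivity)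
          _ ≤ _ := by linarith
      calc _ ≤ √(2*X) * √(2*X) := by gcongr
        _ = _ := Real.mul_self_sqrt (by positivity)
    have h3 : (2*k:ℝ)^A*22 ≤ l := by
      have := hkA A (by omega)
      have h0 : (0:ℝ) < (2*k:ℝ)^A := by positivity
      nlinarith
    have h4 : √(2*X)*(44*l^(A+1)*(2*k:ℝ)^A) ≤ X := by
      have : 44*l^(A+1)*(2*k:ℝ)^A*2 ≤ C*l^(A+2) := by
        calc 44*l^(A+1)*(2*k:ℝ)^A*2 = 4*(l^(A+1)*((2*k:ℝ)^A*22)) := by ring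
          _ ≤ C*(l^(A+1)*l) := by gcongr; linarith
          _ = _ := by ring
      nlinarith [Real.sqrt_nonneg (2*X)]
    calc 2 * √(2*X)*Real.log (2*X) ≤ 2 * √(2*X)*(2*l) := by gcongr
      _ = √(2*X)*(4*l*(2*k*l)^A)*L := by linear_combination (-(4 * √(2*X)*l))*hLl
      _ = √(2*X)*(4*l^(A+1)*(2*k:ℝ)^A)*L := by rw [mul_pow]; ring
      _ ≤ (X / 3)*L := by
          gcongr
          have : 0 ≤ √(2*X)*(l^(A+1)*(2*k:ℝ)^A) := by positivity
          nlinarith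
      _ = _ := by ring
  calc _ ≤ X*L := by
        have t1 := norm_sub_le_norm_sub_add_norm_sub (ff k n (a / q + β)) (lam k n (a / q + β)) (gm k n q a β)
        have t2 := norm_sub_le_norm_sub_add_norm_sub (lam k n (a / q + β)) (∑ u : (ZMod q)ˣ, st q ((a : ZMod q)*(u : ZMod q)^k) *
      ∑ m ∈ range (n+1), (vonMangoldt.residueClass (u : ZMod q) m : ℂ)*gg k n β m) (gm k n q a β)
        rw [norm_sub_rev (ff k n (a / q + β)) (lam _ _ _)] at t1; linarith
    _ ≤ _ := mul_le_mul hXr hLn hL0.le (rt_nonneg _ _)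
lemma lam_minor (n : ℕ) (hn : 0 < n) (hX : 14 ≤ XX 5 n) (α R : ℝ) (hR : ∀ y : ℕ, (y:ℝ) ≤ 2*XX 5 n →
    ‖∑ m ∈ Ioc 0 y, ((vonMangoldt m:ℝ):ℂ)*ee (α*(m:ℝ)^5)‖ ≤ R) : ‖lam 5 n α‖ ≤ 225*R := by
  have hXk := XX_pow 5 n (by norm_num)
  have hadm := (gg_adm 5 n (by norm_num) hn 0).2.2
  have hz := hw_zero' 5 n (by norm_num) hn
  obtain ⟨X, hX'⟩ : ∃ X, X = XX 5 n := ⟨_, rfl⟩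
  rw [← hX'] at hX hXk hR hadm hz
  have hX0 : 0 < X := by linarith
  obtain ⟨M, hM⟩ : ∃ M, M = ⌈2*X⌉₊ := ⟨_, rfl⟩
  have hM1 : 2*X ≤ M := hM ▸ Nat.le_ceil _
  have hM2 : (M:ℝ) < 2*X + 1 := hM ▸ Nat.ceil_lt_add_one (by positivity)
  have hMn : M ≤ n := by
    have : X ≤ X^5 := le_self_pow₀ (by linarith) (by norm_num)
    have : (M:ℝ) ≤ n := by linarith
    exact_mod_cast this
  have h1 : lam 5 n α = ∑ m ∈ range (M+1), (hw 5 n m : ℂ) • (((vonMangoldt m:ℝ):ℂ)*ee (α*(m:ℝ)^5)) := by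
    unfold lam; rw [← sum_subset (range_mono (show M+1 ≤ n+1 by omega))]
    · exact sum_congr rfl fun m _ => by rw [smul_eq_mul]; ring
    · intro m _ hm; rw [mem_range, not_lt] at hm
      have : (M:ℝ) ≤ m := by exact_mod_cast (by omega : M ≤ m)
      rw [hz m (Or.inr (by linarith))]; simp
  rw [h1, sum_range_by_parts, Nat.add_sub_cancel, hz M (Or.inr hM1), Complex.ofReal_zero, zero_smul, zero_sub, norm_neg]
  have hd : ∀ x y, |hw 5 n x - hw 5 n y| ≤ 75 / X * |x - y| := fun x y => by
    have := hadm x y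
    simp only [gg_eq 5 n (by norm_num) hn, zero_mul, ee_zero, mul_one, ← Complex.ofReal_sub, Complex.norm_real, Real.norm_eq_abs] at this
    norm_num at this
    exact this
  have hR0 : 0 ≤ R := (norm_nonneg _).trans (hR 0 (by simp; linarith))
  calc _ ≤ ∑ i ∈ range M, 75 / X*R := by
        refine (norm_sum_le _ _).trans (sum_le_sum fun i hi => ?_)
        rw [norm_smul, ← Complex.ofReal_sub, Complex.norm_real, Real.norm_eq_abs]
        refine mul_le_mul ?_ ?_ (norm_nonneg _) (by positivity)
        · refine (hd _ _).trans (le_of_eq ?_)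
          push_cast; simp
        · have hi' : (i:ℝ) ≤ 2*X := by rw [mem_range, hM, Nat.lt_ceil] at hi; exact hi.le
          have e : range (i+1) = insert 0 (Ioc 0 i) := by ext j; simp
          rw [e, sum_insert (by simp)]; simpa using hR i hi'
    _ = M*(75 / X*R) := by rw [sum_const, card_range, nsmul_eq_mul]
    _ ≤ (3*X)*(75 / X*R) := by gcongr; linarith
    _ = _ := by field_simp; ring
lemma minor5 (A : ℕ) : ∃ B n0 : ℕ, ∀ n ≥ n0, ∀ (α : ℝ) (a : ℤ) (q : ℕ), IsCoprime a (q:ℤ) → |α - a/q| ≤ 1/(q:ℝ)^2 → Real.log n^B ≤ q →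
    q*Real.log n^B ≤ n → ‖ff 5 n α‖ ≤ rt 5 n*(Real.log n)⁻¹^A := by
  obtain ⟨B, X1, h1⟩ := expsum5 (A+2)
  obtain ⟨X2, h2⟩ := ev_log (max 14 (226*10^A))
  obtain ⟨X3, h3⟩ := ev_pow 32 (2*A+6)
  obtain ⟨n0, hn0⟩ := ev_X 5 (by norm_num) (max X1 (max X2 X3))
  refine ⟨B+1, max n0 3, fun n hn α a q hc hα hq1 hq2 => ?_⟩
  have hn3 : 3 ≤ n := (le_max_right _ _).trans hn
  obtain ⟨hXX, hX14, hl1, hl2⟩ := hn0 n ((le_max_left _ _).trans hn)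
  have hE := h1 (XX 5 n) ((le_max_left _ _).trans hXX) α a q
  have hlC := (h2 (XX 5 n) (((le_max_left _ _).trans (le_max_right _ _)).trans hXX)).1
  have hpow := h3 (XX 5 n) (((le_max_right _ _).trans (le_max_right _ _)).trans hXX)
  have hm := lam_minor n (by omega) hX14 α
  have hff := ff_lam 5 n (by norm_num) (by omega) (by linarith) α
  have hXr := XX_le 5 n
  have hXk := XX_pow 5 n (by norm_num)
  unfold MA at hE
  obtain ⟨X, hX⟩ : ∃ X, X = XX 5 n := ⟨_, rfl⟩
  rw [← hX] at hX14 hl1 hl2 hE hlC hpow hm hff hXr hXk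
  obtain ⟨l, hl⟩ : ∃ l, l = Real.log X := ⟨_, rfl⟩
  rw [← hl] at hl1 hl2 hE hlC hpow
  have hl14 : 14 ≤ l := (le_max_left _ _).trans hlC
  have hlA : 226*10^A ≤ l := (le_max_right _ _).trans hlC
  have hX0 : 0 < X := by linarith
  push_cast at hl1
  have hlB : 14*l^B ≤ Real.log n^(B+1) := by
    calc 14*l^B ≤ Real.log n*Real.log n^B := by gcongr; linarith
      _ = _ := by ring
  have hlB0 : 0 ≤ l^B := by positivity
  have hR := hm _ (hE ⟨hc, hα, by linarith, by
    rw [hXk, le_div_iff₀ (by norm_num)]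
    calc (q:ℝ)*l^B*14 = q*(14*l^B) := by ring
      _ ≤ q*Real.log n^(B+1) := by gcongr
      _ ≤ n := hq2⟩)
  have hpp : 2 * √(2*X)*Real.log (2*X) ≤ X*l⁻¹^(A+2) := by
    have h1 : Real.log (2*X) ≤ 2*l := by
      calc Real.log (2*X) ≤ Real.log (X^2) := Real.log_le_log (by positivity) (by nlinarith)
        _ = _ := by rw [Real.log_pow, hl]; norm_num
    have h2 : 4*l^(A+3) ≤ √X / √2 := by
      rw [← Real.sqrt_div hX0.le]
      refine Real.le_sqrt_of_sq_le ?_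
      rw [le_div_iff₀ (by norm_num)]
      refine le_trans (le_of_eq ?_) hpow
      ring
    rw [inv_pow, ← div_eq_mul_inv, le_div_iff₀ (by positivity)]
    calc 2 * √(2*X)*Real.log (2*X)*l^(A+2) ≤ 2 * √(2*X)*(2*l)*l^(A+2) := by gcongr
      _ = √(2*X)*(4*l^(A+3)) := by ring
      _ ≤ √(2*X)*(√X / √2) := by gcongr
      _ = √X * √X := by rw [Real.sqrt_mul (by norm_num)]; field_simp
      _ = X := Real.mul_self_sqrt hX0.le
  calc ‖ff 5 n α‖ ≤ ‖lam 5 n α‖ + ‖lam 5 n α - ff 5 n α‖ := by rw [add_comm, norm_sub_rev]; exact norm_le_norm_sub_add _ _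
    _ ≤ 226*(X*l⁻¹^(A+2)) := by linarith
    _ = X*((226*10^A*l⁻¹)*l⁻¹)*(10*l)⁻¹^A := by
        rw [mul_inv, mul_pow (10:ℝ)⁻¹, inv_pow (10:ℝ), pow_add l⁻¹ A 2]
        have : (10:ℝ)^A*(10^A)⁻¹ = 1 := mul_inv_cancel₀ (by positivity)
        linear_combination (-(226*X*l⁻¹^2*l⁻¹^A))*this
    _ ≤ X*(1*1)*(Real.log n)⁻¹^A := by
        gcongr
        · rw [← div_eq_mul_inv, div_le_one (by linarith)]; exact hlA
        · exact inv_le_one_of_one_le₀ (by linarith)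
        · exact lt_of_lt_of_le (by linarith) hl2
        · linarith
    _ ≤ rt 5 n*(Real.log n)⁻¹^A := by
        rw [mul_one, mul_one]
        have : 0 ≤ Real.log n := by linarith
        gcongr
end WG
end
section
open Finset
namespace WG
noncomputable def WW (n : ℕ) (α : ℝ) : ℂ := ff 2 n α*(ff 3 n α*ff 6 n α)
noncomputable def FF (n : ℕ) (α : ℝ) : ℂ := ff 5 n α*(WW n α*WW n α)*ee (α*(-n : ℤ))
lemma ff_per (k n : ℕ) (α : ℝ) : ff k n (α + 1) = ff k n α := by
  unfold ff
  refine sum_congr rfl fun p _ => ?_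
  rw [add_mul, ee_add, one_mul, show (((p^k : ℕ) : ℝ)) = (((p^k : ℕ) : ℤ) : ℝ) by push_cast; rfl, ee_int, mul_one]
lemma ff_cont (k n : ℕ) : Continuous (ff k n) := continuous_finsetSum _ fun p _ => (ee_cont _).const_mul _
lemma WW_per (n : ℕ) (α : ℝ) : WW n (α + 1) = WW n α := by simp only [WW, ff_per]
lemma WW_cont (n : ℕ) : Continuous (WW n) := (ff_cont 2 n).mul ((ff_cont 3 n).mul (ff_cont 6 n))
lemma FF_per (n : ℕ) (α : ℝ) : FF n (α + 1) = FF n α := by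
  simp only [FF, ff_per, WW_per]
  rw [add_mul, ee_add, one_mul, ee_int, mul_one]
lemma FF_cont (n : ℕ) : Continuous (FF n) := ((ff_cont 5 n).mul ((WW_cont n).mul (WW_cont n))).mul (ee_cont _)
lemma FF_zero (n : ℕ) (h : ¬ ∃ p1 p2 p3 p4 p5 p6 p7 : ℕ, p1.Prime ∧ p2.Prime ∧ p3.Prime ∧ p4.Prime ∧ p5.Prime ∧ p6.Prime ∧ p7.Prime ∧
    n = p1^2 + p2^2 + p3^3 + p4^3 + p5^5 + p6^6 + p7^6) : ∫ α in (0:ℝ)..1, FF n α = 0 := by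
  obtain ⟨I, hI⟩ : ∃ I, I = Sp 2 n ×ˢ (Sp 3 n ×ˢ Sp 6 n) := ⟨_, rfl⟩
  have hexp : ∀ α, FF n α = ∑ t ∈ Sp 5 n ×ˢ (I ×ˢ I), ((((Real.log t.1*hw 5 n t.1 : ℝ) : ℂ) *
      ((((Real.log t.2.1.1*hw 2 n t.2.1.1)*((Real.log t.2.1.2.1*hw 3 n t.2.1.2.1)*(Real.log t.2.1.2.2*hw 6 n t.2.1.2.2)) : ℝ) : ℂ) *
       (((Real.log t.2.2.1*hw 2 n t.2.2.1)*((Real.log t.2.2.2.1*hw 3 n t.2.2.2.1)*(Real.log t.2.2.2.2*hw 6 n t.2.2.2.2)) : ℝ) : ℂ))) *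
      ee (α*(((t.1^5 + ((t.2.1.1^2 + (t.2.1.2.1^3 + t.2.1.2.2^6)) + (t.2.2.1^2 + (t.2.2.2.1^3 + t.2.2.2.2^6))) : ℕ) : ℤ) - n : ℤ))) := by
    intro α; unfold FF WW; rw [ff_prod, ← hI, ff, sum_mul_sum, ← sum_product', sum_mul_sum, ← sum_product', sum_mul]
    refine sum_congr rfl fun t _ => ?_
    have hs : ∀ a b c : ℕ, ee (α*(((a + (b + c) : ℕ) : ℤ) - n : ℤ)) = ee (α*(a:ℝ))*(ee (α*(b:ℝ))*ee (α*(c:ℝ)))*ee (α*(-n : ℤ)) := by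
      intro a b c; rw [← ee_add, ← ee_add, ← ee_add]
      congr 1; push_cast; ring
    rw [hs]; ring
  simp only [hexp]
  rw [intervalIntegral.integral_finsetSum fun t _ => ((ee_cont _).const_mul _).intervalIntegrable _ _]
  refine sum_eq_zero fun t ht => ?_
  rw [intervalIntegral.integral_const_mul, ee_integral, if_neg, mul_zero]; intro h0; apply h
  rw [hI] at ht; simp only [mem_product, mem_Sp] at ht
  refine ⟨t.2.1.1, t.2.2.1, t.2.1.2.1, t.2.2.2.1, t.1, t.2.1.2.2, t.2.2.2.2, ht.2.1.1.2.1, ht.2.2.1.2.1, ht.2.1.2.1.2.1, ht.2.2.2.1.2.1, ht.1.2.1, ht.2.1.2.2.2.1, ht.2.2.2.2.2.1, ?_⟩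
  zify at h0 ⊢
  linarith
lemma clm {x y z w : ℂ} {r s e d : ℝ} (h1 : ‖x - y‖ ≤ r*e ∧ ‖y‖ ≤ r) (h2 : ‖z - w‖ ≤ s*d ∧ ‖w‖ ≤ s) (he : 0 ≤ e) (he1 : e ≤ 1) :
    ‖x*z - y*w‖ ≤ r*s*(e + 2*d) ∧ ‖y*w‖ ≤ r*s := by
  have hr := (norm_nonneg _).trans h1.2
  have hs := (norm_nonneg _).trans h2.2
  constructor
  · have hx : ‖x‖ ≤ 2*r := by
      have := norm_le_norm_sub_add x y
      nlinarith [h1.1, h1.2]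
    rw [show x*z - y*w = (x - y)*w + x*(z - w) by ring]
    refine (norm_add_le _ _).trans ?_
    rw [norm_mul, norm_mul]
    have a1 : ‖x - y‖ * ‖w‖ ≤ (r*e)*s := mul_le_mul h1.1 h2.2 (norm_nonneg _) (by positivity)
    have a2 : ‖x‖ * ‖z - w‖ ≤ (2*r)*(s*d) := mul_le_mul hx h2.1 (norm_nonneg _) (by positivity)
    linarith
  · rw [norm_mul]; exact mul_le_mul h1.2 h2.2 (norm_nonneg _) hr
lemma gm_le (k n q : ℕ) [NeZero q] (hk : 2 ≤ k) (a : ZMod q) (β : ℝ) : ‖gm k n q a β‖ ≤ rt k n := by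
  have hφ : (0:ℝ) < q.totient := by exact_mod_cast Nat.totient_pos.mpr (Nat.pos_of_ne_zero (NeZero.ne q))
  have h1 : ‖Sk k q a‖ ≤ q.totient := by
    refine (norm_sum_le _ _).trans ?_
    simp [AddChar.norm_apply]
  have hk2 : (1:ℝ) ≤ k := by exact_mod_cast (by omega : 1 ≤ k)
  unfold gm
  rw [norm_mul, norm_mul, norm_mul, norm_mul, norm_ee, one_mul, norm_inv, Complex.norm_natCast, Complex.norm_real, Complex.norm_real,
    Real.norm_of_nonneg (div_nonneg (rt_nonneg _ _) (by linarith))]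
  have h2 := kap_le (β*n)
  rw [← Real.norm_eq_abs] at h2
  calc _ ≤ (q.totient:ℝ)⁻¹*q.totient*(rt k n / 1*1) := by
        have := rt_nonneg k n
        gcongr
    _ = _ := by rw [inv_mul_cancel₀ hφ.ne']; ring
lemma rt_prod (n : ℕ) : rt 5 n*((rt 2 n*(rt 3 n*rt 6 n))*(rt 2 n*(rt 3 n*rt 6 n))) = rt 5 n*(n:ℝ)^2 := by
  have h2 := rt_pow 2 n (by norm_num)
  have h3 := rt_pow 3 n (by norm_num)
  have h6 := rt_eq 3 2 n (by norm_num) (by norm_num)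
  norm_num at h6
  calc _ = rt 5 n*(rt 2 n^2*(rt 3 n^2*rt 6 n^2)) := by ring
    _ = rt 5 n*(rt 2 n^2*rt 3 n^3) := by rw [← h6]; ring
    _ = _ := by rw [h2, h3]; ring
lemma gm_prod (n q : ℕ) [NeZero q] (a : ℤ) (β : ℝ) :
    gm 5 n q a β*((gm 2 n q a β*(gm 3 n q a β*gm 6 n q a β))*(gm 2 n q a β*(gm 3 n q a β*gm 6 n q a β)))*ee ((a / q + β)*(-n : ℤ)) =
    ((rt 5 n*(n:ℝ)^2 / 6480 : ℝ) : ℂ)*((q.totient:ℂ)⁻¹^7*(PS q a*st q (-((n:ZMod q)*a))))*((kap (β*n)^7 : ℝ) : ℂ) := by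
  have h1 : ee (β*n / 7)^7*ee (β*(-n : ℤ)) = 1 := by
    have : ee (β*n / 7)^7 = ee (β*n) := by
      unfold ee
      rw [← Complex.exp_nat_mul]; congr 1; push_cast; ring
    rw [this, ← ee_add, ← ee_zero]; congr 1; push_cast; ring
  have h2 : st q (-((n:ZMod q)*a)) = ee (a / q*(-n : ℤ)) := by
    have : (-((n:ZMod q)*a)) = ((-(n*a) : ℤ) : ZMod q) := by push_cast; rfl
    rw [this, st_ee]; congr 1; push_cast; ring
  rw [h2, add_mul, ee_add, ← rt_prod]; unfold gm PS; push_cast at h1 ⊢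
  linear_combination ((rt 5 n : ℂ)*((rt 2 n*(rt 3 n*rt 6 n))*(rt 2 n*(rt 3 n*rt 6 n))) / 6480*((q.totient:ℂ)⁻¹^7*(Sk 2 q a^2*Sk 3 q a^2*Sk 6 q a^2*Sk 5 q a*ee (a / q*(-n))))*(kap (β*n) : ℂ)^7)*h1
lemma FF_major (A B : ℕ) (hA : A ≠ 0) : ∃ n0 : ℕ, ∀ n ≥ n0, ∀ (q : ℕ) [NeZero q] (a : ℤ) (β : ℝ), (q:ℝ) ≤ Real.log n^B → |β| * n ≤ Real.log n^B →
    ‖FF n (a / q + β) - ((rt 5 n*(n:ℝ)^2 / 6480 : ℝ) : ℂ)*((q.totient:ℂ)⁻¹^7*(PS q a*st q (-((n:ZMod q)*a))))*((kap (β*n)^7 : ℝ) : ℂ)‖ ≤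
      rt 5 n*(n:ℝ)^2*(43*(Real.log n)⁻¹^A) := by
  obtain ⟨n2, h2⟩ := ff_major 2 (by norm_num) A B
  obtain ⟨n3, h3⟩ := ff_major 3 (by norm_num) A B
  obtain ⟨n5, h5⟩ := ff_major 5 (by norm_num) A B
  obtain ⟨n6, h6⟩ := ff_major 6 (by norm_num) A B
  obtain ⟨X0, h0⟩ := ev_log 7
  refine ⟨n2 + n3 + n5 + n6 + ⌈X0⌉₊, fun n hn q _ a β hq hβ => ?_⟩
  have hl := (h0 n ((Nat.le_ceil _).trans (by exact_mod_cast (by omega : ⌈X0⌉₊ ≤ n)))).1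
  obtain ⟨e, he⟩ : ∃ e, e = (Real.log n)⁻¹^A := ⟨_, rfl⟩
  have he0 : 0 ≤ e := by rw [he]; positivity
  have he1 : e ≤ 1/7 := by
    have h7 : (Real.log n)⁻¹ ≤ 1/7 := by rw [inv_eq_one_div]; gcongr
    rw [he]; exact (pow_le_of_le_one (by positivity) (by linarith) hA).trans h7
  have g2 := h2 n (by omega) q a β hq hβ
  have g3 := h3 n (by omega) q a β hq hβ
  have g5 := h5 n (by omega) q a β hq hβ
  have g6 := h6 n (by omega) q a β hq hβ
  rw [← he] at g2 g3 g5 g6 ⊢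
  have c1 := clm ⟨g3, gm_le 3 n q (by norm_num) a β⟩ ⟨g6, gm_le 6 n q (by norm_num) a β⟩ he0 (by linarith)
  have c2 := clm ⟨g2, gm_le 2 n q (by norm_num) a β⟩ c1 he0 (by linarith)
  have c3 := clm c2 c2 (by linarith) (by linarith)
  have c4 := (clm ⟨g5, gm_le 5 n q (by norm_num) a β⟩ c3 he0 (by linarith)).1
  rw [rt_prod] at c4; rw [← gm_prod, FF, WW, ← sub_mul, norm_mul, norm_ee, mul_one]
  refine c4.trans (le_of_eq ?_)
  ring
lemma unit_sum (q : ℕ) [NeZero q] (h : ZMod q → ℂ) : ∑ a ∈ (range q).filter (fun a => a.Coprime q), h (a : ℕ) = ∑ u : (ZMod q)ˣ, h u := by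
  refine sum_bij' (fun a ha => ZMod.unitOfCoprime a (mem_filter.mp ha).2) (fun u _ => (u : ZMod q).val) (fun _ _ => mem_univ _)
    (fun u _ => mem_filter.mpr ⟨mem_range.mpr (ZMod.val_lt _), ZMod.val_coe_unit_coprime u⟩) (fun a ha => ?_) (fun u _ => ?_) (fun a ha => ?_)
  · rw [ZMod.coe_unitOfCoprime, ZMod.val_natCast_of_lt (mem_range.mp (mem_filter.mp ha).1)]
  · ext; rw [ZMod.coe_unitOfCoprime, ZMod.natCast_zmod_val]
  · rw [ZMod.coe_unitOfCoprime]
end WG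
end
section
open Finset MeasureTheory
namespace WG
lemma dissect (f : ℝ → ℂ) (hf : Continuous f) (hp : ∀ x, f (x+1) = f x) (P : ℕ) (δ : ℝ) (hδ : 0 < δ) (h2 : 2*δ*(P:ℝ)^2 < 1) :
    ∃ S : Set ℝ, MeasurableSet S ∧ S ⊆ Set.Ico (-δ) (1-δ) ∧ (∀ α ∈ S, ∀ q ∈ Icc 1 P, ∀ a ∈ (range q).filter (fun a => a.Coprime q), δ < |α - a/q|) ∧
      ∫ α in (0:ℝ)..1, f α = ∑ q ∈ Icc 1 P, ∑ a ∈ (range q).filter (fun a => a.Coprime q), (∫ β in (-δ)..δ, f (a/q+β)) + ∫ α in S, f α := by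
  obtain ⟨T, hT⟩ : ∃ T : Finset (Σ _ : ℕ, ℕ), T = (Icc 1 P).sigma fun q => (range q).filter fun a => a.Coprime q := ⟨_, rfl⟩
  obtain ⟨M, hM⟩ : ∃ M : Set ℝ, M = ⋃ t ∈ T, Set.Icc ((t.2:ℝ)/t.1 - δ) ((t.2:ℝ)/t.1 + δ) := ⟨_, rfl⟩
  have hT1 : ∀ t ∈ T, (1 ≤ t.1 ∧ t.1 ≤ P) ∧ t.2 < t.1 ∧ t.2.Coprime t.1 := by intro t ht; simpa [hT] using ht
  have hq2 : ∀ x y : ℕ, x ≤ P → y ≤ P → 2*δ*(x*y) < 1 := by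
    intro x y hx hy
    refine lt_of_le_of_lt (mul_le_mul_of_nonneg_left ?_ (by positivity)) h2
    rw [sq]; gcongr
  have hMm : MeasurableSet M := by rw [hM]; exact T.measurableSet_biUnion fun t _ => measurableSet_Icc
  have hMU : M ⊆ Set.Ico (-δ) (1-δ) := by
    rw [hM]
    refine Set.iUnion₂_subset fun t ht x hx => ?_
    obtain ⟨⟨h1, hP⟩, h3, -⟩ := hT1 t ht
    have hq : (0:ℝ) < t.1 := by exact_mod_cast h1
    have h4 := hq2 t.1 1 hP (h1.trans hP)
    have h5 : (t.2:ℝ) + 1 ≤ t.1 := by exact_mod_cast h3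
    have h6 : (t.2:ℝ)/t.1 + 2*δ < 1 := by
      rw [div_add' _ _ _ hq.ne', div_lt_one hq]
      push_cast at h4; linarith
    have h7 : 0 ≤ (t.2:ℝ)/t.1 := by positivity
    exact ⟨by linarith [hx.1], by linarith [hx.2]⟩
  refine ⟨Set.Ico (-δ) (1-δ) \ M, measurableSet_Ico.diff hMm, Set.sdiff_subset, ?_, ?_⟩
  · intro α hα q hq a ha
    by_contra! h
    refine hα.2 ?_
    rw [hM]
    refine Set.mem_iUnion₂.mpr ⟨⟨q, a⟩, by rw [hT]; exact mem_sigma.mpr ⟨hq, ha⟩, ?_⟩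
    rw [abs_le] at h
    exact ⟨by simp only; linarith, by simp only; linarith⟩
  have hI : ∀ x y, IntegrableOn f (Set.Icc x y) := fun x y => hf.continuousOn.integrableOn_Icc
  have hper : Function.Periodic f 1 := hp
  have e1 := hper.intervalIntegral_add_eq 0 (-δ)
  rw [zero_add, neg_add_eq_sub] at e1
  rw [e1, intervalIntegral.integral_of_le (by linarith), ← integral_Ico_eq_integral_Ioc,
    ← integral_inter_add_sdiff hMm ((hI (-δ) (1-δ)).mono_set Set.Ico_subset_Icc_self), Set.inter_eq_self_of_subset_right hMU, hM,
    integral_biUnion_finset T (fun _ _ => measurableSet_Icc) ?_ (fun _ _ => hI _ _), hT, sum_sigma]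
  · congr 1
    refine sum_congr rfl fun q _ => sum_congr rfl fun a _ => ?_
    rw [integral_Icc_eq_integral_Ioc, ← intervalIntegral.integral_of_le (by linarith), intervalIntegral.integral_comp_add_left, sub_eq_add_neg]
  · intro t ht s hs hts
    refine Set.disjoint_left.mpr fun x hx hy => hts ?_
    obtain ⟨⟨h1, hP⟩, h3, h4⟩ := hT1 t ht
    obtain ⟨⟨g1, gP⟩, g3, g4⟩ := hT1 s hs
    obtain ⟨q, a⟩ := t
    obtain ⟨r, b⟩ := s
    simp only at *
    have hq : (0:ℝ) < q := by exact_mod_cast h1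
    have hr : (0:ℝ) < r := by exact_mod_cast g1
    have h5 : |(a:ℝ)/q - b/r| ≤ 2*δ := abs_le.mpr ⟨by linarith [hx.2, hy.1], by linarith [hx.1, hy.2]⟩
    rw [div_sub_div _ _ hq.ne' hr.ne', abs_div, abs_of_pos (mul_pos hq hr), div_le_iff₀ (mul_pos hq hr)] at h5
    have h6 : |(a:ℤ)*r - q*b| < 1 := by exact_mod_cast h5.trans_lt (hq2 q r hP gP)
    rw [Int.abs_lt_one_iff, sub_eq_zero] at h6
    have h7 : a*r = q*b := by exact_mod_cast h6
    have e : q = r := Nat.dvd_antisymm (h4.symm.dvd_of_dvd_mul_left ⟨b, h7⟩) (g4.symm.dvd_of_dvd_mul_right ⟨a, by rw [← h7, mul_comm]⟩)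
    subst e; rw [mul_comm, Nat.mul_left_cancel_iff h1] at h7; rw [h7]
lemma dioph (n : ℕ) (D α : ℝ) (hD : 1 ≤ D) (hn : 3*D^3 ≤ n) (hα : α ∈ Set.Ico (-(D/n)) (1-D/n))
    (h : ∀ q ∈ Icc 1 ⌊D⌋₊, ∀ a ∈ (range q).filter (fun a => a.Coprime q), D/n < |α - a/q|) :
    ∃ (a : ℤ) (q : ℕ), IsCoprime a (q:ℤ) ∧ |α - a/q| ≤ 1/(q:ℝ)^2 ∧ D ≤ q ∧ q*D ≤ n := by
  have hD3 : D ≤ D^3 := le_self_pow₀ hD (by norm_num)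
  have hn0 : (0:ℝ) < n := by linarith
  have hQ : 0 < ⌊n/D⌋₊ := Nat.floor_pos.mpr ((one_le_div (by linarith)).mpr (by linarith))
  obtain ⟨r, hr1, hr2⟩ := Real.exists_rat_abs_sub_le_and_den_le α hQ
  have hd : (0:ℝ) < r.den := by exact_mod_cast r.den_pos
  have hd1 : (1:ℝ) ≤ r.den := by exact_mod_cast r.den_pos
  have hrr : (r:ℝ) = r.num / r.den := Rat.cast_def r
  have hQ1 : (n:ℝ)/D ≤ ⌊n/D⌋₊ + 1 := (Nat.lt_floor_add_one _).le
  have hco : IsCoprime r.num (r.den:ℤ) := by rw [Int.isCoprime_iff_gcd_eq_one]; exact r.reduced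
  rw [hrr] at hr1
  have hr2' : (r.den:ℝ) ≤ ⌊n/D⌋₊ := by exact_mod_cast hr2
  refine ⟨r.num, r.den, hco, hr1.trans ?_, ?_, ?_⟩
  · rw [sq]; gcongr; linarith
  · by_contra! hlt
    have h1 : |α - r.num/r.den| ≤ D/n := by
      refine hr1.trans ?_
      rw [← one_div_div (n:ℝ) D]
      refine one_div_le_one_div_of_le (by positivity) (hQ1.trans ?_)
      exact le_mul_of_one_le_right (by positivity) hd1
    have h1' := abs_le.mp h1
    have h3 : 2*(D/n)*r.den < 1 := by
      have : 2*(D/n)*r.den ≤ 2*D^3/n := by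
        rw [mul_div_assoc', div_mul_eq_mul_div]
        refine div_le_div_of_nonneg_right ?_ hn0.le
        have := mul_le_mul_of_nonneg_left hlt.le (by linarith : 0 ≤ 2*D)
        nlinarith
      refine this.trans_lt ?_
      rw [div_lt_one hn0]; linarith
    have h4 : -1 < (r.num:ℝ) := by
      have : -(2*(D/n)) ≤ (r.num:ℝ)/r.den := by linarith [hα.1]
      rw [le_div_iff₀ hd] at this; linarith
    have h5 : (r.num:ℝ) < r.den := by rw [← div_lt_one hd]; linarith [hα.2]
    have h4' : 0 ≤ r.num := by
      have : (-1:ℤ) < r.num := by exact_mod_cast h4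
      omega
    obtain ⟨a, ha⟩ := Int.eq_ofNat_of_zero_le h4'
    rw [ha] at h1 h5 hco
    refine absurd (h r.den (mem_Icc.mpr ⟨r.den_pos, Nat.le_floor hlt.le⟩) a (mem_filter.mpr ⟨mem_range.mpr ?_, ?_⟩)) (not_lt.mpr ?_)
    · exact_mod_cast h5
    · exact Nat.isCoprime_iff_coprime.mp hco
    · simpa using h1
  · have := Nat.floor_le (show 0 ≤ n/D by positivity)
    rw [← le_div_iff₀ (by linarith)]; linarith
end WG
end
open Finset MeasureTheory
namespace WG
lemma kap_J (n : ℕ) (D : ℝ) (hD : 1 ≤ D) (hn : (0:ℝ) < n) : 2/n*(1/28)^7 ≤ ∫ β in (-(D/n))..(D/n), kap (β*n)^7 := by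
  have hc : Continuous fun β : ℝ => kap (β*n)^7 := (kap_cont.comp (continuous_id.mul continuous_const)).pow 7
  have h1 : 1/(n:ℝ) ≤ D/n := by gcongr
  have h0 : 0 < 1/(n:ℝ) := by positivity
  refine le_trans ?_ (intervalIntegral.integral_mono_interval (a := -(1/(n:ℝ))) (b := 1/n) (by linarith) (by linarith) h1
    (Filter.Eventually.of_forall fun β => pow_nonneg (kap_nonneg _) 7) (hc.intervalIntegrable _ _))
  have := intervalIntegral.integral_mono_on (μ := volume) (a := -(1/(n:ℝ))) (b := 1/n) (by linarith) (intervalIntegrable_const (c := ((1:ℝ)/28)^7))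
    (hc.intervalIntegrable _ _) (fun β hβ => by
      refine pow_le_pow_left₀ (by norm_num) (kap_low _ ?_) 7
      rw [abs_mul, Nat.abs_cast, ← le_div_iff₀ hn]
      exact abs_le.mpr hβ)
  rw [intervalIntegral.integral_const, smul_eq_mul] at this
  refine le_trans (le_of_eq ?_) this
  ring
lemma main : ∃ N : ℕ, ∀ n ≥ N, ¬ 2 ∣ n → ∫ α in (0:ℝ)..1, FF n α ≠ 0 := by
  obtain ⟨B0, n1, h1⟩ := minor5 72
  obtain ⟨n2, h2⟩ := V_mean
  obtain ⟨B, hB⟩ : ∃ B, B = B0 + 1 := ⟨_, rfl⟩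
  obtain ⟨n3, h3⟩ := FF_major (3*B+1) B (by omega)
  obtain ⟨c, hc, P0, h4⟩ := sing_lower
  obtain ⟨X5, h5⟩ := ev_log (max (P0+1) (87*6480*28^7/c))
  obtain ⟨X6, h6⟩ := ev_pow 3 (3*B)
  refine ⟨n1+n2+n3+⌈X5⌉₊+⌈X6⌉₊, fun n hn hodd hz => ?_⟩
  have hX5 := (h5 n ((Nat.le_ceil _).trans (by exact_mod_cast (by omega : ⌈X5⌉₊ ≤ n)))).1
  have hX6 := h6 n ((Nat.le_ceil _).trans (by exact_mod_cast (by omega : ⌈X6⌉₊ ≤ n)))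
  obtain ⟨L, hL⟩ : ∃ L, L = Real.log n := ⟨_, rfl⟩
  obtain ⟨D, hDL⟩ : ∃ D, D = L^B := ⟨_, rfl⟩
  obtain ⟨R, hR⟩ : ∃ R, R = rt 5 n := ⟨_, rfl⟩
  have g1 := h1 n (by omega)
  have g2 := h2 n (by omega)
  have g3 := h3 n (by omega)
  clear h1 h2 h3 h5 h6
  simp only [← hL, ← hDL, ← hR] at g1 g2 g3 hX5 hX6
  rw [mul_comm 3 B, pow_mul, ← hDL] at hX6
  have hL1 : (P0:ℝ) + 1 ≤ L := (le_max_left _ _).trans hX5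
  have hL2 : 87*6480*28^7/c ≤ L := (le_max_right _ _).trans hX5
  have hLone : 1 ≤ L := by have : (0:ℝ) ≤ P0 := Nat.cast_nonneg _; linarith
  have hLD : L ≤ D := by rw [hDL]; exact le_self_pow₀ hLone (by omega)
  have hD1 : 1 ≤ D := hLone.trans hLD
  have hn0 : (0:ℝ) < n := lt_of_lt_of_le (by positivity) hX6
  have hR0 : 0 < R := by rw [hR]; exact rt_pos 5 n (by exact_mod_cast hn0)
  have hP1 : (⌊D⌋₊:ℝ) ≤ D := Nat.floor_le (by linarith)
  have hP0 : P0 ≤ ⌊D⌋₊ := Nat.le_floor (by linarith)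
  have hδ : 0 < D/n := by positivity
  obtain ⟨S, hSm, hSU, hSa, hSe⟩ := dissect (FF n) (FF_cont n) (FF_per n) ⌊D⌋₊ (D/n) hδ (by
    calc 2*(D/n)*(⌊D⌋₊:ℝ)^2 ≤ 2*(D/n)*D^2 := mul_le_mul_of_nonneg_left (pow_le_pow_left₀ (by positivity) hP1 2) (by positivity)
      _ = 2*D^3/n := by ring
      _ < 1 := by rw [div_lt_one hn0]; linarith [pow_pos (zero_lt_one.trans_le hD1) 3])
  -- minor arcs
  have hmin : ‖∫ α in S, FF n α‖ ≤ R*n*L⁻¹ := by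
    have hWc : Continuous fun α => ‖WW n α‖^2 := (WW_cont n).norm.pow 2
    have hWU : IntegrableOn (fun α => ‖WW n α‖^2) (Set.Ico (-(D/n)) (1-D/n)) := hWc.continuousOn.integrableOn_Icc.mono_set Set.Ico_subset_Icc_self
    have hWp : Function.Periodic (fun α => ‖WW n α‖^2) 1 := fun α => by simp only [WW_per]
    have e1 := hWp.intervalIntegral_add_eq 0 (-(D/n))
    rw [zero_add, neg_add_eq_sub, intervalIntegral.integral_of_le (by linarith : -(D/n) ≤ 1-D/n), ← integral_Ico_eq_integral_Ioc] at e1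
    calc ‖∫ α in S, FF n α‖ ≤ ∫ α in S, R*L⁻¹^72*‖WW n α‖^2 := by
          refine norm_integral_le_of_norm_le ((hWU.mono_set hSU).const_mul _) ((ae_restrict_iff' hSm).mpr (Filter.Eventually.of_forall fun α hα => ?_))
          obtain ⟨a, q, k1, k2, k3, k4⟩ := dioph n D α hD1 hX6 (hSU hα) (hSa α hα)
          have hBD : L^B0 ≤ D := by rw [hDL]; exact pow_le_pow_right₀ hLone (by omega)
          have := g1 α a q k1 k2 (hBD.trans k3) ((mul_le_mul_of_nonneg_left hBD (Nat.cast_nonneg _)).trans k4)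
          rw [FF, norm_mul, norm_ee, mul_one, norm_mul, norm_mul, ← sq]; exact mul_le_mul_of_nonneg_right this (by positivity)
      _ = R*L⁻¹^72*∫ α in S, ‖WW n α‖^2 := integral_const_mul _ _
      _ ≤ R*L⁻¹^72*(n*L^71) := by
          refine mul_le_mul_of_nonneg_left (le_trans ?_ g2) (by positivity)
          refine (setIntegral_mono_set hWU (Filter.Eventually.of_forall fun α => by positivity) hSU.eventuallyLE).trans (le_of_eq ?_)
          exact e1.symm
      _ = R*n*L⁻¹ := by field_simp
  -- major arcs
  obtain ⟨J, hJ⟩ : ∃ J, J = ∫ β in (-(D/n))..(D/n), kap (β*n)^7 := ⟨_, rfl⟩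
  have hJ1 := kap_J n D hD1 hn0
  rw [← hJ] at hJ1
  have hmaj : ‖∑ q ∈ Icc 1 ⌊D⌋₊, ∑ a ∈ (range q).filter (fun a => a.Coprime q), (∫ β in (-(D/n))..(D/n), FF n (a/q+β)) -
      ((R*n^2/6480*J : ℝ):ℂ) * ∑ q ∈ range (⌊D⌋₊+1), AA n q‖ ≤ R*n*(86*L⁻¹) := by
    have hA : ∑ q ∈ range (⌊D⌋₊+1), AA n q = ∑ q ∈ Icc 1 ⌊D⌋₊, AA n q := by
      rw [range_eq_Ico, sum_eq_sum_Ico_succ_bot (by omega)]; simp only [AA, dif_pos, zero_add]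
      rfl
    rw [hA, mul_sum, ← sum_sub_distrib]
    have hE : ∀ q ∈ Icc 1 ⌊D⌋₊, ‖∑ a ∈ (range q).filter (fun a => a.Coprime q), (∫ β in (-(D/n))..(D/n), FF n (a/q+β)) -
        ((R*n^2/6480*J : ℝ):ℂ)*AA n q‖ ≤ D*(R*n^2*(43*L⁻¹^(3*B+1))*(2*(D/n))) := by
      intro q hq
      obtain ⟨hq1, hq2⟩ := mem_Icc.mp hq
      haveI : NeZero q := ⟨by omega⟩
      have hqD : (q:ℝ) ≤ D := le_trans (by exact_mod_cast hq2) hP1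
      rw [AA_eq, AN, ← unit_sum q fun a => PS q a*st q (-((n:ZMod q)*a)), mul_sum, mul_sum, ← sum_sub_distrib]
      refine (norm_sum_le _ _).trans ((sum_le_card_nsmul _ _ (R*n^2*(43*L⁻¹^(3*B+1))*(2*(D/n))) fun a _ => ?_).trans ?_)
      · have e2 : ((R*n^2/6480*J : ℝ):ℂ)*((q.totient:ℂ)⁻¹^7*(PS q (a:ℕ)*st q (-((n:ZMod q)*(a:ℕ))))) = ∫ β in (-(D/n))..(D/n),
            ((R*n^2/6480 : ℝ):ℂ)*((q.totient:ℂ)⁻¹^7*(PS q (a:ℕ)*st q (-((n:ZMod q)*(a:ℕ)))))*((kap (β*n)^7 : ℝ):ℂ) := by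
          rw [intervalIntegral.integral_const_mul, intervalIntegral.integral_ofReal, ← hJ]
          push_cast; ring
        have hc1 : Continuous fun β : ℝ => FF n (a/q+β) := (FF_cont n).comp (continuous_const.add continuous_id)
        have hc2 : Continuous fun β : ℝ => ((kap (β*n)^7 : ℝ):ℂ) := Complex.continuous_ofReal.comp ((kap_cont.comp (continuous_id.mul continuous_const)).pow 7)
        rw [e2, ← intervalIntegral.integral_sub (hc1.intervalIntegrable _ _) ((hc2.const_mul _).intervalIntegrable _ _)]
        refine (intervalIntegral.norm_integral_le_of_norm_le_const (C := R*n^2*(43*L⁻¹^(3*B+1))) fun β hβ => ?_).trans (le_of_eq ?_)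
        · have hβ' : |β| * n ≤ D := by rw [← le_div_iff₀ hn0]; rw [Set.uIoc_of_le (by linarith)] at hβ; exact abs_le.mpr ⟨hβ.1.le, hβ.2⟩
          simpa using g3 q a β hqD hβ'
        · rw [abs_of_pos (by linarith)]; ring
      · rw [nsmul_eq_mul]
        refine mul_le_mul_of_nonneg_right (le_trans ?_ hqD) (by positivity)
        exact_mod_cast (card_filter_le _ _).trans (card_range q).le
    refine (norm_sum_le _ _).trans ((sum_le_card_nsmul _ _ _ hE).trans ?_)
    rw [nsmul_eq_mul, Nat.card_Icc, Nat.add_sub_cancel]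
    refine (mul_le_mul_of_nonneg_right hP1 (by positivity)).trans (le_of_eq ?_)
    have hL0 : L ≠ 0 := by positivity
    rw [hDL, pow_succ L⁻¹, mul_comm 3 B, pow_mul, inv_pow L B]; field_simp; ring
  -- conclusion
  have hs := h4 ⌊D⌋₊ hP0 n hodd
  rw [hSe] at hz
  obtain ⟨E, hE⟩ : ∃ E, E = ∑ q ∈ range (⌊D⌋₊+1), AA n q := ⟨_, rfl⟩
  rw [← hE] at hs hmaj
  rw [eq_neg_of_add_eq_zero_left hz] at hmaj
  have hf : ‖((R*n^2/6480*J : ℝ):ℂ)*E‖ ≤ R*n*(87*L⁻¹) := by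
    rw [show ((R*n^2/6480*J : ℝ):ℂ)*E = -(-(∫ α in S, FF n α) - ((R*n^2/6480*J : ℝ):ℂ)*E) - ∫ α in S, FF n α by ring]
    refine (norm_sub_le _ _).trans ?_
    rw [norm_neg]; linarith
  have hJ0 : 0 ≤ J := le_trans (by positivity) hJ1
  rw [norm_mul, Complex.norm_real, Real.norm_of_nonneg (by positivity)] at hf
  have hc2 : c ≤ ‖E‖ := hs.trans (Complex.re_le_norm E)
  have h8 : R*n^2/6480*(2/n*(1/28)^7)*c ≤ R*n*(87*L⁻¹) := le_trans (mul_le_mul (mul_le_mul_of_nonneg_left hJ1 (by positivity)) hc2 hc.le (by positivity)) hf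
  rw [show R*n^2/6480*(2/n*(1/28)^7)*c = R*n*(2*c/(6480*28^7)) by field_simp, mul_le_mul_iff_right₀ (by positivity),
    ← div_eq_mul_inv, div_le_div_iff₀ (by positivity) (by positivity)] at h8
  rw [div_le_iff₀ hc] at hL2; nlinarith [mul_pos hc (zero_lt_one.trans_le hLone)]
end WG
theorem waring_goldbach_c6 :
    ∃ N : ℕ, ∀ n : ℕ, N ≤ n → ¬ 2 ∣ n →
      ∃ p1 p2 p3 p4 p5 p6 p7 : ℕ,
        p1.Prime ∧ p2.Prime ∧ p3.Prime ∧ p4.Prime ∧ p5.Prime ∧ p6.Prime ∧ p7.Prime ∧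
        n = p1 ^ 2 + p2 ^ 2 + p3 ^ 3 + p4 ^ 3 + p5 ^ 5 + p6 ^ 6 + p7 ^ 6 := by
  obtain ⟨N, hN⟩ := WG.main
  refine ⟨N, fun n hn h2 => ?_⟩
  by_contra h
  exact hN n hn h2 (WG.FF_zero n h)
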